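/- Given an integer n > 2, there exist constants c = c(n) > 0 and e = e(n) > 0 such that for every polynomial f ∈ ℤ[y_1,…,y_n] of degree d ≥ 5 whose homogeneous part of highest degree is irreducible over the algebraic closure of ℚ, and every real B ≥ 1, one has N_aff(f,B) ≤ c·d^e·B^{n−2}. -/

import Mathlib

/-- The number of integer points `x ∈ ℤ^N` with `|x_i| ≤ B` for all `i` and `f(x) = 0`. -/
noncomputable def Naff {N : ℕ} (f : MvPolynomial (Fin N) ℤ) (B : ℝ) : ℕ :=
  Set.ncard {x : Fin N → ℤ | (∀ i, |(x i : ℝ)| ≤ B) ∧ MvPolynomial.eval x f = 0}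


section
open Finset MvPolynomial
open Finsupp (degree_eq_sum single degree_single single_eq_same degree le_degree single_apply prod_fintype sum_single_index tail_cons cons_tail single_eq_of_ne)
open Polynomial (X_pow_dvd_iff X_dvd_iff coeff_zero_eq_eval_zero irreducible_X finsetSum_coeff evalRingHom derivative derivative_mul coeff_derivative leadingCoeff Monic mapRingHom coeff_C_mul_X_pow card_roots' mem_roots IsRoot eq_zero_of_infinite_isRoot)
open Real (log log_mul log_div log_natCast_nonneg log_le_log log_pow exp sq_sqrt)
open Fin (cons_zero cons_succ succ_ne_zero sum_univ_succ prod_univ_succ succAboveCases snoc lastCases snoc_last snoc_castSucc)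
open Function (update Injective Surjective update_self update_of_ne)
set_option maxHeartbeats 4000000

/-- Polynomials over `R` in `n` variables. -/
local notation "MP" n:max R:max => MvPolynomial (Fin n) R
/-- Univariate variable, constants, and the inclusion of `ℤ` in `ℚ`. -/
local notation "PX" => Polynomial.X
local notation "CX" => Polynomial.C
local notation "toℚ" => Int.castRingHom ℚ

variable {A : Type*} [CommRing A]

theorem det_dvd_of_rows {R ι κ : Type*} [CommRing R] [Fintype ι] [DecidableEq ι] [Fintype κ] [DecidableEq κ]
    (M : Matrix ι ι R) (I : Finset ι) (q : R) (m : ℕ) (w : κ → ℕ)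
    (hw : ∀ k, w k ≤ m) (a : ι → κ → R) (V : κ → ι → R) (N : ι → ι → R)
    (h : ∀ i ∈ I, M i = ∑ k, (a i k * q ^ w k) • V k + q ^ m • N i) :
    q ^ (m * I.card - ∑ k, (m - w k)) ∣ M.det := by
  classical
  let c : ι → Option κ → R := fun i o => if i ∈ I then
      (match o with | none => q ^ m | some k => q ^ w k)
    else (match o with | none => 1 | some k => 1)
  let b : ι → Option κ → (ι → R) := fun i o => if i ∈ I then
      (match o with | none => N i | some k => a i k • V k)
    else (match o with | none => M i | some k => 0)
  have hM : M = fun i => ∑ o, c i o • b i o := by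
    funext i
    rw [Fintype.sum_option]
    by_cases hi : i ∈ I
    · rw [h i hi]
      simp only [c, b, if_pos hi]
      rw [add_comm]
      congr 1
      refine sum_congr rfl fun k _ => ?_
      rw [smul_smul, mul_comm]
    · simp [c, b, hi]
  have hdet : M.det = Matrix.detRowAlternating.toMultilinearMap M := rfl
  rw [hdet, hM, MultilinearMap.map_sum]
  refine dvd_sum fun r _ => ?_
  rw [MultilinearMap.map_smul_univ]
  by_cases hinj : ∀ i ∈ I, ∀ j ∈ I, ∀ k, r i = some k → r j = some k → i = j
  · refine Dvd.dvd.mul_right ?_ _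
    have h1 : q ^ (∑ i ∈ I, (match r i with | none => m | some k => w k)) ∣ ∏ i, c i (r i) := by
      rw [← prod_pow_eq_pow_sum]
      refine dvd_trans (b := ∏ i ∈ I, c i (r i)) ?_ (prod_dvd_prod_of_subset _ _ _ (subset_univ _))
      refine prod_dvd_prod_of_dvd _ _ fun i hi => ?_
      simp only [c, if_pos hi]
      cases r i <;> simp
    refine dvd_trans (pow_dvd_pow q ?_) h1
    rw [tsub_le_iff_right]
    have h2 : ∑ i ∈ I, (match r i with | none => 0 | some k => m - w k) ≤ ∑ k, (m - w k) := by
      calc _ = ∑ i ∈ I, ∑ k, (if r i = some k then m - w k else 0) := by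
            refine sum_congr rfl fun i _ => ?_
            cases hr : r i <;> simp
        _ = ∑ k, ∑ i ∈ I, (if r i = some k then m - w k else 0) := sum_comm
        _ ≤ ∑ k, (m - w k) := by
            refine sum_le_sum fun k _ => ?_
            rw [← sum_filter, sum_const, smul_eq_mul]
            have : (I.filter fun i => r i = some k).card ≤ 1 := by
              rw [card_le_one]
              intro x hx y hy
              simp only [mem_filter] at hx hy
              exact hinj x hx.1 y hy.1 k hx.2 hy.2
            nlinarith
    have h3 : m * I.card = ∑ i ∈ I, (match r i with | none => m | some k => w k) +
        ∑ i ∈ I, (match r i with | none => 0 | some k => m - w k) := by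
      rw [← sum_add_distrib, mul_comm, ← smul_eq_mul, ← sum_const]
      refine sum_congr rfl fun i _ => ?_
      cases hr : r i with
      | none => simp
      | some k => have := hw k; simp only []; omega
    omega
  · push Not at hinj
    obtain ⟨i, hi, j, hj, k, h1, h2, h3⟩ := hinj
    refine dvd_mul_of_dvd_right ?_ _
    have hb : (fun i => b i (r i)) = update (update (fun i => b i (r i)) i (a i k • V k)) j (a j k • V k) := by
      funext x
      rcases eq_or_ne x j with rfl | hx
      · simp [b, hj, h2]
      rcases eq_or_ne x i with rfl | hx'
      · simp [b, hi, h1, hx]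
      simp [hx, hx']
    rw [hb, MultilinearMap.map_update_smul, Function.update_comm h3, MultilinearMap.map_update_smul]
    have : (Matrix.detRowAlternating.toMultilinearMap : MultilinearMap R (fun _ : ι => ι → R) R)
        (update (update (fun i => b i (r i)) j (V k)) i (V k)) = 0 := by
      apply AlternatingMap.map_eq_zero_of_eq Matrix.detRowAlternating (i := i) (j := j) _ _ h3
      simp [h3.symm]
    rw [this]; simp

theorem exists_det_ne_zero {P ι K : Type*} [Field K] [Fintype ι] [DecidableEq ι]
    (φ : P → ι → K) (S : Set P)
    (h : ∀ c : ι → K, (∀ p ∈ S, ∑ i, c i * φ p i = 0) → c = 0) :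
    ∃ p : ι → P, (∀ i, p i ∈ S) ∧ (Matrix.of fun i j => φ (p i) j).det ≠ 0 := by
  classical
  have hspan : Submodule.span K (φ '' S) = ⊤ := by
    by_contra hne
    obtain ⟨f, hf0, hf⟩ := Submodule.exists_le_ker_of_lt_top _ (lt_top_iff_ne_top.mpr hne)
    apply hf0
    have := h (fun i => f (Pi.single i 1)) ?_
    · refine LinearMap.pi_ext' fun i => ?_
      ext
      simpa using congrFun this i
    · intro p hp
      have h1 : φ p ∈ LinearMap.ker f := hf (Submodule.subset_span ⟨p, hp, rfl⟩)
      rw [LinearMap.mem_ker] at h1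
      rw [← h1]
      conv_rhs => rw [← univ_sum_single (φ p), map_sum]
      refine sum_congr rfl fun i _ => ?_
      have : Pi.single i (φ p i) = (φ p i) • (Pi.single i (1 : K) : ι → K) := by
        rw [← Pi.single_smul]; simp
      rw [this, map_smul, smul_eq_mul, mul_comm]
  obtain ⟨b, hbS, hbspan, hbli⟩ := exists_linearIndependent K (φ '' S)
  rw [hspan] at hbspan
  let B : Module.Basis b K (ι → K) := Module.Basis.mk hbli (by rw [Subtype.range_coe]; exact hbspan.ge)
  have : Fintype b := FiniteDimensional.fintypeBasisIndex B
  have hcard : Fintype.card b = Fintype.card ι := by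
    rw [← Module.finrank_eq_card_basis B]; simp
  let e : ι ≃ b := (Fintype.equivOfCardEq hcard).symm
  choose p hp hpe using fun i => hbS (e i).2
  refine ⟨p, hp, ?_⟩
  have hli : LinearIndependent K (fun i => φ (p i)) := by
    have : (fun i => φ (p i)) = (fun x : b => (x : ι → K)) ∘ e := by
      funext i; exact hpe i
    rw [this]
    exact hbli.comp _ e.injective
  have := (Matrix.linearIndependent_rows_iff_isUnit (A := Matrix.of fun i j => φ (p i) j)).mp hli
  exact ((Matrix.isUnit_iff_isUnit_det _).mp this).ne_zero

/-- height dichotomy -/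
theorem exists_small_relation {P ι : Type*} [Fintype ι] [DecidableEq ι]
    (φ : P → ι → ℤ) (S : Set P) (H : ℕ) (hH : ∀ p ∈ S, ∀ i, |φ p i| ≤ H) (hH1 : 1 ≤ H)
    (c₀ : ι → ℚ) (hc₀ : c₀ ≠ 0) (hc : ∀ p ∈ S, ∑ i, c₀ i * φ p i = 0)
    (huniq : ∀ c : ι → ℚ, (∀ p ∈ S, ∑ i, c i * φ p i = 0) → ∃ t : ℚ, c = t • c₀) :
    ∃ (c₁ : ι → ℤ) (t : ℚ), t ≠ 0 ∧ (∀ i, (c₁ i : ℚ) = t * c₀ i) ∧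
      ∀ i, |c₁ i| ≤ (Fintype.card ι).factorial * (H : ℤ) ^ Fintype.card ι := by
  classical
  obtain ⟨j₀, hj₀⟩ : ∃ j, c₀ j ≠ 0 := by
    by_contra hcon; push Not at hcon; exact hc₀ (funext hcon)
  let ψ : Option P → ι → ℤ := fun o => match o with | none => Pi.single j₀ 1 | some p => φ p
  let S' : Set (Option P) := {none} ∪ some '' S
  obtain ⟨p, hpS, hdet⟩ := exists_det_ne_zero (fun o i => (ψ o i : ℚ)) S' (by
    intro c hcc
    obtain ⟨t, rfl⟩ := huniq c (fun p hp => hcc (some p) (Or.inr ⟨p, hp, rfl⟩))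
    have := hcc none (Or.inl rfl)
    have h2 : t * c₀ j₀ = 0 := by
      simpa [ψ, Pi.single_apply] using this
    rcases mul_eq_zero.mp h2 with h | h
    · simp [h]
    · exact absurd h hj₀)
  let A : Matrix ι ι ℤ := Matrix.of fun i j => ψ (p i) j
  have hA : A.map toℚ = Matrix.of fun i j => (ψ (p i) j : ℚ) := by
    ext i j; simp [A]
  have hdet' : A.det ≠ 0 := by
    intro h0
    apply hdet
    rw [← hA, ← RingHom.mapMatrix_apply, ← RingHom.map_det, h0]; simp
  have hex : ∃ i, p i = none := by
    by_contra hcon; push Not at hcon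
    apply hdet
    rw [← Matrix.exists_mulVec_eq_zero_iff]
    refine ⟨c₀, hc₀, ?_⟩
    funext i
    rcases hpS i with h | ⟨x, hx, hxe⟩
    · exact absurd h (hcon i)
    · simp only [Matrix.mulVec, dotProduct, Matrix.of_apply, Pi.zero_apply]
      rw [← hxe, ← hc x hx]
      exact sum_congr rfl fun i _ => mul_comm _ _
  obtain ⟨i₀, hi₀⟩ := hex
  have huni : ∀ i, i ≠ i₀ → p i ≠ none := by
    intro i hi hn
    apply hdet'
    apply Matrix.det_zero_of_row_eq hi
    funext j; simp [A, hn, hi₀]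
  let c₁ : ι → ℤ := fun j => A.adjugate j i₀
  let Aq := A.map toℚ
  have hAc : Aq.mulVec c₀ = c₀ j₀ • Pi.single i₀ 1 := by
    funext i
    by_cases hi : i = i₀
    · subst hi
      simp [Aq, A, Matrix.mulVec, dotProduct, hi₀, ψ, Pi.single_apply]
    · rcases hpS i with h | ⟨x, hx, hxe⟩
      · exact absurd h (huni i hi)
      · simp only [Matrix.mulVec, dotProduct, Aq, A, Matrix.map_apply, Matrix.of_apply]
        rw [← hxe]
        simp only [Pi.smul_apply, Pi.single_apply, if_neg hi, smul_zero]
        rw [← hc x hx]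
        exact sum_congr rfl fun i _ => by simp [ψ, mul_comm]
  have hadj : Aq.adjugate = A.adjugate.map toℚ := by
    have := RingHom.map_adjugate toℚ A
    exact this.symm
  have hdq : Aq.det = (A.det : ℚ) := by
    have := RingHom.map_det toℚ A
    exact this.symm
  have hrel : ∀ i, (A.det : ℚ) * c₀ i = c₀ j₀ * c₁ i := by
    intro i
    have h1 : Aq.adjugate.mulVec (Aq.mulVec c₀) = (A.det : ℚ) • c₀ := by
      rw [Matrix.mulVec_mulVec, Matrix.adjugate_mul, Matrix.smul_mulVec, Matrix.one_mulVec, hdq]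
    have h2 := congrFun h1 i
    rw [hAc, Matrix.mulVec_smul, hadj] at h2
    simp only [Pi.smul_apply, smul_eq_mul, Matrix.mulVec_single_one] at h2
    rw [← h2]; simp [c₁]
  refine ⟨c₁, (A.det : ℚ) / c₀ j₀, div_ne_zero (by exact_mod_cast hdet') hj₀, fun i => ?_, fun i => ?_⟩
  · have := hrel i
    field_simp
    linarith
  · have hent : ∀ i j, |A i j| ≤ (H : ℤ) := by
      intro i j
      simp only [A, Matrix.of_apply]
      rcases hpS i with h | ⟨x, hx, hxe⟩
      · rw [Set.mem_singleton_iff] at h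
        rw [h]
        simp only [ψ, Pi.single_apply]
        split_ifs <;> simp <;> exact_mod_cast (by omega)
      · rw [← hxe]; exact hH x hx j
    have := Matrix.det_le (A := A.updateRow i₀ (Pi.single i 1)) (abv := AbsoluteValue.abs) (x := (H:ℤ)) (by
      intro a b
      rw [Matrix.updateRow_apply]
      split_ifs
      · simp only [Pi.single_apply]; split_ifs <;> simp <;> exact_mod_cast (by omega)
      · exact hent a b)
    simp only [AbsoluteValue.abs_apply, nsmul_eq_mul] at this
    simpa [c₁, Matrix.adjugate_apply] using this

/-- exponents of total degree at most `D` -/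
noncomputable def mons (n D : ℕ) : Finset (Fin n →₀ ℕ) :=
  (range (D + 1)).biUnion (fun k => (univ : Finset (Fin n)).finsuppAntidiag k)

theorem mem_mons {n D : ℕ} {m : Fin n →₀ ℕ} : m ∈ mons n D ↔ m.degree ≤ D := by
  simp [mons, mem_finsuppAntidiag, degree_eq_sum, Nat.lt_succ_iff]

theorem card_mons (n D : ℕ) : (mons n D).card = (D + n).choose n := by
  have h1 : (mons n D).card = Nat.multichoose (n + 1) D := by
    rw [mons, card_biUnion]
    · induction D with
      | zero => simp
      | succ D ih =>
        rw [sum_range_succ, ih, card_finsuppAntidiag_nat_eq_multichoose, Nat.multichoose_succ_succ]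
        simp [add_comm]
    · intro i _ j _ hij
      rw [Function.onFun, disjoint_left]
      intro m hm hm'
      simp only [mem_finsuppAntidiag] at hm hm'
      exact hij (hm.1.symm.trans hm'.1)
  rw [h1, Nat.multichoose_eq, show n + 1 + D - 1 = D + n by omega, Nat.choose_symm_add]

theorem restrictTotalDegree_eq (k : Type*) [CommSemiring k] (n D : ℕ) :
    restrictTotalDegree (Fin n) k D = restrictSupport k (mons n D : Set (Fin n →₀ ℕ)) := by
  ext p
  rw [mem_restrictTotalDegree, mem_restrictSupport_iff, totalDegree, Finset.sup_le_iff]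
  constructor
  · intro h m hm
    simp only [mem_coe, mem_mons]
    exact h m hm
  · intro h m hm
    exact mem_mons.mp (h hm)

theorem finrank_restrictTotalDegree (k : Type*) [Field k] (n D : ℕ) :
    Module.finrank k (restrictTotalDegree (Fin n) k D) = (D + n).choose n := by
  rw [restrictTotalDegree_eq, Module.finrank_eq_card_basis (basisRestrictSupport k _), ← card_mons]
  simp

theorem finrank_map_inj {k V W : Type*} [Field k] [AddCommGroup V] [Module k V] [AddCommGroup W] [Module k W]
    {f : V →ₗ[k] W} (hf : Injective f) (p : Submodule k V) :
    Module.finrank k (p.map f) = Module.finrank k p :=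
  (Submodule.equivMapOfInjective f hf p).finrank_eq.symm

/-- dimension of `F V + G V` from below. -/
theorem finrank_sum_ge {k : Type*} [Field k] {n : ℕ} (F G : MP n k)
    (hF : Irreducible F) (hFG : ¬ F ∣ G) (a b r : ℕ) (ha : F.totalDegree = a) (hb : G.totalDegree ≤ b) :
    ∃ U : Submodule k (MP n k), U ≤ restrictTotalDegree (Fin n) k (a + b + r) ∧
      (∀ x ∈ U, ∃ u w, x = F * u + G * w) ∧
      (b + r + n).choose n + (a + r + n).choose n ≤ Module.finrank k U + (r + n).choose n := by
  classical
  let V := fun D => restrictTotalDegree (Fin n) k D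
  let mF := LinearMap.mulLeft k F
  let mG := LinearMap.mulLeft k G
  have hG0 : G ≠ 0 := fun h => hFG (h ▸ dvd_zero F)
  have hF0 := hF.ne_zero
  have injF : Injective mF := fun x y h => mul_left_cancel₀ hF0 h
  have injG : Injective mG := fun x y h => mul_left_cancel₀ hG0 h
  have injFG : Injective (LinearMap.mulLeft k (F * G)) :=
    fun x y h => mul_left_cancel₀ (mul_ne_zero hF0 hG0) h
  refine ⟨(V (b + r)).map mF ⊔ (V (a + r)).map mG, ?_, ?_, ?_⟩
  · rw [sup_le_iff, Submodule.map_le_iff_le_comap, Submodule.map_le_iff_le_comap]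
    constructor
    · intro x hx
      have : x.totalDegree ≤ b + r := (mem_restrictTotalDegree _ _ _).mp hx
      rw [Submodule.mem_comap, mem_restrictTotalDegree]
      exact (totalDegree_mul _ _).trans (by omega)
    · intro x hx
      have : x.totalDegree ≤ a + r := (mem_restrictTotalDegree _ _ _).mp hx
      rw [Submodule.mem_comap, mem_restrictTotalDegree]
      exact (totalDegree_mul _ _).trans (by omega)
  · intro x hx
    rw [Submodule.mem_sup] at hx
    obtain ⟨y, ⟨u, _, rfl⟩, z, ⟨w, _, rfl⟩, rfl⟩ := hx
    exact ⟨u, w, rfl⟩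
  · have h1 := Submodule.finrank_sup_add_finrank_inf_eq ((V (b + r)).map mF) ((V (a + r)).map mG)
    rw [finrank_map_inj injF, finrank_map_inj injG,
      finrank_restrictTotalDegree, finrank_restrictTotalDegree] at h1
    have h2 : (V (b + r)).map mF ⊓ (V (a + r)).map mG ≤ (V r).map (LinearMap.mulLeft k (F * G)) := by
      rintro x ⟨⟨u, hu, hux⟩, ⟨w, hw, hwx⟩⟩
      have e : F * u = G * w := hux.trans hwx.symm
      have hdvd : F ∣ w := by
        rcases hF.prime.dvd_or_dvd (show F ∣ G * w from ⟨u, e.symm⟩) with h | h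
        · exact absurd h hFG
        · exact h
      obtain ⟨w', rfl⟩ := hdvd
      refine ⟨w', ?_, ?_⟩
      · rw [SetLike.mem_coe, mem_restrictTotalDegree] at hw ⊢
        by_cases hw0 : w' = 0
        · simp [hw0]
        · rw [totalDegree_mul_of_isDomain hF0 hw0] at hw
          omega
      · rw [← hwx]; simp only [mG, LinearMap.mulLeft_apply]; ring
    have h3 := Submodule.finrank_mono h2
    rw [finrank_map_inj injFG, finrank_restrictTotalDegree] at h3
    omega

theorem choose_two_id (a b r : ℕ) : (a + b + r + 2).choose 2 + (r + 2).choose 2 =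
    (b + r + 2).choose 2 + (a + r + 2).choose 2 + a * b := by
  have h : ∀ x : ℕ, ((x + 2).choose 2 : ℚ) = (x + 1) * (x + 2) / 2 := by
    intro x; rw [Nat.cast_choose_two]; push_cast; ring
  have : ((((a + b + r + 2).choose 2 + (r + 2).choose 2 : ℕ)) : ℚ) =
    (((b + r + 2).choose 2 + (a + r + 2).choose 2 + a * b : ℕ)) := by
    push_cast; rw [h, h, h, h]; push_cast; ring
  exact_mod_cast this

/-- Bezout, abstract form -/
theorem bezout_linear {k W : Type*} [Field k] [AddCommGroup W] [Module k W] [Module.Finite k W]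
    (F G : MP 2 k) (hF : Irreducible F) (hFG : ¬ F ∣ G)
    (L : MP 2 k →ₗ[k] W) (hL : Surjective L)
    (hLF : ∀ u, L (F * u) = 0) (hLG : ∀ u, L (G * u) = 0) :
    Module.finrank k W ≤ F.totalDegree * G.totalDegree := by
  classical
  set a := F.totalDegree with ha
  set b := G.totalDegree with hb
  let B := Module.finBasis k W
  choose p hp using fun i => hL (B i)
  let r := univ.sup fun i => (p i).totalDegree
  let V := restrictTotalDegree (Fin 2) k (a + b + r)
  have hmap : V.map L = ⊤ := by
    rw [eq_top_iff, ← B.span_eq, Submodule.span_le]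
    rintro _ ⟨i, rfl⟩
    refine ⟨p i, ?_, hp i⟩
    rw [SetLike.mem_coe, mem_restrictTotalDegree]
    have : (p i).totalDegree ≤ r := le_sup (f := fun i => (p i).totalDegree) (mem_univ i)
    omega
  obtain ⟨U, hU1, hU2, hU3⟩ := finrank_sum_ge F G hF hFG a b r rfl le_rfl
  let LV := L.domRestrict V
  have hr := LinearMap.finrank_range_add_finrank_ker LV
  have hrange : LinearMap.range LV = ⊤ := by
    rw [LinearMap.range_domRestrict, hmap]
  rw [hrange, finrank_top, finrank_restrictTotalDegree] at hr
  have hker : Module.finrank k U ≤ Module.finrank k (LinearMap.ker LV) := by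
    let j : U →ₗ[k] LinearMap.ker LV := LinearMap.codRestrict _ (Submodule.inclusion hU1) (by
      intro x
      obtain ⟨u, w, h⟩ := hU2 x x.2
      rw [LinearMap.mem_ker]
      change L x.1 = 0
      rw [h, map_add, hLF, hLG, add_zero])
    refine LinearMap.finrank_le_finrank_of_injective (f := j) ?_
    intro x y hxy
    have := congrArg (fun z => (z.1.1 : MP 2 k)) hxy
    exact Subtype.ext this
  have := choose_two_id a b r
  omega

/-- Bezout for jets along germs `t ↦ (ξ t, y + t)`. -/
theorem bezout_jets {k ι : Type*} [Field k] [DecidableEq ι] (F G : MP 2 k) (hF : Irreducible F)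
    (hFG : ¬ F ∣ G) (Z : Finset ι) (M : ℕ) (ξ : ι → Polynomial k) (y : ι → k)
    (hdist : ∀ z ∈ Z, ∀ w ∈ Z, (ξ z).coeff 0 = (ξ w).coeff 0 → y z = y w → z = w)
    (hZF : ∀ z ∈ Z, PX ^ M ∣ aeval ![ξ z, CX (y z) + PX] F)
    (hZG : ∀ z ∈ Z, PX ^ M ∣ aeval ![ξ z, CX (y z) + PX] G) :
    M * Z.card ≤ F.totalDegree * G.totalDegree := by
  classical
  let Φ : ι → (MP 2 k →ₐ[k] Polynomial k) :=
    fun z => aeval ![ξ z, CX (y z) + PX]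
  let L : MP 2 k →ₗ[k] (Z → Fin M → k) :=
    LinearMap.pi fun z => LinearMap.pi fun j => (Polynomial.lcoeff k j.1).comp (Φ z.1).toLinearMap
  have hLapp : ∀ u z j, L u z j = (Φ z.1 u).coeff j.1 := fun u z j => rfl
  have hz : ∀ (z : Z) u, PX ^ M ∣ Φ z.1 u → ∀ j : Fin M, (Φ z.1 u).coeff j.1 = 0 := by
    intro z u h j
    exact X_pow_dvd_iff.mp h j.1 j.2
  -- separating
  have hsep : ∀ z ∈ Z, ∃ e : MP 2 k, (∀ w ∈ Z, w ≠ z → PX ^ M ∣ Φ w e) ∧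
      (Φ z e).coeff 0 ≠ 0 := by
    intro z hzZ
    have hlin : ∀ w ∈ Z, w ≠ z → ∃ l : MP 2 k, PX ∣ Φ w l ∧ (Φ z l).coeff 0 ≠ 0 := by
      intro w hw hne
      by_cases hx : (ξ w).coeff 0 = (ξ z).coeff 0
      · have hy : y w ≠ y z := fun h => hne (hdist w hw z hzZ hx h)
        refine ⟨X 1 - C (y w), ?_, ?_⟩
        · simp [Φ, X_dvd_iff, ← Polynomial.C_eq_algebraMap]
        · simp [Φ, ← Polynomial.C_eq_algebraMap, sub_eq_zero, hy.symm]
      · refine ⟨X 0 - C ((ξ w).coeff 0), ?_, ?_⟩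
        · simp [Φ, X_dvd_iff, ← Polynomial.C_eq_algebraMap]
        · simp [Φ, ← Polynomial.C_eq_algebraMap, sub_eq_zero, Ne.symm hx]
    choose! l hl1 hl2 using hlin
    refine ⟨∏ w ∈ Z.erase z, l w ^ M, ?_, ?_⟩
    · intro w hw hne
      rw [map_prod]
      refine dvd_trans ?_ (dvd_prod_of_mem _ (mem_erase.mpr ⟨hne, hw⟩))
      rw [map_pow]
      exact pow_dvd_pow_of_dvd (hl1 w hw hne) M
    · rw [map_prod, coeff_zero_eq_eval_zero, Polynomial.eval_prod, prod_ne_zero_iff]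
      intro w hw
      rw [mem_erase] at hw
      rw [map_pow, Polynomial.eval_pow]
      refine pow_ne_zero _ ?_
      rw [← coeff_zero_eq_eval_zero]
      exact hl2 w hw.2 hw.1
  have hpoly : ∀ z (g : Polynomial k), Φ z (Polynomial.aeval (X 1 - C (y z)) g) = g := by
    intro z g
    rw [← Polynomial.aeval_algHom_apply]
    have : Φ z (X 1 - C (y z)) = PX := by simp [Φ, ← Polynomial.C_eq_algebraMap]
    rw [this]; simp
  have hsurj : Surjective L := by
    intro g
    have hbase : ∀ z : Z, ∃ H : MP 2 k, L H = Pi.single z (g z) := by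
      intro z
      obtain ⟨e, he1, he2⟩ := hsep z.1 z.2
      have hcop : IsCoprime (Φ z.1 e) (PX ^ M) := by
        apply IsCoprime.pow_right
        rw [isCoprime_comm, irreducible_X.coprime_iff_not_dvd, X_dvd_iff]
        exact he2
      obtain ⟨u, v, huv⟩ := hcop
      let gz : Polynomial k := ∑ j : Fin M, Polynomial.monomial j.1 (g z j)
      refine ⟨e * Polynomial.aeval (X 1 - C (y z.1)) (u * gz), ?_⟩
      funext w
      by_cases hwz : w = z
      · subst hwz
        funext j
        rw [Pi.single_eq_same, hLapp, map_mul, hpoly]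
        have : Φ w.1 e * (u * gz) = gz - PX ^ M * (v * gz) := by
          linear_combination gz * huv
        rw [this, Polynomial.coeff_sub, X_pow_dvd_iff.mp (Dvd.intro _ rfl) j.1 j.2, sub_zero]
        simp only [gz, finsetSum_coeff, Polynomial.coeff_monomial]
        rw [sum_eq_single j]
        · simp
        · intro b _ hb
          rw [if_neg]; exact fun h => hb (Fin.ext h)
        · simp
      · rw [Pi.single_eq_of_ne hwz]
        funext j
        rw [hLapp]
        refine hz w _ ?_ j
        rw [map_mul]
        exact Dvd.dvd.mul_right (he1 w.1 w.2 (fun h => hwz (Subtype.ext h))) _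
    choose H hH using hbase
    refine ⟨∑ z, H z, ?_⟩
    rw [map_sum]
    simp_rw [hH]
    exact univ_sum_single g
  have := bezout_linear F G hF hFG L hsurj ?_ ?_
  · simpa [mul_comm, Module.finrank_pi_fintype] using this
  · intro u; funext z j
    rw [hLapp]
    refine hz z _ ?_ j
    rw [map_mul]; exact Dvd.dvd.mul_right (hZF z.1 z.2) _
  · intro u; funext z j
    rw [hLapp]
    refine hz z _ ?_ j
    rw [map_mul]; exact Dvd.dvd.mul_right (hZG z.1 z.2) _

/-- Bezout for points -/
theorem bezout_points {k : Type*} [Field k] (F G : MP 2 k) (hF : Irreducible F)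
    (hFG : ¬ F ∣ G) (Z : Finset (Fin 2 → k))
    (hZF : ∀ z ∈ Z, eval z F = 0) (hZG : ∀ z ∈ Z, eval z G = 0) :
    Z.card ≤ F.totalDegree * G.totalDegree := by
  classical
  have key : ∀ (z : Fin 2 → k) (H : MP 2 k), eval z H = 0 →
      PX ^ 1 ∣ aeval ![CX (z 0), CX (z 1) + PX] H := by
    intro z H h
    rw [pow_one, X_dvd_iff, coeff_zero_eq_eval_zero]
    have : (evalRingHom (0 : k)).comp
        (aeval ![CX (z 0), CX (z 1) + PX] : MP 2 k →ₐ[k] Polynomial k).toRingHom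
        = eval z := by
      apply ringHom_ext
      · intro r; simp [← Polynomial.C_eq_algebraMap]
      · intro i; fin_cases i <;> simp
    exact (congrArg (fun φ => φ H) this).trans h
  have := bezout_jets F G hF hFG Z 1 (fun z => CX (z 0)) (fun z => z 1) (by
    intro z _ w _ h0 h1
    funext i
    fin_cases i
    · simpa using h0
    · simpa using h1) (fun z hz => key z F (hZF z hz)) (fun z hz => key z G (hZG z hz))
  simpa using this

/-- Elimination. -/
theorem elimination {k : Type*} [Field k] (f g : MP 3 k) (hf : Irreducible f)
    (hfg : ¬ f ∣ g) (d D : ℕ) (hd : f.totalDegree = d) (hD : g.totalDegree ≤ D) (hd1 : 1 ≤ d) (hD1 : 1 ≤ D) :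
    ∃ h : MP 2 k, h ≠ 0 ∧ h.totalDegree ≤ 2 * d * D ∧
      ∃ u w, rename Fin.succ h = f * u + g * w := by
  classical
  have hge : d + D ≤ 2 * d * D := by nlinarith
  obtain ⟨r, hr⟩ := Nat.exists_eq_add_of_le hge
  obtain ⟨U, hU1, hU2, hU3⟩ := finrank_sum_ge f g hf hfg d D r hd hD
  let V2 := (restrictTotalDegree (Fin 2) k (2 * d * D)).map
    (rename (Fin.succ : Fin 2 → Fin 3) : MP 2 k →ₐ[k] MP 3 k).toLinearMap
  have hinj : Injective (rename (Fin.succ : Fin 2 → Fin 3) : MP 2 k →ₐ[k] MP 3 k).toLinearMap :=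
    rename_injective _ (Fin.succ_injective _)
  have hV2 : Module.finrank k V2 = (2 * d * D + 2).choose 2 := by
    rw [finrank_map_inj hinj, finrank_restrictTotalDegree]
  have hV2le : V2 ≤ restrictTotalDegree (Fin 3) k (d + D + r) := by
    rw [← hr, Submodule.map_le_iff_le_comap]
    intro x hx
    rw [Submodule.mem_comap, mem_restrictTotalDegree]
    exact (totalDegree_rename_le _ _).trans ((mem_restrictTotalDegree _ _ _).mp hx)
  have hne : V2 ⊓ U ≠ ⊥ := by
    intro hbot
    have : FiniteDimensional k U := Submodule.finiteDimensional_of_le hU1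
    have h1 := Submodule.finrank_sup_add_finrank_inf_eq V2 U
    rw [hbot, finrank_bot] at h1
    have h2 := Submodule.finrank_mono (sup_le hV2le hU1)
    rw [finrank_restrictTotalDegree] at h2
    rw [hV2] at h1
    have hc3 : ∀ x : ℕ, ((x + 3).choose 3 : ℚ) = (x + 1) * (x + 2) * (x + 3) / 6 := by
      intro x
      rw [Nat.cast_choose_eq_ascPochhammer_div]
      simp [ascPochhammer_succ_right, Nat.factorial]
      ring
    have hc2 : ∀ x : ℕ, ((x + 2).choose 2 : ℚ) = (x + 1) * (x + 2) / 2 := by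
      intro x; rw [Nat.cast_choose_two]; push_cast; ring
    have h3 : (2 * d * D + 2).choose 2 + (D + r + 3).choose 3 + (d + r + 3).choose 3 ≤
      (d + D + r + 3).choose 3 + (r + 3).choose 3 := by omega
    have h4 : (((2 * d * D + 2).choose 2 + (D + r + 3).choose 3 + (d + r + 3).choose 3 : ℕ) : ℚ) ≤
      ((d + D + r + 3).choose 3 + (r + 3).choose 3 : ℕ) := by exact_mod_cast h3
    push_cast at h4
    rw [hc3, hc3, hc3, hc3, hc2] at h4
    push_cast at h4
    have hrq : (r : ℚ) = 2 * d * D - d - D := by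
      have : ((2 * d * D : ℕ) : ℚ) = ((d + D + r : ℕ) : ℚ) := by exact_mod_cast hr
      push_cast at this; linarith
    rw [hrq] at h4
    have hdq : (1 : ℚ) ≤ d := by exact_mod_cast hd1
    have hDq : (1 : ℚ) ≤ D := by exact_mod_cast hD1
    nlinarith [mul_pos (show (0:ℚ) < d by linarith) (show (0:ℚ) < D by linarith),
      mul_nonneg (mul_nonneg (show (0:ℚ) ≤ d by linarith) (show (0:ℚ) ≤ D by linarith)) (show (0:ℚ) ≤ d + D - 2 by linarith)]
  obtain ⟨x, hx, hx0⟩ := Submodule.exists_mem_ne_zero_of_ne_bot hne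
  obtain ⟨⟨h, hh, hhx⟩, hxU⟩ := hx
  refine ⟨h, ?_, (mem_restrictTotalDegree _ _ _).mp hh, ?_⟩
  · rintro rfl
    apply hx0; rw [← hhx]; simp
  · obtain ⟨u, w, huw⟩ := hU2 x hxU
    exact ⟨u, w, by rw [← huw]; exact hhx⟩

theorem taylor_zero {A S : Type*} [CommRing A] [CommRing S] [Algebra A S] {r : ℕ}
    (f : MP (r + 1) A) (z δ : S) (y : Fin r → S) :
    ∃ k : S, aeval (Fin.cons (z + δ) y : Fin (r + 1) → S) f = aeval (Fin.cons z y : Fin (r + 1) → S) f +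
      aeval (Fin.cons z y : Fin (r + 1) → S) (pderiv 0 f) * δ + k * δ ^ 2 := by
  induction f using induction_on with
  | C a => exact ⟨0, by simp⟩
  | add p q hp hq =>
    obtain ⟨k, hk⟩ := hp
    obtain ⟨l, hl⟩ := hq
    exact ⟨k + l, by simp only [map_add, hk, hl]; ring⟩
  | mul_X p i hp =>
    obtain ⟨k, hk⟩ := hp
    refine Fin.cases ?_ (fun j => ?_) i
    · refine ⟨k * (z + δ) + aeval (Fin.cons z y : Fin (r + 1) → S) (pderiv 0 p), ?_⟩
      simp only [map_mul, aeval_X, cons_zero, hk, Derivation.leibniz, pderiv_X_self, smul_eq_mul, map_add,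
        mul_one]
      ring
    · refine ⟨k * y j, ?_⟩
      simp only [map_mul, aeval_X, cons_succ, hk, Derivation.leibniz, smul_eq_mul, map_add,
        pderiv_X_of_ne (succ_ne_zero j), mul_zero, zero_add]
      ring

theorem eval_congr_dvd {n : ℕ} (f : MP n A) (q : A) (P Q : Fin n → A)
    (h : ∀ i, q ∣ P i - Q i) : q ∣ eval P f - eval Q f := by
  induction f using induction_on with
  | C a => simp
  | add p s hp hs =>
    have : eval P (p + s) - eval Q (p + s) = (eval P p - eval Q p) + (eval P s - eval Q s) := by
      simp only [map_add]; ring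
    rw [this]; exact dvd_add hp hs
  | mul_X p i hp =>
    have : eval P (p * X i) - eval Q (p * X i) = (eval P p - eval Q p) * P i + eval Q p * (P i - Q i) := by
      simp only [map_mul, eval_X]; ring
    rw [this]; exact dvd_add (hp.mul_right _) ((h i).mul_left _)

theorem germ {r : ℕ} (f : MP (r + 1) ℤ) (P₀ : Fin (r + 1) → ℤ) (q v : ℤ)
    (hv : q ∣ v * eval P₀ (pderiv 0 f) - 1) (m k : ℕ) (hk : k ≤ m) :
    ∃ ψ : MP r ℤ, ∀ P : Fin (r + 1) → ℤ, (∀ i, q ∣ P i - P₀ i) → q ^ m ∣ eval P f →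
      q ^ k ∣ P 0 - eval (fun i => P i.succ - P₀ i.succ) ψ := by
  induction k with
  | zero => exact ⟨0, by simp⟩
  | succ k ih =>
    obtain ⟨ψ, hψ⟩ := ih (by omega)
    rcases Nat.eq_zero_or_pos k with rfl | hkpos
    · exact ⟨C (P₀ 0), fun P hP _ => by simpa using hP 0⟩
    refine ⟨ψ - C v * aeval (Fin.cons ψ (fun i => C (P₀ i.succ) + X i) : Fin (r + 1) → MP r ℤ) f,
      fun P hP hfP => ?_⟩
    set Y : Fin r → ℤ := fun i => P i.succ - P₀ i.succ with hY
    set δ : ℤ := P 0 - eval Y ψ with hδ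
    have hδd : q ^ k ∣ δ := hψ P hP hfP
    have e1 : eval Y (aeval (Fin.cons ψ (fun i => C (P₀ i.succ) + X i) : Fin (r + 1) → MP r ℤ) f)
        = aeval (Fin.cons (P 0 + -δ) (fun i => P i.succ) : Fin (r + 1) → ℤ) f := by
      have : ((aeval Y : MP r ℤ →ₐ[ℤ] ℤ).comp
          (aeval (Fin.cons ψ (fun i => C (P₀ i.succ) + X i) : Fin (r + 1) → MP r ℤ))) =
          aeval (Fin.cons (P 0 + -δ) (fun i => P i.succ) : Fin (r + 1) → ℤ) := by
        apply algHom_ext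
        intro i
        refine Fin.cases ?_ (fun j => ?_) i
        · simp [hδ, aeval_eq_eval]
        · simp [hY]
      have := congrArg (fun φ => φ f) this
      simpa [aeval_eq_eval] using this
    obtain ⟨l, hl⟩ := taylor_zero f (P 0) (-δ) (fun i => P i.succ)
    have hcons : (Fin.cons (P 0) (fun i => P i.succ) : Fin (r + 1) → ℤ) = P := Fin.cons_self_tail P
    rw [hcons] at hl
    simp only [aeval_eq_eval] at hl e1
    rw [map_sub, map_mul, eval_C, e1]
    have e2 : P 0 - (eval Y ψ - v * (aeval (Fin.cons (P 0 + -δ) fun i => P i.succ : Fin (r + 1) → ℤ)) f) =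
      δ * (1 - v * eval P (pderiv 0 f)) + v * eval P f + v * l * δ ^ 2 := by
      simp only [aeval_eq_eval, RingHom.coe_coe] at hl ⊢
      have hl' := hl
      have : P 0 - eval Y ψ = δ := rfl
      linear_combination v * hl' + this
    have e3 : (aeval (Fin.cons (P 0 + -δ) fun i => P i.succ : Fin (r + 1) → ℤ)) f =
      (eval (Fin.cons (P 0 + -δ) fun i => P i.succ : Fin (r + 1) → ℤ)) f := by rw [aeval_eq_eval]
    rw [e3] at e2
    have e4 : q ^ (k + 1) ∣ P 0 - (eval Y ψ - v * (eval (Fin.cons (P 0 + -δ) fun i => P i.succ : Fin (r + 1) → ℤ)) f) := by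
      rw [e2]
      refine dvd_add (dvd_add ?_ ?_) ?_
      · rw [pow_succ]
        refine mul_dvd_mul hδd ?_
        have h1 := eval_congr_dvd (pderiv 0 f) q P P₀ hP
        have : 1 - v * eval P (pderiv 0 f) = -(v * eval P₀ (pderiv 0 f) - 1) - v * (eval P (pderiv 0 f) - eval P₀ (pderiv 0 f)) := by ring
        rw [this]
        exact dvd_sub (hv.neg_right) (h1.mul_left _)
      · exact ((pow_dvd_pow q hk).trans hfP).mul_left _
      · refine Dvd.dvd.mul_left ?_ _
        refine (pow_dvd_pow q (show k + 1 ≤ k * 2 by omega)).trans ?_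
        rw [pow_mul]; exact pow_dvd_pow_of_dvd hδd 2
    exact e4

theorem sum_mons_weight (r m : ℕ) : ∑ α ∈ mons r m, (m + 1 - α.degree) = (m + 1 + r).choose (r + 1) := by
  induction m with
  | zero =>
    have : ∀ α ∈ mons r 0, 0 + 1 - α.degree = 1 := by
      intro α hα; have := mem_mons.mp hα; omega
    rw [sum_congr rfl this, sum_const, card_mons]; simp [add_comm]
  | succ m ih =>
    have h1 : ∑ α ∈ mons r (m + 1), (m + 1 + 1 - α.degree) = ∑ α ∈ mons r (m + 1), (m + 1 - α.degree) + (mons r (m + 1)).card := by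
      rw [card_eq_sum_ones, ← sum_add_distrib]
      refine sum_congr rfl fun α hα => ?_
      have := mem_mons.mp hα; omega
    have h2 : ∑ α ∈ mons r (m + 1), (m + 1 - α.degree) = ∑ α ∈ mons r m, (m + 1 - α.degree) := by
      symm
      apply sum_subset
      · intro α hα; rw [mem_mons] at *; omega
      · intro α hα hα'; rw [mem_mons] at *; omega
    rw [h1, h2, ih, card_mons, show m + 1 + 1 + r = (m + 1 + r) + 1 by ring, Nat.choose_succ_succ]
    ring

theorem det_dvd_classes {r : ℕ} {ι : Type*} [Fintype ι] [DecidableEq ι]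
    (f : MP (r + 1) ℤ) (φ : ι → MP (r + 1) ℤ)
    (M : Matrix ι ι ℤ) (I : Finset ι) (Cl : Finset (Fin (r + 1) → ℤ)) (q : ℤ) (m : ℕ)
    (h : ∀ i ∈ I, ∃ (P : Fin (r + 1) → ℤ) (lam : ℤ), (∀ j, q ^ m ∣ M i j - lam * eval P (φ j)) ∧
      q ^ m ∣ eval P f ∧ ∃ c ∈ Cl, (∀ t, q ∣ P t - c t) ∧ ∃ v, q ∣ v * eval c (pderiv 0 f) - 1) :
    q ^ (m * I.card - Cl.card * (m + r).choose (r + 1)) ∣ M.det := by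
  classical
  rcases Nat.eq_zero_or_pos m with rfl | hm
  · simp
  obtain ⟨m, rfl⟩ : ∃ m', m = m' + 1 := ⟨m - 1, by omega⟩
  -- germs
  have hgerm : ∀ c : Fin (r + 1) → ℤ, (∃ v, q ∣ v * eval c (pderiv 0 f) - 1) → ∃ ψ : MP r ℤ,
      ∀ P : Fin (r + 1) → ℤ, (∀ i, q ∣ P i - c i) → q ^ (m + 1) ∣ eval P f →
      q ^ (m + 1) ∣ P 0 - eval (fun i => P i.succ - c i.succ) ψ := by
    rintro c ⟨v, hv⟩
    exact germ f c q v hv (m + 1) (m + 1) le_rfl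
  choose! ψ hψ using hgerm
  choose! P lam hM hPf c hcCl hcP hcv using h
  choose! s hs using hcP
  -- expansions
  let Ex : (Fin (r + 1) → ℤ) → ι → MP r ℤ := fun c j =>
    aeval (Fin.cons (ψ c) (fun i => C (c i.succ) + X i) : Fin (r + 1) → MP r ℤ) (φ j)
  have hEx : ∀ i ∈ I, ∀ j, q ^ (m + 1) ∣ eval (P i) (φ j) - eval (fun t => q * s i t.succ) (Ex (c i) j) := by
    intro i hi j
    have hY : (fun t : Fin r => q * s i t.succ) = fun t => P i t.succ - c i t.succ := by
      funext t; rw [hs i hi]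
    have e1 : eval (fun t => q * s i t.succ) (Ex (c i) j) =
        eval (Fin.cons (eval (fun t => P i t.succ - c i t.succ) (ψ (c i))) (fun t => P i t.succ) : Fin (r + 1) → ℤ) (φ j) := by
      rw [hY]
      have : ((aeval (fun t => P i t.succ - c i t.succ) : MP r ℤ →ₐ[ℤ] ℤ).comp
          (aeval (Fin.cons (ψ (c i)) (fun t => C (c i t.succ) + X t) : Fin (r + 1) → MP r ℤ))) =
          aeval (Fin.cons (eval (fun t => P i t.succ - c i t.succ) (ψ (c i))) (fun t => P i t.succ) : Fin (r + 1) → ℤ) := by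
        apply algHom_ext
        intro t
        refine Fin.cases ?_ (fun t => ?_) t
        · simp [aeval_eq_eval]
        · simp
      have := congrArg (fun F => F (φ j)) this
      simp only [aeval_eq_eval] at this
      exact this
    rw [e1]
    apply eval_congr_dvd
    intro t
    refine Fin.cases ?_ (fun t => ?_) t
    · simp only [cons_zero]
      refine hψ (c i) (hcv i hi) (P i) ?_ (hPf i hi)
      intro t; rw [hs i hi]; exact Dvd.intro _ rfl
    · simp
  have hexp : ∀ (E : MP r ℤ) (u : Fin r → ℤ), ∃ N, eval (fun t => q * u t) E =
      ∑ α ∈ mons r m, ((∏ t, u t ^ α t) * q ^ α.degree) * coeff α E + q ^ (m + 1) * N := by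
    intro E u
    have h1 : eval (fun t => q * u t) E = ∑ α ∈ E.support, ((∏ t, u t ^ α t) * q ^ α.degree) * coeff α E := by
      rw [eval_eq']
      refine sum_congr rfl fun α _ => ?_
      simp_rw [mul_pow]
      rw [prod_mul_distrib, prod_pow_eq_pow_sum, degree_eq_sum]; ring
    have h2 : ∑ α ∈ E.support, ((∏ t, u t ^ α t) * q ^ α.degree) * coeff α E =
        ∑ α ∈ E.support ∪ mons r m, ((∏ t, u t ^ α t) * q ^ α.degree) * coeff α E := by
      apply sum_subset subset_union_left
      intro α _ hα
      rw [notMem_support_iff.mp hα, mul_zero]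
    have h3 : q ^ (m + 1) ∣ ∑ α ∈ (E.support ∪ mons r m) \ mons r m, ((∏ t, u t ^ α t) * q ^ α.degree) * coeff α E := by
      refine dvd_sum fun α hα => ?_
      rw [mem_sdiff, mem_mons] at hα
      refine Dvd.dvd.mul_right (Dvd.dvd.mul_left (pow_dvd_pow q (by omega)) _) _
    obtain ⟨N, hN⟩ := h3
    refine ⟨N, ?_⟩
    rw [h1, h2, ← hN, add_comm]
    exact (sum_sdiff subset_union_right).symm
  choose N hN using hexp
  have hrow : ∀ i ∈ I, ∀ j, ∃ n, M i j = (∑ k : Cl × mons r m,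
      ((if k.1.1 = c i then lam i * (∏ t, s i t.succ ^ k.2.1 t) else 0) * q ^ k.2.1.degree) * coeff k.2.1 (Ex k.1.1 j)) + q ^ (m + 1) * n := by
    intro i hi j
    obtain ⟨a, ha⟩ := hM i hi j
    obtain ⟨b, hb⟩ := hEx i hi j
    refine ⟨a + lam i * b + lam i * N (Ex (c i) j) (fun t => s i t.succ), ?_⟩
    rw [Fintype.sum_prod_type, sum_eq_single (⟨c i, hcCl i hi⟩ : Cl)]
    · simp only [if_true]
      have h4 := hN (Ex (c i) j) (fun t => s i t.succ)
      have h5 : ∑ x : mons r m, lam i * (∏ t, s i t.succ ^ x.1 t) * q ^ x.1.degree * coeff x.1 (Ex (c i) j) =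
        lam i * ∑ α ∈ mons r m, ((∏ t, s i t.succ ^ α t) * q ^ α.degree) * coeff α (Ex (c i) j) := by
        rw [mul_sum, ← sum_coe_sort (mons r m)]
        refine sum_congr rfl fun x _ => ?_
        ring
      rw [h5]
      linear_combination ha + lam i * hb + lam i * h4
    · intro b _ hb
      refine sum_eq_zero fun x _ => ?_
      rw [if_neg (fun h => hb (Subtype.ext h))]; simp
    · intro h; exact absurd (mem_univ _) h
  choose! n hn using hrow
  have := det_dvd_of_rows M I q (m + 1) (fun k : Cl × mons r m => k.2.1.degree)
    (fun k => (mem_mons.mp k.2.2).trans (Nat.le_succ _))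
    (fun i k => if k.1.1 = c i then lam i * (∏ t, s i t.succ ^ k.2.1 t) else 0)
    (fun k j => coeff k.2.1 (Ex k.1.1 j)) n (by
      intro i hi
      funext j
      rw [hn i hi j]
      simp only [Pi.add_apply, Finset.sum_apply, Pi.smul_apply, smul_eq_mul])
  refine dvd_trans (pow_dvd_pow q ?_) this
  apply Nat.sub_le_sub_left
  rw [Fintype.sum_prod_type]
  simp only [sum_const, card_univ, Fintype.card_coe, smul_eq_mul]
  rw [sum_coe_sort (mons r m) (fun α => m + 1 - α.degree), sum_mons_weight]

/-- exponents of total degree at most `D`, with exponent of variable 0 less than `d` -/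
noncomputable def monsd (n d D : ℕ) : Finset (Fin (n + 1) →₀ ℕ) := (mons (n + 1) D).filter (fun m => m 0 < d)

theorem mem_monsd {n d D : ℕ} {m : Fin (n + 1) →₀ ℕ} : m ∈ monsd n d D ↔ m.degree ≤ D ∧ m 0 < d := by
  simp [monsd, mem_mons]

theorem card_monsd (n d D : ℕ) (h : d ≤ D) :
    (monsd n d D).card + (D - d + (n + 1)).choose (n + 1) = (D + (n + 1)).choose (n + 1) := by
  classical
  rw [← card_mons, ← card_mons, ← card_filter_add_card_filter_not (s := mons (n + 1) D) (fun m => m 0 < d)]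
  congr 1
  rw [← card_image_of_injective (mons (n + 1) (D - d)) (add_left_injective (single (0 : Fin (n + 1)) d))]
  congr 1
  ext m
  simp only [mem_image, mem_filter, mem_mons, not_lt]
  constructor
  · rintro ⟨a, ha, rfl⟩
    simp only [map_add, degree_single, Finsupp.add_apply, single_eq_same]
    omega
  · rintro ⟨h1, h2⟩
    have hle : single (0 : Fin (n + 1)) d ≤ m := by
      rw [Finsupp.single_le_iff]; exact h2
    refine ⟨m - single 0 d, ?_, tsub_add_cancel_of_le hle⟩
    have := congrArg degree (tsub_add_cancel_of_le hle)
    simp only [map_add, degree_single] at this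
    omega

/-- the polynomial with given coefficients -/
noncomputable def polyOf {n : ℕ} {k : Type*} [CommSemiring k] (s : Finset (Fin n →₀ ℕ)) (c : s → k) : MP n k :=
  ∑ m : s, monomial m.1 (c m)

theorem coeff_polyOf {n : ℕ} {k : Type*} [CommSemiring k] (s : Finset (Fin n →₀ ℕ)) (c : s → k) (m : s) :
    coeff m.1 (polyOf s c) = c m := by
  classical
  simp only [polyOf, coeff_sum, coeff_monomial]
  rw [sum_eq_single m]
  · simp
  · intro b _ hb; rw [if_neg]; exact fun h => hb (Subtype.ext h)
  · simp

theorem support_polyOf {n : ℕ} {k : Type*} [CommSemiring k] (s : Finset (Fin n →₀ ℕ)) (c : s → k) :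
    (polyOf s c).support ⊆ s := by
  classical
  intro m hm
  by_contra hms
  rw [mem_support_iff] at hm
  apply hm
  simp only [polyOf, coeff_sum, coeff_monomial]
  refine sum_eq_zero fun x _ => ?_
  rw [if_neg]; rintro rfl; exact hms x.2

theorem polyOf_ne_zero {n : ℕ} {k : Type*} [CommSemiring k] (s : Finset (Fin n →₀ ℕ)) (c : s → k) (hc : c ≠ 0) :
    polyOf s c ≠ 0 := by
  intro h
  apply hc; funext m
  rw [← coeff_polyOf s c m, h]; simp

theorem exists_polyOf {n : ℕ} {k : Type*} [CommSemiring k] (s : Finset (Fin n →₀ ℕ)) (g : MP n k)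
    (hg : g.support ⊆ s) : g = polyOf s (fun m => coeff m.1 g) := by
  classical
  ext m
  by_cases hm : m ∈ s
  · exact (coeff_polyOf s (fun m => coeff m.1 g) ⟨m, hm⟩).symm
  · rw [notMem_support_iff.mp (fun h => hm (hg h)), notMem_support_iff.mp (fun h => hm (support_polyOf s _ h))]

theorem totalDegree_of_supp {n D : ℕ} {k : Type*} [CommSemiring k] (g : MP n k)
    (hg : g.support ⊆ mons n D) : g.totalDegree ≤ D :=
  Finset.sup_le fun m hm => mem_mons.mp (hg hm)

theorem monsd_subset (n d D : ℕ) : monsd n d D ⊆ mons (n + 1) D := filter_subset _ _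

/-- polynomials of degree `< d` in variable 0 are not multiples of `F`. -/
theorem not_dvd_of_supp {n d : ℕ} {k : Type*} [CommRing k] [IsDomain k] (F g : MP (n + 1) k)
    (hF : coeff (single 0 d) F ≠ 0) (hg0 : g ≠ 0) (hg : ∀ m ∈ g.support, m 0 < d) : ¬ F ∣ g := by
  rintro ⟨w, rfl⟩
  have hF0 : F ≠ 0 := by rintro rfl; simp at hF
  have hw0 : w ≠ 0 := by rintro rfl; simp at hg0
  have h1 : degreeOf 0 (F * w) = degreeOf 0 F + degreeOf 0 w := by
    rw [← natDegree_finSuccEquiv, ← natDegree_finSuccEquiv, ← natDegree_finSuccEquiv, map_mul,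
      Polynomial.natDegree_mul]
    · simpa using hF0
    · simpa using hw0
  have h2 : d ≤ degreeOf 0 F := by
    have := monomial_le_degreeOf 0 (mem_support_iff.mpr hF)
    simpa using this
  have hd : 0 < d := by
    obtain ⟨m, hm⟩ := support_nonempty.mpr hg0
    have := hg m hm; omega
  have h3 : degreeOf 0 (F * w) < d := (degreeOf_lt_iff hd).mpr hg
  omega

theorem totalDegree_pderiv_le {n : ℕ} {k : Type*} [CommRing k] (i : Fin n) (g : MP n k) :
    (pderiv i g).totalDegree ≤ g.totalDegree := by
  conv_lhs => rw [g.as_sum, map_sum]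
  refine (totalDegree_finset_sum _ _).trans (Finset.sup_le fun m hm => ?_)
  rw [pderiv_monomial]
  refine (totalDegree_monomial_le _ _).trans ?_
  have h1 : (m - single i 1).degree ≤ m.degree := Finsupp.degree_mono tsub_le_self
  exact h1.trans (le_totalDegree hm)

/-- general Hensel germ -/
theorem hensel_germ_inv {A S : Type*} [CommRing A] [CommRing S] [Algebra A S] {r : ℕ}
    (f : MP (r + 1) A) (I : Ideal S) (z₀ v : S) (y : Fin r → S)
    (h0 : aeval (Fin.cons z₀ y : Fin (r + 1) → S) f ∈ I)
    (hv : v * aeval (Fin.cons z₀ y : Fin (r + 1) → S) (pderiv 0 f) - 1 ∈ I) (Inv : S → Prop) (hI0 : Inv z₀)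
    (hI1 : ∀ z, Inv z → Inv (z + -(v * aeval (Fin.cons z y : Fin (r + 1) → S) f))) (K : ℕ) :
    ∃ z : S, Inv z ∧ z - z₀ ∈ I ∧ aeval (Fin.cons z y : Fin (r + 1) → S) f ∈ I ^ K := by
  rcases Nat.eq_zero_or_pos K with rfl | hK
  · exact ⟨z₀, hI0, by simp, by simp⟩
  induction K, hK using Nat.le_induction with
  | base => exact ⟨z₀, hI0, by simp, by simpa using h0⟩
  | succ K hK ih =>
    obtain ⟨z, hzI, hz, hf⟩ := ih
    set e := aeval (Fin.cons z y : Fin (r + 1) → S) f with he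
    have heI : e ∈ I := Ideal.pow_le_self (by omega) hf
    refine ⟨z + -(v * e), hI1 z hzI, ?_, ?_⟩
    · have : z + -(v * e) - z₀ = (z - z₀) - v * e := by ring
      rw [this]; exact I.sub_mem hz (I.mul_mem_left _ heI)
    · obtain ⟨k, hk⟩ := taylor_zero f z (-(v * e)) y
      rw [hk, ← he]
      obtain ⟨l, hl⟩ := taylor_zero (pderiv 0 f) z₀ (z - z₀) y
      rw [add_sub_cancel] at hl
      have : e + aeval (Fin.cons z y : Fin (r + 1) → S) (pderiv 0 f) * -(v * e) + k * (-(v * e)) ^ 2 =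
        (-(v * aeval (Fin.cons z₀ y : Fin (r + 1) → S) (pderiv 0 f) - 1) -
          v * (aeval (Fin.cons z₀ y : Fin (r + 1) → S) (pderiv 0 (pderiv 0 f)) + l * (z - z₀)) * (z - z₀)) * e
         + (k * v ^ 2 * e) * e := by
        rw [hl]; ring
      rw [this, pow_succ']
      refine Ideal.add_mem _ (Ideal.mul_mem_mul ?_ hf) (Ideal.mul_mem_mul ?_ hf)
      · exact I.sub_mem (I.neg_mem hv) (I.mul_mem_left _ hz)
      · exact I.mul_mem_left _ heI

theorem hensel_germ {A S : Type*} [CommRing A] [CommRing S] [Algebra A S] {r : ℕ}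
    (f : MP (r + 1) A) (I : Ideal S) (z₀ v : S) (y : Fin r → S)
    (h0 : aeval (Fin.cons z₀ y : Fin (r + 1) → S) f ∈ I)
    (hv : v * aeval (Fin.cons z₀ y : Fin (r + 1) → S) (pderiv 0 f) - 1 ∈ I) (K : ℕ) :
    ∃ z : S, z - z₀ ∈ I ∧ aeval (Fin.cons z y : Fin (r + 1) → S) f ∈ I ^ K := by
  obtain ⟨z, -, h⟩ := hensel_germ_inv f I z₀ v y h0 hv (fun _ => True) trivial (fun _ _ => trivial) K
  exact ⟨z, h⟩

/-- evaluation along a germ -/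
noncomputable def gm {k : Type*} [CommRing k] (ξ : Polynomial k) (y : k) : MP 2 k →ₐ[k] Polynomial k :=
  aeval ![ξ, CX y + PX]

theorem gm_coeff_zero {k : Type*} [CommRing k] (ξ : Polynomial k) (z : Fin 2 → k) (h : ξ.coeff 0 = z 0)
    (H : MP 2 k) : (gm ξ (z 1) H).coeff 0 = eval z H := by
  rw [coeff_zero_eq_eval_zero]
  have : (evalRingHom (0 : k)).comp (gm ξ (z 1)).toRingHom = eval z := by
    apply ringHom_ext
    · intro r; simp [gm]
    · intro i
      fin_cases i
      · simp [gm, ← h, coeff_zero_eq_eval_zero]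
      · simp [gm]
  exact congrArg (fun φ => φ H) this

theorem gm_deriv {k : Type*} [CommRing k] (ξ : Polynomial k) (y : k) (H : MP 2 k) :
    derivative (gm ξ y H) = gm ξ y (pderiv 0 H) * derivative ξ + gm ξ y (pderiv 1 H) := by
  induction H using induction_on with
  | C a => simp [gm]
  | add p q hp hq => simp only [map_add, hp, hq]; ring
  | mul_X p i hp =>
    simp only [map_mul, derivative_mul, hp, Derivation.leibniz, smul_eq_mul, map_add]
    fin_cases i
    · simp [gm, pderiv_X_of_ne]; ring
    · simp [gm, pderiv_X_of_ne]; ring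

theorem exists_germ {k : Type*} [Field k] (F : MP 2 k) (z : Fin 2 → k)
    (h0 : eval z F = 0) (h1 : eval z (pderiv 0 F) ≠ 0) (K : ℕ) :
    ∃ ξ : Polynomial k, ξ.coeff 0 = z 0 ∧ PX ^ K ∣ gm ξ (z 1) F := by
  have hc : ∀ ξ : Polynomial k, (Fin.cons ξ (fun _ => CX (z 1) + PX) : Fin 2 → Polynomial k) =
    ![ξ, CX (z 1) + PX] := by
    intro ξ; funext i; fin_cases i <;> rfl
  obtain ⟨ξ, h2, h3⟩ := hensel_germ (r := 1) F (Ideal.span {PX}) (CX (z 0))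
    (CX (eval z (pderiv 0 F))⁻¹) (fun _ => CX (z 1) + PX)
    (by
      rw [hc, Ideal.mem_span_singleton, X_dvd_iff]
      exact (gm_coeff_zero (CX (z 0)) z (by simp) F).trans h0)
    (by
      rw [hc, Ideal.mem_span_singleton, X_dvd_iff]
      have := gm_coeff_zero (CX (z 0)) z (by simp) (pderiv 0 F)
      unfold gm at this
      rw [Polynomial.coeff_sub, Polynomial.coeff_C_mul, this]
      simp [h1]) K
  refine ⟨ξ, ?_, ?_⟩
  · rw [Ideal.mem_span_singleton, X_dvd_iff] at h2
    simpa [sub_eq_zero] using h2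
  · rw [Ideal.span_singleton_pow, Ideal.mem_span_singleton, hc] at h3
    exact h3

/-- the derivation along the curve -/
noncomputable def Dcurve {k : Type*} [CommRing k] (F : MP 2 k) : MP 2 k →ₗ[k] MP 2 k :=
  (pderiv 0 F • pderiv (1 : Fin 2) - pderiv 1 F • pderiv (0 : Fin 2) : Derivation k (MP 2 k) _).toLinearMap

theorem Dcurve_apply {k : Type*} [CommRing k] (F H : MP 2 k) :
    Dcurve F H = pderiv 0 F * pderiv 1 H - pderiv 1 F * pderiv 0 H := rfl

theorem totalDegree_Dcurve {k : Type*} [CommRing k] (F H : MP 2 k) (l : ℕ) :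
    ((Dcurve F ^ l) H).totalDegree ≤ H.totalDegree + F.totalDegree * l := by
  induction l with
  | zero => simp
  | succ l ih =>
    rw [pow_succ', Module.End.mul_apply, Dcurve_apply]
    refine (totalDegree_sub _ _).trans (max_le ?_ ?_)
    · refine (totalDegree_mul _ _).trans ?_
      have h1 := totalDegree_pderiv_le 0 F
      have h2 := totalDegree_pderiv_le 1 ((Dcurve F ^ l) H)
      rw [mul_add, mul_one]; omega
    · refine (totalDegree_mul _ _).trans ?_
      have h1 := totalDegree_pderiv_le 1 F
      have h2 := totalDegree_pderiv_le 0 ((Dcurve F ^ l) H)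
      rw [mul_add, mul_one]; omega

theorem order_of_D {p : ℕ} [Fact p.Prime] (F φ : MP 2 (ZMod p)) (z : Fin 2 → ZMod p)
    (ξ : Polynomial (ZMod p)) (hξ : ξ.coeff 0 = z 0) (M : ℕ) (hM : M ≤ p)
    (hF : PX ^ (M + 1) ∣ gm ξ (z 1) F) (h1 : eval z (pderiv 0 F) ≠ 0)
    (hD : ∀ l < M, eval z ((Dcurve F ^ l) φ) = 0) : PX ^ M ∣ gm ξ (z 1) φ := by
  have key : ∀ j ≤ M, PX ^ j ∣ gm ξ (z 1) ((Dcurve F ^ (M - j)) φ) := by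
    intro j
    induction j with
    | zero => intro _; simp
    | succ j ih =>
      intro hj
      have h2 := ih (by omega)
      set ψ := (Dcurve F ^ (M - (j + 1))) φ with hψ
      have e1 : (Dcurve F ^ (M - j)) φ = Dcurve F ψ := by
        rw [hψ, show M - j = (M - (j + 1)) + 1 by omega, pow_succ', Module.End.mul_apply]
      rw [e1, Dcurve_apply] at h2
      have h3 : PX ^ j ∣ gm ξ (z 1) (pderiv 0 F) * derivative ξ + gm ξ (z 1) (pderiv 1 F) := by
        rw [← gm_deriv]
        obtain ⟨w, hw⟩ := hF
        rw [hw, derivative_mul, Polynomial.derivative_X_pow]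
        refine dvd_add ?_ ?_
        · refine Dvd.dvd.mul_right (Dvd.dvd.mul_left (pow_dvd_pow _ (by omega)) _) _
        · exact Dvd.dvd.mul_right (pow_dvd_pow _ (by omega)) _
      have h4 : PX ^ j ∣ gm ξ (z 1) (pderiv 0 F) * derivative (gm ξ (z 1) ψ) := by
        have : gm ξ (z 1) (pderiv 0 F) * derivative (gm ξ (z 1) ψ) =
          gm ξ (z 1) (pderiv 0 F * pderiv 1 ψ - pderiv 1 F * pderiv 0 ψ) +
          gm ξ (z 1) (pderiv 0 ψ) * (gm ξ (z 1) (pderiv 0 F) * derivative ξ + gm ξ (z 1) (pderiv 1 F)) := by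
          rw [gm_deriv]; simp only [map_sub, map_mul]; ring
        rw [this]
        exact dvd_add h2 (h3.mul_left _)
      have h5 : PX ^ j ∣ derivative (gm ξ (z 1) ψ) := by
        refine (IsCoprime.dvd_of_dvd_mul_left ?_ h4)
        apply IsCoprime.pow_left
        rw [irreducible_X.coprime_iff_not_dvd, X_dvd_iff, gm_coeff_zero ξ z hξ]
        exact h1
      rw [X_pow_dvd_iff] at h5 ⊢
      intro i hi
      rcases Nat.eq_zero_or_pos i with rfl | hi0
      · rw [gm_coeff_zero ξ z hξ]
        exact hD _ (by omega)
      · have := h5 (i - 1) (by omega)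
        rw [coeff_derivative] at this
        have e2 : i - 1 + 1 = i := by omega
        rw [e2] at this
        rcases mul_eq_zero.mp this with h | h
        · exact h
        · exfalso
          have h6 : ((i : ℕ) : ZMod p) = 0 := by
            rw [← e2]; push_cast; exact h
          rw [ZMod.natCast_eq_zero_iff] at h6
          exact absurd (Nat.le_of_dvd hi0 h6) (by omega)
  have := key M le_rfl
  simpa using this

theorem X_pow_dvd_pow_sub {p : ℕ} [Fact p.Prime] (w : Polynomial (ZMod p)) :
    PX ^ p ∣ w ^ p - CX (w.coeff 0) := by
  have h : PX ∣ w - CX (w.coeff 0) := by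
    rw [X_dvd_iff]; simp
  have h2 := pow_dvd_pow_of_dvd h p
  rw [sub_pow_char, ← Polynomial.C_pow, ZMod.pow_card] at h2
  exact h2

theorem stepanov_core {p : ℕ} [Fact p.Prime] (F : MP 2 (ZMod p)) (d A J M : ℕ)
    (hF : Irreducible F) (hd : F.totalDegree = d) (hc : coeff (single 0 d) F ≠ 0)
    (hMp : M ≤ p) (hAp : d * A < p)
    (hcount : M * (A + J + d * M + 2).choose 2 <
      (monsd 1 d A).card * (monsd 1 d J).card + M * (A + J + d * M - d + 2).choose 2)
    (hn : d ≤ A + J + d * M)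
    (Z : Finset (Fin 2 → ZMod p)) (hZ : ∀ z ∈ Z, eval z F = 0) (hZ1 : ∀ z ∈ Z, eval z (pderiv 0 F) ≠ 0) :
    M * Z.card ≤ d * (A + p * J) := by
  classical
  set n := A + J + d * M with hndef
  let k := ZMod p
  rcases Z.eq_empty_or_nonempty with rfl | ⟨z₀, hz₀⟩
  · simp
  -- degrees
  have hdegm : ∀ (D : ℕ) (m : monsd 1 d D), (monomial m.1 (1 : k)).totalDegree ≤ D := by
    intro D m
    exact (totalDegree_monomial_le _ _).trans (mem_monsd.mp m.2).1
  -- the linear system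
  let Hl : ℕ → ((monsd 1 d A × monsd 1 d J) → k) →ₗ[k] MP 2 k := fun l =>
    ∑ ij : monsd 1 d A × monsd 1 d J, (LinearMap.proj ij : ((monsd 1 d A × monsd 1 d J) → k) →ₗ[k] k).smulRight
      (monomial ij.2.1 (1 : k) * (Dcurve F ^ l) (monomial ij.1.1 1))
  have hHl : ∀ l a, Hl l a = ∑ ij : monsd 1 d A × monsd 1 d J, a ij • (monomial ij.2.1 (1 : k) * (Dcurve F ^ l) (monomial ij.1.1 1)) := by
    intro l a; simp [Hl, LinearMap.sum_apply]
  have hHdeg : ∀ l, l < M → ∀ a, (Hl l a).totalDegree ≤ n := by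
    intro l hl a
    rw [hHl]
    refine (totalDegree_finset_sum _ _).trans (Finset.sup_le fun ij _ => ?_)
    refine (totalDegree_smul_le _ _).trans ((totalDegree_mul _ _).trans ?_)
    have h1 := hdegm J ij.2
    have h2 := totalDegree_Dcurve F (monomial ij.1.1 (1 : k)) l
    have h3 := hdegm A ij.1
    rw [hd] at h2
    have : d * l ≤ d * M := Nat.mul_le_mul_left _ hl.le
    omega
  let Lam : (((monsd 1 d A × monsd 1 d J) → k) × (Fin M → restrictTotalDegree (Fin 2) k (n - d))) →ₗ[k]
      (Fin M → restrictTotalDegree (Fin 2) k n) :=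
    LinearMap.pi fun l => LinearMap.codRestrict _
      ((Hl l.1).comp (LinearMap.fst k _ _) - (LinearMap.mulLeft k F).comp
        ((Submodule.subtype _).comp ((LinearMap.proj l).comp (LinearMap.snd k _ _)))) (by
        rintro ⟨a, w⟩
        rw [mem_restrictTotalDegree]
        refine (totalDegree_sub _ _).trans (max_le (hHdeg l.1 l.2 a) ?_)
        refine (totalDegree_mul _ _).trans ?_
        have := (mem_restrictTotalDegree _ _ _).mp (w l).2
        rw [hd]
        simp only [LinearMap.comp_apply, LinearMap.snd_apply, LinearMap.proj_apply, Submodule.subtype_apply]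
        omega)
  have hker : LinearMap.ker Lam ≠ ⊥ := by
    apply LinearMap.ker_ne_bot_of_finrank_lt
    have f1 : Module.finrank k ((monsd 1 d A × monsd 1 d J) → k) = (monsd 1 d A).card * (monsd 1 d J).card := by
      rw [Module.finrank_fintype_fun_eq_card, Fintype.card_prod, Fintype.card_coe, Fintype.card_coe]
    have f2 : ∀ t, Module.finrank k (Fin M → restrictTotalDegree (Fin 2) k t) = M * (t + 2).choose 2 := by
      intro t
      rw [Module.finrank_pi_fintype]
      simp only [finrank_restrictTotalDegree, sum_const, card_univ, Fintype.card_fin, smul_eq_mul]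
    rw [Module.finrank_prod, f1, f2, f2]
    exact hcount
  obtain ⟨⟨a, w⟩, haw, haw0⟩ := Submodule.exists_mem_ne_zero_of_ne_bot hker
  have hrel : ∀ l (hl : l < M), Hl l a = F * (w ⟨l, hl⟩).1 := by
    intro l hl
    have := congrArg (fun f => ((f ⟨l, hl⟩ : restrictTotalDegree (Fin 2) k n) : MP 2 k)) (LinearMap.mem_ker.mp haw)
    exact sub_eq_zero.mp this
  have ha0 : a ≠ 0 := by
    rintro rfl
    apply haw0
    have : w = 0 := by
      funext l
      have := hrel l.1 l.2
      rw [map_zero] at this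
      have := (mul_eq_zero.mp this.symm).resolve_left hF.ne_zero
      exact Subtype.ext this
    rw [this]; rfl
  -- the auxiliary polynomial
  let u : monsd 1 d A → MP 2 k := fun i => polyOf (monsd 1 d J) (fun j => a (i, j))
  let G : MP 2 k := ∑ i : monsd 1 d A, monomial i.1 1 * u i ^ p
  have hudeg : ∀ i, (u i).totalDegree ≤ J := fun i =>
    totalDegree_of_supp _ ((support_polyOf _ _).trans (monsd_subset _ _ _))
  have hGdeg : G.totalDegree ≤ A + p * J := by
    refine (totalDegree_finset_sum _ _).trans (Finset.sup_le fun i _ => ?_)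
    refine (totalDegree_mul _ _).trans (add_le_add (hdegm A i) ?_)
    exact (totalDegree_pow _ _).trans (Nat.mul_le_mul_left _ (hudeg i))
  -- a single germ lemma
  have hsingle : ∀ (ξ : Polynomial k) (y : k) (K : ℕ) (φ : MP 2 k) (D : ℕ), φ ≠ 0 →
      φ.support ⊆ monsd 1 d D → PX ^ K ∣ gm ξ y F → PX ^ K ∣ gm ξ y φ → K ≤ d * D := by
    intro ξ y K φ D hφ hφs h1 h2
    have hnd : ¬ F ∣ φ := not_dvd_of_supp F φ hc hφ (fun m hm => (mem_monsd.mp (hφs hm)).2)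
    have := bezout_jets F φ hF hnd {()} K (fun _ => ξ) (fun _ => y) (by simp) (fun _ _ => h1) (fun _ _ => h2)
    rw [hd] at this
    simp only [card_singleton, mul_one] at this
    exact this.trans (Nat.mul_le_mul_left _ (totalDegree_of_supp _ (hφs.trans (monsd_subset _ _ _))))
  have hFG : ¬ F ∣ G := by
    intro hdvd
    obtain ⟨ξ, hξ, hξF⟩ := exists_germ F z₀ (hZ z₀ hz₀) (hZ1 z₀ hz₀) (p * (d * J) + p + (d * J + 1))
    set U : monsd 1 d A → Polynomial k := fun i => gm ξ (z₀ 1) (u i) with hU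
    obtain ⟨i₁, hi₁⟩ : ∃ i, u i ≠ 0 := by
      by_contra hcon; push Not at hcon
      apply ha0; funext ij
      have := coeff_polyOf (monsd 1 d J) (fun j => a (ij.1, j)) ij.2
      have h2 := hcon ij.1
      simp only [u] at h2
      rw [h2] at this
      simpa using this.symm
    have hUne : ¬ PX ^ (d * J + 1) ∣ U i₁ := by
      intro h
      have := hsingle ξ (z₀ 1) (d * J + 1) (u i₁) J hi₁ (support_polyOf _ _)
        ((pow_dvd_pow _ (by omega)).trans hξF) h
      omega
    -- s maximal with X^s dividing all U i
    have hex : ∃ s, ¬ ∀ i, PX ^ (s + 1) ∣ U i := ⟨d * J, fun h => hUne (h i₁)⟩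
    set s := Nat.find hex with hs
    have hs1 : ¬ ∀ i, PX ^ (s + 1) ∣ U i := Nat.find_spec hex
    have hs2 : ∀ i, PX ^ s ∣ U i := by
      rcases Nat.eq_zero_or_pos s with h | h
      · intro i; rw [h]; simp
      · have := Nat.find_min hex (show s - 1 < Nat.find hex by omega)
        rw [not_not, show s - 1 + 1 = s by omega] at this
        exact this
    have hsle : s ≤ d * J := Nat.find_min' hex (fun h => hUne (h i₁))
    choose W hW using hs2
    push Not at hs1
    obtain ⟨i₂, hi₂⟩ := hs1
    have hW0 : (W i₂).coeff 0 ≠ 0 := by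
      intro h
      apply hi₂
      rw [hW i₂, pow_succ]
      exact mul_dvd_mul_left _ (X_dvd_iff.mpr h)
    -- divide
    have hG1 : PX ^ (p * s + p) ∣ gm ξ (z₀ 1) G := by
      obtain ⟨g, hg⟩ := hdvd
      rw [hg, map_mul]
      refine Dvd.dvd.mul_right ((pow_dvd_pow _ ?_).trans hξF) _
      have : p * s ≤ p * (d * J) := Nat.mul_le_mul_left _ hsle
      omega
    have hG2 : gm ξ (z₀ 1) G = PX ^ (p * s) * ∑ i : monsd 1 d A, gm ξ (z₀ 1) (monomial i.1 1) * W i ^ p := by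
      simp only [G, map_sum, map_mul, map_pow, mul_sum]
      refine sum_congr rfl fun i _ => ?_
      change _ * U i ^ p = _
      rw [hW i, mul_pow, ← pow_mul, mul_comm s p]; ring
    rw [hG2, pow_add] at hG1
    have hG3 := (mul_dvd_mul_iff_left (pow_ne_zero (p * s) Polynomial.X_ne_zero)).mp hG1
    let φ := polyOf (monsd 1 d A) (fun i => (W i).coeff 0)
    have hφ0 : φ ≠ 0 := polyOf_ne_zero _ _ (fun h => hW0 (congrFun h i₂))
    have hφ1 : PX ^ p ∣ gm ξ (z₀ 1) φ := by
      have : gm ξ (z₀ 1) φ = ∑ i : monsd 1 d A, gm ξ (z₀ 1) (monomial i.1 1) * W i ^ p -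
          ∑ i : monsd 1 d A, gm ξ (z₀ 1) (monomial i.1 1) * (W i ^ p - CX ((W i).coeff 0)) := by
        rw [← sum_sub_distrib]
        simp only [φ, polyOf, map_sum]
        refine sum_congr rfl fun i _ => ?_
        have : (monomial i.1 ((W i).coeff 0) : MP 2 k) = (W i).coeff 0 • monomial i.1 (1 : k) := by
          rw [smul_monomial, smul_eq_mul, mul_one]
        rw [this, map_smul, Polynomial.smul_eq_C_mul]; ring
      rw [this]
      refine dvd_sub hG3 (dvd_sum fun i _ => Dvd.dvd.mul_left (X_pow_dvd_pow_sub (W i)) _)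
    have := hsingle ξ (z₀ 1) p φ A hφ0 (support_polyOf _ _) ((pow_dvd_pow _ (by omega)).trans hξF) hφ1
    omega
  -- germs at all points
  have hgerms : ∀ z ∈ Z, ∃ ξ : Polynomial k, ξ.coeff 0 = z 0 ∧ PX ^ (M + 1) ∣ gm ξ (z 1) F :=
    fun z hz => exists_germ F z (hZ z hz) (hZ1 z hz) (M + 1)
  choose! ξ hξ0 hξF using hgerms
  have hGz : ∀ z ∈ Z, PX ^ M ∣ gm (ξ z) (z 1) G := by
    intro z hz
    let φ : MP 2 k := ∑ ij : monsd 1 d A × monsd 1 d J, (a ij * eval z (monomial ij.2.1 (1 : k))) • monomial ij.1.1 1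
    have hφ : PX ^ M ∣ gm (ξ z) (z 1) φ := by
      refine order_of_D F φ z (ξ z) (hξ0 z hz) M hMp (hξF z hz) (hZ1 z hz) ?_
      intro l hl
      have h1 : eval z ((Dcurve F ^ l) φ) = eval z (Hl l a) := by
        rw [hHl]
        simp only [φ, map_sum, map_smul]
        refine sum_congr rfl fun ij _ => ?_
        simp only [smul_eval, map_mul]; ring
      rw [h1, hrel l hl, map_mul, hZ z hz, zero_mul]
    have hdiff : PX ^ p ∣ gm (ξ z) (z 1) G - gm (ξ z) (z 1) φ := by
      have : gm (ξ z) (z 1) G - gm (ξ z) (z 1) φ = ∑ i : monsd 1 d A, gm (ξ z) (z 1) (monomial i.1 1) *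
          ((gm (ξ z) (z 1) (u i)) ^ p - CX ((gm (ξ z) (z 1) (u i)).coeff 0)) := by
        simp only [mul_sub, sum_sub_distrib]
        congr 1
        · simp only [G, map_sum, map_mul, map_pow]
        · simp only [φ, map_sum, map_smul, Fintype.sum_prod_type]
          refine sum_congr rfl fun i _ => ?_
          rw [gm_coeff_zero (ξ z) z (hξ0 z hz), ← sum_smul, Polynomial.smul_eq_C_mul, mul_comm]
          congr 2
          simp only [u, polyOf, map_sum, eval_monomial, one_mul]
      rw [this]
      exact dvd_sum fun i _ => Dvd.dvd.mul_left (X_pow_dvd_pow_sub _) _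
    have := dvd_add ((pow_dvd_pow PX hMp).trans hdiff) hφ
    simpa using this
  have := bezout_jets F G hF hFG Z M ξ (fun z => z 1) (by
    intro z hz w hw h0 h1
    rw [hξ0 z hz, hξ0 w hw] at h0
    funext i; fin_cases i
    · exact h0
    · exact h1) (fun z hz => (pow_dvd_pow _ (by omega)).trans (hξF z hz)) hGz
  rw [hd] at this
  exact this.trans (Nat.mul_le_mul_left _ hGdeg)

theorem pderiv_zero_props {k : Type*} [Field k] {n : ℕ} (F : MP (n + 1) k) (d : ℕ)
    (hd : F.totalDegree = d) (hc : coeff (single 0 d) F ≠ 0) (hdk : (d : k) ≠ 0) : ¬ F ∣ pderiv 0 F := by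
  have hd0 : d ≠ 0 := by rintro rfl; simp at hdk
  have hcoeff : coeff (single 0 (d - 1)) (pderiv 0 F) ≠ 0 := by
    rw [coeff_pderiv]
    have : single (0 : Fin (n+1)) (d - 1) + single 0 1 = single 0 d := by
      rw [← Finsupp.single_add, Nat.sub_add_cancel (by omega)]
    rw [this]
    simp only [single_eq_same]
    have h2 : ((d - 1 : ℕ) : k) + 1 = d := by
      rw [← Nat.cast_succ]; congr 1; omega
    rw [h2]
    exact mul_ne_zero hc hdk
  refine not_dvd_of_supp F _ hc ?_ ?_
  · intro h; rw [h] at hcoeff; simp at hcoeff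
  · intro m hm
    rw [mem_support_iff, coeff_pderiv] at hm
    have : m + single 0 1 ∈ F.support := by
      rw [mem_support_iff]; intro h; rw [h] at hm; simp at hm
    have := le_totalDegree this
    rw [hd] at this
    change (m + single 0 1).degree ≤ d at this
    rw [map_add, degree_single] at this
    have h2 : m 0 ≤ m.degree := le_degree 0 m
    omega

theorem stepanov_num (d A J M a j : ℕ) (hd1 : 1 ≤ d) (hA : A = 10000 * d ^ 3) (hJ : J = 50 * d) (hM : M = 49 * d ^ 2)
    (ha : a + (A - d + 2).choose 2 = (A + 2).choose 2) (hj : j + (J - d + 2).choose 2 = (J + 2).choose 2) :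
    M * (A + J + d * M + 2).choose 2 < a * j + M * (A + J + d * M - d + 2).choose 2 := by
  have hdA : d ≤ A := by
    rw [hA]
    have : d * 1 ≤ d * d ^ 2 := Nat.mul_le_mul_left _ (Nat.one_le_pow _ _ hd1)
    have : d ^ 3 = d * d ^ 2 := by ring
    omega
  obtain ⟨x, hx⟩ : ∃ x, A = d + x := ⟨A - d, by omega⟩
  obtain ⟨y, hy⟩ : ∃ y, J = d + y := ⟨J - d, by omega⟩
  rw [show A - d = x by omega] at ha
  rw [show J - d = y by omega] at hj
  rw [show A + J + d * M - d = x + J + d * M by omega]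
  have hc2 : ∀ x : ℕ, ((x + 2).choose 2 : ℚ) = (x + 1) * (x + 2) / 2 := by
    intro x; rw [Nat.cast_choose_two]; push_cast; ring
  have h1q : (a : ℚ) + (x + 1) * (x + 2) / 2 = (A + 1) * (A + 2) / 2 := by
    rw [← hc2, ← hc2]; exact_mod_cast ha
  have h2q : (j : ℚ) + (y + 1) * (y + 2) / 2 = (J + 1) * (J + 2) / 2 := by
    rw [← hc2, ← hc2]; exact_mod_cast hj
  have hxq : (x : ℚ) = A - d := by rw [hx]; push_cast; ring
  have hyq : (y : ℚ) = J - d := by rw [hy]; push_cast; ring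
  have hAq : (A : ℚ) = 10000 * d ^ 3 := by rw [hA]; push_cast; ring
  have hJq : (J : ℚ) = 50 * d := by rw [hJ]; push_cast; ring
  have hMq : (M : ℚ) = 49 * d ^ 2 := by rw [hM]; push_cast; ring
  have e1 : (a : ℚ) = d * (A + 3 / 2 - d / 2) := by
    rw [hxq] at h1q; linear_combination h1q
  have e2 : (j : ℚ) = d * (J + 3 / 2 - d / 2) := by
    rw [hyq] at h2q; linear_combination h2q
  have hdq : (1 : ℚ) ≤ d := by exact_mod_cast hd1
  have goal : ((M * (A + J + d * M + 2).choose 2 : ℕ) : ℚ) <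
    ((a * j + M * (x + J + d * M + 2).choose 2 : ℕ) : ℚ) := by
    push_cast
    rw [hc2, hc2]
    push_cast
    rw [e1, e2, hxq, hAq, hJq, hMq]
    generalize (d : ℚ) = D at hdq
    have h5 : 0 < (10000 * D ^ 3 + 3 / 2 - D / 2) * (50 * D + 3 / 2 - D / 2) -
        49 * ((10000 * D ^ 3 + 50 * D + D * (49 * D ^ 2)) + 3 / 2 - D / 2) * D := by
      have hD2 : 1 ≤ D ^ 2 := by nlinarith
      have hD3 : D ^ 2 ≤ D ^ 3 := by nlinarith
      have hD4 : D ^ 3 ≤ D ^ 4 := by nlinarith [pow_pos (show (0:ℚ) < D by linarith) 3]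
      nlinarith
    have := mul_pos (show 0 < D ^ 2 by positivity) h5
    linear_combination this
  exact_mod_cast goal

theorem stepanov {p : ℕ} [Fact p.Prime] (F : MP 2 (ZMod p)) (d : ℕ)
    (hF : Irreducible F) (hd : F.totalDegree = d) (hd1 : 1 ≤ d) (hc : coeff (single 0 d) F ≠ 0)
    (hp : 10 ^ 5 * d ^ 4 ≤ p)
    (Z : Finset (Fin 2 → ZMod p)) (hZ : ∀ z ∈ Z, eval z F = 0) : 100 * Z.card ≤ 103 * p := by
  classical
  have hd2 : d ≤ d ^ 2 := by nlinarith
  have hd3 : d ^ 2 ≤ d ^ 3 := by nlinarith [Nat.pow_le_pow_left hd1 2]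
  have hd4 : d ^ 3 ≤ d ^ 4 := by nlinarith [Nat.pow_le_pow_left hd1 3]
  have hdp : d < p := by
    nlinarith
  have hdk : (d : ZMod p) ≠ 0 := by
    intro h; rw [ZMod.natCast_eq_zero_iff] at h
    exact absurd (Nat.le_of_dvd (by omega) h) (by omega)
  obtain ⟨A, hA⟩ : ∃ A, A = 10000 * d ^ 3 := ⟨_, rfl⟩
  obtain ⟨J, hJ⟩ : ∃ J, J = 50 * d := ⟨_, rfl⟩
  obtain ⟨M, hM⟩ : ∃ M, M = 49 * d ^ 2 := ⟨_, rfl⟩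
  have hcore := stepanov_core F d A J M hF hd hc (by rw [hM]; nlinarith) (by rw [hA]; nlinarith)
    (stepanov_num d A J M _ _ hd1 hA hJ hM (card_monsd 1 d A (by rw [hA]; nlinarith)) (card_monsd 1 d J (by omega)))
    (by omega) (Z.filter fun z => eval z (pderiv 0 F) ≠ 0)
    (fun z hz => hZ z (mem_filter.mp hz).1) (fun z hz => (mem_filter.mp hz).2)
  have hsing := bezout_points F (pderiv 0 F) hF (pderiv_zero_props F d hd hc hdk)
    (Z.filter fun z => ¬ eval z (pderiv 0 F) ≠ 0) (fun z hz => hZ z (mem_filter.mp hz).1)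
    (fun z hz => not_not.mp (mem_filter.mp hz).2)
  have hsplit := card_filter_add_card_filter_not (s := Z) (fun z => eval z (pderiv 0 F) ≠ 0)
  have hs2 : (Z.filter fun z => ¬ eval z (pderiv 0 F) ≠ 0).card ≤ d * d := by
    refine hsing.trans ?_
    rw [hd]
    exact Nat.mul_le_mul_left _ (hd ▸ totalDegree_pderiv_le 0 F)
  set N1 := (Z.filter fun z => eval z (pderiv 0 F) ≠ 0).card
  have h49 : 49 * N1 ≤ 10000 * d ^ 2 + p * 50 := by
    have : d ^ 2 * (49 * N1) ≤ d ^ 2 * (10000 * d ^ 2 + p * 50) := by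
      subst hA hJ hM
      calc d ^ 2 * (49 * N1) = 49 * d ^ 2 * N1 := by ring
        _ ≤ _ := hcore
        _ = _ := by ring
    exact Nat.le_of_mul_le_mul_left this (by positivity)
  have : d ^ 2 ≤ d ^ 4 := hd3.trans hd4
  nlinarith

/-- restriction of a polynomial to the plane through the distinguished axis with slope `s` -/
noncomputable def psl {A k : Type*} [CommRing A] [CommRing k] {m : ℕ} (φ : A →+* k) (s : Fin m → k) :
    MP (m + 1) A →+* MP 2 k :=
  eval₂Hom (C.comp φ) (Fin.cons (X 0) fun i => C (s i) * X 1 : Fin (m + 1) → MP 2 k)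

theorem finSuccEquiv_top {K : Type*} [Field K] {m : ℕ} (F : MP (m + 1) K) (d : ℕ)
    (hd : F.totalDegree = d) (hc : coeff (single 0 d) F ≠ 0) :
    (finSuccEquiv K m F).natDegree = d ∧ (finSuccEquiv K m F).coeff d = C (coeff (single 0 d) F) := by
  have hcoeff : (finSuccEquiv K m F).coeff d = C (coeff (single 0 d) F) := by
    ext e
    rw [finSuccEquiv_coeff_coeff, coeff_C]
    split_ifs with h
    · subst h
      congr 1
      ext i
      refine Fin.cases ?_ (fun j => ?_) i
      · simp
      · simp [single_apply, succ_ne_zero, (succ_ne_zero _).symm]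
    · by_contra hne
      have h1 : e.cons d ∈ F.support := mem_support_iff.mpr hne
      have h2 := le_totalDegree h1
      rw [hd] at h2
      change (e.cons d).degree ≤ d at h2
      apply h
      have h3 : (e.cons d).degree = d + e.degree := by
        rw [degree_eq_sum, degree_eq_sum, sum_univ_succ]; simp
      have h4 : e.degree = 0 := by omega
      exact ((Finsupp.degree_eq_zero_iff e).mp h4).symm
  refine ⟨?_, hcoeff⟩
  apply le_antisymm
  · rw [natDegree_finSuccEquiv]
    exact hd ▸ degreeOf_le_totalDegree F 0
  · apply Polynomial.le_natDegree_of_ne_zero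
    rw [hcoeff]
    simpa using hc

theorem generic_irred {K : Type*} [Field K] {m : ℕ} (F : MP (m + 1) K) (d : ℕ)
    (hF : Irreducible F) (hd : F.totalDegree = d) (hc : coeff (single 0 d) F ≠ 0) :
    Irreducible (psl ((algebraMap (MP m K) (FractionRing (MP m K))).comp C)
      (fun i => algebraMap (MP m K) (FractionRing (MP m K)) (X i)) F) := by
  classical
  obtain ⟨hnd, hlc⟩ := finSuccEquiv_top F d hd hc
  set c := coeff (single 0 d) F with hcdef
  set P := finSuccEquiv K m F with hP
  have hPirr : Irreducible P := (MulEquiv.irreducible_iff (finSuccEquiv K m)).mpr hF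
  let P' : Polynomial (MP m K) := CX (C c⁻¹) * P
  have hunit : IsUnit (CX (C c⁻¹) : Polynomial (MP m K)) :=
    ((isUnit_iff_ne_zero.mpr (inv_ne_zero hc)).map C).map CX
  have hP'irr : Irreducible P' := (irreducible_isUnit_mul hunit).mpr hPirr
  have hlead : P.leadingCoeff = C c := by rw [leadingCoeff, hnd, hlc]
  have hP'mon : P'.Monic := by
    change leadingCoeff (CX (C c⁻¹) * P) = 1
    rw [Polynomial.leadingCoeff_mul, Polynomial.leadingCoeff_C, hlead, ← C_mul, inv_mul_cancel₀ hc, C_1]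
  let θ : (MP m K) →+* (MP 1 (MP m K)) := eval₂Hom (C.comp C) (fun i => C (X i) * X 0)
  let ψ : (MP 1 (MP m K)) →+* (MP m K) := eval₂Hom (RingHom.id (MP m K)) (fun _ => 1)
  have hψθ : ψ.comp θ = RingHom.id (MP m K) := by
    apply ringHom_ext
    · intro r; simp [ψ, θ]
    · intro i; simp [ψ, θ]
  have hf1mon : (P'.map θ).Monic := hP'mon.map θ
  have hf1irr : Irreducible (P'.map θ) := by
    apply Monic.irreducible_of_irreducible_map ψ _ hf1mon
    rw [Polynomial.map_map, hψθ, Polynomial.map_id]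
    exact hP'irr
  have hf1Q : Irreducible ((P'.map θ).map (algebraMap (MP 1 (MP m K)) (FractionRing (MP 1 (MP m K))))) :=
    (Monic.irreducible_iff_irreducible_map_fraction_map hf1mon).mp hf1irr
  let ι : (MP 1 (MP m K)) →+* MP 1 (FractionRing (MP m K)) := MvPolynomial.map (algebraMap (MP m K) (FractionRing (MP m K)))
  have hinj : Injective ((algebraMap (MP 1 (MP m K)) (FractionRing (MP 1 (MP m K)))).comp (C : (MP m K) →+* (MP 1 (MP m K)))) :=
    (IsFractionRing.injective (MP 1 (MP m K)) (FractionRing (MP 1 (MP m K)))).comp (C_injective (Fin 1) (MP m K))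
  let j : MP 1 (FractionRing (MP m K)) →+* (FractionRing (MP 1 (MP m K))) := eval₂Hom (IsFractionRing.lift hinj) (fun i => algebraMap (MP 1 (MP m K)) (FractionRing (MP 1 (MP m K))) (X i))
  have hjι : j.comp ι = algebraMap (MP 1 (MP m K)) (FractionRing (MP 1 (MP m K))) := by
    apply ringHom_ext
    · intro r; simp [j, ι]
    · intro i; simp [j, ι]
  have hk : Irreducible ((P'.map θ).map ι) := by
    apply Monic.irreducible_of_irreducible_map j _ (hf1mon.map ι)
    rw [Polynomial.map_map, hjι]
    exact hf1Q
  rw [← MulEquiv.irreducible_iff (finSuccEquiv (FractionRing (MP m K)) 1)]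
  have hcomp : ((finSuccEquiv (FractionRing (MP m K)) 1 : MP 2 (FractionRing (MP m K)) ≃ₐ[(FractionRing (MP m K))] _) : MP 2 (FractionRing (MP m K)) →+* _).comp
      (psl ((algebraMap (MP m K) (FractionRing (MP m K))).comp C) (fun i => algebraMap (MP m K) (FractionRing (MP m K)) (X i))) =
      (mapRingHom (ι.comp θ)).comp (finSuccEquiv K m : MP (m+1) K →+* _) := by
    apply ringHom_ext
    · intro r; simp [psl, ι, θ, finSuccEquiv_apply]
    · intro i
      refine Fin.cases ?_ (fun i => ?_) i
      · simp [psl, ι, θ, finSuccEquiv_apply]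
      · simp [psl, ι, θ, finSuccEquiv_apply]
        rfl
  have h2 := congrArg (fun f => f F) hcomp
  simp only [RingHom.comp_apply] at h2
  have h3 : (P'.map θ).map ι = (Polynomial.map (ι.comp θ) (CX (C c⁻¹))) * Polynomial.map (ι.comp θ) P := by
    rw [Polynomial.map_map, ← Polynomial.map_mul]
  rw [h3] at hk
  replace hk := (irreducible_isUnit_mul (hunit.map (mapRingHom (ι.comp θ)))).mp hk
  have h4 : Irreducible (mapRingHom (ι.comp θ) (finSuccEquiv K m F)) := hk
  exact (congrArg Irreducible h2).mpr h4

/-- entries of the Newton matrix -/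
noncomputable def nEntry {A : Type*} [CommRing A] {m : ℕ} (α : MP m A) (i : ℕ) (e : Fin 2 →₀ ℕ) :
    MP m A :=
  if e 1 ≤ i then homogeneousComponent (i - e 1) (α ^ (e 0)) else 0

/-- substitution `w = sY` -/
noncomputable def nPhi {A k : Type*} [CommRing A] [CommRing k] {m : ℕ} (φ : A →+* k) (s : Fin m → k) :
    MP m A →+* Polynomial k :=
  eval₂Hom (Polynomial.C.comp φ) (fun i => CX (s i) * PX)

theorem coeff_nPhi {A k : Type*} [CommRing A] [CommRing k] {m : ℕ} (φ : A →+* k) (s : Fin m → k)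
    (P : MP m A) (j : ℕ) : (nPhi φ s P).coeff j = eval₂ φ s (homogeneousComponent j P) := by
  induction P using MvPolynomial.induction_on' with
  | add p q hp hq => simp only [map_add, Polynomial.coeff_add, hp, hq, eval₂_add]
  | monomial e c =>
    have h1 : nPhi φ s (monomial e c) = CX (φ c * ∏ i, s i ^ e i) * PX ^ e.degree := by
      simp only [nPhi, coe_eval₂Hom, eval₂_monomial]
      rw [prod_fintype _ _ (by simp)]
      simp only [mul_pow, prod_mul_distrib, prod_pow_eq_pow_sum, RingHom.comp_apply]
      rw [degree_eq_sum, map_mul, map_prod]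
      simp only [map_pow]; ring
    rw [h1, coeff_C_mul_X_pow]
    have h2 : homogeneousComponent j (monomial e c) = if j = e.degree then monomial e c else 0 := by
      ext m'
      rw [coeff_homogeneousComponent]
      split_ifs with h3 h4 h4
      · rfl
      · rw [coeff_monomial, if_neg]; · simp
        rintro rfl; exact h4 h3.symm
      · rw [coeff_monomial, if_neg]
        rintro rfl; exact h3 h4.symm
      · simp
    rw [h2]
    split_ifs
    · rw [eval₂_monomial, prod_fintype _ _ (by simp)]
    · simp

theorem nEntry_eval {A k : Type*} [CommRing A] [CommRing k] {m : ℕ} (φ : A →+* k) (s : Fin m → k)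
    (α : MP m A) (i : ℕ) (e : Fin 2 →₀ ℕ) :
    eval₂ φ s (nEntry α i e) = (gm (nPhi φ s α) 0 (monomial e 1)).coeff i := by
  have h1 : gm (nPhi φ s α) 0 (monomial e (1 : k)) = nPhi φ s (α ^ (e 0)) * PX ^ (e 1) := by
    simp [gm, aeval_monomial, prod_fintype, Fin.prod_univ_two]
  rw [h1, Polynomial.coeff_mul_X_pow', nEntry]
  split_ifs
  · rw [coeff_nPhi]
  · simp

theorem gm_psl {A k : Type*} [CommRing A] [CommRing k] {m : ℕ} (φ : A →+* k) (s : Fin m → k)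
    (α : MP m A) (F : MP (m + 1) A) :
    gm (nPhi φ s α) 0 (psl φ s F) = nPhi φ s (aeval (Fin.cons α X : Fin (m + 1) → MP m A) F) := by
  have : (gm (nPhi φ s α) 0 : MP 2 k →+* Polynomial k).comp (psl φ s) =
      (nPhi φ s).comp ((aeval (Fin.cons α X : Fin (m + 1) → MP m A) : MP (m+1) A →ₐ[A] MP m A) : MP (m+1) A →+* MP m A) := by
    apply ringHom_ext
    · intro r; simp [gm, psl, nPhi]
    · intro i
      refine Fin.cases ?_ (fun i => ?_) i
      · simp [gm, psl]
      · simp [gm, psl, nPhi]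
  exact congrArg (fun f => f F) this

theorem psl_monomial {A k : Type*} [CommRing A] [CommRing k] {m : ℕ} (φ : A →+* k) (s : Fin m → k)
    (e : Fin (m + 1) →₀ ℕ) (c : A) :
    psl φ s (monomial e c) = monomial (single 0 (e 0) + single 1 (∑ i : Fin m, e i.succ))
      (φ c * ∏ i : Fin m, s i ^ e i.succ) := by
  simp only [psl, coe_eval₂Hom, eval₂_monomial]
  rw [prod_fintype _ _ (by simp), prod_univ_succ]
  simp only [cons_zero, cons_succ, mul_pow, prod_mul_distrib, prod_pow_eq_pow_sum, RingHom.comp_apply]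
  rw [monomial_eq, prod_fintype _ _ (by simp), Fin.prod_univ_two]
  simp
  ring

theorem psl_top {A k : Type*} [CommRing A] [CommRing k] {m : ℕ} (φ : A →+* k) (s : Fin m → k)
    (F : MP (m + 1) A) (d : ℕ) (hd : F.totalDegree ≤ d) :
    (psl φ s F).totalDegree ≤ d ∧ coeff (single 0 d) (psl φ s F) = φ (coeff (single 0 d) F) := by
  have hsum : psl φ s F = ∑ e ∈ F.support, psl φ s (monomial e (coeff e F)) := by
    rw [← map_sum, ← F.as_sum]
  have hdeg : ∀ e ∈ F.support, e 0 + ∑ i : Fin m, e i.succ ≤ d := by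
    intro e he
    have := (le_totalDegree he).trans hd
    change e.degree ≤ d at this
    rwa [degree_eq_sum, sum_univ_succ] at this
  constructor
  · rw [hsum]
    refine (totalDegree_finset_sum _ _).trans (Finset.sup_le fun e he => ?_)
    rw [psl_monomial]
    refine (totalDegree_monomial_le _ _).trans ?_
    change degree _ ≤ d
    rw [map_add, degree_single, degree_single]
    exact hdeg e he
  · rw [hsum, coeff_sum]
    rw [sum_eq_single (single 0 d)]
    · rw [psl_monomial]; simp
    · intro e he hne
      rw [psl_monomial, coeff_monomial, if_neg]
      intro h
      apply hne
      have h0 := DFunLike.congr_fun h 0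
      have h1 := DFunLike.congr_fun h 1
      simp at h0 h1
      ext i
      refine Fin.cases ?_ (fun i => ?_) i
      · simp [h0]
      · rw [h1 i]; simp [single_apply, (succ_ne_zero _).symm]
    · intro h
      rw [notMem_support_iff.mp h]; simp

theorem newton_det_zero {A k : Type*} [CommRing A] [Field k] {m : ℕ} (φ : A →+* k) (s : Fin m → k)
    (α : MP m A) (D L : ℕ) (G : MP 2 k) (hG : G ≠ 0) (hGD : G.totalDegree ≤ D)
    (hL : PX ^ L ∣ gm (nPhi φ s α) 0 G) (r : mons 2 D → ℕ) (hr : ∀ e, r e < L) :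
    eval₂ φ s (Matrix.of fun e e' : mons 2 D => nEntry α (r e) e'.1).det = 0 := by
  classical
  rw [← coe_eval₂Hom, RingHom.map_det, ← Matrix.exists_mulVec_eq_zero_iff]
  have hsup : G.support ⊆ mons 2 D := fun e he => mem_mons.mpr ((le_totalDegree he).trans hGD)
  have hGp := exists_polyOf (mons 2 D) G hsup
  refine ⟨fun e => coeff e.1 G, ?_, ?_⟩
  · intro h
    apply hG
    rw [hGp, h]
    simp [polyOf]
  · funext e
    have h1 := X_pow_dvd_iff.mp hL (r e) (hr e)
    rw [hGp] at h1
    simp only [polyOf, map_sum, finsetSum_coeff] at h1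
    simp only [Matrix.mulVec, dotProduct, RingHom.mapMatrix_apply, Matrix.map_apply, Matrix.of_apply, coe_eval₂Hom,
      nEntry_eval, Pi.zero_apply]
    refine Eq.trans ?_ h1
    refine sum_congr rfl fun e' _ => ?_
    have : (monomial e'.1 (coeff e'.1 G) : MP 2 k) = coeff e'.1 G • monomial e'.1 (1 : k) := by
      rw [smul_monomial, smul_eq_mul, mul_one]
    rw [this, map_smul, Polynomial.coeff_smul, smul_eq_mul, mul_comm]

theorem irred_of_newton {A k : Type*} [CommRing A] [Field k] {m : ℕ} (φ : A →+* k) (s : Fin m → k)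
    (F : MP (m + 1) A) (α : MP m A) (d : ℕ) (hd1 : 1 ≤ d)
    (hd : F.totalDegree ≤ d) (hc : φ (coeff (single 0 d) F) ≠ 0) (L : ℕ)
    (hα : aeval (Fin.cons α X : Fin (m + 1) → MP m A) F ∈
      (Ideal.span (Set.range X) : Ideal (MP m A)) ^ (2 * L))
    (r : mons 2 (d - 1) → ℕ) (hr : ∀ e, r e < L)
    (hμ : eval₂ φ s (Matrix.of fun e e' : mons 2 (d - 1) => nEntry α (r e) e'.1).det ≠ 0) :
    Irreducible (psl φ s F) ∧ (psl φ s F).totalDegree = d ∧ coeff (single 0 d) (psl φ s F) ≠ 0 := by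
  classical
  obtain ⟨h1, h2⟩ := psl_top φ s F d hd
  rw [← h2] at hc
  have htd : (psl φ s F).totalDegree = d := by
    apply le_antisymm h1
    have := le_totalDegree (mem_support_iff.mpr hc)
    change (single (0 : Fin 2) d).degree ≤ _ at this
    rwa [degree_single] at this
  refine ⟨?_, htd, hc⟩
  have hne : psl φ s F ≠ 0 := by intro h; rw [h] at hc; simp at hc
  have hord : PX ^ (2 * L) ∣ gm (nPhi φ s α) 0 (psl φ s F) := by
    rw [gm_psl, ← Ideal.mem_span_singleton, ← Ideal.span_singleton_pow]
    have := Ideal.mem_map_of_mem (nPhi φ s) hα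
    rw [Ideal.map_pow] at this
    refine Ideal.pow_right_mono ?_ _ this
    rw [Ideal.map_span, Ideal.span_le]
    rintro _ ⟨_, ⟨i, rfl⟩, rfl⟩
    rw [SetLike.mem_coe, Ideal.mem_span_singleton]
    simp [nPhi]
  have hunit : ∀ G : MP 2 k, G ≠ 0 → G.totalDegree = 0 → IsUnit G := by
    intro G hG h0
    rw [totalDegree_eq_zero_iff_eq_C] at h0
    rw [h0]
    apply IsUnit.map
    rw [isUnit_iff_ne_zero]
    intro h; rw [h] at h0; exact hG (by rw [h0]; simp)
  refine ⟨?_, ?_⟩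
  · intro hu
    obtain ⟨c, hc1, hc2⟩ := isUnit_iff_eq_C_of_isReduced.mp hu
    rw [hc2, totalDegree_C] at htd
    omega
  · intro G H hGH
    by_contra hcon
    push Not at hcon
    have hG0 : G ≠ 0 := by rintro rfl; exact hne (by rw [hGH, zero_mul])
    have hH0 : H ≠ 0 := by rintro rfl; exact hne (by rw [hGH, mul_zero])
    have hdeg := totalDegree_mul_of_isDomain hG0 hH0
    rw [← hGH, htd] at hdeg
    have hGd : G.totalDegree ≠ 0 := fun h => hcon.1 (hunit G hG0 h)
    have hHd : H.totalDegree ≠ 0 := fun h => hcon.2 (hunit H hH0 h)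
    rw [hGH, map_mul] at hord
    have hor : ∀ u v : Polynomial k, PX ^ (2 * L) ∣ u * v → PX ^ L ∣ u ∨ PX ^ L ∣ v := by
      intro u v huv
      by_contra hh
      push Not at hh
      have hp : Prime (PX : Polynomial k) := Polynomial.prime_X
      rw [two_mul] at huv
      have := (emultiplicity_lt_iff_not_dvd.mpr hh.1)
      have h2' := (emultiplicity_lt_iff_not_dvd.mpr hh.2)
      have h3 := le_emultiplicity_of_pow_dvd huv
      rw [emultiplicity_mul hp] at h3
      have h4 := ENat.add_lt_add this h2'
      push_cast at h3
      exact absurd h4 (not_lt.mpr h3)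
    rcases hor _ _ hord with h | h
    · exact hμ (newton_det_zero φ s α (d - 1) L G hG0 (by omega) h r hr)
    · exact hμ (newton_det_zero φ s α (d - 1) L H hH0 (by omega) h r hr)

theorem totalDegree_map_le' {A K : Type*} [CommRing A] [CommRing K] {σ : Type*} (ψ : A →+* K) (F : MvPolynomial σ A) :
    (map ψ F).totalDegree ≤ F.totalDegree :=
  sup_mono (support_map_subset ψ F)

theorem exists_newton_minor {A K : Type*} [CommRing A] [Field K] {m : ℕ} (ψ : A →+* K)
    (F : MP (m + 1) A) (α : MP m A) (d : ℕ) (hd1 : 1 ≤ d)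
    (hd : F.totalDegree ≤ d) (hc : ψ (coeff (single 0 d) F) ≠ 0)
    (hirr : Irreducible (map ψ F))
    (hα : aeval (Fin.cons α X : Fin (m + 1) → MP m A) F ∈
      (Ideal.span (Set.range X) : Ideal (MP m A)) ^ (2 * d ^ 2)) :
    ∃ r : mons 2 (d - 1) → ℕ, (∀ e, r e < d ^ 2) ∧
      (Matrix.of fun e e' : mons 2 (d - 1) => nEntry α (r e) e'.1).det ≠ 0 := by
  classical
  set φ : A →+* FractionRing (MP m K) :=
    ((algebraMap (MP m K) (FractionRing (MP m K))).comp C).comp ψ with hφ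
  set s : Fin m → FractionRing (MP m K) := fun i => algebraMap (MP m K) _ (X i)
  have hpsl : psl φ s F = psl ((algebraMap (MP m K) (FractionRing (MP m K))).comp C) s (map ψ F) := by
    have : psl φ s = (psl ((algebraMap (MP m K) (FractionRing (MP m K))).comp C) s).comp (map ψ) := by
      apply ringHom_ext
      · intro r; simp [psl, hφ]
      · intro i; simp [psl]
    rw [this]; rfl
  have hcm : coeff (single 0 d) (map ψ F) ≠ 0 := by rwa [coeff_map]
  have hdm : (map ψ F).totalDegree = d := by
    apply le_antisymm ((totalDegree_map_le' ψ F).trans hd)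
    have := le_totalDegree (mem_support_iff.mpr hcm)
    change (single (0 : Fin (m + 1)) d).degree ≤ _ at this
    rwa [degree_single] at this
  have hgen : Irreducible (psl φ s F) := by
    rw [hpsl]; exact generic_irred (map ψ F) d hirr hdm hcm
  have hord : PX ^ (2 * d ^ 2) ∣ gm (nPhi φ s α) 0 (psl φ s F) := by
    rw [gm_psl, ← Ideal.mem_span_singleton, ← Ideal.span_singleton_pow]
    have := Ideal.mem_map_of_mem (nPhi φ s) hα
    rw [Ideal.map_pow] at this
    refine Ideal.pow_right_mono ?_ _ this
    rw [Ideal.map_span, Ideal.span_le]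
    rintro _ ⟨_, ⟨i, rfl⟩, rfl⟩
    rw [SetLike.mem_coe, Ideal.mem_span_singleton]
    simp [nPhi]
  obtain ⟨h1, h2⟩ := psl_top φ s F d hd
  have hc' : coeff (single 0 d) (psl φ s F) ≠ 0 := by
    rw [h2, hφ]
    simp only [RingHom.comp_apply]
    rw [Ne, IsFractionRing.to_map_eq_zero_iff]
    simpa using hc
  obtain ⟨r, hr, hdet⟩ := exists_det_ne_zero (P := ℕ) (ι := mons 2 (d - 1))
    (fun i e => eval₂ φ s (nEntry α i e.1)) {i | i < d ^ 2} (by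
      intro c hcz
      by_contra hcne
      set G := polyOf (mons 2 (d - 1)) c with hG
      have hG0 : G ≠ 0 := polyOf_ne_zero _ _ hcne
      have hGd : G.totalDegree ≤ d - 1 := totalDegree_of_supp _ (support_polyOf _ _)
      have hGX : PX ^ (d ^ 2) ∣ gm (nPhi φ s α) 0 G := by
        rw [X_pow_dvd_iff]
        intro i hi
        refine Eq.trans ?_ (hcz i hi)
        rw [hG]
        simp only [polyOf, map_sum, finsetSum_coeff]
        refine sum_congr rfl fun e' _ => ?_
        have : (monomial e'.1 (c e') : MP 2 (FractionRing (MP m K))) = c e' • monomial e'.1 1 := by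
          rw [smul_monomial, smul_eq_mul, mul_one]
        rw [this, map_smul, Polynomial.coeff_smul, smul_eq_mul, nEntry_eval]
      have hnd : ¬ psl φ s F ∣ G := by
        refine not_dvd_of_supp _ G hc' hG0 ?_
        intro e he
        have h3 := le_totalDegree he
        change e.degree ≤ _ at h3
        have h4 : e 0 ≤ e.degree := le_degree 0 e
        omega
      have := bezout_jets (psl φ s F) G hgen hnd {()} (d ^ 2) (fun _ => nPhi φ s α) (fun _ => 0) (by simp)
        (fun _ _ => (pow_dvd_pow _ (by omega)).trans hord) (fun _ _ => hGX)
      simp only [card_singleton, mul_one] at this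
      have h5 := Nat.mul_le_mul h1 hGd
      have h6 : d * (d - 1) < d ^ 2 := by
        rw [pow_two]; exact Nat.mul_lt_mul_of_pos_left (by omega) (by omega)
      omega)
  refine ⟨r, hr, ?_⟩
  intro h0
  apply hdet
  have := congrArg (eval₂Hom φ s) h0
  rw [RingHom.map_det, map_zero] at this
  exact this

theorem sub_C_mem {m : ℕ} (P : MP m A) :
    P - C (constantCoeff P) ∈ (Ideal.span (Set.range X) : Ideal (MP m A)) := by
  induction P using induction_on with
  | C a => simp
  | add p q hp hq =>
    have := Ideal.add_mem _ hp hq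
    convert this using 1
    simp only [map_add]; ring
  | mul_X p i hp =>
    have : constantCoeff (p * X i) = 0 := by simp
    rw [this, C_0, sub_zero]
    exact Ideal.mul_mem_left _ _ (Ideal.subset_span ⟨i, rfl⟩)

theorem mem_of_constantCoeff {m : ℕ} (P : MP m A) (h : constantCoeff P = 0) :
    P ∈ (Ideal.span (Set.range X) : Ideal (MP m A)) := by
  have := sub_C_mem P
  rwa [h, C_0, sub_zero] at this

theorem constantCoeff_aeval {m : ℕ} (P : MP (m + 1) A) :
    constantCoeff (aeval (Fin.cons 0 X : Fin (m + 1) → MP m A) P) = constantCoeff P := by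
  have : (constantCoeff : MP m A →+* A).comp
      ((aeval (Fin.cons 0 X : Fin (m + 1) → MP m A) : MP (m+1) A →ₐ[A] _) : MP (m+1) A →+* _)
      = constantCoeff := by
    apply ringHom_ext
    · intro r; simp
    · intro i
      refine Fin.cases ?_ (fun i => ?_) i <;> simp
  exact congrArg (fun f => f P) this

/-- existence of the approximate root -/
theorem exists_newton_root {m : ℕ} (F : MP (m + 1) A)
    (h0 : coeff 0 F = 0) (h1 : coeff (single 0 1) F = 1) (Inv : MP m A → Prop) (hI0 : Inv 0)
    (hI1 : ∀ z, Inv z → Inv (z - aeval (Fin.cons z X : Fin (m + 1) → MP m A) F)) (K : ℕ) :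
    ∃ α : MP m A, Inv α ∧ aeval (Fin.cons α X : Fin (m + 1) → MP m A) F ∈
      (Ideal.span (Set.range X) : Ideal (MP m A)) ^ K := by
  obtain ⟨z, hz, -, h⟩ := hensel_germ_inv F (Ideal.span (Set.range X) : Ideal (MP m A)) 0 1 X
    (mem_of_constantCoeff _ (by rw [constantCoeff_aeval]; exact h0))
    (by
      apply mem_of_constantCoeff
      rw [one_mul, map_sub, constantCoeff_aeval, map_one, sub_eq_zero]
      rw [constantCoeff_eq, coeff_pderiv]
      simp [h1]) Inv hI0 (fun z hz => by
        rw [one_mul, ← sub_eq_add_neg]; exact hI1 z hz) K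
  exact ⟨z, hz, h⟩

/-- weighted `ℓ¹` norm -/
noncomputable def nrm {σ : Type*} (ρ : ℝ) (P : MvPolynomial σ ℤ) : ℝ := ∑ m ∈ P.support, |((coeff m P : ℤ) : ℝ)| * ρ ^ m.degree

theorem nrm_eq {σ : Type*} (ρ : ℝ) (P : MvPolynomial σ ℤ) (s : Finset (σ →₀ ℕ)) (hs : P.support ⊆ s) :
    nrm ρ P = ∑ m ∈ s, |((coeff m P : ℤ) : ℝ)| * ρ ^ m.degree := by
  refine sum_subset hs fun m _ hm => ?_
  rw [notMem_support_iff.mp hm]; simp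

theorem nrm_nonneg {σ : Type*} {ρ : ℝ} (hρ : 0 ≤ ρ) (P : MvPolynomial σ ℤ) : 0 ≤ nrm ρ P :=
  sum_nonneg fun m _ => by positivity

theorem nrm_zero {σ : Type*} (ρ : ℝ) : nrm ρ (0 : MvPolynomial σ ℤ) = 0 := by simp [nrm]

theorem nrm_add {σ : Type*} {ρ : ℝ} (hρ : 0 ≤ ρ) (P Q : MvPolynomial σ ℤ) : nrm ρ (P + Q) ≤ nrm ρ P + nrm ρ Q := by
  classical
  rw [nrm_eq ρ (P + Q) (P.support ∪ Q.support) support_add, nrm_eq ρ P _ subset_union_left,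
    nrm_eq ρ Q _ subset_union_right, ← sum_add_distrib]
  refine sum_le_sum fun m _ => ?_
  rw [← add_mul, coeff_add]
  push_cast
  exact mul_le_mul_of_nonneg_right (abs_add_le _ _) (by positivity)

theorem nrm_neg {σ : Type*} (ρ : ℝ) (P : MvPolynomial σ ℤ) : nrm ρ (-P) = nrm ρ P := by
  simp [nrm, support_neg]

theorem nrm_sum {σ ι : Type*} {ρ : ℝ} (hρ : 0 ≤ ρ) (s : Finset ι) (P : ι → MvPolynomial σ ℤ) :
    nrm ρ (∑ i ∈ s, P i) ≤ ∑ i ∈ s, nrm ρ (P i) := by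
  classical
  induction s using Finset.induction_on with
  | empty => simp [nrm_zero]
  | insert a s ha ih =>
    rw [sum_insert ha, sum_insert ha]
    exact (nrm_add hρ _ _).trans (by linarith)

theorem nrm_monomial {σ : Type*} (ρ : ℝ) (e : σ →₀ ℕ) (c : ℤ) : nrm ρ (monomial e c) = |(c : ℝ)| * ρ ^ e.degree := by
  classical
  rw [nrm_eq ρ _ {e} support_monomial_subset]
  simp

theorem nrm_monomial_mul {σ : Type*} {ρ : ℝ} (hρ : 0 ≤ ρ) (e : σ →₀ ℕ) (c : ℤ) (Q : MvPolynomial σ ℤ) :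
    nrm ρ (monomial e c * Q) ≤ |(c : ℝ)| * ρ ^ e.degree * nrm ρ Q := by
  have : monomial e c * Q = ∑ m ∈ Q.support, monomial (e + m) (c * coeff m Q) := by
    conv_lhs => rw [Q.as_sum, mul_sum]
    exact sum_congr rfl fun m _ => monomial_mul
  rw [this]
  refine (nrm_sum hρ _ _).trans (le_of_eq ?_)
  rw [nrm, mul_sum]
  refine sum_congr rfl fun m _ => ?_
  rw [nrm_monomial, map_add, pow_add]
  push_cast
  rw [abs_mul]; ring

theorem nrm_mul {σ : Type*} {ρ : ℝ} (hρ : 0 ≤ ρ) (P Q : MvPolynomial σ ℤ) : nrm ρ (P * Q) ≤ nrm ρ P * nrm ρ Q := by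
  conv_lhs => rw [P.as_sum, sum_mul]
  refine (nrm_sum hρ _ _).trans ?_
  rw [nrm, sum_mul]
  exact sum_le_sum fun m _ => nrm_monomial_mul hρ _ _ _

theorem nrm_C {σ : Type*} (ρ : ℝ) (c : ℤ) : nrm ρ (C c : MvPolynomial σ ℤ) = |(c : ℝ)| := by
  rw [C_apply, nrm_monomial]; simp

theorem nrm_X {σ : Type*} (ρ : ℝ) (i : σ) : nrm ρ (X i : MvPolynomial σ ℤ) = ρ := by
  rw [X, nrm_monomial]; simp

theorem nrm_one {σ : Type*} (ρ : ℝ) : nrm ρ (1 : MvPolynomial σ ℤ) = 1 := by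
  rw [← C_1, nrm_C]; simp

theorem nrm_pow {σ : Type*} {ρ : ℝ} (hρ : 0 ≤ ρ) (P : MvPolynomial σ ℤ) (n : ℕ) : nrm ρ (P ^ n) ≤ nrm ρ P ^ n := by
  induction n with
  | zero => simp [nrm_one]
  | succ n ih =>
    rw [pow_succ, pow_succ]
    exact (nrm_mul hρ _ _).trans (mul_le_mul_of_nonneg_right ih (nrm_nonneg hρ _))

theorem nrm_prod {σ ι : Type*} {ρ : ℝ} (hρ : 0 ≤ ρ) (s : Finset ι) (P : ι → MvPolynomial σ ℤ) :
    nrm ρ (∏ i ∈ s, P i) ≤ ∏ i ∈ s, nrm ρ (P i) := by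
  classical
  induction s using Finset.induction_on with
  | empty => simp [nrm_one]
  | insert a s ha ih =>
    rw [prod_insert ha, prod_insert ha]
    exact (nrm_mul hρ _ _).trans (mul_le_mul_of_nonneg_left ih (nrm_nonneg hρ _))

theorem coeff_le_nrm {σ : Type*} {ρ : ℝ} (hρ : 0 ≤ ρ) (P : MvPolynomial σ ℤ) (m : σ →₀ ℕ) :
    |((coeff m P : ℤ) : ℝ)| * ρ ^ m.degree ≤ nrm ρ P := by
  classical
  rw [nrm_eq ρ P (insert m P.support) (subset_insert _ _)]
  exact single_le_sum (f := fun m => |((coeff m P : ℤ) : ℝ)| * ρ ^ m.degree) (fun _ _ => by positivity) (mem_insert_self _ _)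

theorem nrm_aeval {σ : Type*} {n : ℕ} {ρ : ℝ} (hρ : 0 ≤ ρ) (G : MP n ℤ) (v : Fin n → MvPolynomial σ ℤ)
    (V : Fin n → ℝ) (hV : ∀ i, nrm ρ (v i) ≤ V i) :
    nrm ρ (aeval v G) ≤ ∑ e ∈ G.support, |((coeff e G : ℤ) : ℝ)| * ∏ i, V i ^ e i := by
  have : aeval v G = ∑ e ∈ G.support, C (coeff e G) * ∏ i, v i ^ e i := by
    conv_lhs => rw [G.as_sum, map_sum]
    refine sum_congr rfl fun e _ => ?_
    rw [aeval_monomial, prod_fintype _ _ (by simp)]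
    rfl
  rw [this]
  refine (nrm_sum hρ _ _).trans (sum_le_sum fun e _ => ?_)
  refine (nrm_mul hρ _ _).trans ?_
  rw [nrm_C]
  refine mul_le_mul_of_nonneg_left ((nrm_prod hρ _ _).trans ?_) (abs_nonneg _)
  refine prod_le_prod (fun i _ => nrm_nonneg hρ _) fun i _ => ?_
  exact (nrm_pow hρ _ _).trans (pow_le_pow_left₀ (nrm_nonneg hρ _) (hV i) _)

theorem newton_inv {m : ℕ} (F : MP (m + 1) ℤ) (h0 : coeff 0 F = 0) (h1 : coeff (single 0 1) F = 1)
    (M : ℝ) (hM : nrm 1 F ≤ M) (hM1 : 1 ≤ M) (z : MP m ℤ) (hz : nrm (1 / (4 * M ^ 2)) z ≤ 1 / (2 * M)) :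
    nrm (1 / (4 * M ^ 2)) (z - aeval (Fin.cons z X : Fin (m + 1) → MP m ℤ) F) ≤ 1 / (2 * M) := by
  classical
  set ρ : ℝ := 1 / (4 * M ^ 2) with hρ
  set r : ℝ := 1 / (2 * M) with hr
  have hM0 : 0 < M := by linarith
  have hρ0 : 0 ≤ ρ := by positivity
  have hr0 : 0 ≤ r := by positivity
  have hr1 : r ≤ 1 := by rw [hr, div_le_one (by positivity)]; linarith
  have hρr : ρ = r ^ 2 := by rw [hρ, hr]; field_simp; norm_num
  have hρ1 : ρ ≤ 1 := by rw [hρr]; exact pow_le_one₀ hr0 hr1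
  have e1 : z - aeval (Fin.cons z X : Fin (m + 1) → MP m ℤ) F =
      -aeval (Fin.cons z X : Fin (m + 1) → MP m ℤ) (F - X 0) := by
    rw [map_sub, aeval_X]; simp
  rw [e1, nrm_neg]
  refine (nrm_aeval hρ0 (F - X 0) _ (Fin.cons r (fun _ => ρ)) ?_).trans ?_
  · intro i
    refine Fin.cases ?_ (fun i => ?_) i
    · simpa using hz
    · simp [nrm_X]
  have hco : ∀ e ∈ (F - X 0).support, coeff e (F - X 0) = coeff e F ∧
      ∏ i, (Fin.cons r (fun _ => ρ) : Fin (m + 1) → ℝ) i ^ e i ≤ r ^ 2 := by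
    intro e he
    have hne : e ≠ single 0 1 := by
      rintro rfl
      rw [mem_support_iff, coeff_sub, h1] at he
      simp at he
    have hee : coeff e (F - X 0) = coeff e F := by
      rw [coeff_sub, coeff_X', if_neg (fun h => hne h.symm), sub_zero]
    refine ⟨hee, ?_⟩
    have hne0 : e ≠ 0 := by
      rintro rfl
      rw [mem_support_iff, hee, h0] at he
      simp at he
    rw [prod_univ_succ]
    simp only [cons_zero, cons_succ]
    rw [prod_pow_eq_pow_sum]
    by_cases hs : ∑ i : Fin m, e i.succ = 0
    · have h2 : 2 ≤ e 0 := by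
        have hz' : ∀ i : Fin m, e i.succ = 0 := fun i => by
          have := sum_eq_zero_iff.mp hs i (mem_univ _)
          exact this
        by_contra hlt
        have hlt : e 0 = 0 ∨ e 0 = 1 := by omega
        rcases hlt with h | h
        · apply hne0; ext i; refine Fin.cases ?_ (fun i => ?_) i
          · simpa using h
          · simpa using hz' i
        · apply hne; ext i; refine Fin.cases ?_ (fun i => ?_) i
          · simpa using h
          · simpa [single_apply, (succ_ne_zero _).symm] using hz' i
      rw [hs, pow_zero, mul_one]
      exact pow_le_pow_of_le_one hr0 hr1 h2
    · calc r ^ e 0 * ρ ^ (∑ i : Fin m, e i.succ) ≤ 1 * ρ ^ 1 := by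
            refine mul_le_mul (pow_le_one₀ hr0 hr1) (pow_le_pow_of_le_one hρ0 hρ1 (by omega)) (by positivity) (by norm_num)
        _ = r ^ 2 := by rw [hρr]; ring
  calc ∑ e ∈ (F - X 0).support, |((coeff e (F - X 0) : ℤ) : ℝ)| * ∏ i, (Fin.cons r (fun _ => ρ) : Fin (m + 1) → ℝ) i ^ e i
      ≤ ∑ e ∈ (F - X 0).support, |((coeff e F : ℤ) : ℝ)| * r ^ 2 := by
        refine sum_le_sum fun e he => ?_
        rw [(hco e he).1]
        exact mul_le_mul_of_nonneg_left (hco e he).2 (abs_nonneg _)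
    _ ≤ nrm 1 F * r ^ 2 := by
        rw [← sum_mul]
        refine mul_le_mul_of_nonneg_right ?_ (by positivity)
        rw [nrm_eq 1 F (F.support ∪ (F - X 0).support) subset_union_left]
        simp only [one_pow, mul_one]
        exact sum_le_sum_of_subset_of_nonneg subset_union_right (fun _ _ _ => abs_nonneg _)
    _ ≤ M * r ^ 2 := mul_le_mul_of_nonneg_right hM (by positivity)
    _ ≤ r := by
        have : M * r = 1 / 2 := by rw [hr]; field_simp
        nlinarith

theorem nrm_nEntry {m : ℕ} (α : MP m ℤ) (ρ : ℝ) (hρ : 0 < ρ) (hρ1 : ρ ≤ 1) (hα : nrm ρ α ≤ 1) (i L : ℕ) (hi : i ≤ L)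
    (e : Fin 2 →₀ ℕ) : nrm 1 (nEntry α i e) ≤ (1 / ρ) ^ L := by
  have h1ρ : 1 ≤ 1 / ρ := by rw [le_div_iff₀ hρ]; linarith
  unfold nEntry
  split_ifs with h
  · set j := i - e 1
    set Q := α ^ e 0
    have hQ : nrm ρ Q ≤ 1 := (nrm_pow hρ.le _ _).trans (pow_le_one₀ (nrm_nonneg hρ.le _) hα)
    have hsub : (homogeneousComponent j Q).support ⊆ Q.support := by
      intro m' hm
      rw [mem_support_iff, coeff_homogeneousComponent] at hm
      rw [mem_support_iff]
      intro h; rw [h] at hm; simp at hm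
    have : nrm 1 (homogeneousComponent j Q) ≤ (1 / ρ) ^ j * nrm ρ Q := by
      rw [nrm_eq 1 _ _ hsub, nrm, mul_sum]
      refine sum_le_sum fun m' _ => ?_
      rw [coeff_homogeneousComponent]
      split_ifs with h2
      · rw [h2, one_pow, mul_one]
        have : (1 / ρ) ^ j * ρ ^ j = 1 := by rw [← mul_pow, one_div, inv_mul_cancel₀ hρ.ne', one_pow]
        have h3 : (1 / ρ) ^ j * (|((coeff m' Q : ℤ) : ℝ)| * ρ ^ j) = |((coeff m' Q : ℤ) : ℝ)| := by
          rw [mul_left_comm, this, mul_one]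
        exact h3.ge
      · simp; positivity
    refine this.trans ?_
    calc (1 / ρ) ^ j * nrm ρ Q ≤ (1 / ρ) ^ j * 1 := mul_le_mul_of_nonneg_left hQ (by positivity)
      _ ≤ (1 / ρ) ^ L := by rw [mul_one]; exact pow_le_pow_right₀ h1ρ (by omega)
  · rw [nrm_zero]; positivity

theorem nrm_det {σ ι : Type*} [Fintype ι] [DecidableEq ι] (N : Matrix ι ι (MvPolynomial σ ℤ)) (B : ℝ) (hB : ∀ i j, nrm 1 (N i j) ≤ B) :
    nrm 1 N.det ≤ (Fintype.card ι).factorial * B ^ (Fintype.card ι) := by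
  rw [Matrix.det_apply']
  refine (nrm_sum zero_le_one _ _).trans ?_
  calc ∑ τ : Equiv.Perm ι, nrm 1 (((Equiv.Perm.sign τ : ℤ) : MvPolynomial σ ℤ) * ∏ i, N (τ i) i)
      ≤ ∑ τ : Equiv.Perm ι, B ^ (Fintype.card ι) := by
        refine sum_le_sum fun τ _ => ?_
        refine (nrm_mul zero_le_one _ _).trans ?_
        have : nrm 1 (((Equiv.Perm.sign τ : ℤ) : MvPolynomial σ ℤ)) = 1 := by
          have h := nrm_C (σ := σ) 1 (Equiv.Perm.sign τ : ℤ)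
          rw [show (C ((Equiv.Perm.sign τ : ℤ)) : MvPolynomial σ ℤ) = ((Equiv.Perm.sign τ : ℤ) : MvPolynomial σ ℤ) by simp] at h
          rw [h]
          rcases Int.units_eq_one_or (Equiv.Perm.sign τ) with h | h <;> simp [h]
        rw [this, one_mul]
        refine (nrm_prod zero_le_one _ _).trans ?_
        refine (prod_le_prod (fun i _ => nrm_nonneg zero_le_one _) (fun i _ => hB _ _)).trans ?_
        simp
    _ = _ := by simp [Fintype.card_perm]

theorem totalDegree_det_le {A σ ι : Type*} [CommRing A] [Fintype ι] [DecidableEq ι] (N : Matrix ι ι (MvPolynomial σ A)) (B : ℕ)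
    (hB : ∀ i j, (N i j).totalDegree ≤ B) : N.det.totalDegree ≤ Fintype.card ι * B := by
  rw [Matrix.det_apply']
  refine (totalDegree_finset_sum _ _).trans (Finset.sup_le fun τ _ => ?_)
  refine (totalDegree_mul _ _).trans ?_
  have h0 : (((Equiv.Perm.sign τ : ℤ) : MvPolynomial σ A)).totalDegree = 0 := by
    rw [← map_intCast (C : A →+* MvPolynomial σ A), totalDegree_C]
  rw [h0, zero_add]
  refine (totalDegree_finset_prod _ _).trans ((sum_le_sum fun i _ => hB _ _).trans ?_)
  simp

theorem totalDegree_nEntry {m : ℕ} (α : MP m A) (i : ℕ) (e : Fin 2 →₀ ℕ) :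
    (nEntry α i e).totalDegree ≤ i := by
  unfold nEntry
  split_ifs
  · refine Finset.sup_le fun m' hm => ?_
    rw [mem_support_iff, coeff_homogeneousComponent] at hm
    have : m'.degree = i - e 1 := by by_contra h; rw [if_neg h] at hm; exact hm rfl
    change m'.degree ≤ i
    omega
  · simp

theorem card_mons_le (d : ℕ) (hd1 : 1 ≤ d) : Fintype.card (mons 2 (d - 1)) ≤ d ^ 2 := by
  rw [Fintype.card_coe, card_mons, Nat.choose_two_right]
  apply Nat.div_le_of_le_mul
  obtain ⟨e, rfl⟩ : ∃ e, d = e + 1 := ⟨d - 1, by omega⟩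
  simp only [Nat.add_sub_cancel]
  rw [show e + 2 - 1 = e + 1 by omega]
  nlinarith

/-- effective Bertini over a general ring (no heights) -/
theorem bertini_field {A : Type} [CommRing A] {K : Type} [Field K] {m : ℕ} (ψ : A →+* K) (F : MP (m + 1) A)
    (d : ℕ) (hd1 : 1 ≤ d) (hd : F.totalDegree ≤ d) (h0 : coeff 0 F = 0) (h1 : coeff (single 0 1) F = 1)
    (hc : ψ (coeff (single 0 d) F) ≠ 0) (hirr : Irreducible (map ψ F)) :
    ∃ μ : MP m A, μ ≠ 0 ∧ μ.totalDegree ≤ d ^ 4 ∧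
      ∀ (k : Type) [Field k] (φ : A →+* k) (s : Fin m → k), φ (coeff (single 0 d) F) ≠ 0 → eval₂ φ s μ ≠ 0 →
        Irreducible (psl φ s F) ∧ (psl φ s F).totalDegree = d ∧ coeff (single 0 d) (psl φ s F) ≠ 0 := by
  obtain ⟨α, -, hα⟩ := exists_newton_root F h0 h1 (fun _ => True) trivial (fun _ _ => trivial) (2 * d ^ 2)
  obtain ⟨r, hr, hdet⟩ := exists_newton_minor ψ F α d hd1 hd hc hirr hα
  refine ⟨_, hdet, ?_, fun k _ φ s hφ hμ => irred_of_newton φ s F α d hd1 hd hφ (d ^ 2) hα r hr hμ⟩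
  refine (totalDegree_det_le _ (d ^ 2) fun i j => (totalDegree_nEntry _ _ _).trans (hr i).le).trans ?_
  calc _ ≤ d ^ 2 * d ^ 2 := Nat.mul_le_mul_right _ (card_mons_le d hd1)
    _ = d ^ 4 := by ring

theorem bertini_int {m : ℕ} (F : MP (m + 1) ℤ)
    (d : ℕ) (hd1 : 1 ≤ d) (hd : F.totalDegree ≤ d) (h0 : coeff 0 F = 0) (h1 : coeff (single 0 1) F = 1)
    (hc : coeff (single 0 d) F ≠ 0) (hirr : Irreducible (map toℚ F)) (M : ℝ) (hM : nrm 1 F ≤ M) (hM1 : 1 ≤ M) :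
    ∃ μ : MP m ℤ, μ ≠ 0 ∧ μ.totalDegree ≤ d ^ 4 ∧ nrm 1 μ ≤ (d ^ 2).factorial * (4 * M ^ 2) ^ (d ^ 4) ∧
      ∀ (k : Type) [Field k] (φ : ℤ →+* k) (s : Fin m → k), φ (coeff (single 0 d) F) ≠ 0 → eval₂ φ s μ ≠ 0 →
        Irreducible (psl φ s F) ∧ (psl φ s F).totalDegree = d ∧ coeff (single 0 d) (psl φ s F) ≠ 0 := by
  obtain ⟨α, hαn, hα⟩ := exists_newton_root F h0 h1 (fun z => nrm (1 / (4 * M ^ 2)) z ≤ 1 / (2 * M))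
    (by rw [nrm_zero]; positivity) (fun z hz => newton_inv F h0 h1 M hM hM1 z hz) (2 * d ^ 2)
  obtain ⟨r, hr, hdet⟩ := exists_newton_minor toℚ F α d hd1 hd (by simpa using hc) hirr hα
  have hcard := card_mons_le d hd1
  have hM4 : 1 ≤ 4 * M ^ 2 := by nlinarith
  refine ⟨_, hdet, ?_, ?_, fun k _ φ s hφ hμ => irred_of_newton φ s F α d hd1 hd hφ (d ^ 2) hα r hr hμ⟩
  · refine (totalDegree_det_le _ (d ^ 2) fun i j => (totalDegree_nEntry _ _ _).trans (hr i).le).trans ?_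
    calc _ ≤ d ^ 2 * d ^ 2 := Nat.mul_le_mul_right _ hcard
      _ = d ^ 4 := by ring
  · refine (nrm_det _ ((4 * M ^ 2) ^ (d ^ 2)) fun i j => ?_).trans ?_
    · have := nrm_nEntry α (1 / (4 * M ^ 2)) (by positivity) (by rw [div_le_one (by positivity)]; exact hM4)
        (hαn.trans (by rw [div_le_one (by positivity)]; linarith)) (r i) (d ^ 2) (hr i).le j.1
      rwa [one_div_one_div] at this
    · refine mul_le_mul (by exact_mod_cast Nat.factorial_le hcard) ?_ (by positivity) (by positivity)
      rw [← pow_mul]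
      refine pow_le_pow_right₀ hM4 ?_
      calc _ ≤ d ^ 2 * d ^ 2 := Nat.mul_le_mul_left _ hcard
        _ = d ^ 4 := by ring

theorem sz_card {R : Type*} [CommRing R] [IsDomain R] [DecidableEq R] {n : ℕ} (p : MP n R) (hp : p ≠ 0) (S : Finset R) :
    #{f ∈ Fintype.piFinset fun _ : Fin n => S | eval f p = 0} * #S ≤ p.totalDegree * #S ^ n := by
  rcases S.eq_empty_or_nonempty with rfl | hS
  · simp
  have h := schwartz_zippel_totalDegree hp S
  have hS0 : (0 : ℚ≥0) < #S := by exact_mod_cast hS.card_pos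
  rw [div_le_div_iff₀ (by positivity) hS0] at h
  exact_mod_cast h

theorem irreducible_aeval_iff {K : Type*} [Field K] {n : ℕ} (v w : Fin n → MP n K)
    (h1 : ∀ i, aeval v (w i) = X i) (h2 : ∀ i, aeval w (v i) = X i) (f : MP n K) :
    Irreducible (aeval v f) ↔ Irreducible f := by
  have e1 : (aeval v).comp (aeval w) = AlgHom.id K (MP n K) := by
    apply algHom_ext; intro i; rw [AlgHom.comp_apply, aeval_X, h1]; rfl
  have e2 : (aeval w).comp (aeval v) = AlgHom.id K (MP n K) := by
    apply algHom_ext; intro i; rw [AlgHom.comp_apply, aeval_X, h2]; rfl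
  exact MulEquiv.irreducible_iff (AlgEquiv.ofAlgHom (aeval v) (aeval w) e1 e2) (x := f)

theorem aeval_congr_dvd {A S : Type*} [CommRing A] [CommRing S] [Algebra A S] {n : ℕ} (f : MP n A) (q : S) (P Q : Fin n → S)
    (h : ∀ i, q ∣ P i - Q i) : q ∣ aeval P f - aeval Q f := by
  have := eval_congr_dvd (map (algebraMap A S) f) q P Q h
  simpa [eval_map, aeval_def] using this

theorem aeval_C_pt {σ : Type*} {n : ℕ} (f : MP n A) (P : Fin n → A) :
    aeval (fun i => (C (P i) : MvPolynomial σ A)) f = C (eval P f) := by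
  have := aeval_algebraMap_apply (MvPolynomial σ A) P f
  simpa [algebraMap_eq, Function.comp_def, aeval_eq_eval] using this

/-- coefficient of X0^d in an affine substitution -/
theorem coeff_affine_top {m : ℕ} {A : Type*} [CommRing A] (f : MP (m + 1) A) (d : ℕ) (hd : f.totalDegree ≤ d)
    (P t : Fin (m + 1) → A) :
    coeff (single 0 d) (aeval (fun i => C (P i) + C (t i) * X i : Fin (m + 1) → MP (m + 1) A) f)
      = t 0 ^ d * coeff (single 0 d) f := by
  classical
  -- specialize other variables to zero
  let R : MP (m + 1) A →ₐ[A] Polynomial A := aeval (Fin.cons PX (fun _ => 0) : Fin (m + 1) → Polynomial A)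
  have hR : ∀ G : MP (m + 1) A, (R G).coeff d = coeff (single 0 d) G := by
    intro G
    induction G using MvPolynomial.induction_on' with
    | add p q hp hq => simp [hp, hq]
    | monomial e a =>
      simp only [R, aeval_monomial]
      rw [prod_fintype _ _ (by simp), prod_univ_succ]
      simp only [cons_zero, cons_succ]
      rw [coeff_monomial, Polynomial.algebraMap_eq, Polynomial.coeff_C_mul]
      split_ifs with h
      · rw [h]; simp [single_apply, succ_ne_zero, (succ_ne_zero _).symm]
      · by_cases hz : ∀ i : Fin m, e i.succ = 0
        · have h0 : e 0 ≠ d := by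
            intro h0; apply h; ext i
            refine Fin.cases ?_ (fun i => ?_) i
            · simp [h0]
            · simp [hz i, single_apply, (succ_ne_zero _).symm]
          simp [hz, Polynomial.coeff_X_pow, h0.symm]
        · push Not at hz
          obtain ⟨i, hi⟩ := hz
          rw [prod_eq_zero (mem_univ i) (zero_pow hi)]
          simp
  rw [← hR]
  have hcomp : R (aeval (fun i => C (P i) + C (t i) * X i : Fin (m + 1) → MP (m + 1) A) f) =
      aeval (Fin.cons (CX (P 0) + CX (t 0) * PX) (fun i => CX (P i.succ)) : Fin (m + 1) → Polynomial A) f := by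
    rw [← AlgHom.comp_apply, comp_aeval]
    congr 1
    congr 1
    funext i
    refine Fin.cases ?_ (fun i => ?_) i
    · simp [R, ← algebraMap_eq, Polynomial.algebraMap_eq]
    · simp [R, ← algebraMap_eq, Polynomial.algebraMap_eq]
  rw [hcomp]
  conv_lhs => rw [f.as_sum, map_sum, finsetSum_coeff]
  have hterm : ∀ e ∈ f.support, (aeval (Fin.cons (CX (P 0) + CX (t 0) * PX) (fun i => CX (P i.succ)) : Fin (m + 1) → Polynomial A) (monomial e (coeff e f))).coeff d
      = if e = single 0 d then t 0 ^ d * coeff e f else 0 := by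
    intro e he
    rw [aeval_monomial, prod_fintype _ _ (by simp), prod_univ_succ]
    simp only [cons_zero, cons_succ, ← map_pow, ← map_prod, Polynomial.algebraMap_eq]
    rw [Polynomial.coeff_C_mul, Polynomial.coeff_mul_C]
    have hdeg : e.degree ≤ d := (le_totalDegree he).trans hd
    have hlin : (CX (P 0) + CX (t 0) * PX : Polynomial A).natDegree ≤ 1 := by
      rw [add_comm]; exact Polynomial.natDegree_linear_le
    have hpow : ((CX (P 0) + CX (t 0) * PX : Polynomial A) ^ (e 0)).natDegree ≤ e 0 :=
      Polynomial.natDegree_pow_le_of_le _ hlin |>.trans (by simp)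
    have h0le : e 0 ≤ e.degree := le_degree 0 e
    split_ifs with h
    · have he0 : e 0 = d := by rw [h]; simp
      have hs : ∀ i : Fin m, e i.succ = 0 := by intro i; rw [h]; simp [single_apply, (succ_ne_zero _).symm]
      rw [he0]
      have := Polynomial.coeff_pow_of_natDegree_le (m := d) hlin
      rw [mul_one] at this
      rw [this]
      simp only [hs, pow_zero, prod_const_one, mul_one]
      rw [mul_comm]; simp
    · have : e 0 < d := by
        by_contra hlt
        have he0 : e 0 = d := by omega
        apply h
        rw [degree_eq_sum, sum_univ_succ] at hdeg
        have hz : ∑ i : Fin m, e i.succ = 0 := by omega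
        rw [sum_eq_zero_iff] at hz
        ext i
        refine Fin.cases ?_ (fun i => ?_) i
        · simp [he0]
        · simp [hz i (mem_univ _), single_apply, (succ_ne_zero _).symm]
      rw [Polynomial.coeff_eq_zero_of_natDegree_lt (hpow.trans_lt this)]
      simp
  rw [sum_congr rfl hterm, sum_ite_eq' f.support]
  split_ifs with h
  · rfl
  · rw [notMem_support_iff.mp h, mul_zero]

theorem totalDegree_affine_le {m : ℕ} {A : Type*} [CommRing A] (f : MP m A) {τ : Type*} (v : Fin m → MvPolynomial τ A)
    (hv : ∀ i, (v i).totalDegree ≤ 1) : (aeval v f).totalDegree ≤ f.totalDegree := by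
  conv_lhs => rw [f.as_sum, map_sum]
  refine (totalDegree_finset_sum _ _).trans (Finset.sup_le fun e he => ?_)
  rw [aeval_monomial, prod_fintype _ _ (by simp)]
  refine (totalDegree_mul _ _).trans ?_
  rw [algebraMap_eq, totalDegree_C, zero_add]
  refine (totalDegree_finset_prod _ _).trans ?_
  calc _ ≤ ∑ i, e i := sum_le_sum fun i _ => (totalDegree_pow _ _).trans (by nlinarith [hv i])
    _ = e.degree := (degree_eq_sum e).symm
    _ ≤ _ := le_totalDegree he

/-- recentring at a smooth point -/
theorem recenter {A K : Type*} [CommRing A] [IsDomain A] [Field K] (ψ : A →+* K) (hψ : Injective ψ) {m : ℕ} (f : MP (m + 1) A) (d : ℕ) (hd : f.totalDegree ≤ d) (P : Fin (m + 1) → A) (hP : eval P f = 0)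
    (u : A) (hu : eval P (pderiv 0 f) = u) (hu0 : u ≠ 0) (hc : coeff (single 0 d) f ≠ 0) (hirr : Irreducible (map ψ f)) :
    ∃ F : MP (m + 1) A,
      C (u ^ 2) * F = aeval (fun i => C (P i) + C ((Fin.cons u (fun _ => u ^ 2) : Fin (m + 1) → A) i) * X i : Fin (m + 1) → MP (m + 1) A) f ∧
      F.totalDegree ≤ d ∧ coeff 0 F = 0 ∧ coeff (single 0 1) F = 1 ∧ coeff (single 0 d) F ≠ 0 ∧
      Irreducible (map ψ F) := by
  set t : Fin (m + 1) → A := Fin.cons u (fun _ => u ^ 2) with ht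
  set v : Fin (m + 1) → MP (m + 1) A := fun i => C (P i) + C (t i) * X i with hv
  have ht0 : ∀ i, t i ≠ 0 := fun i => Fin.cases (by simpa [ht] using hu0) (fun i => by simpa [ht] using hu0) i
  have hvd : ∀ i, (v i).totalDegree ≤ 1 := by
    intro i
    refine (totalDegree_add _ _).trans (max_le (by rw [totalDegree_C]; exact Nat.zero_le _) ((totalDegree_mul _ _).trans ?_))
    rw [totalDegree_C, totalDegree_X]
  have hvcons : v = Fin.cons (C (P 0) + C u * X 0) (fun i : Fin m => v i.succ) := by
    funext i; refine Fin.cases ?_ (fun i => ?_) i <;> simp [hv, ht]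
  have hbase : ∀ g : MP (m + 1) A, (C (u ^ 2) : MP (m + 1) A) ∣
      aeval (Fin.cons (C (P 0)) (fun i : Fin m => v i.succ) : Fin (m + 1) → MP (m + 1) A) g - C (eval P g) := by
    intro g
    rw [← aeval_C_pt g P]
    refine aeval_congr_dvd g _ _ _ (fun i => ?_)
    refine Fin.cases ?_ (fun i => ?_) i
    · simp
    · simp [hv, ht]
  have hdvd : (C (u ^ 2) : MP (m + 1) A) ∣ aeval v f := by
    obtain ⟨k, hk⟩ := taylor_zero f (C (P 0)) (C u * X 0) (fun i : Fin m => v i.succ)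
    rw [hvcons, hk]
    obtain ⟨a, ha⟩ := hbase f
    obtain ⟨b, hb⟩ := hbase (pderiv 0 f)
    rw [hP, C_0, sub_zero] at ha
    rw [hu, sub_eq_iff_eq_add] at hb
    rw [ha, hb]
    refine ⟨a + b * (C u * X 0) + X 0 + k * X 0 ^ 2, ?_⟩
    rw [map_pow]; ring
  obtain ⟨F, hF⟩ := hdvd
  have hu2 : u ^ 2 ≠ 0 := pow_ne_zero _ hu0
  have hco : ∀ e, u ^ 2 * coeff e F = coeff e (aeval v f) := fun e => by rw [hF, coeff_C_mul]
  have hcc : ∀ g : MP (m + 1) A, coeff 0 (aeval v g) = eval P g := by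
    intro g
    change constantCoeff (aeval v g) = eval P g
    induction g using induction_on with
    | C a => simp
    | add p q hp hq => simp only [map_add, hp, hq]
    | mul_X p i hp => 
      have : constantCoeff (v i) = P i := by simp only [hv, map_add, map_mul, constantCoeff_C, constantCoeff_X, mul_zero, add_zero]
      rw [map_mul, map_mul, aeval_X, hp, this, map_mul, eval_X]
  refine ⟨F, hF.symm, ?_, ?_, ?_, ?_, ?_⟩
  · have h1 := totalDegree_affine_le f v hvd
    refine Finset.sup_le fun e he => ?_
    have : e ∈ (aeval v f).support := by
      rw [mem_support_iff, ← hco]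
      exact mul_ne_zero hu2 (mem_support_iff.mp he)
    exact (le_totalDegree this).trans (h1.trans hd)
  · have := hco 0
    rw [hcc, hP] at this
    exact (mul_eq_zero.mp this).resolve_left hu2
  · have h1 := hco (single 0 1)
    have h2 : coeff (single 0 1) (aeval v f) = coeff 0 (pderiv 0 (aeval v f)) := by
      rw [coeff_pderiv]; simp
    have h3 : pderiv 0 (aeval v f) = aeval v (pderiv 0 f) * C u := by
      clear h2 h1 hco hF hc hirr hP hu hd
      induction f using induction_on with
      | C a => simp
      | add p q hp hq => simp only [map_add, hp, hq]; ring
      | mul_X p i hp =>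
        rw [map_mul, Derivation.leibniz, Derivation.leibniz, map_add]
        simp only [smul_eq_mul, map_mul, hp, aeval_X, pderiv_X]
        have : pderiv 0 (v i) = aeval v (Pi.single (M := fun _ => MP (m + 1) A) 0 1 i) * C u := by
          refine Fin.cases ?_ (fun i => ?_) i
          · simp [hv, ht, pderiv_X]
          · simp [hv, ht, pderiv_X, Pi.single_apply]
        rw [this]; ring
    rw [h2, h3, mul_comm (aeval v _), coeff_C_mul, hcc, hu] at h1
    have : u ^ 2 * coeff (single 0 1) F = u ^ 2 * 1 := by rw [h1]; ring
    exact mul_left_cancel₀ hu2 this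
  · intro h
    have h1 := hco (single 0 d)
    rw [h, mul_zero, coeff_affine_top f d hd] at h1
    exact mul_ne_zero (pow_ne_zero _ (ht0 0)) hc h1.symm
  · have hmap : C ((ψ u) ^ 2) * map ψ F = aeval (fun i => C (ψ (P i)) + C (ψ (t i)) * X i : Fin (m + 1) → MP (m + 1) K) (map ψ f) := by
      have h := congrArg (map ψ) hF
      rw [map_mul, map_C] at h
      rw [map_pow ψ] at h
      rw [← h]
      clear h hco hF hc hirr hP hu hd
      induction f using induction_on with
      | C a => simp
      | add p q hp hq => simp only [map_add, hp, hq]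
      | mul_X p i hp =>
        have : map ψ (v i) = C (ψ (P i)) + C (ψ (t i)) * X i := by
          change map ψ (C (P i) + C (t i) * X i) = _
          rw [map_add, map_mul, map_C, map_C, map_X]
        rw [map_mul, map_mul, hp, aeval_X, this, map_mul, map_mul, map_X, aeval_X]
    have hun : IsUnit (C ((ψ u) ^ 2) : MP (m + 1) K) := by
      apply IsUnit.map; rw [isUnit_iff_ne_zero]; rw [← map_pow]; exact (map_ne_zero_iff ψ hψ).mpr hu2
    rw [← irreducible_isUnit_mul hun, hmap]
    rw [irreducible_aeval_iff _ (fun i => C ((ψ (t i))⁻¹) * (X i - C (ψ (P i))))]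
    · exact hirr
    · intro i
      have : (ψ (t i)) ≠ 0 := (map_ne_zero_iff ψ hψ).mpr (ht0 i)
      simp only [map_mul, map_sub, aeval_X, aeval_C, algebraMap_eq, add_sub_cancel_left]
      rw [← mul_assoc, ← C_mul, inv_mul_cancel₀ this, C_1, one_mul]
    · intro i
      have : (ψ (t i)) ≠ 0 := (map_ne_zero_iff ψ hψ).mpr (ht0 i)
      simp only [map_add, map_mul, aeval_X, aeval_C, algebraMap_eq]
      rw [← mul_assoc, ← C_mul, mul_inv_cancel₀ this, C_1, one_mul]
      ring

/-- zeros in affine space over a finite field -/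
noncomputable def zset {k : Type*} [Field k] [Fintype k] {n : ℕ} (G : MP n k) : Finset (Fin n → k) := by
  classical exact univ.filter fun x => eval x G = 0

theorem mem_zset {k : Type*} [Field k] [Fintype k] {n : ℕ} (G : MP n k) (x : Fin n → k) : x ∈ zset G ↔ eval x G = 0 := by
  simp [zset]

theorem card_zset_le {k : Type*} [Field k] [Fintype k] {n : ℕ} (G : MP n k) (hG : G ≠ 0) (d : ℕ) (hd : G.totalDegree ≤ d) :
    (zset G).card * Fintype.card k ≤ d * Fintype.card k ^ n := by
  classical
  have := sz_card G hG univ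
  rw [Fintype.piFinset_univ] at this
  refine le_trans (le_of_eq ?_) (this.trans (Nat.mul_le_mul_right _ hd))
  simp [zset]

theorem eval_psl {A k : Type*} [CommRing A] [Field k] {m : ℕ} (φ : A →+* k) (s : Fin m → k) (F : MP (m + 1) A) (x : Fin 2 → k) :
    eval x (psl φ s F) = eval (Fin.cons (x 0) (fun i => s i * x 1) : Fin (m + 1) → k) (map φ F) := by
  induction F using induction_on with
  | C a => simp [psl]
  | add p q hp hq => simp only [map_add, hp, hq]
  | mul_X p i hp =>
    rw [map_mul, map_mul, hp, map_mul, map_mul]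
    congr 1
    refine Fin.cases ?_ (fun i => ?_) i <;> simp [psl]

theorem lw_count {p : ℕ} [Fact p.Prime] (F : MP 3 ℤ) (d : ℕ) (hd1 : 1 ≤ d) (hd : F.totalDegree ≤ d)
    (hc : ((coeff (single 0 d) F : ℤ) : ZMod p) ≠ 0)
    (μ : MP 2 ℤ) (hμd : μ.totalDegree ≤ d ^ 4) (e : Fin 2 →₀ ℕ) (hμ0 : ((coeff e μ : ℤ) : ZMod p) ≠ 0)
    (hμ : ∀ (s : Fin 2 → ZMod p), eval₂ (Int.castRingHom (ZMod p)) s μ ≠ 0 →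
        Irreducible (psl (Int.castRingHom (ZMod p)) s F) ∧ (psl (Int.castRingHom (ZMod p)) s F).totalDegree = d ∧
          coeff (single 0 d) (psl (Int.castRingHom (ZMod p)) s F) ≠ 0)
    (hp : 10 ^ 5 * d ^ 5 ≤ p) :
    100 * (zset (map (Int.castRingHom (ZMod p)) F)).card ≤ 104 * p ^ 2 := by
  classical
  set φ := Int.castRingHom (ZMod p)
  set Z := zset (map φ F)
  have hp1 : 10 ^ 5 ≤ p := by
    have := Nat.one_le_pow 5 d hd1
    omega
  set A := Z.filter fun x => ¬ (x 1 = 0 ∧ x 2 = 0)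
  have hW : (Z.filter fun x => (x 1 = 0 ∧ x 2 = 0)).card ≤ p := by
    refine le_trans ?_ ((card_univ (α := ZMod p)).trans (ZMod.card p)).le
    refine card_le_card_of_injOn (fun x => x 0) (fun _ _ => mem_univ _) ?_
    intro x hx y hy h
    simp only [coe_filter, Set.mem_setOf_eq] at hx hy
    funext i; fin_cases i
    · exact h
    · exact hx.2.1.trans hy.2.1.symm
    · exact hx.2.2.trans hy.2.2.symm
  have hsplit : Z.card = (Z.filter fun x => (x 1 = 0 ∧ x 2 = 0)).card + A.card := by
    rw [card_filter_add_card_filter_not]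
  -- bad directions
  set bad : Finset (Fin 2 → ZMod p) := zset (map φ μ)
  have hbad : bad.card * p ≤ d ^ 4 * p ^ 2 := by
    have := card_zset_le (map φ μ) (fun h => hμ0 (by have := congrArg (coeff e) h; simpa [coeff_map, φ] using this)) (d ^ 4)
      ((totalDegree_map_le' _ _).trans hμd)
    rwa [ZMod.card] at this
  -- fibre sizes
  have hgood : ∀ s ∉ bad, 100 * (zset (psl φ s F)).card ≤ 103 * p := by
    intro s hs
    have hs' : eval₂ φ s μ ≠ 0 := by rwa [mem_zset, eval_map] at hs
    obtain ⟨h1, h2, h3⟩ := hμ s hs'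
    refine stepanov _ d h1 h2 hd1 h3 (le_trans ?_ hp) _ (fun z hz => (mem_zset _ _).mp hz)
    exact Nat.mul_le_mul_left _ (Nat.pow_le_pow_right hd1 (by norm_num))
  have hall : ∀ s, (zset (psl φ s F)).card ≤ d * p := by
    intro s
    obtain ⟨h1, h2⟩ := psl_top φ s F d hd
    have hne : psl φ s F ≠ 0 := fun h => hc (by rw [h] at h2; simpa [φ] using h2.symm)
    have := card_zset_le _ hne d h1
    rw [ZMod.card, sq, ← mul_assoc] at this
    exact Nat.le_of_mul_le_mul_right this (by omega)
  have hinj : A.card * (p - 1) ≤ ∑ s : Fin 2 → ZMod p, (zset (psl φ s F)).card := by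
    rw [← card_sigma]
    have hu : (univ.filter fun y : ZMod p => y ≠ 0).card = p - 1 := by
      rw [filter_ne', card_erase_of_mem (mem_univ _), card_univ, ZMod.card]
    rw [← hu, ← card_product]
    refine card_le_card_of_injOn (fun q => ⟨![q.1 1 / q.2, q.1 2 / q.2], ![q.1 0, q.2]⟩) ?_ ?_
    · intro q hq
      simp only [coe_product, Set.mem_prod, mem_coe, A, mem_filter, Z, mem_zset] at hq
      have hq2 : q.2 ≠ 0 := hq.2.2
      simp only [coe_sigma, Set.mem_sigma_iff, mem_coe, mem_univ, true_and, mem_zset, eval_psl]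
      refine Eq.trans ?_ hq.1.1
      congr 2
      funext i; fin_cases i
      · simp
      · exact div_mul_cancel₀ _ hq2
      · exact div_mul_cancel₀ _ hq2
    · intro q hq q' hq' h
      simp only [coe_product, Set.mem_prod, mem_coe, A, mem_filter, Z, mem_zset] at hq hq'
      have hq2 : q.2 ≠ 0 := hq.2.2
      have hq2' : q'.2 ≠ 0 := hq'.2.2
      simp only [Sigma.mk.injEq, heq_eq_eq] at h
      have a1 := congrFun h.1 0
      have a2 := congrFun h.1 1
      have a3 := congrFun h.2 0
      have a4 := congrFun h.2 1
      simp at a1 a2 a3 a4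
      rw [a4] at a1 a2
      have b1 : q.1 1 = q'.1 1 := by simpa [div_left_inj' hq2'] using a1
      have b2 : q.1 2 = q'.1 2 := by simpa [div_left_inj' hq2'] using a2
      refine Prod.ext ?_ a4
      funext i; fin_cases i
      · exact a3
      · exact b1
      · exact b2
  have hsum : 100 * ∑ s : Fin 2 → ZMod p, (zset (psl φ s F)).card ≤ p ^ 2 * (103 * p) + bad.card * (100 * (d * p)) := by
    rw [mul_sum]
    calc ∑ s : Fin 2 → ZMod p, 100 * (zset (psl φ s F)).card
        ≤ ∑ s : Fin 2 → ZMod p, (103 * p + if s ∈ bad then 100 * (d * p) else 0) := by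
          refine sum_le_sum fun s _ => ?_
          split_ifs with h
          · have := hall s; omega
          · simpa using hgood s h
      _ = _ := by
          rw [sum_add_distrib, ← sum_filter]
          simp [ZMod.card]
  obtain ⟨q, hq⟩ : ∃ q, p = q + 1 := ⟨p - 1, by omega⟩
  have hbad' : bad.card ≤ d ^ 4 * p := by
    rw [sq, ← mul_assoc] at hbad
    exact Nat.le_of_mul_le_mul_right hbad (by omega)
  have h1 : 100 * (A.card * (p - 1)) ≤ p ^ 2 * (103 * p) + d ^ 4 * p * (100 * (d * p)) :=
    (Nat.mul_le_mul_left _ hinj).trans (hsum.trans (by gcongr))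
  have h2 : d ^ 4 * p * (100 * (d * p)) * 1000 ≤ p * p ^ 2 := by
    calc d ^ 4 * p * (100 * (d * p)) * 1000 = (10 ^ 5 * d ^ 5) * p ^ 2 := by ring
      _ ≤ p * p ^ 2 := Nat.mul_le_mul_right _ hp
  have h3 : 100000 * (A.card * q) ≤ 103001 * p ^ 3 := by
    rw [show p - 1 = q by omega] at h1
    nlinarith
  -- q = p-1
  have h4 : p * 99999 ≤ q * 100000 := by norm_num at hp1; linarith
  have h5 : 100000 * A.card * 99999 ≤ 103001 * p ^ 2 * 100000 := by
    have : (100000 * A.card * 99999) * p ≤ (103001 * p ^ 2 * 100000) * p := by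
      calc (100000 * A.card * 99999) * p = 100000 * A.card * (p * 99999) := by ring
        _ ≤ 100000 * A.card * (q * 100000) := Nat.mul_le_mul_left _ h4
        _ = 100000 * (100000 * (A.card * q)) := by ring
        _ ≤ 100000 * (103001 * p ^ 3) := Nat.mul_le_mul_left _ h3
        _ = _ := by ring
    exact Nat.le_of_mul_le_mul_right this (by omega)
  have h6 : 10 ^ 5 * p ≤ p ^ 2 := by rw [sq]; exact Nat.mul_le_mul_right _ hp1
  rw [hsplit]
  omega

theorem nrm_eval_le {n : ℕ} (G : MP n ℤ) (d : ℕ) (hd : G.totalDegree ≤ d) (P : Fin n → ℤ) (V : ℝ) (hV : 1 ≤ V) (hP : ∀ i, |(P i : ℝ)| ≤ V) :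
    |((eval P G : ℤ) : ℝ)| ≤ nrm 1 G * V ^ d := by
  rw [eval_eq', nrm, sum_mul]
  push_cast
  refine (abs_sum_le_sum_abs _ _).trans (sum_le_sum fun e he => ?_)
  rw [abs_mul, one_pow, mul_one, abs_prod]
  refine mul_le_mul_of_nonneg_left ?_ (abs_nonneg _)
  calc ∏ i, |(P i : ℝ) ^ e i| ≤ ∏ i, V ^ e i := by
        refine prod_le_prod (fun _ _ => abs_nonneg _) fun i _ => ?_
        rw [abs_pow]; exact pow_le_pow_left₀ (abs_nonneg _) (hP i) _
    _ = V ^ e.degree := by rw [prod_pow_eq_pow_sum, degree_eq_sum]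
    _ ≤ V ^ d := pow_le_pow_right₀ hV ((le_totalDegree he).trans hd)

theorem nrm_pderiv_le {n : ℕ} (G : MP n ℤ) (d : ℕ) (hd : G.totalDegree ≤ d) (i : Fin n) : nrm 1 (pderiv i G) ≤ d * nrm 1 G := by
  have : pderiv i G = ∑ e ∈ G.support, pderiv i (monomial e (coeff e G)) := by
    rw [← map_sum, ← G.as_sum]
  rw [this]
  refine (nrm_sum zero_le_one _ _).trans ?_
  rw [nrm, mul_sum]
  refine sum_le_sum fun e he => ?_
  rw [pderiv_monomial, nrm_monomial]
  push_cast
  rw [abs_mul, one_pow, one_pow, mul_one, mul_one, mul_comm]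
  refine mul_le_mul_of_nonneg_right ?_ (abs_nonneg _)
  rw [abs_of_nonneg (by positivity)]
  exact_mod_cast (le_degree i e).trans ((le_totalDegree he).trans hd)

theorem lang_weil (f : MP 3 ℤ) (d : ℕ) (hd1 : 1 ≤ d) (hd : f.totalDegree ≤ d)
    (hc : coeff (single 0 d) f ≠ 0) (hirr : Irreducible (map toℚ f))
    (P : Fin 3 → ℤ) (hP : eval P f = 0) (hu0 : eval P (pderiv 0 f) ≠ 0) (V : ℝ) (hV4 : 4 ≤ V) (hVd : (d : ℝ) ≤ V)
    (hVf : nrm 1 f ≤ V) (hVP : ∀ i, |(P i : ℝ)| ≤ V) :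
    ∃ Ω : ℤ, Ω ≠ 0 ∧ |(Ω : ℝ)| ≤ V ^ (100 * d ^ 6) ∧ ∀ p : ℕ, [Fact p.Prime] → 10 ^ 5 * d ^ 5 ≤ p → ¬ (p : ℤ) ∣ Ω →
      100 * (zset (map (Int.castRingHom (ZMod p)) f)).card ≤ 104 * p ^ 2 := by
  classical
  obtain ⟨u, hu⟩ : ∃ u, eval P (pderiv 0 f) = u := ⟨_, rfl⟩
  rw [hu] at hu0
  have hV1 : 1 ≤ V := by linarith
  obtain ⟨F, hF, hFd, hF0, hF1, hFc, hFirr⟩ := recenter _ Int.cast_injective f d hd P hP u hu hu0 hc hirr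
  have hub : |(u : ℝ)| ≤ V ^ (d + 2) := by
    rw [← hu]
    refine (nrm_eval_le _ d ((totalDegree_pderiv_le 0 f).trans hd) P V hV1 hVP).trans ?_
    have h1 := nrm_pderiv_le f d hd 0
    calc _ ≤ (V * V) * V ^ d := by
          refine mul_le_mul_of_nonneg_right (h1.trans ?_) (by positivity)
          exact mul_le_mul hVd hVf (nrm_nonneg zero_le_one _) (by positivity)
      _ = V ^ (d + 2) := by ring
  have hu1 : (1 : ℝ) ≤ |(u : ℝ)| := by exact_mod_cast Int.one_le_abs hu0
  have hdd : d ≤ d ^ 2 := by nlinarith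
  have hd26 : d ^ 2 ≤ d ^ 6 := Nat.pow_le_pow_right hd1 (by norm_num)
  have hd46 : d ^ 4 ≤ d ^ 6 := Nat.pow_le_pow_right hd1 (by norm_num)
  have hFn : nrm 1 F ≤ V ^ (16 * d ^ 2) := by
    have h1 : nrm 1 F ≤ nrm 1 (C (u ^ 2) * F) := by
      have : C (u ^ 2) * F = ∑ e ∈ F.support, monomial e (u ^ 2 * coeff e F) := by
        conv_lhs => rw [F.as_sum, mul_sum]
        refine sum_congr rfl fun e _ => ?_
        rw [C_mul_monomial]
      have hs : (C (u ^ 2) * F).support ⊆ F.support := by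
        intro e he
        rw [mem_support_iff, coeff_C_mul] at he
        rw [mem_support_iff]; exact right_ne_zero_of_mul he
      rw [nrm_eq 1 _ _ hs, nrm]
      refine sum_le_sum fun e _ => ?_
      rw [coeff_C_mul]
      push_cast
      rw [abs_mul, abs_pow]
      refine mul_le_mul_of_nonneg_right ?_ (by positivity)
      have : (1 : ℝ) ≤ |(u : ℝ)| ^ 2 := one_le_pow₀ hu1
      nlinarith [abs_nonneg ((coeff e F : ℤ) : ℝ)]
    refine h1.trans ?_
    rw [hF]
    refine (nrm_aeval zero_le_one f _ (fun _ => V ^ (2 * d + 5)) ?_).trans ?_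
    · intro i
      refine (nrm_add zero_le_one _ _).trans ?_
      refine (add_le_add (nrm_C _ _).le ((nrm_mul zero_le_one _ _).trans (le_of_eq (by rw [nrm_C, nrm_X, mul_one])))).trans ?_
      have hti : |(((Fin.cons u (fun _ => u ^ 2) : Fin 3 → ℤ) i : ℤ) : ℝ)| ≤ V ^ (2 * d + 4) := by
        have hsq : |(u : ℝ)| ^ 2 ≤ V ^ (2 * d + 4) := by
          calc |(u : ℝ)| ^ 2 ≤ (V ^ (d + 2)) ^ 2 := pow_le_pow_left₀ (abs_nonneg _) hub 2
            _ = _ := by rw [← pow_mul]; congr 1; ring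
        refine Fin.cases ?_ (fun i => ?_) i
        · simp only [cons_zero]
          exact hub.trans (pow_le_pow_right₀ hV1 (by omega))
        · simp only [cons_succ]
          push_cast; rw [abs_pow]; exact hsq
      have hPi : |(P i : ℝ)| ≤ V ^ (2 * d + 4) := (hVP i).trans (by simpa using pow_le_pow_right₀ hV1 (show 1 ≤ 2 * d + 4 by omega))
      calc _ ≤ V ^ (2 * d + 4) + V ^ (2 * d + 4) := add_le_add hPi hti
        _ ≤ V ^ (2 * d + 4) * V := by nlinarith [pow_pos (show 0 < V by linarith) (2 * d + 4)]
        _ = _ := by ring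
    · calc ∑ e ∈ f.support, |((coeff e f : ℤ) : ℝ)| * ∏ i, (V ^ (2 * d + 5)) ^ e i
          ≤ ∑ e ∈ f.support, |((coeff e f : ℤ) : ℝ)| * (V ^ (2 * d + 5)) ^ d := by
            refine sum_le_sum fun e he => mul_le_mul_of_nonneg_left ?_ (abs_nonneg _)
            rw [prod_pow_eq_pow_sum, ← degree_eq_sum]
            exact pow_le_pow_right₀ (one_le_pow₀ hV1) ((le_totalDegree he).trans hd)
        _ = nrm 1 f * (V ^ (2 * d + 5)) ^ d := by rw [← sum_mul, nrm]; simp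
        _ ≤ V * (V ^ (2 * d + 5)) ^ d := mul_le_mul_of_nonneg_right hVf (by positivity)
        _ = V ^ (1 + (2 * d + 5) * d) := by rw [pow_add V 1, pow_one, pow_mul V (2 * d + 5)]
        _ ≤ _ := pow_le_pow_right₀ hV1 (by nlinarith)
  obtain ⟨μ, hμ0, hμd, hμn, hμ⟩ := bertini_int F d hd1 hFd hF0 hF1 hFc hFirr _ hFn (one_le_pow₀ hV1)
  obtain ⟨e, he⟩ := ne_zero_iff.mp hμ0
  refine ⟨u * coeff (single 0 d) F * coeff e μ, mul_ne_zero (mul_ne_zero hu0 hFc) he, ?_, ?_⟩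
  · have hFc' : |((coeff (single 0 d) F : ℤ) : ℝ)| ≤ V ^ (16 * d ^ 2) := by
      have := coeff_le_nrm zero_le_one F (single 0 d)
      rw [one_pow, mul_one] at this
      exact this.trans hFn
    have hμc : |((coeff e μ : ℤ) : ℝ)| ≤ V ^ (2 * d ^ 2 + 34 * d ^ 6) := by
      have := coeff_le_nrm zero_le_one μ e
      rw [one_pow, mul_one] at this
      refine this.trans (hμn.trans ?_)
      have hfac : ((d ^ 2).factorial : ℝ) ≤ V ^ (2 * d ^ 2) := by
        calc ((d ^ 2).factorial : ℝ) ≤ (((d ^ 2) ^ (d ^ 2) : ℕ) : ℝ) := by exact_mod_cast Nat.factorial_le_pow _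
          _ = ((d : ℝ) ^ 2) ^ (d ^ 2) := by push_cast; rfl
          _ ≤ (V ^ 2) ^ (d ^ 2) := by gcongr
          _ = _ := by rw [← pow_mul]
      have h4 : (4 * (V ^ (16 * d ^ 2)) ^ 2) ^ (d ^ 4) ≤ V ^ (34 * d ^ 6) := by
        calc (4 * (V ^ (16 * d ^ 2)) ^ 2) ^ (d ^ 4) ≤ (V * (V ^ (16 * d ^ 2)) ^ 2) ^ (d ^ 4) := by gcongr
          _ = V ^ ((1 + 32 * d ^ 2) * d ^ 4) := by rw [← pow_mul, ← pow_succ', ← pow_mul]; congr 1; ring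
          _ ≤ _ := pow_le_pow_right₀ hV1 (by nlinarith)
      calc _ ≤ V ^ (2 * d ^ 2) * V ^ (34 * d ^ 6) := mul_le_mul hfac h4 (by positivity) (by positivity)
        _ = _ := by rw [pow_add]
    push_cast
    rw [abs_mul, abs_mul]
    calc _ ≤ V ^ (d + 2) * V ^ (16 * d ^ 2) * V ^ (2 * d ^ 2 + 34 * d ^ 6) :=
          mul_le_mul (mul_le_mul hub hFc' (abs_nonneg _) (by positivity)) hμc (abs_nonneg _) (by positivity)
      _ = V ^ (d + 2 + 16 * d ^ 2 + (2 * d ^ 2 + 34 * d ^ 6)) := by rw [← pow_add, ← pow_add]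
      _ ≤ _ := pow_le_pow_right₀ hV1 (by nlinarith [Nat.one_le_pow 6 d hd1])
  · intro p _ hp hpΩ
    have hz : ((u * coeff (single 0 d) F * coeff e μ : ℤ) : ZMod p) ≠ 0 := by
      rwa [Ne, ZMod.intCast_zmod_eq_zero_iff_dvd]
    push_cast at hz
    have hu' : (u : ZMod p) ≠ 0 := left_ne_zero_of_mul (left_ne_zero_of_mul hz)
    have hc' : ((coeff (single 0 d) F : ℤ) : ZMod p) ≠ 0 := right_ne_zero_of_mul (left_ne_zero_of_mul hz)
    have hm' : ((coeff e μ : ℤ) : ZMod p) ≠ 0 := right_ne_zero_of_mul hz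
    have hcount := lw_count F d hd1 hFd hc' μ hμd e hm' (fun s hs => hμ (ZMod p) (Int.castRingHom (ZMod p)) s (by simpa using hc') hs) hp
    refine le_trans (Nat.mul_le_mul_left _ ?_) hcount
    set t : Fin 3 → ℤ := Fin.cons u (fun _ => u ^ 2) with ht
    have ht0 : ∀ i, ((t i : ℤ) : ZMod p) ≠ 0 := fun i => Fin.cases (by simpa [ht] using hu') (fun i => by simpa [ht] using hu') i
    refine card_le_card_of_injOn (fun x i => (x i - (P i : ZMod p)) / ((t i : ℤ) : ZMod p)) ?_ ?_
    · intro x hx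
      rw [mem_coe, mem_zset] at hx ⊢
      have h := congrArg (fun G => eval (fun i => (x i - (P i : ZMod p)) / ((t i : ℤ) : ZMod p)) (map (Int.castRingHom (ZMod p)) G)) hF
      simp only [map_mul, map_C, eval_C] at h
      have h2 : eval (fun i => (x i - (P i : ZMod p)) / ((t i : ℤ) : ZMod p)) (map (Int.castRingHom (ZMod p))
          (aeval (fun i => C (P i) + C (t i) * X i : Fin 3 → MP 3 ℤ) f)) = eval x (map (Int.castRingHom (ZMod p)) f) := by
        clear h hx hμ hc hirr hP hu hd hF hVf
        induction f using induction_on with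
        | C a => simp
        | add p q hp hq => simp only [map_add, hp, hq]
        | mul_X p i hp =>
          rw [map_mul, map_mul, map_mul, hp, map_mul, map_mul, aeval_X, map_X, eval_X, map_add, map_mul, map_C, map_C, map_X,
            map_add, map_mul, eval_C, eval_C, eval_X]
          congr 1
          rw [mul_div_assoc']
          have := ht0 i
          simp only [eq_intCast]
          rw [mul_div_cancel_left₀ _ this]; ring
      rw [h2, hx] at h
      refine (mul_eq_zero.mp h).resolve_left ?_
      simpa using hu'
    · intro x _ y _ h
      funext i
      have := congrFun h i
      simp only [div_left_inj' (ht0 i)] at this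
      simpa using this

theorem log_factorial_sum (n : ℕ) : log (n.factorial) = ∑ p ∈ (Ioc 0 n).filter Nat.Prime, (n.factorial.factorization p : ℝ) * log p := by
  rw [Real.log_nat_eq_sum_factorization, Finsupp.sum]
  refine sum_subset ?_ ?_
  · intro p hp
    rw [Nat.support_factorization, Nat.mem_primeFactors] at hp
    rw [mem_filter, mem_Ioc]
    exact ⟨⟨hp.1.pos, (hp.1.dvd_factorial).mp hp.2.1⟩, hp.1⟩
  · intro p _ hp
    rw [Finsupp.notMem_support_iff] at hp
    simp [hp]

theorem log_factorial_ge (n : ℕ) : (n : ℝ) * log n - n ≤ log n.factorial := by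
  induction n with
  | zero => simp
  | succ n ih =>
    rw [Nat.factorial_succ]
    push_cast
    rw [log_mul (by positivity) (by positivity)]
    rcases Nat.eq_zero_or_pos n with rfl | hn
    · simp
    have hn' : (0 : ℝ) < n := by exact_mod_cast hn
    have : log (n + 1) - log n ≤ 1 / n := by
      rw [← log_div (by positivity) (by positivity)]
      have := Real.log_le_sub_one_of_pos (show (0 : ℝ) < (n + 1) / n by positivity)
      refine this.trans (le_of_eq ?_)
      field_simp; ring
    have h2 : (n : ℝ) * (log (n + 1) - log n) ≤ 1 := by
      calc _ ≤ (n : ℝ) * (1 / n) := mul_le_mul_of_nonneg_left this hn'.le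
        _ = 1 := by field_simp
    nlinarith

noncomputable def mSum (n : ℕ) : ℝ := ∑ p ∈ (Ioc 0 n).filter Nat.Prime, log p / p

theorem mSum_upper (n : ℕ) (hn : 1 ≤ n) : mSum n ≤ log n + log 4 := by
  have hn' : (0 : ℝ) < n := by exact_mod_cast hn
  have h1 : ∑ p ∈ (Ioc 0 n).filter Nat.Prime, ((n : ℝ) / p - 1) * log p ≤ log n.factorial := by
    rw [log_factorial_sum]
    refine sum_le_sum fun p hp => ?_
    rw [mem_filter, mem_Ioc] at hp
    have hl : 0 ≤ log p := log_natCast_nonneg p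
    refine mul_le_mul_of_nonneg_right ?_ hl
    have h2 : n / p ≤ n.factorial.factorization p := by
      have hpp := hp.2
      have : p ^ (n / p) ∣ n.factorial := by
        have h3 : (p * (n / p)).factorial ∣ n.factorial := Nat.factorial_dvd_factorial (Nat.mul_div_le n p)
        refine dvd_trans ?_ h3
        generalize n / p = k
        have := Nat.factorization_factorial_mul (n := k) hpp
        rw [hpp.pow_dvd_iff_le_factorization (Nat.factorial_ne_zero _), this]
        omega
      exact (hpp.pow_dvd_iff_le_factorization (Nat.factorial_ne_zero _)).mp this
    have h3 : (n : ℝ) / p < (n / p : ℕ) + 1 := by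
      have := Nat.lt_floor_add_one ((n : ℝ) / p)
      rwa [Nat.floor_div_natCast, Nat.floor_natCast] at this
    have h4 : ((n / p : ℕ) : ℝ) ≤ (n.factorial.factorization p : ℝ) := by exact_mod_cast h2
    linarith
  have h2 : ∑ p ∈ (Ioc 0 n).filter Nat.Prime, ((n : ℝ) / p - 1) * log p = n * mSum n - Chebyshev.theta n := by
    rw [mSum, Chebyshev.theta, Nat.floor_natCast, mul_sum, ← sum_sub_distrib]
    refine sum_congr rfl fun p _ => ?_
    ring
  have h3 := Chebyshev.theta_le_log4_mul_x hn'.le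
  have h4 : log n.factorial ≤ n * log n := by
    have : (n.factorial : ℝ) ≤ (n : ℝ) ^ n := by exact_mod_cast Nat.factorial_le_pow n
    calc _ ≤ log ((n : ℝ) ^ n) := log_le_log (by positivity) this
      _ = _ := by rw [log_pow]
  have h5 : (n : ℝ) * mSum n ≤ n * (log n + log 4) := by rw [h2] at h1; nlinarith
  exact le_of_mul_le_mul_left h5 hn'

theorem mSum_lower : ∃ C : ℝ, 0 < C ∧ ∀ n : ℕ, 1 ≤ n → log n - C ≤ mSum n := by
  have hsum : Summable fun k : ℕ => 4 * (1 / (k : ℝ) ^ (3 / 2 : ℝ)) :=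
    (Real.summable_one_div_nat_rpow.mpr (by norm_num)).mul_left 4
  refine ⟨1 + ∑' k : ℕ, 4 * (1 / (k : ℝ) ^ (3 / 2 : ℝ)), ?_, ?_⟩
  · have : 0 ≤ ∑' k : ℕ, 4 * (1 / (k : ℝ) ^ (3 / 2 : ℝ)) := tsum_nonneg fun k => by positivity
    linarith
  intro n hn
  have hn' : (0 : ℝ) < n := by exact_mod_cast hn
  have h1 : log n.factorial ≤ ∑ p ∈ (Ioc 0 n).filter Nat.Prime, (n * (log p / p) + n * (4 * (1 / (p : ℝ) ^ (3 / 2 : ℝ)))) := by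
    rw [log_factorial_sum]
    refine sum_le_sum fun p hp => ?_
    rw [mem_filter, mem_Ioc] at hp
    have hp2 : (2 : ℝ) ≤ p := by exact_mod_cast hp.2.two_le
    have hl : 0 ≤ log p := log_natCast_nonneg p
    have h2 : (n.factorial.factorization p : ℝ) ≤ n / (p - 1) := by
      have := Nat.factorization_factorial_le_div_pred hp.2 n
      have h3 : ((n / (p - 1) : ℕ) : ℝ) ≤ (n : ℝ) / ((p - 1 : ℕ) : ℝ) := Nat.cast_div_le
      rw [Nat.cast_sub hp.2.one_le, Nat.cast_one] at h3
      exact le_trans (by exact_mod_cast this) h3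
    have h3 : log p ≤ 2 * (p : ℝ) ^ (1 / 2 : ℝ) := by
      have := Real.log_le_rpow_div (show (0 : ℝ) ≤ p by positivity) (show (0 : ℝ) < 1 / 2 by norm_num)
      linarith
    have h4 : log p / (p * (p - 1)) ≤ 4 * (1 / (p : ℝ) ^ (3 / 2 : ℝ)) := by
      have hpp : (p : ℝ) ^ (1 / 2 : ℝ) * (p : ℝ) ^ (3 / 2 : ℝ) = p ^ 2 := by
        rw [← Real.rpow_add (by positivity)]; norm_num
      rw [mul_one_div, div_le_div_iff₀ (by nlinarith) (by positivity)]
      calc log p * (p : ℝ) ^ (3 / 2 : ℝ) ≤ (2 * (p : ℝ) ^ (1 / 2 : ℝ)) * (p : ℝ) ^ (3 / 2 : ℝ) :=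
            mul_le_mul_of_nonneg_right h3 (by positivity)
        _ = 2 * p ^ 2 := by rw [mul_assoc, hpp]
        _ ≤ _ := by nlinarith
    calc _ ≤ n / (p - 1) * log p := mul_le_mul_of_nonneg_right h2 hl
      _ = n * (log p / p) + n * (log p / (p * (p - 1))) := by
          have : (p : ℝ) - 1 ≠ 0 := by linarith
          field_simp; ring
      _ ≤ _ := by gcongr
  have h2 := log_factorial_ge n
  rw [sum_add_distrib, ← mul_sum, ← mul_sum] at h1
  have h3 : ∑ p ∈ (Ioc 0 n).filter Nat.Prime, (4 * (1 / (p : ℝ) ^ (3 / 2 : ℝ))) ≤ ∑' k : ℕ, 4 * (1 / (k : ℝ) ^ (3 / 2 : ℝ)) :=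
    hsum.sum_le_tsum _ (fun k _ => by positivity)
  have h4 : (n : ℝ) * (log n - 1) ≤ n * (mSum n + ∑' k : ℕ, 4 * (1 / (k : ℝ) ^ (3 / 2 : ℝ))) := by
    rw [mSum]; nlinarith
  have := le_of_mul_le_mul_left h4 hn'
  linarith

theorem mertens : ∃ C : ℝ, 0 < C ∧ ∀ N T : ℕ, 1 ≤ N → N ≤ T →
    log T - log N - C ≤ ∑ p ∈ (Ioc N T).filter Nat.Prime, log p / p := by
  obtain ⟨C, hC, h⟩ := mSum_lower
  refine ⟨C + log 4, by positivity, fun N T hN hT => ?_⟩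
  have h1 := h T (hN.trans hT)
  have h2 := mSum_upper N hN
  have h3 : mSum T = mSum N + ∑ p ∈ (Ioc N T).filter Nat.Prime, log p / p := by
    rw [mSum, mSum, ← sum_union]
    · congr 1
      rw [← filter_union, Ioc_union_Ioc_eq_Ioc (Nat.zero_le _) hT]
    · apply disjoint_filter_filter
      rw [disjoint_left]
      intro x hx hx'
      rw [mem_Ioc] at hx hx'
      omega
  linarith

/-- many primes between consecutive powers -/
theorem many_primes : ∃ C : ℝ, 0 < C ∧ ∀ N a : ℕ, 2 ≤ a → C + 4 * a ≤ log N →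
    N ≤ ((Ioc (N ^ a) (N ^ (a + 1))).filter Nat.Prime).card := by
  obtain ⟨C, hC, h⟩ := mertens
  refine ⟨2 * C, by positivity, fun N a ha hN => ?_⟩
  have hlog : 0 < log N := lt_of_lt_of_le (by positivity) hN
  have hN1 : 1 ≤ N := by
    rcases Nat.eq_zero_or_pos N with rfl | h0
    · simp at hlog
    · exact h0
  have hNr : (1 : ℝ) ≤ N := by exact_mod_cast hN1
  have hm := h (N ^ a) (N ^ (a + 1)) (Nat.one_le_pow _ _ hN1) (Nat.pow_le_pow_right hN1 (by omega))
  push_cast at hm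
  rw [log_pow, log_pow] at hm
  push_cast at hm
  have hle : ∑ p ∈ (Ioc (N ^ a) (N ^ (a + 1))).filter Nat.Prime, log p / p ≤
      ((Ioc (N ^ a) (N ^ (a + 1))).filter Nat.Prime).card * ((a + 1) * log N / (N : ℝ) ^ a) := by
    rw [← nsmul_eq_mul]
    refine sum_le_card_nsmul _ _ _ fun p hp => ?_
    rw [mem_filter, mem_Ioc] at hp
    have h1 : (N : ℝ) ^ a ≤ p := by exact_mod_cast hp.1.1.le
    have h2 : (p : ℝ) ≤ (N : ℝ) ^ (a + 1) := by exact_mod_cast hp.1.2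
    have h3 : log p ≤ (a + 1) * log N := by
      have := log_le_log (by exact_mod_cast hp.2.pos) h2
      rwa [log_pow, Nat.cast_add, Nat.cast_one] at this
    exact div_le_div₀ (by positivity) h3 (by positivity) h1
  set c := ((Ioc (N ^ a) (N ^ (a + 1))).filter Nat.Prime).card
  have h1 : log N / 2 ≤ c * ((a + 1) * log N / (N : ℝ) ^ a) := by nlinarith
  have hpow : (0 : ℝ) < (N : ℝ) ^ a := by positivity
  have h2 : (N : ℝ) ^ a ≤ c * (2 * (a + 1)) := by
    rw [mul_div_assoc', le_div_iff₀ hpow] at h1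
    have : log N * (N : ℝ) ^ a ≤ log N * (c * (2 * (a + 1))) := by nlinarith
    exact le_of_mul_le_mul_left this hlog
  have h3 : (2 * (a + 1) : ℝ) ≤ N := by
    have : log N ≤ N := (Real.log_le_sub_one_of_pos (by positivity)).trans (by linarith)
    have : (2 : ℝ) ≤ a := by exact_mod_cast ha
    linarith
  have h4 : (N : ℝ) ^ 2 ≤ (N : ℝ) ^ a := pow_le_pow_right₀ hNr ha
  have h5 : (N : ℝ) * N ≤ c * N := by
    calc (N : ℝ) * N = N ^ 2 := by ring
      _ ≤ c * (2 * (a + 1)) := h4.trans h2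
      _ ≤ c * N := by gcongr
  have := le_of_mul_le_mul_right h5 (by linarith)
  exact_mod_cast this

theorem choose_three (n : ℕ) : ((n + 3).choose 3 : ℝ) = (n + 1) * (n + 2) * (n + 3) / 6 := by
  have h : (n + 3).choose 3 * 6 = (n + 1) * (n + 2) * (n + 3) := by
    have := Nat.descFactorial_eq_factorial_mul_choose (n + 3) 3
    simp only [Nat.descFactorial, Nat.factorial] at this
    have e : n + 3 - 2 = n + 1 := by omega
    have e' : n + 3 - 1 = n + 2 := by omega
    rw [e, e', Nat.sub_zero] at this
    linarith
  have : (((n + 3).choose 3 : ℕ) : ℝ) * 6 = (n + 1) * (n + 2) * (n + 3) := by exact_mod_cast h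
  linarith

theorem choose_three_le (m : ℕ) : ((m + 2).choose 3 : ℝ) ≤ (m + 1) ^ 3 / 6 := by
  cases m with
  | zero => simp
  | succ m =>
    rw [show m + 1 + 2 = m + 3 by ring, choose_three]
    have : (0:ℝ) ≤ m := Nat.cast_nonneg m
    push_cast
    nlinarith

theorem card_monsd_real (d D : ℕ) (h : d ≤ D) : ((monsd 2 d D).card : ℝ) =
    (((D:ℝ) + 1) * (D + 2) * (D + 3) - ((D:ℝ) - d + 1) * (D - d + 2) * (D - d + 3)) / 6 := by
  have h1 := card_monsd 2 d D h
  have h2 : ((monsd 2 d D).card : ℝ) + ((D - d + 3).choose 3 : ℕ) = ((D + 3).choose 3 : ℕ) := by exact_mod_cast h1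
  rw [choose_three, choose_three, Nat.cast_sub h] at h2
  linarith

theorem card_monsd_ge (d D : ℕ) (h : d ≤ D) : (d : ℝ) * (D - d) ^ 2 / 2 ≤ (monsd 2 d D).card := by
  rw [card_monsd_real d D h]
  have h1 : (0:ℝ) ≤ (D:ℝ) - d := by rw [sub_nonneg]; exact_mod_cast h
  obtain ⟨u, hu⟩ : ∃ u : ℝ, u = (D:ℝ) - d := ⟨_, rfl⟩
  have hd : (0:ℝ) ≤ d := Nat.cast_nonneg d
  rw [← hu] at h1 ⊢
  rw [show (D:ℝ) = u + d by linarith]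
  have e : (0:ℝ) ≤ u * d ∧ 0 ≤ u * d ^ 2 ∧ 0 ≤ d ^ 3 ∧ 0 ≤ u^2 * d ∧ (0:ℝ) ≤ d ^ 2 := by refine ⟨?_, ?_, ?_, ?_, ?_⟩ <;> positivity
  nlinarith [e.1, e.2.1, e.2.2.1, e.2.2.2.1]

theorem card_monsd_upper (d D : ℕ) (h : d ≤ D) : ((monsd 2 d D).card : ℝ) ≤ d * (D + 3) ^ 2 / 2 := by
  rw [card_monsd_real d D h]
  have h1 : (0:ℝ) ≤ (D:ℝ) - d := by rw [sub_nonneg]; exact_mod_cast h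
  obtain ⟨u, hu⟩ : ∃ u : ℝ, u = (D:ℝ) - d := ⟨_, rfl⟩
  have hd : (0:ℝ) ≤ d := Nat.cast_nonneg d
  rw [← hu] at h1 ⊢
  rw [show (D:ℝ) = u + d by linarith]
  have e : (0:ℝ) ≤ u * d ∧ 0 ≤ u * d ^ 2 ∧ 0 ≤ d ^ 3 ∧ 0 ≤ u^2 * d ∧ (0:ℝ) ≤ d ^ 2 := by refine ⟨?_, ?_, ?_, ?_, ?_⟩ <;> positivity
  nlinarith [e.1, e.2.1, e.2.2.1, e.2.2.2.1]

theorem sum_sq_ge (U : ℕ) : ((U:ℝ) - 1) ^ 3 / 3 ≤ ∑ u ∈ range U, (u : ℝ) ^ 2 := by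
  induction U with
  | zero => norm_num
  | succ U ih =>
    rw [sum_range_succ]
    have : (0:ℝ) ≤ U := Nat.cast_nonneg U
    rcases Nat.eq_zero_or_pos U with rfl | hU
    · norm_num
    have : (1:ℝ) ≤ U := by exact_mod_cast hU
    push_cast
    nlinarith

theorem monsd_weight (d D : ℕ) (h : d ≤ D) : ((∑ m ∈ monsd 2 d D, m.degree : ℕ) : ℝ) ≤
    D * (d * (D + 3) ^ 2 / 2) - d * ((D:ℝ) - d - 1) ^ 3 / 6 := by
  classical
  have h1 : ∑ m ∈ monsd 2 d D, m.degree + ∑ t ∈ range D, (monsd 2 d t).card = D * (monsd 2 d D).card := by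
    have : ∀ t ∈ range D, (monsd 2 d t).card = ∑ m ∈ monsd 2 d D, if m.degree ≤ t then 1 else 0 := by
      intro t ht
      rw [mem_range] at ht
      rw [sum_boole, Nat.cast_id]
      congr 1
      ext m
      simp only [mem_monsd, mem_filter]
      constructor
      · rintro ⟨a, b⟩; exact ⟨⟨by omega, b⟩, a⟩
      · rintro ⟨⟨a, b⟩, c⟩; exact ⟨c, b⟩
    rw [sum_congr rfl this, sum_comm, ← sum_add_distrib, mul_comm, ← smul_eq_mul, ← sum_const]
    refine sum_congr rfl fun m hm => ?_
    have hm1 := (mem_monsd.mp hm).1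
    rw [sum_boole, Nat.cast_id]
    have : (range D).filter (fun t => m.degree ≤ t) = Ico m.degree D := by
      ext t; simp only [mem_filter, mem_range, mem_Ico]; omega
    rw [this, Nat.card_Ico]; omega
  have h2 : (d:ℝ) * ((D:ℝ) - d - 1) ^ 3 / 6 ≤ ∑ t ∈ range D, ((monsd 2 d t).card : ℝ) := by
    have e : ∑ u ∈ range (D - d), ((monsd 2 d (u + d)).card : ℝ) ≤ ∑ t ∈ range D, ((monsd 2 d t).card : ℝ) := by
      rw [← sum_image (s := range (D - d)) (g := fun u => u + d) (f := fun t => ((monsd 2 d t).card : ℝ))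
        (fun a _ b _ hab => by simpa using hab)]
      refine sum_le_sum_of_subset_of_nonneg ?_ (fun _ _ _ => Nat.cast_nonneg _)
      intro t ht
      simp only [mem_image, mem_range] at ht ⊢
      obtain ⟨u, hu, rfl⟩ := ht; omega
    refine le_trans ?_ e
    have e2 : ∀ u ∈ range (D - d), (d:ℝ) / 2 * (u:ℝ)^2 ≤ ((monsd 2 d (u + d)).card : ℝ) := by
      intro u _
      have := card_monsd_ge d (u + d) (by omega)
      push_cast at this
      rw [add_sub_cancel_right] at this
      linarith
    refine le_trans ?_ (sum_le_sum e2)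
    rw [← mul_sum]
    have := sum_sq_ge (D - d)
    rw [Nat.cast_sub h] at this
    have hd : (0:ℝ) ≤ d := Nat.cast_nonneg d
    have := mul_le_mul_of_nonneg_left this (by linarith : (0:ℝ) ≤ d / 2)
    linarith
  have h3 := card_monsd_upper d D h
  have h4 : ((∑ m ∈ monsd 2 d D, m.degree : ℕ) : ℝ) + ∑ t ∈ range D, ((monsd 2 d t).card : ℝ) = D * (monsd 2 d D).card := by
    exact_mod_cast h1
  have h5 := mul_le_mul_of_nonneg_left h3 (Nat.cast_nonneg (α := ℝ) D)
  linarith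

theorem det_abs_le {ι : Type*} [Fintype ι] [DecidableEq ι] (M : Matrix ι ι ℤ) (H : ι → ℝ)
    (h : ∀ i j, |(M i j : ℝ)| ≤ H j) : |(M.det : ℝ)| ≤ (Fintype.card ι).factorial * ∏ j, H j := by
  rw [Matrix.det_apply']
  push_cast
  refine (abs_sum_le_sum_abs _ _).trans ?_
  have : ∀ σ ∈ (univ : Finset (Equiv.Perm ι)), |(((Equiv.Perm.sign σ : ℤˣ) : ℤ) : ℝ) * ∏ i, (M (σ i) i : ℝ)| ≤ ∏ j, H j := by
    intro σ _
    rw [abs_mul, abs_prod]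
    have : |(((Equiv.Perm.sign σ : ℤˣ) : ℤ) : ℝ)| = 1 := by
      rcases Int.units_eq_one_or (Equiv.Perm.sign σ) with h | h <;> simp [h]
    rw [this, one_mul]
    exact prod_le_prod (fun _ _ => abs_nonneg _) fun i _ => h _ _
  refine (sum_le_sum this).trans ?_
  rw [sum_const, card_univ, Fintype.card_perm, nsmul_eq_mul]

/-- primes larger than `N` dividing a nonzero integer of size at most `N^L` -/
theorem card_primes_dvd (N L : ℕ) (hN : 2 ≤ N) (a : ℤ) (ha : a ≠ 0) (haL : |(a:ℝ)| ≤ (N:ℝ) ^ L) (s : Finset ℕ)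
    (hs : ∀ p ∈ s, p.Prime ∧ N < p ∧ (p:ℤ) ∣ a) : s.card ≤ L := by
  have h1 : ∏ p ∈ s, p ∣ a.natAbs := by
    refine prod_dvd_of_isRelPrime ?_ ?_
    rotate_left
    · intro p hp; exact Int.natCast_dvd.mp (hs p hp).2.2
    · intro p hp q hq hpq
      exact Nat.coprime_iff_isRelPrime.mp <| (Nat.coprime_primes (hs p hp).1 (hs q hq).1).mpr hpq
  have h2 : ∏ p ∈ s, p ≤ a.natAbs := Nat.le_of_dvd (Int.natAbs_pos.mpr ha) h1
  have h3 : N ^ s.card ≤ ∏ p ∈ s, p := by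
    rw [← prod_const]
    exact prod_le_prod' fun p hp => (hs p hp).2.1.le
  have h4 : a.natAbs ≤ N ^ L := by
    have : ((a.natAbs : ℕ) : ℝ) ≤ ((N ^ L : ℕ) : ℝ) := by
      rw [Nat.cast_natAbs]; push_cast; exact haL
    exact_mod_cast this
  exact (Nat.pow_le_pow_iff_right (by omega)).mp ((h3.trans h2).trans h4)

theorem log_div_anti (N p : ℕ) (hN : 3 ≤ N) (hp : N ≤ p) : log p / p ≤ log N / N := by
  have hN' : exp 1 ≤ N := by
    have := Real.exp_one_lt_d9
    have h3 : (3:ℝ) ≤ N := by exact_mod_cast hN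
    linarith
  have hp' : (N:ℝ) ≤ p := by exact_mod_cast hp
  exact Real.log_div_self_antitoneOn hN' (hN'.trans hp') hp'

/-- combine prime power divisors into a logarithmic lower bound -/
theorem log_ge_of_dvd (s : Finset ℕ) (hs : ∀ p ∈ s, p.Prime) (p0 j : ℕ) (hp0 : p0.Prime) (h0 : p0 ∉ s) (e : ℕ → ℕ) (e0 : ℕ) (a : ℤ)
    (ha : a ≠ 0) (h : ∀ p ∈ s, (p:ℤ) ^ e p ∣ a) (h' : ((p0 ^ j : ℕ) : ℤ) ^ e0 ∣ a) :
    ∑ p ∈ s, (e p : ℝ) * log p + e0 * log ((p0 ^ j : ℕ) : ℝ) ≤ log |(a:ℝ)| := by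
  have h1 : (∏ p ∈ s, p ^ e p) * (p0 ^ j) ^ e0 ∣ a.natAbs := by
    refine Nat.Coprime.mul_dvd_of_dvd_of_dvd ?_ ?_ ?_
    · refine Nat.Coprime.prod_left fun p hp => ?_
      refine Nat.Coprime.pow _ _ (Nat.Coprime.pow_right _ ?_)
      exact (Nat.coprime_primes (hs p hp) hp0).mpr (fun e => h0 (e ▸ hp))
    · refine prod_dvd_of_isRelPrime ?_ ?_
      rotate_left
      · intro p hp
        have := h p hp
        exact Int.natCast_dvd.mp (by exact_mod_cast this)
      · intro p hp q hq hpq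
        exact Nat.coprime_iff_isRelPrime.mp <| Nat.Coprime.pow _ _ ((Nat.coprime_primes (hs p hp) (hs q hq)).mpr hpq)
    · exact Int.natCast_dvd.mp (by exact_mod_cast h')
  have h2 := Nat.le_of_dvd (Int.natAbs_pos.mpr ha) h1
  have h3 : (((∏ p ∈ s, p ^ e p) * (p0 ^ j) ^ e0 : ℕ) : ℝ) ≤ |(a:ℝ)| := by
    rw [← Int.cast_abs, ← Nat.cast_natAbs]; exact_mod_cast h2
  have hpos : ∀ p ∈ s, ((p:ℝ)) ^ e p ≠ 0 := fun p hp => pow_ne_zero _ (Nat.cast_ne_zero.mpr (hs p hp).ne_zero)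
  have hp0' : ((p0 ^ j : ℕ) : ℝ) ≠ 0 := Nat.cast_ne_zero.mpr (pow_ne_zero _ hp0.ne_zero)
  have h4 : 0 < (((∏ p ∈ s, p ^ e p) * (p0 ^ j) ^ e0 : ℕ) : ℝ) := by
    rw [Nat.cast_pos]
    exact Nat.mul_pos (prod_pos fun p hp => pow_pos (hs p hp).pos _) (pow_pos (pow_pos hp0.pos _) _)
  refine le_trans (le_of_eq ?_) (log_le_log h4 h3)
  rw [Nat.cast_mul, Nat.cast_prod, Nat.cast_pow (p0 ^ j), log_mul _ (pow_ne_zero _ hp0'), Real.log_prod]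
  · rw [log_pow]
    congr 1
    refine sum_congr rfl fun p hp => ?_
    rw [Nat.cast_pow, log_pow]
  · intro p hp; rw [Nat.cast_pow]; exact hpos p hp
  · rw [prod_ne_zero_iff]; intro p hp; rw [Nat.cast_pow]; exact hpos p hp

theorem gl_exponent (Z p R cl : ℝ) (m : ℕ) (hp : 1 ≤ p) (hZ : 2000 * p ≤ Z) (hm : m = ⌊Z / p⌋₊)
    (hR : 0.999 * (Z ^ 2 / 2) ≤ R) (hcl : cl ≤ 1.04 * p ^ 2) (hcl0 : 0 ≤ cl) :
    0.324 * Z ^ 3 / p ≤ m * R - cl * ((m + 2).choose 3 : ℕ) := by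
  have hp0 : 0 < p := by linarith
  obtain ⟨y, hy⟩ : ∃ y, y = Z / p := ⟨_, rfl⟩
  have hy2 : 2000 ≤ y := by rw [hy, le_div_iff₀ hp0]; exact hZ
  have hZy : Z = y * p := by rw [hy]; field_simp
  have hm1 : y - 1 ≤ m := by rw [hm, ← hy]; linarith [Nat.lt_floor_add_one y]
  have hm2 : (m:ℝ) ≤ y := by rw [hm, ← hy]; exact Nat.floor_le (by linarith)
  have h3 := choose_three_le m
  have h4 : ((m + 2).choose 3 : ℝ) ≤ 0.167 * y ^ 3 := by
    refine h3.trans ?_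
    have : ((m:ℝ) + 1) ^ 3 ≤ (1.0005 * y) ^ 3 := pow_le_pow_left₀ (by positivity) (by linarith) 3
    have hy3 : 0 ≤ y ^ 3 := by positivity
    nlinarith
  have h5 : cl * ((m + 2).choose 3 : ℕ) ≤ (1.04 * p ^ 2) * (0.167 * y ^ 3) :=
    mul_le_mul hcl h4 (by positivity) (by positivity)
  have h6 : (0.9995 * y) * (0.999 * (Z ^ 2 / 2)) ≤ m * R :=
    mul_le_mul (by linarith) hR (by positivity) (by positivity)
  have h7 : 0.324 * Z ^ 3 / p = 0.324 * (y ^ 3 * p ^ 2) := by rw [hZy]; field_simp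
  rw [h7]
  rw [hZy] at h6
  have h8 : 0 ≤ y ^ 3 * p ^ 2 := by positivity
  nlinarith

theorem gl_arith (a C lN lT lP lR Z N W bad sing tot : ℝ) (hZ : 0 ≤ Z) (hC : C + 10 ≤ lN) (hlN : 10 ≤ lN) (hC0 : 0 < C)
    (ha : 1 ≤ a) (hTP : 480 * a * lN - 9 ≤ lT + lP) (hW : W ≤ 0.1492 * Z ^ 3) (hlR : lR ≤ Z ^ 3) (hbad : bad ≤ lN) (hsing : sing ≤ Z ^ 3 * lN)
    (htot : tot ≥ lT - lN - C - bad)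
    (h : 0.324 * Z ^ 3 * tot - sing + 0.324 * Z ^ 3 * lP ≤ lR + W * (1000 * a * lN)) (hZ1 : 0 < Z) : False := by
  have hZ3 : 0 < Z ^ 3 := by positivity
  have h1 : 0.324 * Z ^ 3 * (lT - lN - C - bad) ≤ 0.324 * Z ^ 3 * tot := mul_le_mul_of_nonneg_left htot (by positivity)
  have h2 : W * (1000 * a * lN) ≤ 0.1492 * Z ^ 3 * (1000 * a * lN) := mul_le_mul_of_nonneg_right hW (by positivity)
  have h3 : Z ^ 3 * (0.324 * (lT - lN - C - bad + lP) - lN - 1 - 149.2 * (a * lN)) ≤ 0 := by nlinarith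
  have h5 : lN ≤ a * lN := by nlinarith
  have h4 : 0 < 0.324 * (lT - lN - C - bad + lP) - lN - 1 - 149.2 * (a * lN) := by nlinarith
  nlinarith

theorem W_bound (d D : ℕ) (hd : 5 ≤ d) (hD : 10000 * d ≤ D) (Z : ℝ) (hZ : Z = √d * D) :
    ((∑ m ∈ monsd 2 d D, m.degree : ℕ) : ℝ) ≤ 0.1492 * Z ^ 3 := by
  refine (monsd_weight d D (by omega)).trans ?_
  have hd' : (5:ℝ) ≤ d := by exact_mod_cast hd
  have hD' : 10000 * (d:ℝ) ≤ D := by exact_mod_cast hD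
  have hs : 2.236 ≤ √(d:ℝ) := by
    apply Real.le_sqrt_of_sq_le; norm_num; linarith
  have hs2 : √(d:ℝ) ^ 2 = d := sq_sqrt (by linarith)
  have hZ3 : Z ^ 3 = √d * (d * D ^ 3) := by rw [hZ, ← hs2]; rw [Real.sqrt_sq (Real.sqrt_nonneg _)]; ring
  rw [hZ3]
  have hDp : (0:ℝ) < D := by linarith
  have h0 : (0:ℝ) ≤ d * D ^ 3 := by positivity
  have h1 : 2.236 * ((d:ℝ) * D ^ 3) ≤ √d * (d * D ^ 3) := mul_le_mul_of_nonneg_right hs h0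
  have h2 : ((D:ℝ) + 3) ^ 2 ≤ (1.0001 * D) ^ 2 := pow_le_pow_left₀ (by positivity) (by linarith) 2
  have h3 : (0.9998 * (D:ℝ)) ^ 3 ≤ ((D:ℝ) - d - 1) ^ 3 := pow_le_pow_left₀ (by positivity) (by linarith) 3
  have h4 : (D:ℝ) * (d * (D + 3) ^ 2 / 2) ≤ D * (d * (1.0001 * D) ^ 2 / 2) := by gcongr
  have h5 : (d:ℝ) * (0.9998 * (D:ℝ)) ^ 3 / 6 ≤ d * ((D:ℝ) - d - 1) ^ 3 / 6 := by gcongr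
  nlinarith

theorem R_bounds (d D : ℕ) (hd : 5 ≤ d) (hD : 10000 * d ≤ D) (Z : ℝ) (hZ : Z = √d * D) :
    0.999 * (Z ^ 2 / 2) ≤ ((monsd 2 d D).card : ℝ) ∧ ((monsd 2 d D).card : ℝ) ≤ Z ^ 2 := by
  have hd' : (5:ℝ) ≤ d := by exact_mod_cast hd
  have hD' : 10000 * (d:ℝ) ≤ D := by exact_mod_cast hD
  have hZ2 : Z ^ 2 = d * D ^ 2 := by rw [hZ, mul_pow, sq_sqrt (by linarith)]
  have hDp : (0:ℝ) < D := by linarith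
  rw [hZ2]
  constructor
  · refine le_trans ?_ (card_monsd_ge d D (by omega))
    have h3 : (0.9999 * (D:ℝ)) ^ 2 ≤ ((D:ℝ) - d) ^ 2 := pow_le_pow_left₀ (by positivity) (by linarith) 2
    have h5 : (d:ℝ) * (0.9999 * (D:ℝ)) ^ 2 / 2 ≤ d * ((D:ℝ) - d) ^ 2 / 2 := by gcongr
    have h0 : (0:ℝ) ≤ d * D ^ 2 := by positivity
    nlinarith
  · refine (card_monsd_upper d D (by omega)).trans ?_
    have h3 : ((D:ℝ) + 3) ^ 2 ≤ (1.1 * (D:ℝ)) ^ 2 := pow_le_pow_left₀ (by positivity) (by linarith) 2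
    have h5 : (d:ℝ) * ((D:ℝ) + 3) ^ 2 / 2 ≤ d * (1.1 * (D:ℝ)) ^ 2 / 2 := by gcongr
    have h0 : (0:ℝ) ≤ d * D ^ 2 := by positivity
    nlinarith

theorem log_factorial_le_cube (R : ℕ) (Z : ℝ) (hZ : 16 ≤ Z) (h : (R:ℝ) ≤ Z ^ 2) : log (R.factorial) ≤ Z ^ 3 := by
  rcases Nat.eq_zero_or_pos R with rfl | hR
  · simp; positivity
  have hR' : (0:ℝ) < R := by exact_mod_cast hR
  have h1 : log (R.factorial) ≤ R * log R := by
    rw [← log_pow]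
    apply log_le_log (by exact_mod_cast Nat.factorial_pos R)
    exact_mod_cast Nat.factorial_le_pow R
  have h2 : log R ≤ Z := by
    have : log R ≤ log (Z ^ 2) := log_le_log hR' h
    refine this.trans ?_
    have e : Z ^ 2 = (√Z) ^ 4 := by
      rw [show (4:ℕ) = 2 * 2 by norm_num, pow_mul, sq_sqrt (by linarith)]
    rw [e, log_pow]
    have h4 : 4 ≤ √Z := by apply Real.le_sqrt_of_sq_le; linarith
    have h5 : log √Z ≤ √Z - 1 := Real.log_le_sub_one_of_pos (by linarith)
    have h6 : √Z * √Z = Z := Real.mul_self_sqrt (by linarith)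
    push_cast
    nlinarith
  calc _ ≤ (R:ℝ) * log R := h1
    _ ≤ Z ^ 2 * Z := mul_le_mul h h2 (Real.log_nonneg (by exact_mod_cast hR)) (by positivity)
    _ = Z ^ 3 := by ring

theorem gl_dvd_prime {ι : Type*} [Fintype ι] [DecidableEq ι] (f : MP 3 ℤ) (φ : ι → MP 3 ℤ)
    (pt : ι → Fin 3 → ℤ) (hpt : ∀ i, eval (pt i) f = 0) (p : ℕ) [Fact p.Prime] (m : ℕ) (I : Finset ι)
    (hI : ∀ i ∈ I, ¬ (p:ℤ) ∣ eval (pt i) (pderiv 0 f)) :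
    (p:ℤ) ^ (m * I.card - (zset (map (Int.castRingHom (ZMod p)) f)).card * (m + 2).choose 3) ∣
      (Matrix.of fun i j => eval (pt i) (φ j)).det := by
  classical
  obtain ⟨Cl, hCl⟩ : ∃ Cl : Finset (Fin 3 → ℤ), Cl = (zset (map (Int.castRingHom (ZMod p)) f)).image (fun v t => ((v t).val : ℤ)) := ⟨_, rfl⟩
  have hcard : Cl.card ≤ (zset (map (Int.castRingHom (ZMod p)) f)).card := by rw [hCl]; exact card_image_le
  have key := det_dvd_classes (r := 2) f φ (Matrix.of fun i j => eval (pt i) (φ j)) I Cl (p:ℤ) m ?_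
  · refine dvd_trans (pow_dvd_pow _ ?_) key
    exact Nat.sub_le_sub_left (Nat.mul_le_mul_right _ hcard) _
  intro i hi
  refine ⟨pt i, 1, fun j => by simp, by rw [hpt]; exact dvd_zero _, fun t => (((pt i t : ℤ) : ZMod p).val : ℤ), ?_, ?_, ?_⟩
  · rw [hCl, mem_image]
    refine ⟨fun t => ((pt i t : ℤ) : ZMod p), ?_, rfl⟩
    rw [mem_zset, eval_map]
    have := congrArg (Int.castRingHom (ZMod p)) (hpt i)
    rw [map_zero, eval₂_comp] at this
    exact this
  · intro t
    rw [← ZMod.intCast_zmod_eq_zero_iff_dvd]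
    simp
  · have hcong : ∀ t, (p:ℤ) ∣ pt i t - (((pt i t : ℤ) : ZMod p).val : ℤ) := fun t => by
      rw [← ZMod.intCast_zmod_eq_zero_iff_dvd]; simp
    have h1 := eval_congr_dvd (pderiv 0 f) (p:ℤ) (pt i) (fun t => (((pt i t : ℤ) : ZMod p).val : ℤ)) hcong
    have h2 : ¬ (p:ℤ) ∣ eval (fun t => (((pt i t : ℤ) : ZMod p).val : ℤ)) (pderiv 0 f) := by
      intro h; apply hI i hi
      have := dvd_add h1 h
      rwa [sub_add_cancel] at this
    have h3 : IsCoprime (p:ℤ) (eval (fun t => (((pt i t : ℤ) : ZMod p).val : ℤ)) (pderiv 0 f)) :=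
      (Prime.coprime_iff_not_dvd (Nat.prime_iff_prime_int.mp Fact.out)).mpr h2
    obtain ⟨a, b, hab⟩ := h3
    exact ⟨b, -a, by linarith⟩

theorem gl_dvd_P {ι : Type*} [Fintype ι] [DecidableEq ι] (f : MP 3 ℤ) (φ : ι → MP 3 ℤ)
    (pt : ι → Fin 3 → ℤ) (hpt : ∀ i, eval (pt i) f = 0) (p j : ℕ) (hp : p.Prime) (m : ℕ) (c : Fin 3 → ℤ)
    (hc : ∀ i t, ((p ^ j : ℕ) : ℤ) ∣ pt i t - c t)
    (hI : ∀ i, ¬ (p:ℤ) ∣ eval (pt i) (pderiv 0 f)) :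
    ((p ^ j : ℕ) : ℤ) ^ (m * Fintype.card ι - (m + 2).choose 3) ∣
      (Matrix.of fun i j => eval (pt i) (φ j)).det := by
  classical
  have key := det_dvd_classes (r := 2) f φ (Matrix.of fun i j => eval (pt i) (φ j)) univ {c} ((p ^ j : ℕ) : ℤ) m ?_
  · rw [card_singleton, one_mul, card_univ] at key
    exact key
  intro i hi
  refine ⟨pt i, 1, fun j => by simp, by rw [hpt]; exact dvd_zero _, c, mem_singleton_self c, hc i, ?_⟩
  have h1 := eval_congr_dvd (pderiv 0 f) ((p ^ j : ℕ):ℤ) (pt i) c (hc i)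
  have h2 : IsCoprime ((p ^ j : ℕ):ℤ) (eval (pt i) (pderiv 0 f)) := by
    push_cast
    exact IsCoprime.pow_left ((Prime.coprime_iff_not_dvd (Nat.prime_iff_prime_int.mp hp)).mpr (hI i))
  obtain ⟨a, b, hab⟩ := h2
  obtain ⟨u, hu⟩ := h1
  refine ⟨b, -a - b * u, ?_⟩
  linear_combination hab - b * hu

theorem gl_goodsum (N T E d : ℕ) (Cm : ℝ) (hN : 3 ≤ N)
    (hmert : log T - log N - Cm ≤ ∑ p ∈ (Ioc N T).filter Nat.Prime, log p / p)
    (Bad : Finset ℕ) (hB : ∀ p ∈ Bad, N < p) (K : ℕ) (hK : Bad.card ≤ K) :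
    log T - log N - Cm - K * (log N / N) ≤
      ∑ p ∈ ((Ioc N T).filter Nat.Prime) \ Bad, log p / p := by
  classical
  have hle : 0 ≤ log N / N := div_nonneg (log_natCast_nonneg N) (Nat.cast_nonneg _)
  have h1 : ∑ p ∈ (Ioc N T).filter Nat.Prime, log p / p ≤
      ∑ p ∈ ((Ioc N T).filter Nat.Prime) \ Bad, log p / p + ∑ p ∈ Bad, log (p:ℝ) / p := by
    rw [← sum_union sdiff_disjoint]
    refine sum_le_sum_of_subset_of_nonneg (by intro x hx; simp only [mem_union, mem_sdiff]; tauto) ?_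
    intro p _ _
    exact div_nonneg (log_natCast_nonneg p) (Nat.cast_nonneg _)
  have h2 : ∑ p ∈ Bad, log (p:ℝ) / p ≤ K * (log N / N) := by
    refine (sum_le_card_nsmul _ _ _ fun p hp => log_div_anti N p hN (hB p hp).le).trans ?_
    rw [nsmul_eq_mul]
    exact mul_le_mul_of_nonneg_right (by exact_mod_cast hK) hle
  linarith

theorem gl_singsum {ι : Type*} [Fintype ι] (N L : ℕ) (hN : 3 ≤ N) (a : ι → ℤ) (ha : ∀ i, a i ≠ 0) (haL : ∀ i, |(a i:ℝ)| ≤ (N:ℝ) ^ L)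
    (s : Finset ℕ) (hs : ∀ p ∈ s, p.Prime ∧ N < p) :
    ∑ p ∈ s, ((univ.filter (fun i => (p:ℤ) ∣ a i)).card : ℝ) * (log p / p) ≤ Fintype.card ι * (L * (log N / N)) := by
  classical
  have hle : 0 ≤ log N / N := div_nonneg (log_natCast_nonneg N) (Nat.cast_nonneg _)
  have h1 : ∀ p ∈ s, ((univ.filter (fun i => (p:ℤ) ∣ a i)).card : ℝ) * (log p / p) ≤ ∑ i, if (p:ℤ) ∣ a i then log N / N else 0 := by
    intro p hp
    rw [← sum_filter, sum_const, nsmul_eq_mul]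
    exact mul_le_mul_of_nonneg_left (log_div_anti N p hN (hs p hp).2.le) (Nat.cast_nonneg _)
  refine (sum_le_sum h1).trans ?_
  rw [sum_comm]
  refine (sum_le_card_nsmul _ _ _ (fun i _ => ?_)).trans (le_of_eq (by rw [nsmul_eq_mul, card_univ]))
  rw [← sum_filter, sum_const, nsmul_eq_mul]
  refine mul_le_mul_of_nonneg_right ?_ hle
  have := card_primes_dvd N L (by omega) (a i) (ha i) (haL i) (s.filter (fun p : ℕ => (p:ℤ) ∣ a i)) (fun p hp => by
    rw [mem_filter] at hp
    exact ⟨(hs p hp.1).1, (hs p hp.1).2, hp.2⟩)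
  exact_mod_cast this

theorem eval_int_map {n : ℕ} (x : Fin n → ℤ) (g : MP n ℤ) :
    eval (fun i => (x i : ℚ)) (map toℚ g) = ((eval x g : ℤ) : ℚ) := by
  rw [eval_map]
  have := (eval₂_comp toℚ x g)
  exact this.symm

theorem gl : ∃ C1 : ℕ, 0 < C1 ∧ ∀ (f : MP 3 ℤ) (a d N E p0 j D : ℕ) (S : Set (Fin 3 → ℤ)) (c : Fin 3 → ℤ),
    1 ≤ a → 5 ≤ d → f.totalDegree ≤ d → coeff (single 0 d) f ≠ 0 → Irreducible (map toℚ f) →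
    nrm 1 f ≤ (N:ℝ) ^ E → 1000 * a ≤ E → C1 * (E + 1) * d ^ 7 ≤ N → p0.Prime → N ^ 2 ≤ D → N ^ (480 * a) ≤ 2 * (p0 ^ j * D) →
    (∀ x ∈ S, (∀ i, |x i| ≤ (N:ℤ) ^ (1000 * a)) ∧ eval x f = 0 ∧ ¬ (p0:ℤ) ∣ eval x (pderiv 0 f) ∧
      ∀ t, ((p0 ^ j : ℕ) : ℤ) ∣ x t - c t) →
    ∃ g : MP 3 ℚ, g ≠ 0 ∧ g.support ⊆ monsd 2 d D ∧ ∀ x ∈ S, eval (fun i => (x i : ℚ)) g = 0 := by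
  classical
  obtain ⟨Cm, hCm, hmert⟩ := mertens
  refine ⟨max (10 ^ 6) ⌈exp (Cm + 10)⌉₊, by positivity, ?_⟩
  intro f a d N E p0 j D S c ha hd hfd hfc hirr hnrm hE hNbig hp0 hDN hPD hS
  by_contra hno
  push Not at hno
  -- size of N
  obtain ⟨C1, hC1⟩ : ∃ C1, C1 = max (10 ^ 6) ⌈exp (Cm + 10)⌉₊ := ⟨_, rfl⟩
  rw [← hC1] at hNbig
  have hC1a : 10 ^ 6 ≤ C1 := by rw [hC1]; exact le_max_left _ _
  have hC1b : exp (Cm + 10) ≤ C1 := by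
    refine (Nat.le_ceil _).trans ?_
    rw [hC1]; exact_mod_cast le_max_right _ _
  have hNC : C1 ≤ N := by
    refine le_trans ?_ hNbig
    have : 1 ≤ (E + 1) * d ^ 7 := Nat.one_le_iff_ne_zero.mpr (by positivity)
    nlinarith
  have hN6 : 10 ^ 6 ≤ N := hC1a.trans hNC
  have hN3 : 3 ≤ N := le_trans (by norm_num) hN6
  have hN6r : (10:ℝ) ^ 6 ≤ N := by exact_mod_cast hN6
  have hN1r : (1:ℝ) ≤ N := le_trans (by norm_num) hN6r
  have hlN : Cm + 10 ≤ log N := by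
    rw [Real.le_log_iff_exp_le (by linarith)]
    exact hC1b.trans (by exact_mod_cast hNC)
  have hlN0 : 10 ≤ log N := by linarith
  have hEd : 10 ^ 6 * ((E + 1) * d ^ 7) ≤ N := by
    refine le_trans ?_ hNbig
    rw [mul_assoc]; exact Nat.mul_le_mul_right _ hC1a
  have hd7 : d ^ 7 ≤ (E + 1) * d ^ 7 := Nat.le_mul_of_pos_left _ (by omega)
  have hd5N : 10 ^ 5 * d ^ 5 ≤ N := by
    have : d ^ 5 ≤ d ^ 7 := Nat.pow_le_pow_right (by omega) (by norm_num)
    linarith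
  have hdN : 10000 * d ≤ N := by
    have : d ≤ d ^ 7 := Nat.le_self_pow (by norm_num) d
    linarith
  have hDN1 : N ≤ D := le_trans (Nat.le_self_pow (by norm_num) N) hDN
  have hdD : 10000 * d ≤ D := hdN.trans hDN1
  obtain ⟨Z, hZ⟩ : ∃ Z : ℝ, Z = √d * D := ⟨_, rfl⟩
  have hd' : (5:ℝ) ≤ d := by exact_mod_cast hd
  have hs : 2 ≤ √(d:ℝ) := by
    apply Real.le_sqrt_of_sq_le; norm_num; linarith
  have hDr : (0:ℝ) < D := by
    have : 0 < D := by omega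
    exact_mod_cast this
  have hZD : 2 * (D:ℝ) ≤ Z := by rw [hZ]; exact mul_le_mul_of_nonneg_right hs hDr.le
  have hNDr : (N:ℝ) ≤ D := by exact_mod_cast hDN1
  have hZ0 : 0 < Z := by linarith
  obtain ⟨hR1, hR2⟩ := R_bounds d D hd hdD Z hZ
  have hW := W_bound d D hd hdD Z hZ
  -- determinant
  have hex := exists_det_ne_zero (P := Fin 3 → ℤ) (ι := monsd 2 d D) (K := ℚ)
    (fun x m => ((eval x (monomial m.1 (1:ℤ)) : ℤ) : ℚ)) S ?_
  swap
  · intro a' ha'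
    by_contra hne
    obtain ⟨x, hx, hx0⟩ := hno (polyOf (monsd 2 d D) a') (polyOf_ne_zero _ _ hne) (support_polyOf _ _)
    apply hx0
    rw [← ha' x hx, polyOf, map_sum]
    refine sum_congr rfl fun m _ => ?_
    rw [← eval_int_map, map_monomial, eval_monomial, eval_monomial, map_one, one_mul]
  obtain ⟨pt, hptS, hdet⟩ := hex
  obtain ⟨M, hM⟩ : ∃ M : Matrix (monsd 2 d D) (monsd 2 d D) ℤ, M = Matrix.of fun i j => eval (pt i) (monomial j.1 (1:ℤ)) := ⟨_, rfl⟩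
  have hdetZ : M.det ≠ 0 := by
    intro h0
    apply hdet
    have := congrArg toℚ h0
    rw [map_zero, RingHom.map_det] at this
    refine Eq.trans ?_ this
    congr 1
    rw [hM]
    rfl
  have hptf : ∀ i, eval (pt i) f = 0 := fun i => (hS _ (hptS i)).2.1
  have hpts : ∀ i, ¬ (p0:ℤ) ∣ eval (pt i) (pderiv 0 f) := fun i => (hS _ (hptS i)).2.2.1
  have hptc := fun i => (hS _ (hptS i)).2.2.2
  have hptB : ∀ i t, |((pt i t : ℤ):ℝ)| ≤ (N:ℝ) ^ (1000 * a) := fun i t => by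
    have := (hS _ (hptS i)).1 t
    rw [← Int.cast_abs]; exact_mod_cast this
  have hu0 : ∀ i, eval (pt i) (pderiv 0 f) ≠ 0 := fun i h => hpts i (by rw [h]; exact dvd_zero _)
  have hcardR : Fintype.card (monsd 2 d D) = (monsd 2 d D).card := Fintype.card_coe _
  -- upper bound of the determinant
  have hup : log |(M.det : ℝ)| ≤ log ((monsd 2 d D).card.factorial) + (∑ m ∈ monsd 2 d D, m.degree : ℕ) * (1000 * a * log N) := by
    have h1 := det_abs_le M (fun m => ((N:ℝ) ^ (1000 * a)) ^ (m.1.degree)) (fun i m => by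
      rw [hM, Matrix.of_apply, eval_monomial, one_mul, prod_fintype _ _ (by simp)]
      push_cast
      rw [abs_prod, degree_eq_sum, ← prod_pow_eq_pow_sum]
      refine prod_le_prod (fun _ _ => abs_nonneg _) fun t _ => ?_
      rw [abs_pow]
      exact pow_le_pow_left₀ (abs_nonneg _) (hptB i t) _)
    rw [prod_pow_eq_pow_sum, hcardR, sum_coe_sort (monsd 2 d D) (fun m => m.degree), ← pow_mul] at h1
    have h2 : 0 < |(M.det:ℝ)| := abs_pos.mpr (by exact_mod_cast hdetZ)
    refine (log_le_log h2 h1).trans (le_of_eq ?_)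
    rw [log_mul (by exact_mod_cast Nat.factorial_ne_zero _) (by positivity), log_pow]
    push_cast; ring
  -- Lang-Weil
  have h0mem : (0 : Fin 3 →₀ ℕ) ∈ monsd 2 d D := by rw [mem_monsd]; simp; omega
  have hVN : (N:ℝ) ≤ (N:ℝ) ^ E := le_self_pow₀ hN1r (by omega)
  have hV : (N:ℝ) ^ (1000 * a) ≤ (N:ℝ) ^ E := pow_le_pow_right₀ hN1r hE
  have hdNr : 10000 * (d:ℝ) ≤ N := by exact_mod_cast hdN
  obtain ⟨Ω, hΩ0, hΩb, hΩ⟩ := lang_weil f d (by omega) hfd hfc hirr (pt ⟨0, h0mem⟩) (hptf _) (hu0 _) ((N:ℝ) ^ E)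
    (le_trans (by linarith) hVN) (le_trans (by linarith) hVN) hnrm (fun i => (hptB _ i).trans hV)
  rw [← pow_mul] at hΩb
  -- primes
  obtain ⟨T, hT⟩ : ∃ T, T = D / 1000 := ⟨_, rfl⟩
  have hTD : T * 1000 ≤ D := by rw [hT]; exact Nat.div_mul_le_self _ _
  have hDT : D < (T + 1) * 1000 := by rw [hT]; omega
  have hNT : N ≤ T := by nlinarith
  obtain ⟨Bad, hBad⟩ : ∃ Bad, Bad = ((Ioc N T).filter Nat.Prime).filter (fun p : ℕ => (p:ℤ) ∣ Ω ∨ p = p0) := ⟨_, rfl⟩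
  obtain ⟨s, hs'⟩ : ∃ s, s = ((Ioc N T).filter Nat.Prime) \ Bad := ⟨_, rfl⟩
  have hBcard : Bad.card ≤ E * (100 * d ^ 6) + 1 := by
    rw [hBad, filter_or]
    refine (card_union_le _ _).trans (add_le_add ?_ ?_)
    · refine card_primes_dvd N _ (by omega) Ω hΩ0 hΩb _ fun p hp => ?_
      simp only [mem_filter, mem_Ioc] at hp
      exact ⟨hp.1.2, hp.1.1.1, hp.2⟩
    · rw [card_le_one]
      intro a ha b hb
      rw [mem_filter] at ha hb
      rw [ha.2, hb.2]
  have hsum := gl_goodsum N T E d Cm hN3 (hmert N T (by omega) hNT) Bad (fun p hp => by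
    rw [hBad] at hp; simp only [mem_filter, mem_Ioc] at hp; exact hp.1.1.1) _ hBcard
  rw [← hs'] at hsum
  have hsmem : ∀ p ∈ s, p.Prime ∧ N < p ∧ p ≤ T ∧ ¬ (p:ℤ) ∣ Ω ∧ p ≠ p0 := by
    intro p hp
    rw [hs', hBad] at hp
    simp only [mem_sdiff, mem_filter, mem_Ioc] at hp
    have h2 := fun h => hp.2 ⟨hp.1, h⟩
    exact ⟨hp.1.2, hp.1.1.1, hp.1.1.2, fun h => h2 (Or.inl h), fun h => h2 (Or.inr h)⟩
  -- derivative bound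
  have hder : ∀ i, |((eval (pt i) (pderiv 0 f) : ℤ):ℝ)| ≤ (N:ℝ) ^ (E + 1 + 1000 * a * d) := by
    intro i
    refine (nrm_eval_le _ d ((totalDegree_pderiv_le 0 f).trans hfd) (pt i) ((N:ℝ)^(1000 * a)) (one_le_pow₀ hN1r) (hptB i)).trans ?_
    have h1 := nrm_pderiv_le f d hfd 0
    calc _ ≤ ((N:ℝ) * (N:ℝ) ^ E) * ((N:ℝ)^(1000 * a)) ^ d := by
          refine mul_le_mul_of_nonneg_right (h1.trans ?_) (by positivity)
          exact mul_le_mul (by linarith) hnrm (nrm_nonneg zero_le_one _) (by positivity)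
      _ = (N:ℝ) ^ (E + 1 + 1000 * a * d) := by rw [← pow_mul]; ring
  have hsing := gl_singsum N (E + 1 + 1000 * a * d) hN3 (fun i => eval (pt i) (pderiv 0 f)) hu0 hder s (fun p hp => ⟨(hsmem p hp).1, (hsmem p hp).2.1⟩)
  rw [hcardR] at hsing
  -- exponents
  obtain ⟨e, he⟩ : ∃ e : ℕ → ℕ, ∀ p ∈ s, (p:ℤ) ^ e p ∣ M.det ∧
      0.324 * Z ^ 3 / p - (Z / p) * ((univ.filter (fun i => (p:ℤ) ∣ eval (pt i) (pderiv 0 f))).card : ℝ) ≤ e p := by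
    have : ∀ p ∈ s, ∃ e : ℕ, (p:ℤ) ^ e ∣ M.det ∧
      0.324 * Z ^ 3 / p - (Z / p) * ((univ.filter (fun i => (p:ℤ) ∣ eval (pt i) (pderiv 0 f))).card : ℝ) ≤ e := by
      intro p hp
      obtain ⟨hpp, hpN, hpT, hpΩ, hpp0⟩ := hsmem p hp
      haveI : Fact p.Prime := ⟨hpp⟩
      have hz := hΩ p (hd5N.trans hpN.le) hpΩ
      have hdv := gl_dvd_prime f (fun m : monsd 2 d D => monomial m.1 (1:ℤ)) pt hptf p ⌊Z / p⌋₊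
        (univ.filter (fun i => ¬ (p:ℤ) ∣ eval (pt i) (pderiv 0 f))) (fun i hi => (mem_filter.mp hi).2)
      rw [← hM] at hdv
      refine ⟨_, hdv, ?_⟩
      obtain ⟨zc, hzc⟩ : ∃ zc, zc = (zset (map (Int.castRingHom (ZMod p)) f)).card := ⟨_, rfl⟩
      rw [← hzc] at hz ⊢
      have hp1 : (1:ℝ) ≤ p := by exact_mod_cast hpp.one_lt.le
      have hpZ : 2000 * (p:ℝ) ≤ Z := by
        have : (p:ℝ) * 1000 ≤ D := by exact_mod_cast le_trans (Nat.mul_le_mul_right _ hpT) hTD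
        linarith
      have hex := gl_exponent Z p _ zc ⌊Z / p⌋₊ hp1 hpZ rfl hR1 (by
        have : 100 * (zc:ℝ) ≤ 104 * (p:ℝ) ^ 2 := by exact_mod_cast hz
        linarith) (Nat.cast_nonneg _)
      have hsplit := card_filter_add_card_filter_not (s := (univ : Finset (monsd 2 d D))) (fun i => (p:ℤ) ∣ eval (pt i) (pderiv 0 f))
      rw [card_univ, hcardR] at hsplit
      have hsplit' : ((univ.filter (fun i => (p:ℤ) ∣ eval (pt i) (pderiv 0 f))).card : ℝ) +
        ((univ.filter (fun i => ¬ (p:ℤ) ∣ eval (pt i) (pderiv 0 f))).card : ℝ) = ((monsd 2 d D).card : ℝ) := by exact_mod_cast hsplit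
      obtain ⟨s1, hs1⟩ : ∃ s1, s1 = (univ.filter (fun i => (p:ℤ) ∣ eval (pt i) (pderiv 0 f))).card := ⟨_, rfl⟩
      obtain ⟨s2, hs2⟩ : ∃ s2, s2 = (univ.filter (fun i => ¬ (p:ℤ) ∣ eval (pt i) (pderiv 0 f))).card := ⟨_, rfl⟩
      rw [← hs1, ← hs2] at hsplit'
      rw [← hs1, ← hs2]
      rw [← hsplit'] at hex
      have hfl : ((⌊Z / p⌋₊ : ℕ) : ℝ) ≤ Z / p := Nat.floor_le (by positivity)
      have hsub : ((⌊Z / p⌋₊ * s2 : ℕ) : ℝ) - ((zc * (⌊Z / p⌋₊ + 2).choose 3 : ℕ) : ℝ) ≤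
          ((⌊Z / p⌋₊ * s2 - zc * (⌊Z / p⌋₊ + 2).choose 3 : ℕ) : ℝ) := by
        rw [sub_le_iff_le_add]; exact_mod_cast le_tsub_add
      refine le_trans ?_ hsub
      have := mul_le_mul_of_nonneg_right hfl (Nat.cast_nonneg (α := ℝ) s1)
      push_cast
      linarith
    choose! e he using this
    exact ⟨e, he⟩
  obtain ⟨e0, he0, he0'⟩ : ∃ e0 : ℕ, ((p0 ^ j : ℕ) : ℤ) ^ e0 ∣ M.det ∧ 0.324 * Z ^ 3 ≤ e0 := by
    have hdv := gl_dvd_P f (fun m : monsd 2 d D => monomial m.1 (1:ℤ)) pt hptf p0 j hp0 ⌊Z / 1⌋₊ c hptc hpts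
    rw [← hM, hcardR] at hdv
    refine ⟨_, hdv, ?_⟩
    have hex := gl_exponent Z 1 _ 1 ⌊Z / 1⌋₊ le_rfl (by linarith) rfl hR1 (by norm_num) zero_le_one
    rw [one_mul, div_one] at hex
    refine hex.trans ?_
    rw [sub_le_iff_le_add]
    exact_mod_cast le_tsub_add
  have hlow := log_ge_of_dvd s (fun p hp => (hsmem p hp).1) p0 j hp0 (fun h => (hsmem p0 h).2.2.2.2 rfl) e e0 M.det hdetZ
    (fun p hp => (he p hp).1) he0
  -- final comparison
  have hlP : 0 ≤ log ((p0 ^ j : ℕ) : ℝ) := log_natCast_nonneg _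
  have hmain : 0.324 * Z ^ 3 * (∑ p ∈ s, log p / p) - Z * ∑ p ∈ s, ((univ.filter (fun i => (p:ℤ) ∣ eval (pt i) (pderiv 0 f))).card : ℝ) * (log p / p)
      ≤ ∑ p ∈ s, (e p : ℝ) * log p := by
    rw [mul_sum, mul_sum, ← sum_sub_distrib]
    refine sum_le_sum fun p hp => ?_
    have := mul_le_mul_of_nonneg_right (he p hp).2 (log_natCast_nonneg p)
    refine le_trans (le_of_eq ?_) this
    ring
  have hlNN : 0 ≤ log N / N := by positivity
  have hratio : ∀ K : ℝ, K ≤ N → K * (log N / N) ≤ log N := fun K hK => by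
    calc K * (log N / N) ≤ N * (log N / N) := mul_le_mul_of_nonneg_right hK hlNN
      _ = log N := by field_simp
  have hK1 : ((E * (100 * d ^ 6) + 1 : ℕ) : ℝ) ≤ N := by
    have : E * (100 * d ^ 6) + 1 ≤ N := by
      have h1 : d ^ 6 ≤ d ^ 7 := Nat.pow_le_pow_right (by omega) (by norm_num)
      have h2 := Nat.mul_le_mul_left E h1
      nlinarith
    exact_mod_cast this
  have hK2 : ((E + 1 + 1000 * a * d : ℕ) : ℝ) ≤ N := by
    have : E + 1 + 1000 * a * d ≤ N := by
      have h1 : d ≤ d ^ 7 := Nat.le_self_pow (by norm_num) d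
      have h2 : 1 ≤ d ^ 7 := Nat.one_le_pow _ _ (by omega)
      have h3 : 1000 * a * d ≤ E * d ^ 7 := Nat.mul_le_mul hE h1
      have h4 : E ≤ E * d ^ 7 := Nat.le_mul_of_pos_right _ (by omega)
      linarith
    exact_mod_cast this
  refine gl_arith a Cm (log N) (log T) (log ((p0 ^ j : ℕ) : ℝ)) (log ((monsd 2 d D).card.factorial)) Z N
    (∑ m ∈ monsd 2 d D, m.degree : ℕ) (((E * (100 * d ^ 6) + 1 : ℕ) : ℝ) * (log N / N))
    (Z * ∑ p ∈ s, ((univ.filter (fun i => (p:ℤ) ∣ eval (pt i) (pderiv 0 f))).card : ℝ) * (log p / p))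
    (∑ p ∈ s, log p / p) hZ0.le hlN hlN0 hCm (by exact_mod_cast ha) ?_ hW (log_factorial_le_cube _ Z (by linarith) hR2) (hratio _ hK1) ?_ hsum ?_ hZ0
  · -- log T + log P
    have hTr : (D:ℝ) / 2000 ≤ T := by
      have : D ≤ T * 2000 := by omega
      have : (D:ℝ) ≤ T * 2000 := by exact_mod_cast this
      linarith
    have hT0 : (0:ℝ) < T := by linarith [div_pos hDr (by norm_num : (0:ℝ) < 2000)]
    have hP0 : (0:ℝ) < ((p0 ^ j : ℕ) : ℝ) := by exact_mod_cast pow_pos hp0.pos j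
    rw [← log_mul hT0.ne' hP0.ne']
    have h1 : (N:ℝ) ^ (480 * a) / 4000 ≤ T * ((p0 ^ j : ℕ) : ℝ) := by
      have : (N:ℝ) ^ (480 * a) ≤ 2 * (((p0 ^ j : ℕ) : ℝ) * D) := by exact_mod_cast hPD
      have h2 := mul_le_mul_of_nonneg_right hTr hP0.le
      nlinarith
    have h3 := log_le_log (by positivity) h1
    rw [log_div (by positivity) (by norm_num), log_pow] at h3
    have h4 : log 4000 ≤ 9 := by
      rw [Real.log_le_iff_le_exp (by norm_num)]
      have : (2.7 : ℝ) ^ 9 ≤ exp 1 ^ 9 := pow_le_pow_left₀ (by norm_num) (by linarith [Real.exp_one_gt_d9]) 9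
      rw [← Real.exp_nat_mul] at this
      norm_num at this ⊢
      linarith
    push_cast at h3
    push_cast
    linarith
  · calc _ ≤ Z * (((monsd 2 d D).card : ℝ) * (((E + 1 + 1000 * a * d : ℕ):ℝ) * (log N / N))) := mul_le_mul_of_nonneg_left hsing hZ0.le
      _ ≤ Z * (Z ^ 2 * log N) := by
        refine mul_le_mul_of_nonneg_left ?_ hZ0.le
        exact mul_le_mul hR2 (hratio _ hK2) (by positivity) (by positivity)
      _ = Z ^ 3 * log N := by ring
  · have := mul_le_mul_of_nonneg_right he0' hlP
    linarith

/-- homogeneous monomial value at the integral point `t = (x, w)` -/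
noncomputable def ent {n : ℕ} (e : ℕ) (t : (Fin n → ℤ) × ℤ) (m : Fin n →₀ ℕ) : ℤ := (∏ i, t.1 i ^ m i) * t.2 ^ (e - m.degree)

/-- the rational point `x / w` -/
noncomputable def rp {n : ℕ} (t : (Fin n → ℤ) × ℤ) : Fin n → ℚ := fun i => (t.1 i : ℚ) / (t.2 : ℚ)

theorem ent_rp {n e : ℕ} (t : (Fin n → ℤ) × ℤ) (ht : t.2 ≠ 0) (m : Fin n →₀ ℕ) (hm : m.degree ≤ e) :
    ((ent e t m : ℤ) : ℚ) = (t.2 : ℚ) ^ e * ∏ i, rp t i ^ m i := by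
  have ht' : (t.2 : ℚ) ≠ 0 := by exact_mod_cast ht
  have h1 : ∏ i, rp t i ^ m i = (∏ i, (t.1 i : ℚ) ^ m i) / (t.2 : ℚ) ^ m.degree := by
    simp only [rp, div_pow]
    rw [prod_div_distrib, prod_pow_eq_pow_sum, ← degree_eq_sum]
  rw [h1, ent]
  push_cast
  have h2 : (t.2 : ℚ) ^ e = (t.2 : ℚ) ^ (e - m.degree) * (t.2 : ℚ) ^ m.degree := by rw [← pow_add, Nat.sub_add_cancel hm]
  rw [h2]
  field_simp

theorem eval_polyOf_rp {n e : ℕ} (s : Finset (Fin n →₀ ℕ)) (hs : s ⊆ mons n e) (c : s → ℚ) (t : (Fin n → ℤ) × ℤ) (ht : t.2 ≠ 0) :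
    (t.2 : ℚ) ^ e * eval (rp t) (polyOf s c) = ∑ m, c m * ((ent e t m.1 : ℤ) : ℚ) := by
  rw [polyOf, map_sum, mul_sum]
  refine sum_congr rfl fun m _ => ?_
  rw [ent_rp t ht m.1 (mem_mons.mp (hs m.2)), eval_monomial, prod_fintype _ _ (by simp)]
  ring

theorem ent_abs_le {n e : ℕ} (t : (Fin n → ℤ) × ℤ) (m : Fin n →₀ ℕ) (V W : ℤ) (hV : ∀ i, |t.1 i| ≤ V) (hW : |t.2| ≤ W) :
    |ent e t m| ≤ V ^ m.degree * W ^ (e - m.degree) := by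
  rw [ent, abs_mul, abs_prod, abs_pow]
  have h1 : ∏ i, |t.1 i ^ (m i)| ≤ ∏ i, V ^ (m i) := prod_le_prod (fun _ _ => abs_nonneg _) fun i _ => by
    rw [abs_pow]; exact pow_le_pow_left₀ (abs_nonneg _) (hV i) _
  rw [prod_pow_eq_pow_sum, ← degree_eq_sum] at h1
  exact mul_le_mul h1 (pow_le_pow_left₀ (abs_nonneg _) hW _) (by positivity) ((prod_nonneg fun _ _ => abs_nonneg _).trans h1)

theorem height_dichotomy_proj {n : ℕ} (k : MP n ℚ) (e : ℕ) (hk : k.totalDegree = e) (hk0 : k ≠ 0)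
    (S : Set ((Fin n → ℤ) × ℤ)) (V : ℕ) (hV : 1 ≤ V) (hS : ∀ t ∈ S, (∀ i, |t.1 i| ≤ (V:ℤ)) ∧ |t.2| ≤ V ∧ t.2 ≠ 0)
    (hz : ∀ t ∈ S, eval (rp t) k = 0) :
    (∃ g : MP n ℚ, g.totalDegree ≤ e ∧ ¬ k ∣ g ∧ ∀ t ∈ S, eval (rp t) g = 0) ∨
    ∃ (k1 : MP n ℤ) (t : ℚ), t ≠ 0 ∧ map toℚ k1 = C t * k ∧
      nrm 1 k1 ≤ (mons n e).card * ((mons n e).card.factorial * ((V:ℝ) ^ e) ^ (mons n e).card) := by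
  classical
  have hsup : k.support ⊆ mons n e := fun m hm => mem_mons.mpr (by
    rw [← hk]; exact le_totalDegree hm)
  have hk' := exists_polyOf (mons n e) k hsup
  by_cases huniq : ∀ c : mons n e → ℚ, (∀ x ∈ S, ∑ m, c m * ((ent e x m.1 : ℤ) : ℚ) = 0) →
      ∃ t : ℚ, c = t • (fun m : mons n e => coeff m.1 k)
  · right
    obtain ⟨c₁, t, ht, hc1, hcb⟩ := exists_small_relation (fun (x : (Fin n → ℤ) × ℤ) (m : mons n e) => ent e x m.1) S (V ^ e) (by
      intro x hx m
      refine (ent_abs_le x m.1 V V (hS x hx).1 (hS x hx).2.1).trans ?_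
      rw [← pow_add, Nat.add_sub_cancel' (mem_mons.mp m.2)]
      push_cast; exact le_rfl) (Nat.one_le_pow _ _ hV)
      (fun m => coeff m.1 k) (by
        intro h0
        apply hk0
        rw [hk', h0]
        simp [polyOf]) (by
        intro x hx
        rw [← eval_polyOf_rp _ subset_rfl _ x (hS x hx).2.2, ← hk', hz x hx, mul_zero]) huniq
    refine ⟨polyOf (mons n e) c₁, t, ht, ?_, ?_⟩
    · rw [hk', polyOf, polyOf, map_sum, mul_sum]
      refine sum_congr rfl fun m _ => ?_
      rw [map_monomial, C_mul_monomial, ← hc1]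
      rfl
    · rw [nrm_eq 1 _ (mons n e) (support_polyOf _ _)]
      refine (sum_le_card_nsmul _ _ (((mons n e).card.factorial * ((V:ℝ) ^ e) ^ (mons n e).card)) fun m hm => ?_).trans
        (le_of_eq (nsmul_eq_mul _ _))
      rw [one_pow, mul_one, show coeff m (polyOf (mons n e) c₁) = c₁ ⟨m, hm⟩ from coeff_polyOf _ c₁ ⟨m, hm⟩]
      have := hcb ⟨m, hm⟩
      rw [Fintype.card_coe] at this
      rw [← Int.cast_abs]
      exact_mod_cast this
  · left
    push Not at huniq
    obtain ⟨c, hc, hne⟩ := huniq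
    refine ⟨polyOf (mons n e) c, totalDegree_of_supp _ (support_polyOf _ _), ?_, fun x hx => ?_⟩
    rotate_left
    · have h1 := eval_polyOf_rp _ subset_rfl c x (hS x hx).2.2
      rw [hc x hx] at h1
      exact (mul_eq_zero.mp h1).resolve_left (pow_ne_zero _ (by exact_mod_cast (hS x hx).2.2))
    rintro ⟨w, hw⟩
    have hwc : ∃ t, w = C t := by
      by_cases hw0 : w = 0
      · exact ⟨0, by rw [hw0, map_zero]⟩
      have h1 := totalDegree_mul_of_isDomain hk0 hw0
      rw [← hw, hk] at h1
      have h2 : (polyOf (mons n e) c).totalDegree ≤ e := totalDegree_of_supp _ (support_polyOf _ _)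
      exact ⟨_, totalDegree_eq_zero_iff_eq_C.mp (by omega)⟩
    obtain ⟨t, rfl⟩ := hwc
    apply hne t
    funext m
    rw [← coeff_polyOf (mons n e) c m, hw, mul_comm, coeff_C_mul]
    rfl

theorem rp_one {n : ℕ} (x : Fin n → ℤ) : rp (x, 1) = fun i => (x i : ℚ) := by
  funext i; simp [rp]

theorem height_dichotomy {n : ℕ} (k : MP n ℚ) (e : ℕ) (hk : k.totalDegree = e) (hk0 : k ≠ 0)
    (S : Set (Fin n → ℤ)) (V : ℕ) (hV : 1 ≤ V) (hS : ∀ x ∈ S, ∀ i, |x i| ≤ (V:ℤ)) (hz : ∀ x ∈ S, eval (fun i => (x i : ℚ)) k = 0) :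
    (∃ g : MP n ℚ, g.totalDegree ≤ e ∧ ¬ k ∣ g ∧ ∀ x ∈ S, eval (fun i => (x i : ℚ)) g = 0) ∨
    ∃ (k1 : MP n ℤ) (t : ℚ), t ≠ 0 ∧ map toℚ k1 = C t * k ∧
      nrm 1 k1 ≤ (mons n e).card * ((mons n e).card.factorial * ((V:ℝ) ^ e) ^ (mons n e).card) := by
  rcases height_dichotomy_proj k e hk hk0 {t | t.1 ∈ S ∧ t.2 = 1} V hV (by
    rintro ⟨x, w⟩ ⟨hx, hw⟩
    simp only at hx hw
    subst hw
    exact ⟨hS x hx, by simpa using hV, one_ne_zero⟩) (by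
    rintro ⟨x, w⟩ ⟨hx, hw⟩
    simp only at hx hw
    subst hw
    rw [rp_one]; exact hz x hx) with ⟨g, h1, h2, h3⟩ | h
  · refine Or.inl ⟨g, h1, h2, fun x hx => ?_⟩
    rw [← rp_one]
    exact h3 (x, 1) ⟨hx, rfl⟩
  · exact Or.inr h

theorem deriv_line {r : ℕ} (f : MP (r + 1) A) (τ : Fin r → A) :
    derivative (aeval (Fin.cons PX (fun i => CX (τ i)) : Fin (r + 1) → Polynomial A) f) =
      aeval (Fin.cons PX (fun i => CX (τ i)) : Fin (r + 1) → Polynomial A) (pderiv 0 f) := by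
  induction f using induction_on with
  | C a => simp
  | add p q hp hq => simp only [map_add, hp, hq]
  | mul_X p i hp =>
    rw [map_mul, derivative_mul, hp, aeval_X, Derivation.leibniz, map_add]
    refine Fin.cases ?_ (fun i => ?_) i
    · simp [pderiv_X_self]; ring
    · simp [pderiv_X_of_ne (succ_ne_zero i).symm, pderiv_X_of_ne (succ_ne_zero i)]; ring

theorem eval_line {r : ℕ} (f : MP (r + 1) A) (τ : Fin r → A) (z : A) :
    Polynomial.eval z (aeval (Fin.cons PX (fun i => CX (τ i)) : Fin (r + 1) → Polynomial A) f) =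
      eval (Fin.cons z τ : Fin (r + 1) → A) f := by
  induction f using induction_on with
  | C a => simp
  | add p q hp hq => simp only [map_add, Polynomial.eval_add, hp, hq]
  | mul_X p i hp =>
    rw [map_mul, Polynomial.eval_mul, hp, aeval_X, map_mul, eval_X]
    refine Fin.cases ?_ (fun i => ?_) i <;> simp

theorem hensel_unique {r : ℕ} (f : MP (r + 1) ℤ) (p j : ℕ) (hp : p.Prime) (x y : Fin (r + 1) → ℤ)
    (hx : ((p ^ j : ℕ) : ℤ) ∣ eval x f) (hx' : ¬ (p:ℤ) ∣ eval x (pderiv 0 f)) (hy : ((p ^ j : ℕ) : ℤ) ∣ eval y f)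
    (h0 : (p:ℤ) ∣ x 0 - y 0) (ht : ∀ i : Fin r, ((p ^ j : ℕ) : ℤ) ∣ x i.succ - y i.succ) : ((p ^ j : ℕ) : ℤ) ∣ x 0 - y 0 := by
  have h1 : ((p ^ j : ℕ) : ℤ) ∣ eval (Fin.cons (y 0) (fun i => x i.succ) : Fin (r + 1) → ℤ) f - eval y f := by
    refine eval_congr_dvd f _ _ _ (Fin.cases (by simp) fun i => ?_)
    simpa using ht i
  have h2 : ((p ^ j : ℕ) : ℤ) ∣ eval (Fin.cons (y 0) (fun i => x i.succ) : Fin (r + 1) → ℤ) f := by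
    have := dvd_add h1 hy; rwa [sub_add_cancel] at this
  have hxe : x = (Fin.cons (x 0) (fun i => x i.succ) : Fin (r + 1) → ℤ) := by
    funext i; refine Fin.cases ?_ (fun i => ?_) i <;> simp
  rw [hxe] at hx hx'
  rw [← eval_line] at h2 hx hx'
  rw [← deriv_line] at hx'
  obtain ⟨G, hG⟩ : ∃ G, G = aeval (Fin.cons PX (fun i => CX (x (Fin.succ i))) : Fin (r + 1) → Polynomial ℤ) f := ⟨_, rfl⟩
  rw [← hG] at h2 hx hx'
  obtain ⟨k, hk⟩ := G.binomExpansion (x 0) (y 0 - x 0)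
  rw [add_sub_cancel] at hk
  obtain ⟨w, hw⟩ := h0
  have h3 : ((p ^ j : ℕ) : ℤ) ∣ (x 0 - y 0) * (Polynomial.eval (x 0) (derivative G) - k * (p * w)) := by
    have : (x 0 - y 0) * (Polynomial.eval (x 0) (derivative G) - k * (p * w)) = Polynomial.eval (x 0) G - Polynomial.eval (y 0) G := by
      rw [hk, ← hw]; ring
    rw [this]; exact dvd_sub hx h2
  refine IsCoprime.dvd_of_dvd_mul_right ?_ h3
  push_cast
  refine IsCoprime.pow_left ((Prime.coprime_iff_not_dvd (Nat.prime_iff_prime_int.mp hp)).mpr ?_)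
  intro h
  apply hx'
  have h5 : (p:ℤ) ∣ k * (p * w) := ⟨k * w, by ring⟩
  have := dvd_add h h5
  rwa [sub_add_cancel] at this

theorem class_count {r : ℕ} (f : MP (r + 1) ℤ) (d : ℕ) (hd : f.totalDegree ≤ d) (hd1 : 1 ≤ d) (p j : ℕ) (hp : p.Prime)
    (S : Finset (Fin (r + 1) → ℤ)) (hS : ∀ x ∈ S, ((p ^ j : ℕ) : ℤ) ∣ eval x f ∧ ¬ (p:ℤ) ∣ eval x (pderiv 0 f)) :
    (S.image (fun x t => ((x t : ℤ) : ZMod (p ^ j)))).card ≤ d * (p ^ j) ^ r := by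
  classical
  haveI : Fact p.Prime := ⟨hp⟩
  haveI : NeZero (p ^ j) := ⟨pow_ne_zero _ hp.ne_zero⟩
  rcases Nat.eq_zero_or_pos j with rfl | hj
  · refine le_trans (card_le_one.mpr ?_) (by simpa using hd1)
    intro a _ b _
    haveI : Subsingleton (ZMod (p ^ 0)) := by rw [pow_zero]; infer_instance
    exact Subsingleton.elim _ _
  obtain ⟨T, hT⟩ : ∃ T, T = S.image (fun x t => ((x t : ℤ) : ZMod (p ^ j))) := ⟨_, rfl⟩
  rw [← hT]
  have hmain := card_le_mul_card_image (f := fun v : Fin (r + 1) → ZMod (p ^ j) => Fin.tail v) T d ?_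
  · refine hmain.trans (Nat.mul_le_mul_left _ ?_)
    refine (card_le_univ _).trans (le_of_eq ?_)
    rw [Fintype.card_fun, ZMod.card, Fintype.card_fin]
  intro τ hτ
  rw [mem_image] at hτ
  obtain ⟨v0, hv0, rfl⟩ := hτ
  rw [hT, mem_image] at hv0
  obtain ⟨x0, hx0, rfl⟩ := hv0
  have hpP : p ∣ p ^ j := dvd_pow_self p (by omega)
  have hred : ∀ a : ℤ, ZMod.castHom hpP (ZMod p) (a : ZMod (p ^ j)) = (a : ZMod p) := fun a => map_intCast _ a
  obtain ⟨G, hG⟩ : ∃ G, G = aeval (Fin.cons PX (fun i => CX ((x0 (Fin.succ i) : ℤ) : ZMod p)) : Fin (r + 1) → Polynomial (ZMod p)) (map (Int.castRingHom (ZMod p)) f) := ⟨_, rfl⟩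
  have hfib : ∀ y ∈ S, (∀ i : Fin r, ((y i.succ : ℤ) : ZMod (p ^ j)) = ((x0 i.succ : ℤ) : ZMod (p ^ j))) →
      (Fin.cons ((y 0 : ℤ) : ZMod p) (fun i => ((x0 (Fin.succ i) : ℤ) : ZMod p)) : Fin (r + 1) → ZMod p) = fun t => ((y t : ℤ) : ZMod p) := by
    intro y _ hy
    funext t
    refine Fin.cases ?_ (fun i => ?_) t
    · simp
    · simp only [cons_succ]
      rw [← hred, ← hred, hy i]
  have hev : ∀ (g : MP (r + 1) ℤ) (y : Fin (r + 1) → ℤ), eval (fun t => ((y t : ℤ) : ZMod p)) (map (Int.castRingHom (ZMod p)) g) = ((eval y g : ℤ) : ZMod p) := by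
    intro g y
    rw [eval_map]
    exact (eval₂_comp (Int.castRingHom (ZMod p)) y g).symm
  have hroot : ∀ y ∈ S, (∀ i : Fin r, ((y i.succ : ℤ) : ZMod (p ^ j)) = ((x0 i.succ : ℤ) : ZMod (p ^ j))) →
      Polynomial.eval ((y 0 : ℤ) : ZMod p) G = 0 ∧ Polynomial.eval ((y 0 : ℤ) : ZMod p) (derivative G) ≠ 0 := by
    intro y hyS hy
    constructor
    · rw [hG, eval_line, hfib y hyS hy, hev, ZMod.intCast_zmod_eq_zero_iff_dvd]
      exact dvd_trans (by exact_mod_cast hpP) (hS y hyS).1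
    · rw [hG, deriv_line, eval_line, hfib y hyS hy, pderiv_map, hev, ne_eq, ZMod.intCast_zmod_eq_zero_iff_dvd]
      exact (hS y hyS).2
  have hG0 : G ≠ 0 := by
    intro h0
    have := (hroot x0 hx0 fun _ => rfl).2
    rw [h0] at this; simp at this
  have hGd : G.natDegree ≤ d := by
    rw [hG]
    have := aeval_natDegree_le (m := d) (n := 1) (map (Int.castRingHom (ZMod p)) f) ((totalDegree_map_le' _ f).trans hd)
      (Fin.cons PX (fun i => CX ((x0 (Fin.succ i) : ℤ) : ZMod p)) : Fin (r + 1) → Polynomial (ZMod p)) (Fin.cases (by simp) (by simp))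
    simpa using this
  refine le_trans ?_ hGd
  refine le_trans ?_ (card_roots' G)
  refine le_trans ?_ (Multiset.toFinset_card_le G.roots)
  refine card_le_card_of_injOn (fun v => ZMod.castHom hpP (ZMod p) (v 0)) ?_ ?_
  · intro v hv
    simp only [coe_filter, Set.mem_setOf_eq] at hv
    obtain ⟨hvT, hvt⟩ := hv
    rw [hT, mem_image] at hvT
    obtain ⟨y, hy, rfl⟩ := hvT
    simp only [mem_coe, Multiset.mem_toFinset]
    rw [mem_roots hG0, IsRoot, hred]
    exact (hroot y hy fun i => congrFun hvt i).1
  · intro v hv v' hv' hvv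
    simp only [coe_filter, Set.mem_setOf_eq] at hv hv'
    obtain ⟨hvT, hvt⟩ := hv
    obtain ⟨hvT', hvt'⟩ := hv'
    rw [hT, mem_image] at hvT hvT'
    obtain ⟨y, hy, rfl⟩ := hvT
    obtain ⟨y', hy', rfl⟩ := hvT'
    have hte : ∀ i : Fin r, ((y i.succ : ℤ) : ZMod (p ^ j)) = ((y' i.succ : ℤ) : ZMod (p ^ j)) := fun i =>
      (congrFun hvt i).trans (congrFun hvt' i).symm
    have hz := hensel_unique f p j hp y y' (hS y hy).1 (hS y hy).2 (hS y' hy').1 (by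
      have hvv' : ((y 0 : ℤ) : ZMod p) = ((y' 0 : ℤ) : ZMod p) := by
        have := hvv
        simp only [hred] at this
        exact this
      rw [← ZMod.intCast_zmod_eq_zero_iff_dvd, Int.cast_sub, hvv', sub_self]) (fun i => by
      rw [← ZMod.intCast_zmod_eq_zero_iff_dvd, Int.cast_sub, hte i, sub_self])
    funext t
    refine Fin.cases ?_ (fun i => hte i) t
    rw [← ZMod.intCast_zmod_eq_zero_iff_dvd, Int.cast_sub, sub_eq_zero] at hz
    exact hz

theorem ent_congr {n e : ℕ} (t : (Fin n → ℤ) × ℤ) (Q w' : ℤ) (hw : Q ∣ t.2 * w' - 1) (m : Fin n →₀ ℕ) (hm : m.degree ≤ e) :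
    Q ∣ ent e t m - t.2 ^ e * ∏ i, (t.1 i * w') ^ m i := by
  have h1 : ∏ i, (t.1 i * w') ^ m i = (∏ i, t.1 i ^ m i) * w' ^ m.degree := by
    simp only [mul_pow]
    rw [prod_mul_distrib, prod_pow_eq_pow_sum, ← degree_eq_sum]
  have h2 : t.2 ^ e = t.2 ^ (e - m.degree) * t.2 ^ m.degree := by rw [← pow_add, Nat.sub_add_cancel hm]
  have h3 : Q ∣ (t.2 * w') ^ m.degree - 1 := by
    have := sub_dvd_pow_sub_pow (t.2 * w') 1 m.degree
    rw [one_pow] at this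
    exact hw.trans this
  rw [h1, ent, h2]
  have h4 : (∏ i, t.1 i ^ m i) * t.2 ^ (e - m.degree) - t.2 ^ (e - m.degree) * t.2 ^ m.degree * ((∏ i, t.1 i ^ m i) * w' ^ m.degree)
      = - ((∏ i, t.1 i ^ m i) * t.2 ^ (e - m.degree)) * ((t.2 * w') ^ m.degree - 1) := by rw [mul_pow]; ring
  rw [h4]
  exact Dvd.dvd.mul_left h3 _

/-- homogenised value -/
noncomputable def hv {n : ℕ} (k : MP n ℤ) (e : ℕ) (t : (Fin n → ℤ) × ℤ) : ℤ := ∑ m ∈ mons n e, coeff m k * ent e t m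

theorem eval_mons {n e : ℕ} (k : MP n A) (hk : k.totalDegree ≤ e) (x : Fin n → A) :
    eval x k = ∑ m ∈ mons n e, coeff m k * ∏ i, x i ^ m i := by
  rw [eval_eq']
  refine sum_subset (fun m hm => mem_mons.mpr ((le_totalDegree hm).trans hk)) fun m _ hm => ?_
  rw [notMem_support_iff.mp hm, zero_mul]

theorem hv_rp {n e : ℕ} (k : MP n ℤ) (hk : k.totalDegree ≤ e) (t : (Fin n → ℤ) × ℤ) (ht : t.2 ≠ 0) :
    ((hv k e t : ℤ) : ℚ) = (t.2 : ℚ) ^ e * eval (rp t) (map toℚ k) := by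
  rw [eval_mons (e := e) _ ((totalDegree_map_le' _ k).trans hk), hv, mul_sum]
  push_cast
  refine sum_congr rfl fun m hm => ?_
  rw [ent_rp t ht m (mem_mons.mp hm), coeff_map]
  simp only [eq_intCast]
  ring

theorem hv_congr {n e : ℕ} (k : MP n ℤ) (hk : k.totalDegree ≤ e) (t : (Fin n → ℤ) × ℤ) (Q w' : ℤ) (hw : Q ∣ t.2 * w' - 1) :
    Q ∣ hv k e t - t.2 ^ e * eval (fun i => t.1 i * w') k := by
  rw [eval_mons (e := e) k hk, hv, mul_sum, ← sum_sub_distrib]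
  refine dvd_sum fun m hm => ?_
  have := ent_congr t Q w' hw m (mem_mons.mp hm)
  have h2 : coeff m k * ent e t m - t.2 ^ e * (coeff m k * ∏ i, (t.1 i * w') ^ m i) =
    coeff m k * (ent e t m - t.2 ^ e * ∏ i, (t.1 i * w') ^ m i) := by ring
  rw [h2]
  exact Dvd.dvd.mul_left this _

theorem hv_abs_le {n e : ℕ} (k : MP n ℤ) (hk : k.totalDegree ≤ e) (t : (Fin n → ℤ) × ℤ) (V : ℕ)
    (hV : ∀ i, |t.1 i| ≤ (V:ℤ)) (hW : |t.2| ≤ (V:ℤ)) : |((hv k e t : ℤ) : ℝ)| ≤ nrm 1 k * (V:ℝ) ^ e := by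
  rw [nrm_eq 1 k (mons n e) (fun m hm => mem_mons.mpr ((le_totalDegree hm).trans hk)), hv, sum_mul]
  push_cast
  refine (abs_sum_le_sum_abs _ _).trans (sum_le_sum fun m hm => ?_)
  rw [abs_mul, one_pow, mul_one]
  refine mul_le_mul_of_nonneg_left ?_ (abs_nonneg _)
  have := ent_abs_le (e := e) t m V V hV hW
  rw [← pow_add, Nat.add_sub_cancel' (mem_mons.mp hm)] at this
  rw [← Int.cast_abs]
  exact_mod_cast this

theorem exists_inv_mod (q m : ℕ) (hq : q.Prime) (w : ℤ) (hw : ¬ (q:ℤ) ∣ w) : ∃ w' : ℤ, ((q:ℤ) ^ m) ∣ w * w' - 1 := by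
  have h : IsCoprime w ((q:ℤ) ^ m) := by
    apply IsCoprime.pow_right
    exact ((Nat.prime_iff_prime_int.mp hq).coprime_iff_not_dvd.mpr hw).symm
  obtain ⟨a, b, hab⟩ := h
  exact ⟨a, ⟨-b, by linear_combination hab⟩⟩

theorem class_relation (k : MP 2 ℤ) (κ D q : ℕ) (hq : q.Prime) (T : Set ((Fin 2 → ℤ) × ℤ)) (cl : Fin 2 → ℤ)
    (V W : ℕ) (hT : ∀ t ∈ T, (∀ i, |t.1 i| ≤ (V:ℤ)) ∧ |t.2| ≤ (W:ℤ) ∧ ¬ (q:ℤ) ∣ t.2 ∧ eval (rp t) (map toℚ k) = 0 ∧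
      ∀ i, (q:ℤ) ∣ t.1 i - t.2 * cl i) (hcl : ¬ (q:ℤ) ∣ eval cl (pderiv 0 k))
    (hbig : ((monsd 1 κ D).card.factorial : ℝ) * ∏ m ∈ monsd 1 κ D, ((V:ℝ) ^ m.degree * (W:ℝ) ^ (D - m.degree)) <
      (q:ℝ) ^ ((monsd 1 κ D).card * (monsd 1 κ D).card - ((monsd 1 κ D).card + 1).choose 2)) :
    ∃ g : MP 2 ℚ, g ≠ 0 ∧ g.support ⊆ monsd 1 κ D ∧ ∀ t ∈ T, eval (rp t) g = 0 := by
  classical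
  have hq0 : ∀ t ∈ T, t.2 ≠ 0 := fun t ht h0 => (hT t ht).2.2.1 (by rw [h0]; exact dvd_zero _)
  by_contra hcon
  push Not at hcon
  obtain ⟨p, hp, hdet⟩ := exists_det_ne_zero (fun (t : (Fin 2 → ℤ) × ℤ) (m : monsd 1 κ D) => ((ent D t m.1 : ℤ) : ℚ)) T (by
    intro c hc
    by_contra hc0
    obtain ⟨t, ht, h⟩ := hcon (polyOf (monsd 1 κ D) c) (polyOf_ne_zero _ _ hc0) (support_polyOf _ _)
    apply h
    have h1 := eval_polyOf_rp _ (monsd_subset 1 κ D) c t (hq0 t ht)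
    rw [hc t ht] at h1
    exact (mul_eq_zero.mp h1).resolve_left (pow_ne_zero _ (by exact_mod_cast hq0 t ht)))
  obtain ⟨M, hM⟩ : ∃ M : Matrix (monsd 1 κ D) (monsd 1 κ D) ℤ, M = Matrix.of fun i j => ent D (p i) j.1 := ⟨_, rfl⟩
  have hMdet : M.det ≠ 0 := by
    intro h0
    apply hdet
    have : (Matrix.of fun i j => ((ent D (p i) (j : monsd 1 κ D).1 : ℤ) : ℚ)) = (toℚ).mapMatrix M := by
      rw [hM]; rfl
    rw [this, ← RingHom.map_det, h0, map_zero]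
  obtain ⟨R, hR⟩ : ∃ R, R = (monsd 1 κ D).card := ⟨_, rfl⟩
  have hdvd := det_dvd_classes (r := 1) k (fun j : monsd 1 κ D => monomial j.1 (1:ℤ)) M univ {cl} (q:ℤ) R (by
    intro i _
    obtain ⟨h1, h2, h3, h4, h5⟩ := hT (p i) (hp i)
    obtain ⟨w', hw'⟩ := exists_inv_mod q R hq _ h3
    obtain ⟨v, hv'⟩ := exists_inv_mod q 1 hq _ hcl
    rw [pow_one] at hv'
    refine ⟨fun i' => (p i).1 i' * w', (p i).2 ^ D, fun j => ?_, ?_, cl, by simp, fun i' => ?_, v, by rwa [mul_comm]⟩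
    · rw [hM, Matrix.of_apply, eval_monomial, one_mul, prod_fintype _ _ (by simp)]
      exact ent_congr (p i) _ w' hw' j.1 (mem_mons.mp (monsd_subset _ _ _ j.2))
    · have h6 := hv_congr k le_rfl (p i) _ w' hw'
      have h7 : hv k k.totalDegree (p i) = 0 := by
        have := hv_rp k le_rfl (p i) (hq0 _ (hp i))
        rw [h4, mul_zero] at this
        exact_mod_cast this
      rw [h7, zero_sub, dvd_neg] at h6
      exact IsCoprime.dvd_of_dvd_mul_left (IsCoprime.pow ((Nat.prime_iff_prime_int.mp hq).coprime_iff_not_dvd.mpr h3)) h6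
    · rcases Nat.eq_zero_or_pos R with h0 | h0
      · exfalso
        rw [h0] at hR
        exact absurd (card_pos.mpr ⟨i.1, i.2⟩) (by omega)
      have h6 : (q:ℤ) ∣ (p i).2 * w' - 1 := (dvd_pow_self _ (by omega)).trans hw'
      have h7 : (p i).1 i' * w' - cl i' = ((p i).1 i' - (p i).2 * cl i') * w' + cl i' * ((p i).2 * w' - 1) := by ring
      rw [h7]
      exact dvd_add (Dvd.dvd.mul_right (h5 i') _) (Dvd.dvd.mul_left h6 _))
  rw [card_univ, Fintype.card_coe, card_singleton, one_mul, hR] at hdvd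
  have hle := Int.le_of_dvd (abs_pos.mpr hMdet) ((dvd_abs _ _).mpr hdvd)
  have hub := det_abs_le M (fun j => (V:ℝ) ^ j.1.degree * (W:ℝ) ^ (D - j.1.degree)) (by
    intro i j
    rw [hM, Matrix.of_apply, ← Int.cast_abs]
    have := ent_abs_le (e := D) (p i) j.1 V W (hT _ (hp i)).1 (hT _ (hp i)).2.1
    exact_mod_cast this)
  rw [Fintype.card_coe, prod_coe_sort (monsd 1 κ D) (fun m => (V:ℝ) ^ m.degree * (W:ℝ) ^ (D - m.degree)), ← Int.cast_abs] at hub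
  have hle' : (q:ℝ) ^ ((monsd 1 κ D).card * (monsd 1 κ D).card - ((monsd 1 κ D).card + 1).choose 2) ≤ ((|M.det| : ℤ) : ℝ) := by
    exact_mod_cast hle
  linarith

/-- points of one curve not missed by the prime `q` -/
theorem prime_count (k : MP 2 ℤ) (e : ℕ) (hd : k.totalDegree = e) (he1 : 1 ≤ e)
    (hirr : Irreducible (map toℚ k)) (hc : coeff (single 0 e) k ≠ 0)
    (κ D q : ℕ) (hκ : κ ≤ e) (hq : q.Prime) (T : Finset ((Fin 2 → ℤ) × ℤ))
    (V W : ℕ) (hT : ∀ t ∈ T, (∀ i, |t.1 i| ≤ (V:ℤ)) ∧ |t.2| ≤ (W:ℤ) ∧ ¬ (q:ℤ) ∣ t.2 ∧ eval (rp t) (map toℚ k) = 0 ∧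
      ¬ (q:ℤ) ∣ hv (pderiv 0 k) e t)
    (hbig : ((monsd 1 κ D).card.factorial : ℝ) * ∏ m ∈ monsd 1 κ D, ((V:ℝ) ^ m.degree * (W:ℝ) ^ (D - m.degree)) <
      (q:ℝ) ^ ((monsd 1 κ D).card * (monsd 1 κ D).card - ((monsd 1 κ D).card + 1).choose 2)) :
    (T.image rp).card ≤ (e * q) * (e * D) := by
  classical
  have hq0 : ∀ t ∈ T, t.2 ≠ 0 := fun t ht h0 => (hT t ht).2.2.1 (by rw [h0]; exact dvd_zero _)
  have hinv : ∀ t : (Fin 2 → ℤ) × ℤ, ∃ w' : ℤ, t ∈ T → (q:ℤ) ∣ t.2 * w' - 1 := by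
    intro t
    by_cases ht : t ∈ T
    · obtain ⟨w', h⟩ := exists_inv_mod q 1 hq _ (hT t ht).2.2.1
      exact ⟨w', fun _ => by rwa [pow_one] at h⟩
    · exact ⟨0, fun h => absurd h ht⟩
  choose w' hw' using hinv
  obtain ⟨pt, hpt⟩ : ∃ pt : (Fin 2 → ℤ) × ℤ → (Fin 2 → ℤ), pt = fun t i => t.1 i * w' t := ⟨_, rfl⟩
  have hcc := class_count (r := 1) k e hd.le he1 q 1 hq (T.image pt) (by
    intro x hx
    obtain ⟨t, ht, rfl⟩ := mem_image.mp hx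
    obtain ⟨h1, h2, h3, h4, h5⟩ := hT t ht
    rw [pow_one]
    constructor
    · have h6 := hv_congr k hd.le t _ (w' t) (hw' t ht)
      have h7 : hv k e t = 0 := by
        have := hv_rp k hd.le t (hq0 _ ht)
        rw [h4, mul_zero] at this
        exact_mod_cast this
      rw [h7, zero_sub, dvd_neg] at h6
      rw [hpt]
      exact ((Nat.prime_iff_prime_int.mp hq).dvd_or_dvd h6).resolve_left (fun h => h3 ((Nat.prime_iff_prime_int.mp hq).dvd_of_dvd_pow h))
    · intro h8
      have h6 := hv_congr (pderiv 0 k) ((totalDegree_pderiv_le 0 k).trans hd.le) t _ (w' t) (hw' t ht)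
      apply h5
      rw [hpt] at h8
      have := dvd_add h6 (Dvd.dvd.mul_left h8 (t.2 ^ e))
      rwa [sub_add_cancel] at this)
  rw [pow_one, pow_one] at hcc
  obtain ⟨cls, hcls⟩ : ∃ cls : (Fin 2 → ℤ) × ℤ → (Fin 2 → ZMod q), cls = fun t i => ((pt t i : ℤ) : ZMod q) := ⟨_, rfl⟩
  have himg : (T.image cls).card ≤ e * q := by
    refine le_trans (le_of_eq ?_) hcc
    rw [image_image, hcls]
    rfl
  have hcover : T.image rp ⊆ (T.image cls).biUnion (fun z => (T.filter (fun t => cls t = z)).image rp) := by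
    intro y hy
    obtain ⟨t, ht, rfl⟩ := mem_image.mp hy
    exact mem_biUnion.mpr ⟨cls t, mem_image_of_mem _ ht, mem_image_of_mem _ (mem_filter.mpr ⟨ht, rfl⟩)⟩
  refine (card_le_card hcover).trans (le_trans (card_biUnion_le_card_mul _ _ (e * D) ?_) (Nat.mul_le_mul_right _ himg))
  intro z hz
  obtain ⟨t0, ht0, rfl⟩ := mem_image.mp hz
  have hder : ¬ (q:ℤ) ∣ eval (pt t0) (pderiv 0 k) := by
    intro h8
    have h6 := hv_congr (pderiv 0 k) ((totalDegree_pderiv_le 0 k).trans hd.le) t0 _ (w' t0) (hw' t0 ht0)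
    apply (hT t0 ht0).2.2.2.2
    rw [hpt] at h8
    have := dvd_add h6 (Dvd.dvd.mul_left h8 (t0.2 ^ e))
    rwa [sub_add_cancel] at this
  obtain ⟨g, hg0, hgs, hg⟩ := class_relation k κ D q hq {t | t ∈ T ∧ cls t = cls t0} (pt t0) V W (by
    rintro t ⟨ht, htc⟩
    obtain ⟨h1, h2, h3, h4, h5⟩ := hT t ht
    refine ⟨h1, h2, h3, h4, fun i => ?_⟩
    have h6 : (q:ℤ) ∣ pt t i - pt t0 i := by
      have := congrFun htc i
      rw [hcls] at this
      simp only at this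
      rw [← ZMod.intCast_zmod_eq_zero_iff_dvd]
      push_cast
      rw [this, sub_self]
    have h7 : t.1 i - t.2 * pt t0 i = t.2 * (pt t i - pt t0 i) - t.1 i * (t.2 * w' t - 1) := by
      rw [hpt]; ring
    rw [h7]
    exact dvd_sub (Dvd.dvd.mul_left h6 _) (Dvd.dvd.mul_left (hw' t ht) _)) hder hbig
  have hcQ : coeff (single 0 e) (map toℚ k) ≠ 0 := by
    rw [coeff_map]; simpa using hc
  refine (bezout_points (map toℚ k) g hirr
    (not_dvd_of_supp (d := e) _ g hcQ hg0 fun m hm => lt_of_lt_of_le (mem_monsd.mp (hgs hm)).2 hκ) _ ?_ ?_).trans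
    (Nat.mul_le_mul ((totalDegree_map_le' _ k).trans hd.le) (totalDegree_of_supp _ fun m hm => monsd_subset _ _ _ (hgs hm)))
  · intro y hy
    obtain ⟨t, ht, rfl⟩ := mem_image.mp hy
    exact (hT t (mem_filter.mp ht).1).2.2.2.1
  · intro y hy
    obtain ⟨t, ht, rfl⟩ := mem_image.mp hy
    exact hg t ⟨(mem_filter.mp ht).1, (mem_filter.mp ht).2⟩

theorem plane_count_int (k : MP 2 ℤ) (e : ℕ) (hd : k.totalDegree = e) (he1 : 1 ≤ e)
    (hirr : Irreducible (map toℚ k)) (hc : coeff (single 0 e) k ≠ 0)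
    (κ D : ℕ) (hκ : κ ≤ e) (T : Finset ((Fin 2 → ℤ) × ℤ)) (V W : ℕ) (hWV : W ≤ V)
    (hT : ∀ t ∈ T, (∀ i, |t.1 i| ≤ (V:ℤ)) ∧ |t.2| ≤ (W:ℤ) ∧ t.2 ≠ 0 ∧ eval (rp t) (map toℚ k) = 0)
    (q0 q1 L : ℕ) (hq02 : 2 ≤ q0) (Ps : Finset ℕ) (hPs : ∀ q ∈ Ps, q.Prime ∧ q0 < q ∧ q ≤ q1) (hL : L < Ps.card)
    (hnrm : (e : ℝ) * nrm 1 k * (V:ℝ) ^ (e + 1) ≤ (q0:ℝ) ^ L)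
    (hbig : ((monsd 1 κ D).card.factorial : ℝ) * ∏ m ∈ monsd 1 κ D, ((V:ℝ) ^ m.degree * (W:ℝ) ^ (D - m.degree)) <
      (q0:ℝ) ^ ((monsd 1 κ D).card * (monsd 1 κ D).card - ((monsd 1 κ D).card + 1).choose 2)) :
    (T.image rp).card ≤ e * e + Ps.card * ((e * q1) * (e * D)) := by
  classical
  have hcQ : coeff (single 0 e) (map toℚ k) ≠ 0 := by
    rw [coeff_map]; simpa using hc
  have hdQ : (map toℚ k).totalDegree = e := by
    apply le_antisymm ((totalDegree_map_le' _ k).trans hd.le)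
    have := le_totalDegree (mem_support_iff.mpr hcQ)
    rw [sum_single_index rfl] at this
    exact this
  have hcover : T.image rp ⊆ (T.filter (fun t => hv (pderiv 0 k) e t = 0)).image rp ∪
      Ps.biUnion (fun q => (T.filter (fun t => ¬ (q:ℤ) ∣ t.2 ∧ ¬ (q:ℤ) ∣ hv (pderiv 0 k) e t)).image rp) := by
    intro y hy
    obtain ⟨t, ht, rfl⟩ := mem_image.mp hy
    by_cases h0 : hv (pderiv 0 k) e t = 0
    · exact mem_union_left _ (mem_image_of_mem _ (mem_filter.mpr ⟨ht, h0⟩))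
    apply mem_union_right
    obtain ⟨h1, h2, h3, h4⟩ := hT t ht
    have hWV' : (W:ℤ) ≤ V := by exact_mod_cast hWV
    have hcard := card_primes_dvd q0 L hq02 (t.2 * hv (pderiv 0 k) e t) (mul_ne_zero h3 h0) (by
      refine le_trans ?_ hnrm
      push_cast
      rw [abs_mul]
      have h5 := hv_abs_le (pderiv 0 k) ((totalDegree_pderiv_le 0 k).trans hd.le) t V h1 (h2.trans hWV')
      have h6 := nrm_pderiv_le k e hd.le 0
      have h7 : |(t.2:ℝ)| ≤ V := by rw [← Int.cast_abs]; exact_mod_cast h2.trans hWV'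
      calc |(t.2:ℝ)| * |((hv (pderiv 0 k) e t : ℤ):ℝ)| ≤ V * (e * nrm 1 k * (V:ℝ) ^ e) :=
            mul_le_mul h7 (h5.trans (mul_le_mul_of_nonneg_right h6 (by positivity))) (abs_nonneg _) (by positivity)
        _ = _ := by ring) (Ps.filter (fun q => (q:ℤ) ∣ t.2 * hv (pderiv 0 k) e t)) (by
      intro q hq
      obtain ⟨hq1, hq2⟩ := mem_filter.mp hq
      exact ⟨(hPs q hq1).1, (hPs q hq1).2.1, hq2⟩)
    have : ∃ q ∈ Ps, ¬ (q:ℤ) ∣ t.2 * hv (pderiv 0 k) e t := by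
      by_contra hcon
      push Not at hcon
      rw [filter_true_of_mem hcon] at hcard
      omega
    obtain ⟨q, hq, hqn⟩ := this
    exact mem_biUnion.mpr ⟨q, hq, mem_image_of_mem _ (mem_filter.mpr ⟨ht,
      fun h => hqn (Dvd.dvd.mul_right h _), fun h => hqn (Dvd.dvd.mul_left h _)⟩)⟩
  refine (card_le_card hcover).trans ((card_union_le _ _).trans (Nat.add_le_add ?_ ?_))
  · refine (bezout_points (map toℚ k) (pderiv 0 (map toℚ k)) hirr
      (pderiv_zero_props _ e hdQ hcQ (by exact_mod_cast (show e ≠ 0 by omega))) _ ?_ ?_).trans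
      (Nat.mul_le_mul hdQ.le ((totalDegree_pderiv_le 0 _).trans hdQ.le))
    · intro y hy
      obtain ⟨t, ht, rfl⟩ := mem_image.mp hy
      exact (hT t (mem_filter.mp ht).1).2.2.2
    · intro y hy
      obtain ⟨t, ht, rfl⟩ := mem_image.mp hy
      obtain ⟨ht, h0⟩ := mem_filter.mp ht
      have h1 := hv_rp (pderiv 0 k) ((totalDegree_pderiv_le 0 k).trans hd.le) t (hT t ht).2.2.1
      rw [h0, Int.cast_zero] at h1
      rw [pderiv_map]
      exact (mul_eq_zero.mp h1.symm).resolve_left (pow_ne_zero _ (by exact_mod_cast (hT t ht).2.2.1))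
  · refine card_biUnion_le_card_mul _ _ _ fun q hq => ?_
    obtain ⟨hqp, hq0', hq1⟩ := hPs q hq
    refine (prime_count k e hd he1 hirr hc κ D q hκ hqp _ V W ?_ ?_).trans
      (Nat.mul_le_mul_right _ (Nat.mul_le_mul_left _ hq1))
    · intro t ht
      obtain ⟨ht, h5, h6⟩ := mem_filter.mp ht
      exact ⟨(hT t ht).1, (hT t ht).2.1, h5, (hT t ht).2.2.2, h6⟩
    · exact hbig.trans_le (pow_le_pow_left₀ (by positivity) (by exact_mod_cast hq0'.le) _)

theorem plane_count (k : MP 2 ℚ) (e : ℕ) (hd : k.totalDegree = e) (he1 : 1 ≤ e)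
    (hirr : Irreducible k) (hc : coeff (single 0 e) k ≠ 0)
    (κ D : ℕ) (hκ : κ ≤ e) (T : Finset ((Fin 2 → ℤ) × ℤ)) (V W : ℕ) (hV : 1 ≤ V) (hWV : W ≤ V)
    (hT : ∀ t ∈ T, (∀ i, |t.1 i| ≤ (V:ℤ)) ∧ |t.2| ≤ (W:ℤ) ∧ t.2 ≠ 0 ∧ eval (rp t) k = 0)
    (q0 q1 L : ℕ) (hq02 : 2 ≤ q0) (Ps : Finset ℕ) (hPs : ∀ q ∈ Ps, q.Prime ∧ q0 < q ∧ q ≤ q1) (hL : L < Ps.card)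
    (hnrm : (e : ℝ) * ((mons 2 e).card * ((mons 2 e).card.factorial * ((V:ℝ) ^ e) ^ (mons 2 e).card)) * (V:ℝ) ^ (e + 1) ≤ (q0:ℝ) ^ L)
    (hbig : ((monsd 1 κ D).card.factorial : ℝ) * ∏ m ∈ monsd 1 κ D, ((V:ℝ) ^ m.degree * (W:ℝ) ^ (D - m.degree)) <
      (q0:ℝ) ^ ((monsd 1 κ D).card * (monsd 1 κ D).card - ((monsd 1 κ D).card + 1).choose 2)) :
    (T.image rp).card ≤ e * e + Ps.card * ((e * q1) * (e * D)) := by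
  classical
  have hWV' : (W:ℤ) ≤ V := by exact_mod_cast hWV
  rcases height_dichotomy_proj k e hd hirr.ne_zero (T : Set _) V hV (fun t ht => ⟨(hT t ht).1, (hT t ht).2.1.trans hWV', (hT t ht).2.2.1⟩)
    (fun t ht => (hT t ht).2.2.2) with ⟨g, hg1, hg2, hg3⟩ | ⟨k1, s, hs, hk1, hn⟩
  · refine le_trans ?_ (Nat.le_add_right _ _)
    refine (bezout_points k g hirr hg2 _ ?_ ?_).trans (Nat.mul_le_mul hd.le hg1)
    · intro y hy
      obtain ⟨t, ht, rfl⟩ := mem_image.mp hy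
      exact (hT t ht).2.2.2
    · intro y hy
      obtain ⟨t, ht, rfl⟩ := mem_image.mp hy
      exact hg3 t ht
  · have hinj : Injective toℚ := by
      intro a b hab; simpa using hab
    have hd1 : k1.totalDegree = e := by
      have h1 : (map toℚ k1).support = k1.support := support_map_of_injective _ hinj
      have h2 : (C s * k).support = k.support := by
        ext m; simp [mem_support_iff, coeff_C_mul, hs]
      have h3 : k1.support = k.support := by rw [← h1, hk1, h2]
      rw [← hd, totalDegree, totalDegree, h3]
    refine plane_count_int k1 e hd1 he1 ?_ ?_ κ D hκ T V W hWV ?_ q0 q1 L hq02 Ps hPs hL ?_ hbig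
    · rw [hk1]
      exact (irreducible_isUnit_mul ((isUnit_iff_ne_zero.mpr hs).map C)).mpr hirr
    · intro h0
      have := congrArg (coeff (single 0 e)) hk1
      rw [coeff_map, h0, coeff_C_mul, map_zero] at this
      exact mul_ne_zero hs hc this.symm
    · intro t ht
      refine ⟨(hT t ht).1, (hT t ht).2.1, (hT t ht).2.2.1, ?_⟩
      rw [hk1, map_mul, (hT t ht).2.2.2, mul_zero]
    · refine le_trans ?_ hnrm
      exact mul_le_mul_of_nonneg_right (mul_le_mul_of_nonneg_left hn (by positivity)) (by positivity)

/-- set the variable 0 to 1 -/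
noncomputable def dhz {A : Type*} [CommRing A] (n : ℕ) : MP (n + 1) A →ₐ[A] MP n A :=
  aeval (Fin.cons 1 X : Fin (n + 1) → MP n A)

theorem degree_eq_zero_add_tail {n : ℕ} (M : Fin (n + 1) →₀ ℕ) : M.degree = M 0 + M.tail.degree := by
  rw [degree_eq_sum, degree_eq_sum, sum_univ_succ]
  rfl

theorem degree_cons' {n : ℕ} (j : ℕ) (m : Fin n →₀ ℕ) : (Finsupp.cons j m).degree = j + m.degree := by
  rw [degree_eq_zero_add_tail, Finsupp.cons_zero, tail_cons]

theorem dhz_monomial {n : ℕ} (M : Fin (n + 1) →₀ ℕ) (c : A) : dhz n (monomial M c) = monomial M.tail c := by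
  rw [dhz, aeval_monomial, prod_fintype _ _ (by simp), prod_univ_succ]
  simp only [cons_zero, cons_succ, one_pow, one_mul]
  rw [monomial_eq (s := M.tail), prod_fintype _ _ (by simp), algebraMap_eq]
  rfl

theorem coeff_dhz {n d : ℕ} (F : MP (n + 1) A) (hF : F.IsHomogeneous d) (m : Fin n →₀ ℕ)
    (hm : m.degree ≤ d) : coeff m (dhz n F) = coeff (Finsupp.cons (d - m.degree) m) F := by
  classical
  conv_lhs => rw [F.as_sum, map_sum, coeff_sum]
  simp only [dhz_monomial, coeff_monomial]
  have hiff : ∀ M ∈ F.support, (M.tail = m ↔ M = Finsupp.cons (d - m.degree) m) := by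
    intro M hM
    have hMd : M.degree = d := by
      by_contra h
      exact (mem_support_iff.mp hM) (hF.coeff_eq_zero h)
    constructor
    · intro h
      rw [degree_eq_zero_add_tail, h] at hMd
      rw [← cons_tail M, h]
      congr 1
      omega
    · rintro rfl
      exact tail_cons _ _
  rw [sum_congr rfl (fun M hM => if_congr (hiff M hM) rfl rfl), sum_ite_eq']
  split_ifs with h
  · rfl
  · exact (notMem_support_iff.mp h).symm

theorem dhz_inj {n d : ℕ} (F G : MP (n + 1) A) (hF : F.IsHomogeneous d) (hG : G.IsHomogeneous d)
    (h : dhz n F = dhz n G) : F = G := by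
  ext M
  by_cases hM : M.degree = d
  · have h1 : M.tail.degree ≤ d := by rw [← hM, degree_eq_zero_add_tail]; omega
    have h2 : Finsupp.cons (d - M.tail.degree) M.tail = M := by
      conv_rhs => rw [← cons_tail M]
      congr 1
      rw [← hM, degree_eq_zero_add_tail]; omega
    rw [← h2, ← coeff_dhz F hF _ h1, ← coeff_dhz G hG _ h1, h]
  · rw [hF.coeff_eq_zero hM, hG.coeff_eq_zero hM]

/-- homogenisation with respect to variable 0 -/
theorem exists_hz {n : ℕ} (G : MP n A) (e : ℕ) (hG : G.totalDegree ≤ e) :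
    ∃ F : MP (n + 1) A, F.IsHomogeneous e ∧ dhz n F = G := by
  refine ⟨∑ m ∈ G.support, monomial (Finsupp.cons (e - m.degree) m) (coeff m G), ?_, ?_⟩
  · refine IsHomogeneous.sum _ _ _ fun m hm => isHomogeneous_monomial _ ?_
    rw [degree_cons']
    exact Nat.sub_add_cancel ((le_totalDegree hm).trans hG)
  · rw [map_sum]
    conv_rhs => rw [G.as_sum]
    refine sum_congr rfl fun m _ => ?_
    rw [dhz_monomial, tail_cons]

theorem dhz_irreducible {K : Type*} [Field K] {n d : ℕ} (F : MP (n + 1) K) (hF : F.IsHomogeneous d) (hirr : Irreducible F)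
    (hd : (dhz n F).totalDegree = d) (hd1 : 1 ≤ d) : Irreducible (dhz n F) := by
  have hunit : ∀ P : MP n K, P ≠ 0 → P.totalDegree = 0 → IsUnit P := by
    intro P hP0 hP
    rw [totalDegree_eq_zero_iff_eq_C] at hP
    rw [hP]
    refine IsUnit.map C (isUnit_iff_ne_zero.mpr fun h => hP0 ?_)
    rw [hP, h, C_0]
  have h0 : dhz n F ≠ 0 := by intro h; rw [h, totalDegree_zero] at hd; omega
  refine ⟨fun hu => ?_, fun A B hAB => ?_⟩
  · have := isUnit_iff_eq_C_of_isReduced.mp hu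
    obtain ⟨r, _, hr⟩ := this
    rw [hr, totalDegree_C] at hd; omega
  · have hA0 : A ≠ 0 := by rintro rfl; rw [zero_mul] at hAB; exact h0 hAB
    have hB0 : B ≠ 0 := by rintro rfl; rw [mul_zero] at hAB; exact h0 hAB
    have hdeg := totalDegree_mul_of_isDomain hA0 hB0
    rw [← hAB, hd] at hdeg
    obtain ⟨A', hA', hA'2⟩ := exists_hz A A.totalDegree le_rfl
    obtain ⟨B', hB', hB'2⟩ := exists_hz B B.totalDegree le_rfl
    have hF' : F = A' * B' := by
      refine dhz_inj F (A' * B') hF (by rw [hdeg]; exact hA'.mul hB') ?_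
      rw [map_mul, hA'2, hB'2, hAB]
    have hA'0 : A' ≠ 0 := by rintro rfl; rw [map_zero] at hA'2; exact hA0 hA'2.symm
    have hB'0 : B' ≠ 0 := by rintro rfl; rw [map_zero] at hB'2; exact hB0 hB'2.symm
    rcases hirr.isUnit_or_isUnit hF' with h | h
    · left
      obtain ⟨r, _, hr⟩ := isUnit_iff_eq_C_of_isReduced.mp h
      have := hA'.totalDegree hA'0
      rw [hr, totalDegree_C] at this
      exact hunit A hA0 this.symm
    · right
      obtain ⟨r, _, hr⟩ := isUnit_iff_eq_C_of_isReduced.mp h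
      have := hB'.totalDegree hB'0
      rw [hr, totalDegree_C] at this
      exact hunit B hB0 this.symm

theorem coeff_spec_zero {m : ℕ} {A : Type*} [CommRing A] (d : ℕ) (G : MP (m + 1) A) :
    (aeval (Fin.cons PX (fun _ => 0) : Fin (m + 1) → Polynomial A) G).coeff d = coeff (single 0 d) G := by
  classical
  induction G using MvPolynomial.induction_on' with
  | add p q hp hq => simp [hp, hq]
  | monomial e a =>
    simp only [aeval_monomial]
    rw [prod_fintype _ _ (by simp), prod_univ_succ]
    simp only [cons_zero, cons_succ]
    rw [coeff_monomial, Polynomial.algebraMap_eq, Polynomial.coeff_C_mul]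
    split_ifs with h
    · rw [h]; simp [single_apply, succ_ne_zero, (succ_ne_zero _).symm]
    · by_cases hz : ∀ i : Fin m, e i.succ = 0
      · have h0 : e 0 ≠ d := by
          intro h0; apply h; ext i
          refine Fin.cases ?_ (fun i => ?_) i
          · simp [h0]
          · simp [hz i, single_apply, (succ_ne_zero _).symm]
        simp [hz, Polynomial.coeff_X_pow, h0.symm]
      · push Not at hz
        obtain ⟨i, hi⟩ := hz
        rw [prod_eq_zero (mem_univ i) (zero_pow hi)]
        simp

theorem coeff_ray {m : ℕ} {A : Type*} [CommRing A] (d : ℕ) (f : MP m A) (σ : Fin m → A) :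
    (aeval (fun i => CX (σ i) * PX) f).coeff d = eval σ (homogeneousComponent d f) := by
  classical
  induction f using MvPolynomial.induction_on' with
  | add p q hp hq => simp [hp, hq]
  | monomial e a =>
    rw [homogeneousComponent_of_mem (n := e.degree) (isHomogeneous_monomial a rfl), aeval_monomial,
      prod_fintype _ _ (by simp)]
    simp only [mul_pow, ← Polynomial.C_pow]
    rw [prod_mul_distrib, prod_pow_eq_pow_sum, ← degree_eq_sum, Polynomial.algebraMap_eq,
      ← map_prod, ← mul_assoc, ← Polynomial.C_mul, coeff_C_mul_X_pow]
    split_ifs with h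
    · rw [eval_monomial, prod_fintype _ _ (by simp)]
    · simp

/-- the shear `X_i ↦ X_i + s_i X_0` -/
noncomputable def shv {A : Type*} [CommRing A] {n : ℕ} (s : Fin n → A) : Fin (n + 1) → MP (n + 1) A :=
  Fin.cons (X 0) (fun i => X i.succ + C (s i) * X 0)

theorem coeff_shear {n : ℕ} {A : Type*} [CommRing A] (d : ℕ) (f : MP (n + 1) A) (s : Fin n → A) :
    coeff (single 0 d) (aeval (shv s) f) = eval (Fin.cons 1 s : Fin (n + 1) → A) (homogeneousComponent d f) := by
  rw [← coeff_spec_zero, ← coeff_ray, ← AlgHom.comp_apply, comp_aeval]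
  congr 2
  congr 1
  funext i
  refine Fin.cases ?_ (fun i => ?_) i
  · simp [shv]
  · simp [shv, ← algebraMap_eq, Polynomial.algebraMap_eq]

theorem shv_isHomogeneous {n : ℕ} (s : Fin n → A) (i : Fin (n + 1)) : (shv s i).IsHomogeneous 1 := by
  refine Fin.cases ?_ (fun i => ?_) i
  · exact isHomogeneous_X _ _
  · rw [shv, cons_succ]
    refine (isHomogeneous_X _ _).add ?_
    have := (isHomogeneous_C (Fin (n+1)) (s i)).mul (isHomogeneous_X A (0 : Fin (n + 1)))
    rwa [zero_add] at this

theorem shv_inv {n : ℕ} (s : Fin n → A) (i : Fin (n + 1)) : aeval (shv s) (shv (fun i => - s i) i) = X i := by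
  refine Fin.cases ?_ (fun i => ?_) i
  · simp [shv]
  · have h1 : shv (fun i => - s i) i.succ = X i.succ + C (- s i) * X 0 := rfl
    have h2 : shv s i.succ = X i.succ + C (s i) * X 0 := rfl
    have h3 : shv s 0 = X 0 := rfl
    rw [h1, map_add, map_mul, aeval_X, aeval_X, h2, h3, ← algebraMap_eq, AlgHom.commutes, map_neg]
    ring

theorem shv_irreducible {K : Type*} [Field K] {n : ℕ} (s : Fin n → K) (f : MP (n + 1) K) :
    Irreducible (aeval (shv s) f) ↔ Irreducible f := by
  refine irreducible_aeval_iff (shv s) (shv fun i => - s i) (shv_inv s) (fun i => ?_) f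
  have := shv_inv (fun i => - s i) i
  simpa using this

theorem hc_aeval_linear {n m : ℕ} (v : Fin n → MP m A) (hv : ∀ i, (v i).IsHomogeneous 1) (d : ℕ)
    (f : MP n A) : homogeneousComponent d (aeval v f) = aeval v (homogeneousComponent d f) := by
  classical
  induction f using MvPolynomial.induction_on' with
  | add p q hp hq => simp only [map_add, hp, hq]
  | monomial e a =>
    have h1 : (aeval v (monomial e a)).IsHomogeneous e.degree := by
      rw [aeval_monomial, prod_fintype _ _ (by simp), algebraMap_eq]
      have h2 : (∏ i, v i ^ e i).IsHomogeneous (∑ i, e i) :=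
        IsHomogeneous.prod _ _ _ fun i _ => by simpa using (hv i).pow (e i)
      rw [← degree_eq_sum] at h2
      have := (isHomogeneous_C (Fin m) a).mul h2
      rwa [zero_add] at this
    rw [homogeneousComponent_of_mem (n := e.degree) (isHomogeneous_monomial a rfl), homogeneousComponent_of_mem (n := e.degree) h1]
    split_ifs <;> simp

theorem hc_ne_zero {n d : ℕ} (f : MP n A) (hd : f.totalDegree = d) (hf : f ≠ 0) :
    homogeneousComponent d f ≠ 0 := by
  intro h
  obtain ⟨m, hm, hmd⟩ := exists_mem_eq_sup f.support (support_nonempty.mpr hf) (fun s => s.sum fun _ e => e)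
  have h1 := congrArg (coeff m) h
  rw [coeff_homogeneousComponent, coeff_zero, if_pos] at h1
  · exact (mem_support_iff.mp hm) h1
  · rw [← hd]; exact hmd.symm

theorem exists_nonroot {A : Type*} [CommRing A] [IsDomain A] [CharZero A] {n : ℕ} (p : MP n A) (hp : p ≠ 0) (d : ℕ) (hd : p.totalDegree ≤ d) :
    ∃ s : Fin n → ℕ, (∀ i, s i ≤ d) ∧ eval (fun i => (s i : A)) p ≠ 0 := by
  classical
  by_contra hcon
  push Not at hcon
  have h := sz_card p hp ((range (d + 1)).image (fun i : ℕ => (i : A)))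
  rw [card_image_of_injective _ Nat.cast_injective, card_range, filter_true_of_mem, Fintype.card_piFinset_const,
    card_image_of_injective _ Nat.cast_injective, card_range] at h
  · have h2 : 0 < (d + 1) ^ n := by positivity
    nlinarith
  · intro f hf
    rw [Fintype.mem_piFinset] at hf
    have : ∀ i, ∃ j : ℕ, j ≤ d ∧ (j : A) = f i := by
      intro i
      obtain ⟨j, hj, hj2⟩ := mem_image.mp (hf i)
      exact ⟨j, by simpa [Nat.lt_succ_iff] using hj, hj2⟩
    choose s hs hs2 using this
    have := hcon s hs
    rwa [funext hs2] at this

theorem exists_shear {A : Type*} [CommRing A] [IsDomain A] [CharZero A] {n d : ℕ} (f : MP (n + 1) A) (hd : f.totalDegree = d) (hf : f ≠ 0) :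
    ∃ s : Fin n → ℕ, (∀ i, s i ≤ d) ∧ coeff (single 0 d) (aeval (shv (fun i => (s i : A))) f) ≠ 0 := by
  have hh := homogeneousComponent_isHomogeneous d f
  have h0 := hc_ne_zero f hd hf
  have h1 : dhz n (homogeneousComponent d f) ≠ 0 := by
    intro h
    exact h0 (dhz_inj _ 0 hh (isHomogeneous_zero _ _ _) (by rw [h, map_zero]))
  obtain ⟨s, hs, hs2⟩ := exists_nonroot _ h1 d ((totalDegree_affine_le _ _ (Fin.cases (by simp) (by simp))).trans (hh.totalDegree h0).le)
  refine ⟨s, hs, ?_⟩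
  rw [coeff_shear]
  convert hs2 using 1
  rw [dhz]
  change _ = (eval fun i => (s i : A)) _
  rw [← aeval_eq_eval, ← aeval_eq_eval]
  change _ = ((aeval _).comp (aeval _)) _
  rw [comp_aeval]
  congr 2
  funext i
  refine Fin.cases ?_ (fun i => ?_) i <;> simp

theorem monsd_layer (D : ℕ) : ∑ m ∈ monsd 1 2 D, m.degree + ∑ t ∈ range D, (monsd 1 2 t).card = D * (monsd 1 2 D).card := by
  classical
  have : ∀ t ∈ range D, (monsd 1 2 t).card = ∑ m ∈ monsd 1 2 D, if m.degree ≤ t then 1 else 0 := by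
    intro t ht
    rw [mem_range] at ht
    rw [sum_boole, Nat.cast_id]
    congr 1
    ext m
    simp only [mem_monsd, mem_filter]
    constructor
    · rintro ⟨a, b⟩; exact ⟨⟨by omega, b⟩, a⟩
    · rintro ⟨⟨a, b⟩, c⟩; exact ⟨c, b⟩
  rw [sum_congr rfl this, sum_comm, ← sum_add_distrib, mul_comm, ← smul_eq_mul, ← sum_const]
  refine sum_congr rfl fun m hm => ?_
  have hm1 := (mem_monsd.mp hm).1
  rw [sum_boole, Nat.cast_id]
  have : (range D).filter (fun t => m.degree ≤ t) = Ico m.degree D := by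
    ext t; simp only [mem_filter, mem_range, mem_Ico]; omega
  rw [this, Nat.card_Ico]; omega

theorem card_monsd_two_gen (t : ℕ) (ht : 2 ≤ t) : (monsd 1 2 t).card = 2 * t + 1 := by
  have h3 := card_monsd 1 2 t ht
  obtain ⟨u, rfl⟩ : ∃ u, t = u + 2 := ⟨t - 2, by omega⟩
  simp only [Nat.add_sub_cancel, show 1 + 1 = 2 from rfl] at h3
  rw [Nat.choose_succ_succ' (u + 3) 1, Nat.choose_succ_succ' (u + 2) 1, Nat.choose_one_right, Nat.choose_one_right] at h3
  simp only [show 1 + 1 = 2 from rfl] at h3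
  omega

theorem monsd_weight_two (D : ℕ) (hD : D = 99) : ∑ m ∈ monsd 1 2 D, m.degree ≤ 9904 := by
  classical
  have h1 := monsd_layer D
  have h2 : ∑ t ∈ Ico 2 D, (2 * t + 1) ≤ ∑ t ∈ range D, (monsd 1 2 t).card := by
    refine le_trans (sum_le_sum (g := fun t => (monsd 1 2 t).card) fun t ht => ?_) (sum_le_sum_of_subset (fun t ht => ?_))
    · exact (card_monsd_two_gen t (mem_Ico.mp ht).1).ge
    · rw [mem_Ico] at ht; rw [mem_range]; omega
  have h3 : ∑ t ∈ Ico 2 D, (2 * t + 1) = 9797 := by subst hD; decide +kernel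
  rw [card_monsd_two_gen D (by omega)] at h1
  have h5 : D * (2 * D + 1) = 19701 := by rw [hD]
  omega

theorem card_monsd_three : (monsd 1 3 10).card = 30 := by
  have := card_monsd 1 3 10 (by norm_num)
  norm_num [Nat.choose] at this
  omega

theorem card_mons_two_le (e : ℕ) : (mons 2 e).card ≤ (e + 1) ^ 2 := by
  have := card_mons_le (e + 1) (by omega)
  rwa [Fintype.card_coe, Nat.add_sub_cancel] at this

theorem hnrm_of (N e c α β v u L : ℕ) (hN : 1 ≤ N) (he : e ≤ N ^ α) (hc : c ≤ N ^ β) (h : α + β + β * c + v * (e * c) + v * (e + 1) ≤ u * L) :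
    (e : ℝ) * (c * (c.factorial * (((N ^ v : ℕ):ℝ) ^ e) ^ c)) * ((N ^ v : ℕ):ℝ) ^ (e + 1) ≤ ((N ^ u : ℕ):ℝ) ^ L := by
  have h1 : c.factorial ≤ (N ^ β) ^ c := (Nat.factorial_le_pow c).trans (Nat.pow_le_pow_left hc _)
  have : e * (c * (c.factorial * ((N ^ v) ^ e) ^ c)) * (N ^ v) ^ (e + 1) ≤ (N ^ u) ^ L := by
    calc e * (c * (c.factorial * ((N ^ v) ^ e) ^ c)) * (N ^ v) ^ (e + 1)
        ≤ N ^ α * (N ^ β * ((N ^ β) ^ c * ((N ^ v) ^ e) ^ c)) * (N ^ v) ^ (e + 1) := by gcongr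
      _ = N ^ (α + β + β * c + v * (e * c) + v * (e + 1)) := by
        simp only [← pow_mul, ← pow_add]; congr 1; ring
      _ ≤ N ^ (u * L) := Nat.pow_le_pow_right hN h
      _ = _ := by rw [pow_mul]
  exact_mod_cast this

theorem rp_one_inj {n : ℕ} (x y : Fin n → ℤ) (h : rp (x, 1) = rp (y, 1)) : x = y := by
  rw [rp_one, rp_one] at h
  funext i
  exact_mod_cast congrFun h i

theorem le_log_of (C : ℝ) : ∃ N0 : ℕ, 1 ≤ N0 ∧ ∀ N : ℕ, N0 ≤ N → C ≤ log N := by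
  refine ⟨⌈exp C⌉₊ + 1, by omega, fun N hN => ?_⟩
  have h1 : exp C ≤ N := by
    refine (Nat.le_ceil _).trans ?_
    exact_mod_cast (by omega : ⌈exp C⌉₊ ≤ N)
  have := log_le_log (Real.exp_pos C) h1
  rwa [Real.log_exp] at this

/-- plane curves with top coefficient -/
theorem PC_top : ∃ C2 : ℕ, ∀ a N : ℕ, 100 ≤ a → C2 ≤ N → ∀ (k : MP 2 ℚ) (e : ℕ), k.totalDegree = e → Irreducible k →
    2 ≤ e → e ≤ N ^ 10 → coeff (single 0 e) k ≠ 0 → ∀ S : Finset (Fin 2 → ℤ), (∀ x ∈ S, (∀ i, |x i| ≤ (N:ℤ) ^ (1000 * a + 12)) ∧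
      eval (fun i => (x i : ℚ)) k = 0) → S.card ≤ N ^ (510 * a) := by
  classical
  obtain ⟨D, hD⟩ : ∃ D, D = 99 := ⟨_, rfl⟩
  obtain ⟨R, hR⟩ : ∃ R, R = 2 * D + 1 := ⟨_, rfl⟩
  obtain ⟨C, hC, hprimes⟩ := many_primes
  obtain ⟨N0, hN01, hN0⟩ := le_log_of (C + 4 * 126)
  refine ⟨N0 + 200, fun a N ha hN k e hd hirr he2 heN hc S hS => ?_⟩
  have hN1 : 1 ≤ N := by omega
  have h4a : 1 ≤ 4 * a := by omega
  have hp := hprimes (N ^ (4 * a)) 126 (by norm_num) (hN0 _ (le_trans (by omega : N0 ≤ N) (Nat.le_self_pow (by omega) N)))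
  obtain ⟨Ps, hPs, hPcard⟩ := exists_subset_card_eq ((Nat.pow_le_pow_right hN1 (by omega : 40 ≤ 4 * a)).trans hp)
  obtain ⟨c, hcdef⟩ : ∃ c, c = (mons 2 e).card := ⟨_, rfl⟩
  have hcN : c ≤ N ^ 21 := by
    rw [hcdef]
    refine (card_mons_two_le e).trans ?_
    have h1 : e + 1 ≤ 2 * N ^ 10 := by have := Nat.one_le_pow 10 N hN1; omega
    calc (e + 1) ^ 2 ≤ (2 * N ^ 10) ^ 2 := Nat.pow_le_pow_left h1 2
      _ = 4 * N ^ 20 := by ring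
      _ ≤ N * N ^ 20 := Nat.mul_le_mul_right _ (by omega)
      _ = N ^ 21 := by ring
  have hec : e * c ≤ N ^ 31 := (Nat.mul_le_mul heN hcN).trans (le_of_eq (by ring))
  have hc1 : c ≤ e * c := Nat.le_mul_of_pos_left _ (by omega)
  have hmain := plane_count k e hd (by omega) hirr hc 2 D he2 (S.image fun x => (x, (1:ℤ))) (N ^ (1000 * a + 12)) 1
    (Nat.one_le_pow _ _ hN1) (Nat.one_le_pow _ _ hN1) (by
      intro t ht
      obtain ⟨x, hx, rfl⟩ := mem_image.mp ht
      refine ⟨fun i => by push_cast; exact (hS x hx).1 i, by simp, one_ne_zero, ?_⟩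
      rw [rp_one]; exact (hS x hx).2) (N ^ (504 * a)) (N ^ (508 * a)) (4 * (e * c + e + 1) + 4)
      (le_trans (by omega : 2 ≤ N) (Nat.le_self_pow (by omega) N)) Ps (by
      intro q hq
      have := hPs hq
      rw [mem_filter, mem_Ioc, ← pow_mul, ← pow_mul] at this
      refine ⟨this.2, ?_, ?_⟩
      · rw [show 504 * a = 4 * a * 126 by ring]; exact this.1.1
      · rw [show 508 * a = 4 * a * (126 + 1) by ring]; exact this.1.2) (by
      rw [hPcard]
      have h1 : N ^ 10 ≤ N ^ 31 := Nat.pow_le_pow_right hN1 (by norm_num)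
      have h2 : 1 ≤ N ^ 31 := Nat.one_le_pow _ _ hN1
      have h3 : 200 * N ^ 31 ≤ N * N ^ 31 := Nat.mul_le_mul_right _ (by omega)
      have h4 : N * N ^ 31 ≤ N ^ 40 := by rw [← pow_succ']; exact Nat.pow_le_pow_right hN1 (by norm_num)
      omega) (by
      rw [← hcdef]
      refine hnrm_of N e c 10 21 _ _ _ hN1 heN hcN ?_
      nlinarith [Nat.zero_le (e * c), Nat.mul_le_mul_right (e * c) ha, Nat.mul_le_mul_right e ha]) (by
      rw [card_monsd_two_gen D (by omega), ← hR]
      simp only [Nat.cast_one, one_pow, mul_one]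
      rw [prod_pow_eq_pow_sum]
      have hch : R * R - (R + 1).choose 2 = 19701 := by
        rw [Nat.choose_two_right, hR, hD]
      have : Nat.factorial R * (N ^ (1000 * a + 12)) ^ (∑ m ∈ monsd 1 2 D, m.degree) < (N ^ (504 * a)) ^ (R * R - (R + 1).choose 2) := by
        rw [hch]
        calc Nat.factorial R * (N ^ (1000 * a + 12)) ^ (∑ m ∈ monsd 1 2 D, m.degree)
            ≤ N ^ R * (N ^ (1000 * a + 12)) ^ 9904 := by
              refine Nat.mul_le_mul ((Nat.factorial_le_pow R).trans (Nat.pow_le_pow_left (by omega) _))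
                (Nat.pow_le_pow_right (Nat.one_le_pow _ _ hN1) (monsd_weight_two D hD))
          _ = N ^ (R + (1000 * a + 12) * 9904) := by rw [← pow_mul, ← pow_add]
          _ < N ^ (504 * a * 19701) := Nat.pow_lt_pow_right (by omega) (by omega)
          _ = (N ^ (504 * a)) ^ 19701 := by rw [pow_mul]
      exact_mod_cast this)
  rw [image_image, card_image_of_injective (f := rp ∘ fun x => (x, (1:ℤ))) S (fun x y h => rp_one_inj x y h), hPcard] at hmain
  refine hmain.trans ?_
  have h1 : e * e ≤ N ^ (508 * a + 70) := (Nat.mul_le_mul heN heN).trans (by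
    rw [← pow_add]; exact Nat.pow_le_pow_right hN1 (by omega))
  have h2 : N ^ 40 * (e * N ^ (508 * a) * (e * D)) ≤ N * N ^ (508 * a + 69) := by
    calc N ^ 40 * (e * N ^ (508 * a) * (e * D)) ≤ N ^ 40 * (N ^ 10 * N ^ (508 * a) * (N ^ 10 * N)) := by
          gcongr; omega
      _ = N ^ (508 * a + 61) := by ring
      _ ≤ N ^ (508 * a + 70) := Nat.pow_le_pow_right hN1 (by omega)
      _ = _ := by rw [pow_succ']
  have h3 : N * N ^ (508 * a + 69) = N ^ (508 * a + 70) := by rw [← pow_succ']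
  have h4 : 2 * N ^ (508 * a + 70) ≤ N * N ^ (508 * a + 70) := Nat.mul_le_mul_right _ (by omega)
  have h5 : N * N ^ (508 * a + 70) ≤ N ^ (510 * a) := by
    rw [← pow_succ']; exact Nat.pow_le_pow_right hN1 (by omega)
  omega

theorem eval_shv {n : ℕ} (x : Fin (n + 1) → A) (s : Fin n → A) (f : MP (n + 1) A) :
    eval x (aeval (shv s) f) = eval (Fin.cons (x 0) (fun i => x i.succ + s i * x 0) : Fin (n + 1) → A) f := by
  rw [← aeval_eq_eval, ← aeval_eq_eval]
  change ((aeval x).comp (aeval (shv s))) f = _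
  rw [comp_aeval]
  congr 2
  funext i
  refine Fin.cases ?_ (fun i => ?_) i
  · simp [shv]
  · simp [shv]

theorem totalDegree_shv {n d : ℕ} (s : Fin n → A) (f : MP (n + 1) A) (hd : f.totalDegree ≤ d)
    (hc : coeff (single 0 d) (aeval (shv s) f) ≠ 0) : (aeval (shv s) f).totalDegree = d := by
  apply le_antisymm
  · exact (totalDegree_affine_le f _ fun i => (shv_isHomogeneous s i).totalDegree_le).trans hd
  · have := le_totalDegree (mem_support_iff.mpr hc)
    rwa [sum_single_index rfl] at this

/-- plane curves -/
theorem PC : ∃ C2 : ℕ, ∀ a N : ℕ, 100 ≤ a → C2 ≤ N → ∀ (k : MP 2 ℚ), Irreducible k →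
    2 ≤ k.totalDegree → k.totalDegree ≤ N ^ 10 → ∀ S : Finset (Fin 2 → ℤ), (∀ x ∈ S, (∀ i, |x i| ≤ (N:ℤ) ^ (1000 * a + 1)) ∧
      eval (fun i => (x i : ℚ)) k = 0) → S.card ≤ N ^ (510 * a) := by
  classical
  obtain ⟨C2, h⟩ := PC_top
  refine ⟨C2 + 2, fun a N ha hN k hirr he2 heN S hS => ?_⟩
  obtain ⟨s, hs, hc⟩ := exists_shear k rfl hirr.ne_zero
  obtain ⟨φ, hφ⟩ : ∃ φ : (Fin 2 → ℤ) → (Fin 2 → ℤ), φ = fun x => Fin.cons (x 0) (fun i : Fin 1 => (x i.succ : ℤ) - ((s i : ℕ) : ℤ) * x 0) := ⟨_, rfl⟩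
  have hinj : Injective φ := by
    intro x y hxy
    rw [hφ] at hxy
    have h0 : x 0 = y 0 := by simpa using congrFun hxy 0
    funext i
    refine Fin.cases h0 (fun i => ?_) i
    have h1 := congrFun hxy i.succ
    simp only [cons_succ, h0] at h1
    linarith
  rw [← card_image_of_injective S hinj]
  refine h a N ha (by omega) _ k.totalDegree (totalDegree_shv _ k le_rfl hc) ((shv_irreducible _ k).mpr hirr) he2 heN hc _ ?_
  intro y hy
  obtain ⟨x, hx, rfl⟩ := mem_image.mp hy
  have hN1 : (1:ℤ) ≤ N := by exact_mod_cast (by omega : 1 ≤ N)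
  have hbox : ∀ i, |x i| ≤ (N:ℤ) ^ (1000 * a + 1) := (hS x hx).1
  constructor
  · intro i
    refine Fin.cases ?_ (fun i => ?_) i
    · rw [hφ]
      simp only [cons_zero]
      exact (hbox 0).trans (pow_le_pow_right₀ hN1 (by omega))
    · rw [hφ]
      simp only [cons_succ]
      have h1 : ((s i : ℕ) : ℤ) ≤ (N:ℤ) ^ 10 := by exact_mod_cast (hs i).trans heN
      have hN2 : (2:ℤ) ≤ N := by exact_mod_cast (by omega : 2 ≤ N)
      calc |x i.succ - s i * x 0| ≤ |x i.succ| + |(s i : ℤ) * x 0| := abs_sub _ _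
        _ ≤ (N:ℤ) ^ (1000 * a + 1) + (N:ℤ) ^ 10 * (N:ℤ) ^ (1000 * a + 1) := by
          rw [abs_mul, Nat.abs_cast]
          exact add_le_add (hbox _) (mul_le_mul h1 (hbox 0) (abs_nonneg _) (by positivity))
        _ ≤ (N:ℤ) ^ (1000 * a + 11) + (N:ℤ) ^ (1000 * a + 11) := by
          refine add_le_add (pow_le_pow_right₀ hN1 (by omega)) (le_of_eq (by ring))
        _ = 2 * (N:ℤ) ^ (1000 * a + 11) := by ring
        _ ≤ N * (N:ℤ) ^ (1000 * a + 11) := mul_le_mul_of_nonneg_right hN2 (by positivity)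
        _ = _ := by ring
  · rw [eval_shv]
    refine Eq.trans ?_ (hS x hx).2
    congr 2
    funext i
    refine Fin.cases ?_ (fun i => ?_) i
    · rw [hφ]; simp
    · rw [hφ]; simp

theorem eval_smul_hom {n d : ℕ} (F : MP n A) (hF : F.IsHomogeneous d) (c : A) (v : Fin n → A) :
    eval (fun i => c * v i) F = c ^ d * eval v F := by
  rw [eval_eq', eval_eq', mul_sum]
  refine sum_congr rfl fun m hm => ?_
  have h1 : m.degree = d := by
    by_contra h
    exact (mem_support_iff.mp hm) (hF.coeff_eq_zero h)
  simp only [mul_pow]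
  rw [prod_mul_distrib, prod_pow_eq_pow_sum, ← degree_eq_sum, h1]
  ring

theorem eval_single_hom {n d : ℕ} (F : MP n A) (hF : F.IsHomogeneous d) (j : Fin n) :
    eval (Pi.single j 1) F = coeff (single j d) F := by
  classical
  rw [eval_eq']
  have key : ∀ m ∈ F.support, m ≠ single j d → coeff m F * ∏ i, (Pi.single j (1:A) : Fin n → A) i ^ m i = 0 := by
    intro m hm hne
    have h1 : m.degree = d := by
      by_contra h
      exact (mem_support_iff.mp hm) (hF.coeff_eq_zero h)
    have : ∃ i, i ≠ j ∧ m i ≠ 0 := by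
      by_contra hcon
      push Not at hcon
      apply hne
      have h2 : m j = d := by
        rw [← h1, degree_eq_sum]
        exact (sum_eq_single j (fun i _ hi => hcon i hi) (by simp)).symm
      ext i
      by_cases hi : i = j
      · rw [hi, h2, single_eq_same]
      · rw [hcon i hi, single_eq_of_ne hi]
    obtain ⟨i, hi, hmi⟩ := this
    rw [prod_eq_zero (mem_univ i) (by rw [Pi.single_eq_of_ne hi, zero_pow hmi]), mul_zero]
  have hprod : ∏ i, (Pi.single j (1:A) : Fin n → A) i ^ (single j d) i = 1 := by
    refine prod_eq_one fun i _ => ?_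
    by_cases hi : i = j
    · rw [hi, Pi.single_eq_same, one_pow]
    · rw [single_eq_of_ne hi, pow_zero]
  by_cases hs : single j d ∈ F.support
  · rw [sum_eq_single_of_mem _ hs key, hprod, mul_one]
  · rw [sum_eq_zero (fun m hm => key m hm (fun h => hs (h ▸ hm)))]
    exact (notMem_support_iff.mp hs).symm

/-- primitive integer vectors -/
def Prim {n : ℕ} (v : Fin n → ℤ) : Prop := ∃ u : Fin n → ℤ, ∑ i, u i * v i = 1

theorem prim_eq {n : ℕ} (v w : Fin n → ℤ) (hv : Prim v) (hw : Prim w) (j : Fin n) (hvj : v j ≠ 0)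
    (h : ∀ i, v i * w j = w i * v j) : w = v ∨ w = fun i => - v i := by
  have key : ∀ v w : Fin n → ℤ, Prim v → (∀ i, v i * w j = w i * v j) → v j ∣ w j := by
    rintro v w ⟨u, hu⟩ h
    refine ⟨∑ i, u i * w i, ?_⟩
    calc w j = (∑ i, u i * v i) * w j := by rw [hu, one_mul]
      _ = ∑ i, u i * (v i * w j) := by rw [sum_mul]; exact sum_congr rfl fun i _ => by ring
      _ = ∑ i, u i * (w i * v j) := sum_congr rfl fun i _ => by rw [h i]
      _ = _ := by rw [mul_sum]; exact sum_congr rfl fun i _ => by ring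
  have h1 := key v w hv h
  have h2 := key w v hw (fun i => (h i).symm)
  rcases Int.associated_iff.mp (associated_of_dvd_dvd h1 h2) with h3 | h3
  · left
    funext i
    have := h i
    rw [← h3] at this
    exact (mul_right_cancel₀ hvj this).symm
  · right
    funext i
    have := h i
    have h4 : w j = - v j := by linarith
    rw [h4] at this
    have h5 : (w i + v i) * v j = 0 := by linarith
    rcases mul_eq_zero.mp h5 with h6 | h6
    · linarith
    · exact absurd h6 hvj

theorem prim_card {n : ℕ} {β : Type*} [DecidableEq β] (T : Finset (Fin n → ℤ)) (φ : (Fin n → ℤ) → β) (j : Fin n)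
    (hT : ∀ v ∈ T, Prim v ∧ v j ≠ 0) (h : ∀ v ∈ T, ∀ w ∈ T, φ v = φ w → ∀ i, v i * w j = w i * v j) :
    T.card ≤ 2 * (T.image φ).card := by
  classical
  refine card_le_mul_card_image T 2 ?_
  intro b hb
  obtain ⟨v, hv, rfl⟩ := mem_image.mp hb
  refine le_trans (card_le_card (t := {v, fun i => - v i}) ?_) card_le_two
  intro w hw
  rw [mem_filter] at hw
  rw [mem_insert, mem_singleton]
  exact prim_eq v w (hT v hv).1 (hT w hw.1).1 j (hT v hv).2 (h v hv w hw.1 hw.2.symm)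

theorem Prim.ne_zero {n : ℕ} {v : Fin n → ℤ} (hv : Prim v) : ∃ i, v i ≠ 0 := by
  by_contra h
  push Not at h
  obtain ⟨u, hu⟩ := hv
  rw [sum_eq_zero (fun i _ => by rw [h i, mul_zero])] at hu
  exact zero_ne_one hu

theorem PD_one : ∃ C0 : ℕ, 0 < C0 ∧ ∀ (d M : ℕ) (F : MP 3 ℚ), 3 ≤ d → F.IsHomogeneous d → Irreducible F →
    coeff (single 1 d) F ≠ 0 → C0 * d ^ 5 ≤ M → ∀ T : Finset (Fin 3 → ℤ),
    (∀ v ∈ T, Prim v ∧ (∀ i, |v i| ≤ (M:ℤ) ^ 10) ∧ eval (fun i => (v i : ℚ)) F = 0) → T.card ≤ M ^ 9 := by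
  classical
  obtain ⟨D, hD⟩ : ∃ D, D = 10 := ⟨_, rfl⟩
  obtain ⟨R, hR⟩ : ∃ R, R = 30 := ⟨_, rfl⟩
  have hRD : (monsd 1 3 D).card = R := by rw [hD, hR]; exact card_monsd_three
  obtain ⟨C, hC, hprimes⟩ := many_primes
  obtain ⟨N0, hN01, hN0⟩ := le_log_of (C + 4 * (7:ℕ))
  refine ⟨N0 + 400, by omega, fun d M F hd hF hirr hcF hM T hT => ?_⟩
  have hd5 : 1 ≤ d ^ 5 := Nat.one_le_pow _ _ (by omega)
  have hM1 : N0 + 400 ≤ M := le_trans (Nat.le_mul_of_pos_right _ hd5) hM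
  have hM400 : 400 * d ^ 5 ≤ M := le_trans (Nat.mul_le_mul_right _ (by omega)) hM
  have hp := hprimes M 7 (by norm_num) (hN0 M (by omega))
  obtain ⟨c, hcdef⟩ : ∃ c, c = (mons 2 d).card := ⟨_, rfl⟩
  have hc4 : c ≤ 4 * d ^ 2 := by
    rw [hcdef]; refine (card_mons_two_le d).trans ?_
    calc (d + 1) ^ 2 ≤ (2 * d) ^ 2 := Nat.pow_le_pow_left (by omega) 2
      _ = _ := by ring
  have hd25 : d ^ 2 ≤ d ^ 5 := Nat.pow_le_pow_right (by omega) (by norm_num)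
  have hd35 : d ^ 3 ≤ d ^ 5 := Nat.pow_le_pow_right (by omega) (by norm_num)
  have hd15 : d ≤ d ^ 5 := Nat.le_self_pow (by norm_num) d
  have hd13 : d ≤ d ^ 3 := Nat.le_self_pow (by norm_num) d
  have hdc : d * c ≤ 4 * d ^ 3 := (Nat.mul_le_mul_left d hc4).trans (le_of_eq (by ring))
  obtain ⟨L, hL⟩ : ∃ L, L = 2 * (d * c) + 2 * d + 4 := ⟨_, rfl⟩
  have hL15 : L + 1 ≤ 15 * d ^ 3 := by omega
  obtain ⟨Ps, hPs, hPcard⟩ := exists_subset_card_eq (n := L + 1) (le_trans (by omega) hp)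
  have hcd : c ≤ d * c := Nat.le_mul_of_pos_left _ (by omega)
  obtain ⟨G, hG⟩ : ∃ G, G = dhz 2 F := ⟨_, rfl⟩
  have hcG : coeff (single 0 d) G ≠ 0 := by
    rw [hG, coeff_dhz F hF _ (by simp)]
    have : Finsupp.cons (d - (single (0 : Fin 2) d).degree) (single (0 : Fin 2) d) = single (1 : Fin 3) d := by
      ext i
      refine Fin.cases ?_ (fun i => ?_) i
      · rw [Finsupp.cons_zero, single_eq_of_ne (by decide)]; simp
      · rw [Finsupp.cons_succ]; fin_cases i <;> simp [single_apply]
    rwa [this]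
  have hGd : G.totalDegree = d := by
    apply le_antisymm
    · rw [hG]
      refine (totalDegree_affine_le F _ fun i => ?_).trans hF.totalDegree_le
      refine Fin.cases ?_ (fun i => ?_) i
      · simp
      · rw [cons_succ]; exact (totalDegree_X _).le
    · have := le_totalDegree (mem_support_iff.mpr hcG)
      rwa [sum_single_index rfl] at this
  have hGirr : Irreducible G := by
    rw [hG]; exact dhz_irreducible F hF hirr (hG ▸ hGd) (by omega)
  -- the affine part
  have hA : (T.filter fun v => v 0 ≠ 0).card ≤ 2 * (d * d + (L + 1) * ((d * M ^ 8) * (d * D))) := by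
    obtain ⟨φ, hφ⟩ : ∃ φ : (Fin 3 → ℤ) → (Fin 2 → ℤ) × ℤ, φ = fun v => (fun i => v i.succ, v 0) := ⟨_, rfl⟩
    refine (prim_card (T.filter fun v => v 0 ≠ 0) (rp ∘ φ) 0 ?_ ?_).trans (Nat.mul_le_mul_left 2 ?_)
    · intro v hv
      rw [mem_filter] at hv
      exact ⟨(hT v hv.1).1, hv.2⟩
    · intro v hv w hw hvw i
      rw [mem_filter] at hv hw
      refine Fin.cases (mul_comm _ _) (fun i => ?_) i
      have := congrFun hvw i
      have hv0 : (v 0 : ℚ) ≠ 0 := by exact_mod_cast hv.2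
      have hw0 : (w 0 : ℚ) ≠ 0 := by exact_mod_cast hw.2
      simp only [Function.comp, hφ, rp] at this
      rw [div_eq_div_iff hv0 hw0] at this
      exact_mod_cast this
    · rw [← image_image, ← hPcard]
      refine plane_count G d hGd (by omega) hGirr hcG 3 D hd _ (M ^ 10) (M ^ 10) (Nat.one_le_pow _ _ (by omega)) le_rfl ?_
        (M ^ 7) (M ^ 8) L (le_trans (by omega : 2 ≤ M) (Nat.le_self_pow (by omega) M)) Ps ?_ (by omega) ?_ ?_
      · intro t ht
        obtain ⟨v, hv, rfl⟩ := mem_image.mp ht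
        rw [mem_filter] at hv
        obtain ⟨hv1, hv2⟩ := hv
        rw [hφ]
        refine ⟨fun i => by push_cast; exact (hT v hv1).2.1 _, by push_cast; exact (hT v hv1).2.1 _, hv2, ?_⟩
        have hv0 : (v 0 : ℚ) ≠ 0 := by exact_mod_cast hv2
        have h2 := eval_smul_hom F hF ((v 0 : ℚ)⁻¹) (fun i => (v i : ℚ))
        rw [(hT v hv1).2.2, mul_zero] at h2
        refine Eq.trans ?_ h2
        rw [hG, dhz, ← aeval_eq_eval, ← aeval_eq_eval]
        change ((aeval _).comp (aeval _)) F = _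
        rw [comp_aeval]
        congr 2
        funext i
        refine Fin.cases ?_ (fun i => ?_) i
        · simp [hv0]
        · simp [rp, div_eq_mul_inv, mul_comm]
      · intro q hq
        have := hPs hq
        rw [mem_filter, mem_Ioc] at this
        exact ⟨this.2, this.1.1, this.1.2⟩
      · rw [← hcdef]
        refine hnrm_of M d c 1 1 _ _ _ (by omega) (by rw [pow_one]; omega) (by rw [pow_one]; omega) ?_
        omega
      · rw [hRD]
        have hprod : ∏ m ∈ monsd 1 3 D, (((M ^ 10 : ℕ):ℝ) ^ m.degree * ((M ^ 10 : ℕ):ℝ) ^ (D - m.degree)) = ((M ^ 10 : ℕ):ℝ) ^ (D * R) := by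
          rw [pow_mul, ← hRD, ← prod_const]
          refine prod_congr rfl fun m hm => ?_
          rw [← pow_add]
          congr 1
          have := (mem_monsd.mp hm).1
          omega
        rw [hprod]
        have hch : R * R - (R + 1).choose 2 = 435 := by
          rw [Nat.choose_two_right, hR]
        rw [hch]
        have : Nat.factorial R * (M ^ 10) ^ (D * R) < (M ^ 7) ^ 435 := by
          calc Nat.factorial R * (M ^ 10) ^ (D * R) ≤ M ^ R * (M ^ 10) ^ (D * R) :=
                Nat.mul_le_mul_right _ ((Nat.factorial_le_pow R).trans (Nat.pow_le_pow_left (by omega) _))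
            _ = M ^ (R + 10 * (D * R)) := by rw [← pow_mul, ← pow_add]
            _ < M ^ (7 * 435) := Nat.pow_lt_pow_right (by omega) (by rw [hR, hD]; norm_num)
            _ = (M ^ 7) ^ 435 := by rw [pow_mul]
        exact_mod_cast this
  -- points at infinity
  have hB : (T.filter fun v => v 0 = 0 ∧ v 1 ≠ 0).card ≤ 2 * d := by
    obtain ⟨Q, hQ⟩ : ∃ Q : Polynomial ℚ, Q = aeval (![0, 1, PX] : Fin 3 → Polynomial ℚ) F := ⟨_, rfl⟩
    have hQeval : ∀ r : ℚ, Q.eval r = eval (![0, 1, r] : Fin 3 → ℚ) F := by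
      intro r
      rw [hQ, ← Polynomial.coe_aeval_eq_eval, ← aeval_eq_eval]
      change ((Polynomial.aeval r).comp (aeval _)) F = _
      rw [comp_aeval]
      congr 2
      funext i
      fin_cases i <;> simp
    have hQ0 : Q ≠ 0 := by
      intro h0
      have := hQeval 0
      rw [h0, Polynomial.eval_zero, show (![0, 1, 0] : Fin 3 → ℚ) = Pi.single 1 1 by
        funext i; fin_cases i <;> simp, eval_single_hom F hF] at this
      exact hcF this.symm
    have hQd : Q.natDegree ≤ d := by
      rw [hQ]
      refine (aeval_natDegree_le F hF.totalDegree_le _ (n := 1) fun i => ?_).trans (by omega)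
      fin_cases i <;> simp
    refine (prim_card _ (fun v => (v 2 : ℚ) / (v 1 : ℚ)) 1 ?_ ?_).trans (Nat.mul_le_mul_left 2 ?_)
    · intro v hv
      rw [mem_filter] at hv
      exact ⟨(hT v hv.1).1, hv.2.2⟩
    · intro v hv w hw hvw i
      rw [mem_filter] at hv hw
      have hv0 : (v 1 : ℚ) ≠ 0 := by exact_mod_cast hv.2.2
      have hw0 : (w 1 : ℚ) ≠ 0 := by exact_mod_cast hw.2.2
      rw [div_eq_div_iff hv0 hw0] at hvw
      fin_cases i
      · simp [hv.2.1, hw.2.1]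
      · exact mul_comm _ _
      · exact_mod_cast hvw
    · refine (card_le_card (t := Q.roots.toFinset) ?_).trans ((Multiset.toFinset_card_le _).trans ((card_roots' Q).trans hQd))
      intro r hr
      obtain ⟨v, hv, rfl⟩ := mem_image.mp hr
      rw [mem_filter] at hv
      have hv0 : (v 1 : ℚ) ≠ 0 := by exact_mod_cast hv.2.2
      rw [Multiset.mem_toFinset, mem_roots hQ0, IsRoot.def, hQeval]
      have h2 := eval_smul_hom F hF ((v 1 : ℚ)⁻¹) (fun i => (v i : ℚ))
      rw [(hT v hv.1).2.2, mul_zero] at h2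
      refine Eq.trans ?_ h2
      congr 2
      funext i
      fin_cases i
      · simp [hv.2.1]
      · simp [hv0]
      · simp [div_eq_mul_inv, mul_comm]
  have hE : (T.filter fun v => v 0 = 0 ∧ v 1 = 0).card ≤ 2 := by
    have h2 : ∀ v ∈ T.filter (fun v => v 0 = 0 ∧ v 1 = 0), Prim v ∧ v 2 ≠ 0 := by
      intro v hv
      rw [mem_filter] at hv
      refine ⟨(hT v hv.1).1, ?_⟩
      obtain ⟨i, hi⟩ := (hT v hv.1).1.ne_zero
      fin_cases i
      · exact absurd hv.2.1 hi
      · exact absurd hv.2.2 hi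
      · exact hi
    refine (prim_card _ (fun _ => ()) 2 h2 ?_).trans ?_
    · intro v hv w hw _ i
      rw [mem_filter] at hv hw
      fin_cases i
      · simp [hv.2.1, hw.2.1]
      · simp [hv.2.2, hw.2.2]
      · exact mul_comm _ _
    · have : (image (fun _ : Fin 3 → ℤ => ()) (T.filter (fun v => v 0 = 0 ∧ v 1 = 0))).card ≤ 1 := card_le_one.mpr (fun _ _ _ _ => rfl)
      omega
  have hT3 : T.card ≤ (T.filter fun v => v 0 ≠ 0).card + (T.filter fun v => v 0 = 0 ∧ v 1 ≠ 0).card + (T.filter fun v => v 0 = 0 ∧ v 1 = 0).card := by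
    refine le_trans (card_le_card (t := (T.filter fun v => v 0 ≠ 0) ∪ (T.filter fun v => v 0 = 0 ∧ v 1 ≠ 0) ∪ (T.filter fun v => v 0 = 0 ∧ v 1 = 0)) ?_) ?_
    · intro v hv
      simp only [mem_union, mem_filter]
      by_cases h0 : v 0 = 0 <;> by_cases h1 : v 1 = 0 <;> simp [hv, h0, h1]
    · exact (card_union_le _ _).trans (Nat.add_le_add_right (card_union_le _ _) _)
  have hM8 : 1 ≤ M ^ 8 := Nat.one_le_pow _ _ (by omega)
  have hfin : (L + 1) * ((d * M ^ 8) * (d * D)) ≤ 150 * (d ^ 5 * M ^ 8) := by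
    calc (L + 1) * ((d * M ^ 8) * (d * D)) ≤ (15 * d ^ 3) * ((d * M ^ 8) * (d * D)) := Nat.mul_le_mul_right _ hL15
      _ = _ := by rw [hD]; ring
  have h1 : d ^ 5 ≤ d ^ 5 * M ^ 8 := Nat.le_mul_of_pos_right _ hM8
  have h2 : 400 * (d ^ 5 * M ^ 8) ≤ M ^ 9 := by
    calc 400 * (d ^ 5 * M ^ 8) = (400 * d ^ 5) * M ^ 8 := by ring
      _ ≤ M * M ^ 8 := Nat.mul_le_mul_right _ hM400
      _ = M ^ 9 := by ring
  have h3 : d * d ≤ d ^ 5 := by rw [← pow_two]; exact hd25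
  omega

/-- directions -/
theorem PD : ∃ C0 : ℕ, 0 < C0 ∧ ∀ (d M : ℕ) (F : MP 3 ℚ), 3 ≤ d → F.IsHomogeneous d → Irreducible F →
    coeff (single 0 d) F ≠ 0 → C0 * d ^ 5 ≤ M → ∀ T : Finset (Fin 3 → ℤ),
    (∀ v ∈ T, Prim v ∧ (∀ i, |v i| ≤ (M:ℤ) ^ 10) ∧ eval (fun i => (v i : ℚ)) F = 0) → T.card ≤ M ^ 9 := by
  classical
  obtain ⟨C0, hC0, h⟩ := PD_one
  refine ⟨C0, hC0, fun d M F hd hF hirr hcF hM T hT => ?_⟩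
  obtain ⟨π, hπ⟩ : ∃ π : Equiv.Perm (Fin 3), π = Equiv.swap 0 1 := ⟨_, rfl⟩
  have hππ : ∀ i, π (π i) = i := by intro i; rw [hπ]; exact Equiv.swap_apply_self _ _ _
  have hinj : Injective (fun (v : Fin 3 → ℤ) => v ∘ π) := π.surjective.injective_comp_right
  rw [← card_image_of_injective T hinj]
  refine h d M (rename π F) hd hF.rename_isHomogeneous ?_ ?_ hM _ ?_
  · exact (MulEquiv.irreducible_iff (renameEquiv ℚ π)).mpr hirr
  · have := coeff_rename_mapDomain π π.injective F (single 0 d)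
    rw [Finsupp.mapDomain_single, show π 0 = 1 by rw [hπ]; simp] at this
    rwa [this]
  · intro y hy
    obtain ⟨v, hv, rfl⟩ := mem_image.mp hy
    obtain ⟨⟨u, hu⟩, hb, he⟩ := hT v hv
    refine ⟨⟨u ∘ π, ?_⟩, fun i => hb _, ?_⟩
    · rw [← hu]; exact Equiv.sum_comp π (fun i => u i * v i)
    · rw [eval_rename]
      refine Eq.trans ?_ he
      congr 2
      funext i
      simp [hππ]

theorem factor_sum {σ α : Type*} {K : Type*} [Field K] (c : ℕ) (R : MvPolynomial σ K → α → Prop)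
    (hR : ∀ k k' x, Associated k k' → R k x → R k' x) (h : MvPolynomial σ K) (h0 : h ≠ 0) :
    ∀ (Z : Finset α), (∀ x ∈ Z, ∃ k, Irreducible k ∧ k ∣ h ∧ R k x) →
      (∀ k, Irreducible k → k ∣ h → ∀ Y ⊆ Z, (∀ x ∈ Y, R k x) → Y.card ≤ c * k.totalDegree) → Z.card ≤ c * h.totalDegree := by
  classical
  induction h using WfDvdMonoid.induction_on_irreducible with
  | zero => exact absurd rfl h0
  | unit u hu =>
    intro Z h1 _
    have : Z = ∅ := by
      refine eq_empty_of_forall_notMem fun x hx => ?_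
      obtain ⟨k, hk, hku, _⟩ := h1 x hx
      exact hk.not_isUnit (isUnit_of_dvd_unit hku hu)
    rw [this]; simp
  | mul a p ha hp ih =>
    intro Z h1 h2
    rw [totalDegree_mul_of_isDomain hp.ne_zero ha, mul_add, ← card_filter_add_card_filter_not (s := Z) (fun x => R p x)]
    refine add_le_add ?_ ?_
    · exact h2 p hp (dvd_mul_right _ _) _ (filter_subset _ _) fun x hx => (mem_filter.mp hx).2
    · refine ih ha _ ?_ ?_
      · intro x hx
        rw [mem_filter] at hx
        obtain ⟨k, hk, hkd, hkx⟩ := h1 x hx.1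
        rcases hk.prime.dvd_or_dvd hkd with h3 | h3
        · exact absurd (hR k p x (hk.associated_of_dvd hp h3) hkx) hx.2
        · exact ⟨k, hk, h3, hkx⟩
      · intro k hk hka Y hY hYk
        exact h2 k hk (hka.mul_left p) Y (hY.trans (filter_subset _ _)) hYk

theorem totalDegree_hc {n d : ℕ} (F : MP n A) (hF : F.IsHomogeneous d) (h0 : F ≠ 0) :
    F.totalDegree = d := hF.totalDegree h0

theorem isUnit_of_totalDegree_zero {K : Type*} [Field K] {σ : Type*} (P : MvPolynomial σ K) (hP0 : P ≠ 0) (hP : P.totalDegree = 0) : IsUnit P := by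
  rw [totalDegree_eq_zero_iff_eq_C] at hP
  rw [hP] at hP0 ⊢
  exact (isUnit_iff_ne_zero.mpr (fun h => hP0 (by rw [h, C_0]))).map C

theorem totalDegree_zero_of_isUnit {K : Type*} [Field K] {σ : Type*} (P : MvPolynomial σ K) (hP : IsUnit P) : P.totalDegree = 0 := by
  obtain ⟨r, _, h⟩ := isUnit_iff_eq_C_of_isReduced.mp hP
  rw [h, totalDegree_C]

theorem hc_mul_top {K : Type*} [Field K] {n : ℕ} (a b : MP n K) :
    homogeneousComponent (a.totalDegree + b.totalDegree) (a * b) = homogeneousComponent a.totalDegree a * homogeneousComponent b.totalDegree b := by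
  classical
  obtain ⟨s, hs⟩ : ∃ s, s = a.totalDegree := ⟨_, rfl⟩
  obtain ⟨t, ht⟩ : ∃ t, t = b.totalDegree := ⟨_, rfl⟩
  have hab : a * b = (∑ i ∈ range (a.totalDegree + 1), homogeneousComponent i a) * ∑ i ∈ range (b.totalDegree + 1), homogeneousComponent i b := by
    rw [sum_homogeneousComponent a, sum_homogeneousComponent b]
  rw [hab, sum_mul_sum, map_sum]
  rw [sum_eq_single a.totalDegree]
  · rw [map_sum, sum_eq_single b.totalDegree]
    · exact ((homogeneousComponent_isHomogeneous _ a).mul (homogeneousComponent_isHomogeneous _ b)) |> fun h => by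
        rw [homogeneousComponent_of_mem h, if_pos rfl]
    · intro j hj hne
      have h := (homogeneousComponent_isHomogeneous a.totalDegree a).mul (homogeneousComponent_isHomogeneous j b)
      rw [homogeneousComponent_of_mem h, if_neg (by omega)]
    · intro h; exact absurd (mem_range.mpr (Nat.lt_succ_self _)) h
  · intro i hi hne
    rw [map_sum]
    refine sum_eq_zero fun j hj => ?_
    have h := (homogeneousComponent_isHomogeneous i a).mul (homogeneousComponent_isHomogeneous j b)
    rw [mem_range] at hi hj
    rw [homogeneousComponent_of_mem h, if_neg (by omega)]
  · intro h; exact absurd (mem_range.mpr (Nat.lt_succ_self _)) h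

theorem irred_of_top {K : Type*} [Field K] {n d : ℕ} (f : MP n K) (hd : f.totalDegree = d) (hd1 : 1 ≤ d)
    (h : Irreducible (homogeneousComponent d f)) : Irreducible f := by
  have hf0 : f ≠ 0 := by rintro rfl; exact h.ne_zero (map_zero _)
  refine ⟨fun hu => by have := totalDegree_zero_of_isUnit f hu; omega, ?_⟩
  intro a b hab
  have ha0 : a ≠ 0 := by rintro rfl; exact hf0 (by rw [hab, zero_mul])
  have hb0 : b ≠ 0 := by rintro rfl; exact hf0 (by rw [hab, mul_zero])
  have hdd : d = a.totalDegree + b.totalDegree := by rw [← hd, hab, totalDegree_mul_of_isDomain ha0 hb0]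
  have h1 : homogeneousComponent d f = homogeneousComponent a.totalDegree a * homogeneousComponent b.totalDegree b := by
    rw [hdd, hab]; exact hc_mul_top a b
  have key : ∀ P : MP n K, P ≠ 0 → IsUnit (homogeneousComponent P.totalDegree P) → IsUnit P := by
    intro P hP hu
    have h2 := totalDegree_zero_of_isUnit _ hu
    rw [totalDegree_hc _ (homogeneousComponent_isHomogeneous _ P) (hc_ne_zero P rfl hP)] at h2
    exact isUnit_of_totalDegree_zero P hP h2
  rcases h.isUnit_or_isUnit h1 with h2 | h2
  · exact Or.inl (key a ha0 h2)
  · exact Or.inr (key b hb0 h2)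

theorem irred_of_map {K L : Type*} [Field K] [Field L] (φ : K →+* L) {σ : Type*} (f : MvPolynomial σ K)
    (h : Irreducible (map φ f)) : Irreducible f := by
  have key : ∀ P : MvPolynomial σ K, IsUnit (map φ P) → IsUnit P := by
    intro P hP
    refine isUnit_of_totalDegree_zero P (fun h0 => ?_) ?_
    · rw [h0, map_zero] at hP; exact not_isUnit_zero hP
    · have := totalDegree_zero_of_isUnit _ hP
      rwa [totalDegree, support_map_of_injective _ φ.injective] at this
  refine ⟨fun hu => h.not_isUnit (hu.map _), fun a b hab => ?_⟩
  rcases h.isUnit_or_isUnit (show map φ f = map φ a * map φ b by rw [hab, map_mul]) with h2 | h2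
  · exact Or.inl (key a h2)
  · exact Or.inr (key b h2)

theorem hom_X_dvd {K : Type*} [Field K] {d : ℕ} (P : MP 2 K) (hP : P.IsHomogeneous d) (i j : Fin 2) (hij : i ≠ j)
    (h : coeff (single i d) P = 0) : X j ∣ P := by
  rw [P.as_sum]
  refine dvd_sum fun m hm => ?_
  rw [X_dvd_monomial]
  right
  intro hmj
  have h1 : m.degree = d := by
    by_contra hne
    exact (mem_support_iff.mp hm) (hP.coeff_eq_zero hne)
  have : m = single i d := by
    rw [degree_eq_sum, Fin.sum_univ_two] at h1
    ext t
    fin_cases i <;> fin_cases j <;> first | exact absurd rfl hij | skip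
    all_goals fin_cases t <;> simp_all [single_apply]
  exact (mem_support_iff.mp hm) (this ▸ h)

theorem binary_reducible {K : Type*} [Field K] [IsAlgClosed K] {d : ℕ} (hd : 2 ≤ d) (P : MP 2 K)
    (hP : P.IsHomogeneous d) (h : Irreducible P) : False := by
  have key : ∀ Q : MP 2 K, Q.IsHomogeneous d → Irreducible Q → ∀ j, ¬ (X j ∣ Q) := by
    intro Q hQ hQi j ⟨c, hc⟩
    have hc0 : c ≠ 0 := by rintro rfl; exact hQi.ne_zero (by rw [hc, mul_zero])
    have h1 := hQ.totalDegree hQi.ne_zero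
    rw [hc, totalDegree_mul_of_isDomain (X_ne_zero j) hc0, totalDegree_X] at h1
    rcases hQi.isUnit_or_isUnit hc with h2 | h2
    · have := totalDegree_zero_of_isUnit _ h2
      rw [totalDegree_X] at this; omega
    · have := totalDegree_zero_of_isUnit _ h2
      omega
  have hroot : ∀ s : K, eval (![1, s] : Fin 2 → K) P ≠ 0 := by
    intro s hs
    have h1 := coeff_shear d P (fun _ : Fin 1 => s)
    rw [homogeneousComponent_of_mem hP, if_pos rfl, show (Fin.cons 1 fun _ : Fin 1 => s : Fin 2 → K) = ![1, s] by
      funext i; fin_cases i <;> rfl, hs] at h1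
    have hhom : (aeval (shv fun _ : Fin 1 => s) P).IsHomogeneous d := by
      have := hc_aeval_linear (shv fun _ : Fin 1 => s) (shv_isHomogeneous _) d P
      rw [homogeneousComponent_of_mem hP, if_pos rfl] at this
      rw [← this]; exact homogeneousComponent_isHomogeneous _ _
    exact key _ hhom ((shv_irreducible _ P).mpr h) 1 (hom_X_dvd _ hhom 0 1 (by decide) h1)
  obtain ⟨q, hq⟩ : ∃ q : Polynomial K, q = aeval (![1, PX] : Fin 2 → Polynomial K) P := ⟨_, rfl⟩
  obtain ⟨p, hp⟩ : ∃ p : Polynomial K, p = aeval (![PX, 1] : Fin 2 → Polynomial K) P := ⟨_, rfl⟩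
  have hqe : ∀ r : K, q.eval r = eval (![1, r] : Fin 2 → K) P := by
    intro r
    rw [hq, ← Polynomial.coe_aeval_eq_eval, ← aeval_eq_eval]
    change ((Polynomial.aeval r).comp (aeval _)) P = _
    rw [comp_aeval]
    congr 2
    funext i
    fin_cases i <;> simp
  have hpe : ∀ r : K, p.eval r = eval (![r, 1] : Fin 2 → K) P := by
    intro r
    rw [hp, ← Polynomial.coe_aeval_eq_eval, ← aeval_eq_eval]
    change ((Polynomial.aeval r).comp (aeval _)) P = _
    rw [comp_aeval]
    congr 2
    funext i
    fin_cases i <;> simp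
  have hqd : q.degree = 0 := by
    by_contra hne
    obtain ⟨r, hr⟩ := IsAlgClosed.exists_root q hne
    exact hroot r (by rw [← hqe]; exact hr)
  obtain ⟨c, hc⟩ : ∃ c, q = CX c := ⟨_, Polynomial.eq_C_of_degree_eq_zero hqd⟩
  haveI : Infinite K := IsAlgClosed.instInfinite
  have hpp : p = CX c * PX ^ d := by
    refine Polynomial.eq_of_infinite_eval_eq _ _ (Set.Infinite.mono (s := {0}ᶜ) ?_ (Set.Finite.infinite_compl (Set.finite_singleton 0)))
    intro u hu
    have hu0 : u ≠ 0 := by simpa using hu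
    rw [Set.mem_setOf_eq, hpe]
    have h1 := eval_smul_hom P hP u ![1, u⁻¹]
    rw [← hqe, hc, Polynomial.eval_C] at h1
    simp only [Polynomial.eval_C, Polynomial.eval_mul, Polynomial.eval_pow, Polynomial.eval_X]
    rw [mul_comm, ← h1]
    congr 2
    funext i
    fin_cases i
    · simp
    · simp [hu0]
  have h0 : eval (Pi.single 1 1 : Fin 2 → K) P = 0 := by
    have := hpe 0
    rw [hpp] at this
    simp only [Polynomial.eval_C, Polynomial.eval_mul, Polynomial.eval_pow, Polynomial.eval_X, zero_pow (by omega : d ≠ 0), mul_zero] at this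
    rw [this]
    congr 2
    funext i
    fin_cases i <;> simp
  rw [eval_single_hom P hP] at h0
  exact key P hP h 0 (hom_X_dvd P hP 1 0 (by decide) h0)

theorem irred_aeval_fwd {K : Type*} [Field K] {n : ℕ} (v w : Fin n → MP n K)
    (h1 : ∀ i, aeval v (w i) = X i) (h2 : ∀ i, aeval w (v i) = X i) (f : MP n K) (hf : Irreducible f) :
    Irreducible (aeval v f) := (irreducible_aeval_iff v w h1 h2 f).mpr hf

theorem exists_irred_root {K : Type*} [Field K] {n : ℕ} (y : Fin n → K) (p : MP n K) (hp : p ≠ 0) (h : eval y p = 0) :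
    ∃ k, Irreducible k ∧ k ∣ p ∧ eval y k = 0 := by
  induction p using WfDvdMonoid.induction_on_irreducible with
  | zero => exact absurd rfl hp
  | unit u hu =>
    have := hu.map (eval y)
    rw [h] at this
    exact absurd this not_isUnit_zero
  | mul a q ha hq ih =>
    rw [map_mul, mul_eq_zero] at h
    rcases h with h1 | h1
    · exact ⟨q, hq, dvd_mul_right _ _, h1⟩
    · obtain ⟨k, hk, hk1, hk2⟩ := ih ha h1
      exact ⟨k, hk, hk1.mul_left _, hk2⟩

theorem lines_y {K : Type*} [Field K] [IsAlgClosed K] {d : ℕ} (hd2 : 2 ≤ d) (f : MP 3 K)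
    (hd : f.totalDegree = d) (hirr : Irreducible (homogeneousComponent d f)) (v : Fin 3 → K) (i : Fin 3) (hvi : v i ≠ 0)
    (Z : Finset (Fin 2 → K)) (hZ : ∀ y ∈ Z, ∀ t : ℤ, eval (fun s => i.insertNth (α := fun _ => K) 0 y s + (t : K) * v s) f = 0) [CharZero K] :
    Z.card ≤ d * d := by
  classical
  obtain ⟨w, hw⟩ : ∃ w : Fin 3 → MP 3 K, w = i.insertNth (α := fun _ => MP 3 K) (C (v i) * X 0)
    (fun j => X j.succ + C (v (i.succAbove j)) * X 0) := ⟨_, rfl⟩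
  have hwi : w i = C (v i) * X 0 := by rw [hw, Fin.insertNth_apply_same]
  have hwj : ∀ j, w (i.succAbove j) = X j.succ + C (v (i.succAbove j)) * X 0 := by
    intro j; rw [hw, Fin.insertNth_apply_succAbove]
  obtain ⟨w', hw'⟩ : ∃ w' : Fin 3 → MP 3 K, w' = Fin.cons (C ((v i)⁻¹) * X i)
    (fun j : Fin 2 => X (i.succAbove j) - C (v (i.succAbove j) * (v i)⁻¹) * X i) := ⟨_, rfl⟩
  have hCC : C (v i) * C ((v i)⁻¹) = (1 : MP 3 K) := by rw [← C_mul, mul_inv_cancel₀ hvi, C_1]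
  have e1 : ∀ s, aeval w (w' s) = X s := by
    intro s
    refine Fin.cases ?_ (fun j => ?_) s
    · rw [hw', cons_zero, map_mul, aeval_X, aeval_C, algebraMap_eq, hwi, ← mul_assoc, mul_comm (C (v i)⁻¹), hCC, one_mul]
    · rw [hw', cons_succ, map_sub, map_mul, aeval_X, aeval_X, aeval_C, algebraMap_eq, hwi, hwj, C_mul]
      linear_combination -(C (v (i.succAbove j)) * X 0) * hCC
  have e2 : ∀ s, aeval w' (w s) = X s := by
    intro s
    refine succAboveCases i ?_ (fun j => ?_) s
    · rw [hwi, map_mul, aeval_X, aeval_C, algebraMap_eq, hw', cons_zero, ← mul_assoc, hCC, one_mul]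
    · rw [hwj, map_add, map_mul, aeval_X, aeval_X, aeval_C, algebraMap_eq, hw', cons_zero, cons_succ, C_mul]
      ring
  have hwhom : ∀ s, (w s).IsHomogeneous 1 := by
    intro s
    have hCX : ∀ c : K, (C c * X 0 : MP 3 K).IsHomogeneous 1 := fun c => by
      simpa using (isHomogeneous_C (Fin 3) c).mul (isHomogeneous_X K (0 : Fin 3))
    refine succAboveCases i ?_ (fun j => ?_) s
    · rw [hwi]; exact hCX _
    · rw [hwj]; exact (isHomogeneous_X _ _).add (hCX _)
  have hfirr := irred_of_top f hd (by omega) hirr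
  obtain ⟨g, hg⟩ : ∃ g, g = aeval w f := ⟨_, rfl⟩
  have hgirr : Irreducible g := by rw [hg]; exact irred_aeval_fwd w w' e1 e2 f hfirr
  have hgtop : Irreducible (homogeneousComponent d g) := by
    rw [hg, hc_aeval_linear w hwhom]; exact irred_aeval_fwd w w' e1 e2 _ hirr
  have hgd : g.totalDegree ≤ d := by
    rw [hg, ← hd]; exact totalDegree_affine_le f w fun s => (hwhom s).totalDegree_le
  obtain ⟨P, hP⟩ : ∃ P, P = finSuccEquiv K 2 g := ⟨_, rfl⟩
  have hP0 : P ≠ 0 := by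
    rw [hP]; intro h
    exact hgirr.ne_zero ((map_eq_zero_iff _ (finSuccEquiv K 2).injective).mp h)
  have hcd : ∀ j, (P.coeff j).totalDegree ≤ d := by
    intro j
    by_cases h : P.coeff j = 0
    · rw [h, totalDegree_zero]; omega
    · have := totalDegree_coeff_finSuccEquiv_add_le g j (by rwa [← hP])
      rw [← hP] at this
      omega
  have hzero : ∀ y ∈ Z, ∀ j, eval y (P.coeff j) = 0 := by
    intro y hy j
    have h1 : P.map (eval y) = 0 := by
      refine eq_zero_of_infinite_isRoot _ (Set.Infinite.mono (s := Set.range (fun t : ℤ => (t : K))) ?_ (Set.infinite_range_of_injective Int.cast_injective))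
      rintro _ ⟨t, rfl⟩
      rw [Set.mem_setOf_eq, IsRoot.def, hP, ← eval_eq_eval_mv_eval']
      refine Eq.trans ?_ (hZ y hy t)
      rw [hg, ← aeval_eq_eval, ← aeval_eq_eval]
      change ((aeval _).comp (aeval _)) f = _
      rw [comp_aeval]
      congr 2
      funext s
      refine succAboveCases i ?_ (fun j => ?_) s
      · rw [hwi]; simp [mul_comm]
      · rw [hwj]; simp [mul_comm]
    rw [← Polynomial.coeff_map, h1, Polynomial.coeff_zero]
  have hex : ∀ k : MP 2 K, Irreducible k → ∃ j, ¬ k ∣ P.coeff j := by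
    intro k hk
    by_contra hcon
    push Not at hcon
    have h1 : CX k ∣ P := Polynomial.C_dvd_iff_dvd_coeff _ _ |>.mpr hcon
    have h2 : finSuccEquiv K 2 (rename Fin.succ k) = CX k := by
      change ((finSuccEquiv K 2 : _ →ₐ[K] _).comp (rename Fin.succ)) k = ((Algebra.ofId (MP 2 K) (Polynomial (MP 2 K))).restrictScalars K) k
      congr 1
      apply algHom_ext
      intro s
      simp only [AlgHom.comp_apply, rename_X, AlgHom.coe_restrictScalars', Algebra.ofId_apply, Polynomial.algebraMap_eq]
      exact finSuccEquiv_X_succ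
    have h3 : rename Fin.succ k ∣ g := by
      rw [← h2, hP] at h1
      exact (map_dvd_iff (finSuccEquiv K 2)).mp h1
    have h4 : ¬ IsUnit (rename Fin.succ k : MP 3 K) := by
      intro hu
      have := hu.map (finSuccEquiv K 2)
      rw [h2, Polynomial.isUnit_C] at this
      exact hk.not_isUnit this
    obtain ⟨u, hu⟩ := h3
    have h5 : IsUnit u := (hgirr.isUnit_or_isUnit hu).resolve_left h4
    obtain ⟨r, _, h6⟩ := isUnit_iff_eq_C_of_isReduced.mp h5
    have h7 : g = aeval (fun s : Fin 2 => X s.succ) (k * C r) := by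
      have h8 : (rename Fin.succ : MP 2 K →ₐ[K] MP 3 K) = aeval (fun s : Fin 2 => X s.succ) := by
        apply algHom_ext; intro s; rw [rename_X, aeval_X]
      rw [hu, h6, map_mul, aeval_C, ← h8, algebraMap_eq]
    rw [h7, hc_aeval_linear _ (fun s => isHomogeneous_X _ _)] at hgtop
    have h8 : Irreducible (homogeneousComponent d (k * C r)) := by
      refine ⟨fun hu => hgtop.not_isUnit (hu.map _), fun a b hab => ?_⟩
      have h9 := hgtop.isUnit_or_isUnit (show _ = aeval (fun s : Fin 2 => (X s.succ : MP 3 K)) a * aeval (fun s : Fin 2 => X s.succ) b by rw [hab, map_mul])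
      have hback : ∀ a : MP 2 K, IsUnit (aeval (fun s : Fin 2 => (X s.succ : MP 3 K)) a) → IsUnit a := by
        intro a ha
        have := ha.map (aeval (Fin.cons 0 X : Fin 3 → MP 2 K))
        rw [← AlgHom.comp_apply, comp_aeval] at this
        simpa using this
      exact h9.imp (hback a) (hback b)
    exact binary_reducible hd2 _ (homogeneousComponent_isHomogeneous d _) h8
  have hlead : P.leadingCoeff ≠ 0 := Polynomial.leadingCoeff_ne_zero.mpr hP0
  refine (factor_sum d (fun k y => eval y k = 0) ?_ P.leadingCoeff hlead Z ?_ ?_).trans (Nat.mul_le_mul_left d (hcd _))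
  · rintro k k' x ⟨u, rfl⟩ h
    rw [map_mul, h, zero_mul]
  · intro y hy
    have h1 := hzero y hy P.natDegree
    exact exists_irred_root y _ hlead h1
  · intro k hk _ Y hY hYk
    obtain ⟨j, hj⟩ := hex k hk
    rw [mul_comm]
    exact (bezout_points k (P.coeff j) hk hj Y hYk fun y hy => hzero y (hY hy) j).trans (Nat.mul_le_mul_left _ (hcd j))

theorem lines_dir {K : Type*} [Field K] [IsAlgClosed K] [CharZero K] {d : ℕ} (hd2 : 2 ≤ d) (f : MP 3 K)
    (hd : f.totalDegree = d) (hirr : Irreducible (homogeneousComponent d f)) (v : Fin 3 → ℤ) (hv : Prim v) (i : Fin 3) (H B : ℕ) (hH : 1 ≤ H)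
    (hvi : (H:ℤ) ≤ |v i|) (S : Finset (Fin 3 → ℤ)) (hS : ∀ x ∈ S, (∀ s, |x s| ≤ (B:ℤ)) ∧ ∀ t : ℤ, eval (fun s => ((x s + t * v s : ℤ) : K)) f = 0) :
    S.card ≤ (4 * B / H + 1) * (d * d) := by
  classical
  have hvi0 : v i ≠ 0 := by intro h; rw [h, abs_zero] at hvi; omega
  have hvK : (v i : K) ≠ 0 := by exact_mod_cast hvi0
  obtain ⟨y, hy⟩ : ∃ y : (Fin 3 → ℤ) → (Fin 2 → K), y = fun x j => (x (i.succAbove j) : K) - (x i : K) / v i * v (i.succAbove j) := ⟨_, rfl⟩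
  have hxy : ∀ x s, (x s : K) = i.insertNth (α := fun _ => K) 0 (y x) s + (x i : K) / v i * v s := by
    intro x s
    refine succAboveCases i ?_ (fun j => ?_) s
    · rw [Fin.insertNth_apply_same, zero_add, div_mul_cancel₀ _ hvK]
    · rw [Fin.insertNth_apply_succAbove, hy]; ring
  have hfib : ∀ b ∈ S.image y, (S.filter fun x => y x = b).card ≤ 4 * B / H + 1 := by
    intro b hb
    obtain ⟨x0, hx0, rfl⟩ := mem_image.mp hb
    have hex : ∀ x ∈ S.filter (fun x => y x = y x0), ∃ m : ℤ, (∀ s, x s = x0 s + m * v s) ∧ -((2 * B / H : ℕ):ℤ) ≤ m ∧ m ≤ ((2 * B / H : ℕ):ℤ) := by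
      intro x hx
      rw [mem_filter] at hx
      obtain ⟨u, hu⟩ := hv
      have h1 : ∀ s, (x s - x0 s) * v i = (x i - x0 i) * v s := by
        intro s
        have h2 := hxy x s
        have h3 := hxy x0 s
        rw [hx.2] at h2
        have h4 : ((x s : K) - x0 s) * v i = ((x i : K) - x0 i) * v s := by
          rw [h2, h3]; field_simp; ring
        exact_mod_cast h4
      have h2 : x i - x0 i = (∑ s, u s * (x s - x0 s)) * v i := by
        calc x i - x0 i = (x i - x0 i) * ∑ s, u s * v s := by rw [hu, mul_one]
          _ = ∑ s, u s * ((x i - x0 i) * v s) := by rw [mul_sum]; exact sum_congr rfl fun s _ => by ring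
          _ = ∑ s, u s * ((x s - x0 s) * v i) := sum_congr rfl fun s _ => by rw [h1 s]
          _ = _ := by rw [sum_mul]; exact sum_congr rfl fun s _ => by ring
      obtain ⟨m, hm⟩ : ∃ m, m = ∑ s, u s * (x s - x0 s) := ⟨_, rfl⟩
      rw [← hm] at h2
      have h5 : |m| * H ≤ 2 * B := by
        calc |m| * H ≤ |m| * |v i| := mul_le_mul_of_nonneg_left hvi (abs_nonneg _)
          _ = |x i - x0 i| := by rw [h2, abs_mul]
          _ ≤ |x i| + |x0 i| := abs_sub _ _
          _ ≤ B + B := add_le_add ((hS x hx.1).1 i) ((hS x0 hx0).1 i)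
          _ = 2 * B := by ring
      have h6 : |m| ≤ ((2 * B / H : ℕ):ℤ) := by
        push_cast
        exact (Int.le_ediv_iff_mul_le (by omega)).mpr h5
      refine ⟨m, fun s => ?_, (abs_le.mp h6).1, (abs_le.mp h6).2⟩
      have := h1 s
      rw [h2] at this
      have h7 : (x s - x0 s - m * v s) * v i = 0 := by linear_combination this
      rcases mul_eq_zero.mp h7 with h8 | h8
      · linarith
      · exact absurd h8 hvi0
    have hsub : S.filter (fun x => y x = y x0) ⊆ (Icc (-((2 * B / H : ℕ):ℤ)) ((2 * B / H : ℕ):ℤ)).image (fun m s => x0 s + m * v s) := by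
      intro x hx
      obtain ⟨m, h1, h2, h3⟩ := hex x hx
      exact mem_image.mpr ⟨m, mem_Icc.mpr ⟨h2, h3⟩, funext fun s => (h1 s).symm⟩
    refine (card_le_card hsub).trans (card_image_le.trans ?_)
    rw [Int.card_Icc]
    have : 2 * (2 * B / H) ≤ 4 * B / H := by
      rw [show 4 * B = 2 * (2 * B) by ring]
      exact Nat.mul_div_le_mul_div_assoc 2 (2 * B) H
    omega
  refine (card_le_mul_card_image S _ hfib).trans (Nat.mul_le_mul_left _ ?_)
  refine lines_y hd2 f hd hirr (fun s => (v s : K)) i hvK _ ?_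
  intro b hb t
  obtain ⟨x, hx, rfl⟩ := mem_image.mp hb
  obtain ⟨q, hq⟩ : ∃ q : Polynomial K, q = aeval (fun s => CX (i.insertNth (α := fun _ => K) 0 (y x) s) + PX * CX (v s : K)) f := ⟨_, rfl⟩
  have hqe : ∀ r : K, q.eval r = eval (fun s => i.insertNth (α := fun _ => K) 0 (y x) s + r * v s) f := by
    intro r
    rw [hq, ← Polynomial.coe_aeval_eq_eval, ← aeval_eq_eval]
    change ((Polynomial.aeval r).comp (aeval _)) f = _
    rw [comp_aeval]
    congr 2
    funext s
    simp
  have hq0 : q = 0 := by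
    refine eq_zero_of_infinite_isRoot _ (Set.Infinite.mono (s := Set.range (fun t : ℤ => (x i : K) / v i + (t : K))) ?_
      (Set.infinite_range_of_injective fun a b hab => by simpa using hab))
    rintro _ ⟨t, rfl⟩
    rw [Set.mem_setOf_eq, IsRoot.def, hqe]
    refine Eq.trans ?_ ((hS x hx).2 t)
    congr 2
    funext s
    push_cast
    rw [hxy x s]; ring
  rw [← hqe, hq0, Polynomial.eval_zero]

theorem coeff_line {n d : ℕ} (f : MP n A) (hd : f.totalDegree ≤ d) (x v : Fin n → A) :
    (aeval (fun s => CX (x s) + PX * CX (v s)) f).coeff d = eval v (homogeneousComponent d f) := by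
  classical
  have hl : ∀ s, (CX (x s) + PX * CX (v s)).natDegree ≤ 1 := fun s => by compute_degree
  rw [aeval_def, eval₂_eq', Polynomial.finset_sum_coeff, homogeneousComponent_apply, map_sum, sum_filter]
  refine sum_congr rfl fun m hm => ?_
  have hmd : m.degree ≤ d := (le_totalDegree hm).trans hd
  have hn : ∀ s, ((CX (x s) + PX * CX (v s)) ^ m s).natDegree ≤ m s := fun s =>
    Polynomial.natDegree_pow_le.trans ((Nat.mul_le_mul_left _ (hl s)).trans_eq (mul_one _))
  have hle : ∀ S : Finset (Fin n), (∏ s ∈ S, (CX (x s) + PX * CX (v s)) ^ m s).natDegree ≤ ∑ s ∈ S, m s :=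
    fun S => (Polynomial.natDegree_prod_le _ _).trans (sum_le_sum fun s _ => hn s)
  have hco : ∀ S : Finset (Fin n), (∏ s ∈ S, (CX (x s) + PX * CX (v s)) ^ m s).coeff (∑ s ∈ S, m s) = ∏ s ∈ S, v s ^ m s := by
    intro S
    induction S using Finset.induction_on with
    | empty => simp
    | insert a S ha ih =>
      have := Polynomial.coeff_pow_of_natDegree_le (m := m a) (hl a)
      rw [mul_one] at this
      rw [prod_insert ha, sum_insert ha, prod_insert ha, Polynomial.coeff_mul_add_eq_of_natDegree_le (hn a) (hle S), ih, this]
      simp [Polynomial.coeff_C]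
  rw [Polynomial.algebraMap_apply, Algebra.algebraMap_self, RingHom.id_apply, Polynomial.coeff_C_mul]
  split_ifs with h
  · rw [eval_monomial, prod_fintype _ _ (fun _ => pow_zero _), ← h, degree_eq_sum, hco]
  · rw [Polynomial.coeff_eq_zero_of_natDegree_lt ((hle univ).trans_lt _), mul_zero]
    rw [← degree_eq_sum]
    omega

theorem hc_map {A K : Type*} [CommRing A] [CommRing K] (φ : A →+* K) {n : ℕ} (d : ℕ) (f : MP n A) :
    homogeneousComponent d (map φ f) = map φ (homogeneousComponent d f) := by
  classical
  ext m
  rw [coeff_homogeneousComponent, coeff_map, coeff_map, coeff_homogeneousComponent]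
  split_ifs
  · rfl
  · rw [map_zero]

theorem eval_cast {K : Type*} [CommRing K] {n : ℕ} (y : Fin n → ℤ) (f : MP n ℤ) :
    eval (fun s => (y s : K)) (map (Int.castRingHom K) f) = ((eval y f : ℤ) : K) := by
  rw [eval_map]; exact (eval₂_comp (Int.castRingHom K) y f).symm

/-- The point `x` lies on a line with bounded primitive direction contained in `f = 0`. -/
def LinePt (f : MP 3 ℤ) (B : ℕ) (x : Fin 3 → ℤ) : Prop :=
  ∃ v : Fin 3 → ℤ, Prim v ∧ (∀ i, |v i| ≤ 2 * (B:ℤ)) ∧ ∀ t : ℤ, eval (fun s => x s + t * v s) f = 0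

theorem rat_irred {n : ℕ} (f : MP n ℤ) (h : Irreducible (map (Int.castRingHom (AlgebraicClosure ℚ)) f)) :
    Irreducible (map toℚ f) := by
  refine irred_of_map (algebraMap ℚ (AlgebraicClosure ℚ)) _ ?_
  rw [MvPolynomial.map_map, show (algebraMap ℚ (AlgebraicClosure ℚ)).comp toℚ = Int.castRingHom (AlgebraicClosure ℚ) from RingHom.ext_int _ _]
  exact h

theorem lines_bound : ∃ C : ℕ, ∀ (d : ℕ) (f : MP 3 ℤ) (B : ℕ), 5 ≤ d → f.totalDegree = d →
    Irreducible (map (Int.castRingHom (AlgebraicClosure ℚ)) (homogeneousComponent d f)) → coeff (single 0 d) f ≠ 0 → 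
    ∀ S : Finset (Fin 3 → ℤ), (∀ x ∈ S, (∀ i, |x i| ≤ (B:ℤ)) ∧ LinePt f B x) → S.card ≤ C * d ^ 47 * B := by
  classical
  obtain ⟨C0, hC0, hPD⟩ := PD
  refine ⟨6 * C0 ^ 9 + 6144, fun d f B hd5 hd hirr hc S hS => ?_⟩
  choose! v hv using fun x hx => (hS x hx).2
  obtain ⟨F, hF⟩ : ∃ F, F = map toℚ (homogeneousComponent d f) := ⟨_, rfl⟩
  have hFh : F.IsHomogeneous d := by rw [hF, ← hc_map]; exact homogeneousComponent_isHomogeneous _ _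
  have hFc : coeff (single 0 d) F ≠ 0 := by
    rw [hF, coeff_map, coeff_homogeneousComponent, if_pos (by simp)]
    simpa using hc
  have hFv : ∀ x ∈ S, eval (fun i => (v x i : ℚ)) F = 0 := by
    intro x hx
    rw [hF, eval_cast, ← coeff_line f hd.le x (v x)]
    have h0 : aeval (fun s => CX (x s) + PX * CX (v x s)) f = (0 : Polynomial ℤ) := by
      refine eq_zero_of_infinite_isRoot _ (Set.Infinite.mono (s := Set.univ) ?_ Set.infinite_univ)
      intro t _
      rw [Set.mem_setOf_eq, IsRoot.def]
      refine Eq.trans ?_ ((hv x hx).2.2 t)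
      rw [← Polynomial.coe_aeval_eq_eval, ← aeval_eq_eval]
      change ((Polynomial.aeval t).comp (aeval _)) f = _
      rw [comp_aeval]
      congr 2
      funext s
      simp
    rw [h0, Polynomial.coeff_zero, Int.cast_zero]
  have hinj : Injective (Int.castRingHom (AlgebraicClosure ℚ)) := Int.cast_injective
  have hgd : (map (Int.castRingHom (AlgebraicClosure ℚ)) f).totalDegree = d := by
    rw [← hd, totalDegree, totalDegree, support_map_of_injective _ hinj]
  have hgrp : ∀ M H : ℕ, C0 * d ^ 5 ≤ M → 1 ≤ H → ∀ S' ⊆ S, (∀ x ∈ S', (∀ i, |v x i| ≤ (M:ℤ) ^ 10) ∧ ∃ i, (H:ℤ) ≤ |v x i|) →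
      S'.card ≤ (4 * B / H + 1) * (d * d) * M ^ 9 := by
    intro M H hM hH S' hSS hS'
    refine (card_le_mul_card_image (f := v) S' ((4 * B / H + 1) * (d * d)) ?_).trans (Nat.mul_le_mul_left _ ?_)
    · intro w hw
      obtain ⟨x0, hx0, rfl⟩ := mem_image.mp hw
      obtain ⟨i, hi⟩ := (hS' x0 hx0).2
      refine lines_dir (by omega) (map (Int.castRingHom (AlgebraicClosure ℚ)) f) hgd (by rw [hc_map]; exact hirr) (v x0) (hv x0 (hSS hx0)).1 i H B hH hi _ ?_
      intro x hx
      rw [mem_filter] at hx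
      refine ⟨(hS x (hSS hx.1)).1, fun t => ?_⟩
      rw [eval_cast (fun s => x s + t * v x0 s), ← hx.2, (hv x (hSS hx.1)).2.2 t, Int.cast_zero]
    · refine hPD d M F (by omega) hFh (hF ▸ rat_irred _ hirr) hFc hM _ ?_
      intro w hw
      obtain ⟨x, hx, rfl⟩ := mem_image.mp hw
      exact ⟨(hv x (hSS hx)).1, (hS' x hx).1, hFv x (hSS hx)⟩
  obtain ⟨M0, hM0⟩ : ∃ M0, M0 = C0 * d ^ 5 := ⟨_, rfl⟩
  have hM01 : 1 ≤ M0 := by rw [hM0]; exact Nat.mul_pos hC0 (by positivity)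
  have hB1 : ∀ x ∈ S, 1 ≤ B := by
    intro x hx
    obtain ⟨i, hi⟩ := (hv x hx).1.ne_zero
    have := (hv x hx).2.1 i
    have := abs_pos.mpr hi
    omega
  have key : ∀ k : ℕ, (((S.filter fun x => ∀ i, |v x i| ≤ ((M0 * 2 ^ k : ℕ):ℤ) ^ 10).card : ℕ) : ℝ) ≤ (d * d * B : ℝ) * (6 * (M0:ℝ) ^ 9 + 6144 * (1 - (1/2) ^ k)) := by
    intro k
    induction k with
    | zero =>
      have h1 := hgrp M0 1 hM0.ge le_rfl (S.filter fun x => ∀ i, |v x i| ≤ ((M0 * 2 ^ 0 : ℕ):ℤ) ^ 10) (filter_subset _ _) (fun x hx => by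
        rw [mem_filter, pow_zero, mul_one] at hx
        obtain ⟨i, hi⟩ := (hv x hx.1).1.ne_zero
        exact ⟨hx.2, i, by have := abs_pos.mpr hi; push_cast; omega⟩)
      rcases eq_empty_or_nonempty S with h | ⟨x, hx⟩
      · rw [h]; simp; positivity
      have hb : (1:ℝ) ≤ B := by exact_mod_cast hB1 x hx
      rw [Nat.div_one] at h1
      have h2 : ((S.filter fun x => ∀ i, |v x i| ≤ ((M0 * 2 ^ 0 : ℕ):ℤ) ^ 10).card : ℝ) ≤ (4 * B + 1) * (d * d) * (M0:ℝ) ^ 9 := by exact_mod_cast h1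
      refine h2.trans ?_
      rw [pow_zero, sub_self, mul_zero, add_zero]
      calc (4 * (B:ℝ) + 1) * (d * d) * (M0:ℝ) ^ 9 ≤ (6 * B) * (d * d) * (M0:ℝ) ^ 9 := by gcongr; linarith
        _ = _ := by ring
    | succ k ih =>
      obtain ⟨m, hm⟩ : ∃ m, m = M0 * 2 ^ k := ⟨_, rfl⟩
      have hmk : M0 * 2 ^ (k + 1) = 2 * m := by rw [hm]; ring
      rw [← hm] at ih
      rw [hmk]
      have hm1 : 2 ^ k ≤ m := by rw [hm]; exact Nat.le_mul_of_pos_left _ hM01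
      have hm0 : 1 ≤ m := Nat.one_le_two_pow.trans hm1
      obtain ⟨S', hS'⟩ : ∃ S', S' = (S.filter fun x => (∀ i, |v x i| ≤ ((2 * m : ℕ):ℤ) ^ 10) ∧ ∃ i, ((m ^ 10 : ℕ):ℤ) ≤ |v x i|) := ⟨_, rfl⟩
      have h1 : (S.filter fun x => ∀ i, |v x i| ≤ ((2 * m : ℕ):ℤ) ^ 10) ⊆ (S.filter fun x => ∀ i, |v x i| ≤ (m:ℤ) ^ 10) ∪ S' := by
        intro x hx
        rw [mem_filter] at hx
        rw [mem_union, hS', mem_filter, mem_filter]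
        by_cases h : ∀ i, |v x i| ≤ (m:ℤ) ^ 10
        · exact Or.inl ⟨hx.1, h⟩
        · push Not at h
          obtain ⟨i, hi⟩ := h
          exact Or.inr ⟨hx.1, hx.2, i, by push_cast; exact hi.le⟩
      have h2 : (S'.card : ℝ) ≤ (d * d * B : ℝ) * (6144 * (1/2) ^ (k+1)) := by
        rcases eq_empty_or_nonempty S' with h | ⟨x, hx⟩
        · rw [h, card_empty, Nat.cast_zero]; positivity
        have h3 := hgrp (2 * m) (m ^ 10) (by rw [← hM0]; exact (Nat.le_mul_of_pos_right M0 (by positivity)).trans (hmk.symm ▸ le_rfl : M0 * 2 ^ (k+1) ≤ 2 * m)) (Nat.one_le_pow _ _ hm0) S' (hS' ▸ filter_subset _ _) (fun x hx => by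
          rw [hS', mem_filter] at hx; exact hx.2)
        rw [hS', mem_filter] at hx
        obtain ⟨i, hi⟩ := hx.2.2
        have h4 : ((m ^ 10 : ℕ):ℤ) ≤ ((2 * B : ℕ) : ℤ) := hi.trans (by exact_mod_cast (hv x hx.1).2.1 i)
        have h5 : (m:ℝ) ^ 10 ≤ 2 * B := by exact_mod_cast h4
        have h6 : ((4 * B / m ^ 10 : ℕ) : ℝ) ≤ 4 * B / (m:ℝ) ^ 10 := by
          refine Nat.cast_div_le.trans ?_
          push_cast; exact le_rfl
        have hmr : (1:ℝ) ≤ m := by exact_mod_cast hm0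
        have hmk' : (2:ℝ) ^ k ≤ m := by exact_mod_cast hm1
        calc (S'.card : ℝ) ≤ (((4 * B / m ^ 10 : ℕ) : ℝ) + 1) * (d * d) * (2 * m) ^ 9 := by exact_mod_cast h3
          _ ≤ (4 * B / (m:ℝ) ^ 10 + 2 * B / (m:ℝ) ^ 10) * (d * d) * (2 * m) ^ 9 := by
              gcongr
              rw [le_div_iff₀ (by positivity)]; linarith
          _ = (d * d * B : ℝ) * (3072 * (1 / m)) := by field_simp; ring
          _ ≤ (d * d * B : ℝ) * (3072 * (1 / 2 ^ k)) := by gcongr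
          _ = _ := by rw [pow_succ, one_div_pow]; ring
      have h3 : (((S.filter fun x => ∀ i, |v x i| ≤ ((2 * m : ℕ):ℤ) ^ 10).card : ℕ) : ℝ) ≤ ((S.filter fun x => ∀ i, |v x i| ≤ (m:ℤ) ^ 10).card : ℝ) + S'.card := by
        exact_mod_cast (card_le_card h1).trans (card_union_le _ _)
      refine (h3.trans (add_le_add ih h2)).trans (le_of_eq ?_)
      rw [pow_succ]; ring
  have hall : S = S.filter fun x => ∀ i, |v x i| ≤ ((M0 * 2 ^ (2 * B) : ℕ):ℤ) ^ 10 := by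
    rw [eq_comm, filter_eq_self]
    intro x hx i
    refine ((hv x hx).2.1 i).trans ?_
    have h1 : 2 * B ≤ (M0 * 2 ^ (2 * B)) ^ 10 := by
      calc 2 * B ≤ 2 ^ (2 * B) := Nat.lt_two_pow_self.le
        _ ≤ M0 * 2 ^ (2 * B) := Nat.le_mul_of_pos_left _ hM01
        _ ≤ _ := Nat.le_self_pow (by norm_num) _
    exact_mod_cast h1
  have h1 := key (2 * B)
  rw [← hall] at h1
  have hd1 : (1:ℝ) ≤ (d:ℝ) := by exact_mod_cast (by omega : 1 ≤ d)
  have h2 : (S.card : ℝ) ≤ ((6 * C0 ^ 9 + 6144 : ℕ) : ℝ) * d ^ 47 * B := by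
    calc (S.card : ℝ) ≤ (d * d * B : ℝ) * (6 * (M0:ℝ) ^ 9 + 6144 * (1 - (1/2) ^ (2 * B))) := h1
      _ ≤ (d * d * B : ℝ) * (6 * (M0:ℝ) ^ 9 + 6144 * d ^ 45) := by
        have : (0:ℝ) ≤ (1/2) ^ (2 * B) := by positivity
        have h3 := one_le_pow₀ hd1 (n := 45)
        gcongr; linarith
      _ = _ := by rw [hM0]; push_cast; ring
  exact_mod_cast h2

theorem line_top {d : ℕ} (f : MP 3 A) (hd : f.totalDegree ≤ d) (x : Fin 3 → A) :
    (aeval (fun s => CX (x s) + PX * CX ((Pi.single 0 1 : Fin 3 → A) s)) f).coeff d = coeff (single 0 d) f := by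
  rw [coeff_line f hd, eval_single_hom _ (homogeneousComponent_isHomogeneous _ _), coeff_homogeneousComponent, if_pos (by simp)]

theorem eval_aeval {n m : ℕ} (f : MP n A) (w : Fin n → MP m A) (y : Fin m → A) :
    eval y (aeval w f) = eval (fun s => eval y (w s)) f := by
  rw [← aeval_eq_eval, ← aeval_eq_eval]
  change ((aeval _).comp (aeval _)) f = _
  rw [comp_aeval]

theorem aeval_aeval' {A T : Type*} [CommRing A] [CommRing T] [Algebra A T] {n m : ℕ} (f : MP n A) (w : Fin n → MP m A) (y : Fin m → T) :
    aeval y (aeval w f) = aeval (fun s => aeval y (w s)) f := by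
  rw [← AlgHom.comp_apply, comp_aeval]

theorem fiber_le {d : ℕ} (f : MP 3 ℤ) (hd : f.totalDegree ≤ d) (hc : coeff (single 0 d) f ≠ 0)
    (S : Finset (Fin 3 → ℤ)) (hS : ∀ x ∈ S, eval x f = 0) : S.card ≤ d * (S.image (fun x (i : Fin 2) => x i.succ)).card := by
  classical
  refine card_le_mul_card_image S d fun b hb => ?_
  obtain ⟨x0, hx0, rfl⟩ := mem_image.mp hb
  obtain ⟨q, hq⟩ : ∃ q : Polynomial ℤ, q = aeval (fun s => CX (x0 s) + PX * CX ((Pi.single 0 1 : Fin 3 → ℤ) s)) f := ⟨_, rfl⟩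
  have hq0 : q ≠ 0 := by
    intro h
    have := line_top f hd x0
    rw [← hq, h, Polynomial.coeff_zero] at this
    exact hc this.symm
  have hqd : q.natDegree ≤ d := by
    rw [hq]
    refine (aeval_natDegree_le f le_rfl (n := 1) _ fun s => ?_).trans (by simpa using hd)
    compute_degree
  refine le_trans ?_ ((Multiset.toFinset_card_le _).trans (q.card_roots'.trans hqd))
  refine card_le_card_of_injOn (fun x => x 0 - x0 0) ?_ ?_
  · intro x hx
    rw [mem_coe, mem_filter] at hx
    rw [mem_coe, Multiset.mem_toFinset, mem_roots hq0, IsRoot.def]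
    refine Eq.trans ?_ (hS x hx.1)
    rw [hq, ← Polynomial.coe_aeval_eq_eval, ← aeval_eq_eval]
    change ((Polynomial.aeval _).comp (aeval _)) f = _
    rw [comp_aeval]
    congr 2
    funext s
    refine Fin.cases ?_ (fun i => ?_) s
    · simp
    · have := congrFun hx.2 i
      simp [this]
  · intro x hx y hy h
    rw [mem_coe, mem_filter] at hx hy
    funext s
    refine Fin.cases ?_ (fun i => ?_) s
    · simpa using h
    · exact congrFun (hx.2.trans hy.2.symm) i

theorem lin_form {K : Type*} [Field K] (k : MP 2 K) (hk : k.totalDegree ≤ 1) :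
    k = C (coeff 0 k) + C (coeff (single 0 1) k) * X 0 + C (coeff (single 1 1) k) * X 1 := by
  classical
  ext m
  rw [coeff_add, coeff_add, coeff_C, coeff_C_mul, coeff_C_mul, coeff_X', coeff_X']
  have e : ∀ m' : Fin 2 →₀ ℕ, m' = m ↔ m' 0 = m 0 ∧ m' 1 = m 1 := fun m' => by
    rw [Finsupp.ext_iff, Fin.forall_fin_two]
  by_cases h : m.degree ≤ 1
  · rw [degree_eq_sum, Fin.sum_univ_two] at h
    have : m = 0 ∨ m = single 0 1 ∨ m = single 1 1 := by
      rw [eq_comm, e, eq_comm (a := m), e, eq_comm (a := m), e]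
      simp only [Finsupp.coe_zero, Pi.zero_apply, single_apply]
      norm_num
      omega
    rcases this with rfl | rfl | rfl <;> simp [Finsupp.single_left_inj, Finsupp.ext_iff, single_apply]
  · have h0 : coeff m k = 0 := by
      refine coeff_eq_zero_of_totalDegree_lt (lt_of_le_of_lt hk ?_)
      push Not at h
      rwa [degree] at h
    have h1 : 0 ≠ m := by rintro rfl; simp at h
    have h2 : ∀ i, single i 1 ≠ m := by rintro i rfl; simp at h
    rw [h0, if_neg h1, if_neg (h2 0), if_neg (h2 1)]; ring

theorem exists_prim {n : ℕ} (v0 : Fin n → ℤ) (h : v0 ≠ 0) : ∃ (g : ℤ) (v : Fin n → ℤ), g ≠ 0 ∧ Prim v ∧ ∀ i, v0 i = g * v i := by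
  obtain ⟨g, hg⟩ := (IsPrincipalIdealRing.principal (Ideal.span (Set.range v0))).principal
  have h1 : ∀ i, g ∣ v0 i := fun i => by
    rw [← Ideal.mem_span_singleton, ← Ideal.submodule_span_eq, ← hg]; exact Ideal.subset_span ⟨i, rfl⟩
  choose v hv using h1
  have hg0 : g ≠ 0 := by
    rintro rfl
    exact h (funext fun i => by rw [hv i, zero_mul]; rfl)
  have h2 : g ∈ Ideal.span (Set.range v0) := by rw [hg]; exact Submodule.mem_span_singleton_self g
  obtain ⟨c, hc⟩ := Ideal.mem_span_range_iff_exists_fun.mp h2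
  refine ⟨g, v, hg0, ⟨c, mul_left_cancel₀ hg0 ?_⟩, hv⟩
  rw [mul_one, mul_sum]
  refine Eq.trans (sum_congr rfl fun i _ => ?_) hc
  rw [hv i]; ring

theorem FS : ∃ C2 : ℕ, ∀ a N d : ℕ, 100 ≤ a → C2 ≤ N → 5 ≤ d → d ≤ N → ∀ f : MP 3 ℤ, f.totalDegree = d →
    coeff (single 0 d) f ≠ 0 → ∀ h : MP 2 ℚ, h ≠ 0 → h.totalDegree ≤ N ^ (480 * a + 2) →
    ∀ S : Finset (Fin 3 → ℤ), (∀ x ∈ S, (∀ i, |x i| ≤ (N:ℤ) ^ (1000 * a)) ∧ eval x f = 0 ∧ ¬ LinePt f (N ^ (1000 * a)) x ∧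
      ∃ k, Irreducible k ∧ k ∣ h ∧ k.totalDegree ≤ N ^ 10 ∧ eval (fun i => (x i.succ : ℚ)) k = 0) → S.card ≤ N ^ (999 * a) := by
  classical
  obtain ⟨C2, hPC⟩ := PC
  refine ⟨C2, fun a N d ha hN hd5 hdN f hd hc h h0 hh S hS => ?_⟩
  have hN1 : 1 ≤ N := by omega
  have hbox : ∀ x ∈ S, ∀ i, |x i| ≤ (N:ℤ) ^ (1000 * a + 1) := fun x hx i =>
    ((hS x hx).1 i).trans (pow_le_pow_right₀ (by exact_mod_cast hN1) (by omega))
  have hdN10 : d ≤ N ^ 10 := hdN.trans (Nat.le_self_pow (by norm_num) _)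
  -- points on an irreducible planar curve via some coordinates
  have hmain : S.card ≤ (N ^ (510 * a) * d) * d * h.totalDegree := by
    refine factor_sum ((N ^ (510 * a) * d) * d) (fun k (x : Fin 3 → ℤ) => k.totalDegree ≤ N ^ 10 ∧ eval (fun i => (x i.succ : ℚ)) k = 0) ?_ h h0 S ?_ ?_
    · rintro k _ x ⟨u, rfl⟩ ⟨h1, h2⟩
      refine ⟨(totalDegree_mul _ _).trans ?_, by rw [map_mul, h2, zero_mul]⟩
      rw [totalDegree_zero_of_isUnit _ u.isUnit]; exact h1
    · intro x hx
      obtain ⟨k, h1, h2, h3, h4⟩ := (hS x hx).2.2.2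
      exact ⟨k, h1, h2, h3, h4⟩
    · intro k hk _ Y hY hYk
      rcases eq_empty_or_nonempty Y with rfl | ⟨y0, hy0⟩
      · simp
      have hk1 : 1 ≤ k.totalDegree := by
        by_contra hcon
        exact hk.not_isUnit (isUnit_of_totalDegree_zero k hk.ne_zero (by omega))
      by_cases hk2 : 2 ≤ k.totalDegree
      · have h1 := hPC a N ha hN k hk hk2 (hYk y0 hy0).1 (Y.image (fun x (i : Fin 2) => x i.succ)) (by
          intro y hy
          obtain ⟨x, hx, rfl⟩ := mem_image.mp hy
          exact ⟨fun i => hbox x (hY hx) _, (hYk x hx).2⟩)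
        calc Y.card ≤ d * N ^ (510 * a) := (fiber_le f hd.le hc Y fun x hx => (hS x (hY hx)).2.1).trans (Nat.mul_le_mul_left _ h1)
          _ = N ^ (510 * a) * d * 1 * 1 := by ring
          _ ≤ _ := by gcongr; omega
      · have hk11 : k.totalDegree = 1 := by omega
        have hkl := lin_form k hk11.le
        obtain ⟨b, hb⟩ : ∃ b : Fin 2 → ℚ, b = fun i => coeff (single i 1) k := ⟨_, rfl⟩
        obtain ⟨c0, hc0⟩ : ∃ c0, c0 = coeff 0 k := ⟨_, rfl⟩
        have hke : ∀ y : Fin 2 → ℚ, ∀ i, eval y k = c0 + b i * y i + b (1 - i) * y (1 - i) := by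
          intro y i
          conv_lhs => rw [hkl]
          simp only [map_add, map_mul, eval_C, eval_X]
          rw [hb, hc0]
          fin_cases i <;> simp <;> ring
        have hbi : ∃ i, b i ≠ 0 := by
          by_contra hcon
          push Not at hcon
          rw [hb] at hcon
          have h1 := hcon 0
          have h2 := hcon 1
          simp only at h1 h2
          rw [h1, h2, C_0, zero_mul, zero_mul, add_zero, add_zero] at hkl
          rw [hkl, totalDegree_C] at hk11
          omega
        obtain ⟨i, hi⟩ := hbi
        obtain ⟨w, hw⟩ : ∃ w : Fin 3 → MP 2 ℚ, w = Fin.cons (X 0) (fun s => if s = i then C (-c0 / b i) + C (-b (1 - i) / b i) * X 1 else X 1) := ⟨_, rfl⟩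
        obtain ⟨π, hπ⟩ : ∃ π : (Fin 3 → ℤ) → (Fin 2 → ℤ), π = fun x => ![x 0, x (1 - i).succ] := ⟨_, rfl⟩
        have hwx : ∀ x ∈ Y, ∀ s, eval (fun j => ((π x j : ℤ) : ℚ)) (w s) = x s := by
          intro x hx s
          have h1 := (hYk x hx).2
          rw [hke _ i] at h1
          rw [hw, hπ]
          refine Fin.cases ?_ (fun s => ?_) s
          · simp
          · rw [cons_succ]
            split_ifs with hs
            · simp only [map_add, map_mul, eval_C, eval_X, Matrix.cons_val_one, Matrix.cons_val_zero]
              rw [hs]; field_simp; linarith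
            · have : s = 1 - i := by omega
              simp [this]
        obtain ⟨G, hG⟩ : ∃ G, G = aeval w (map toℚ f) := ⟨_, rfl⟩
        have hfq : (map toℚ f).totalDegree ≤ d := (totalDegree_map_le' _ f).trans hd.le
        have hwd : ∀ s, (w s).totalDegree ≤ 1 := by
          intro s
          rw [hw]
          refine Fin.cases ?_ (fun s => ?_) s
          · simp
          · rw [cons_succ]
            split_ifs
            · refine (totalDegree_add _ _).trans (max_le (by simp) ((totalDegree_mul _ _).trans (by simp)))
            · simp
        have hGd : G.totalDegree ≤ d := by rw [hG]; exact (totalDegree_affine_le _ w hwd).trans hfq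
        have hG0 : G ≠ 0 := by
          intro h
          have h1 := line_top (map toℚ f) hfq (Fin.cons 0 (fun s => if s = i then -c0 / b i else 0))
          have h2 : ∀ s, CX ((Fin.cons 0 (fun s => if s = i then -c0 / b i else 0) : Fin 3 → ℚ) s) + PX * CX ((Pi.single 0 1 : Fin 3 → ℚ) s)
              = aeval (![PX, 0] : Fin 2 → Polynomial ℚ) (w s) := by
            intro s
            rw [hw]
            refine Fin.cases ?_ (fun s => ?_) s
            · rw [cons_zero, cons_zero, Pi.single_eq_same, aeval_X, Polynomial.C_0, zero_add, Polynomial.C_1, mul_one]; rfl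
            · rw [cons_succ, cons_succ, Pi.single_eq_of_ne (succ_ne_zero s), Polynomial.C_0, mul_zero, add_zero]
              split_ifs
              · rw [map_add, map_mul, aeval_X, aeval_C, aeval_C]
                change _ = CX _ + _ * 0
                rw [mul_zero, add_zero]
              · rw [aeval_X, Polynomial.C_0]; rfl
          rw [funext h2, ← aeval_aeval', ← hG, h, map_zero, Polynomial.coeff_zero, coeff_map] at h1
          exact hc (by simpa using h1.symm)
        have hGe : ∀ x ∈ Y, eval (fun j => ((π x j : ℤ) : ℚ)) G = 0 := by
          intro x hx
          rw [hG, eval_aeval, funext (hwx x hx), eval_cast, (hS x (hY hx)).2.1, Int.cast_zero]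
        have hinj : Set.InjOn π Y := by
          intro x hx y hy hxy
          funext s
          have h1 := hwx x hx s
          rw [hxy, hwx y hy s] at h1
          exact_mod_cast h1.symm
        have h1 : Y.card ≤ N ^ (510 * a) * G.totalDegree := by
          refine factor_sum (N ^ (510 * a)) (fun κ (x : Fin 3 → ℤ) => eval (fun j => ((π x j : ℤ) : ℚ)) κ = 0) ?_ G hG0 Y ?_ ?_
          · rintro κ _ x ⟨u, rfl⟩ h2
            rw [map_mul, h2, zero_mul]
          · exact fun x hx => exists_irred_root _ G hG0 (hGe x hx)
          · intro κ hκ hκG Z hZ hZκ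
            have hκ1 : 1 ≤ κ.totalDegree := by
              by_contra hcon
              exact hκ.not_isUnit (isUnit_of_totalDegree_zero κ hκ.ne_zero (by omega))
            have hκd : κ.totalDegree ≤ d := by
              obtain ⟨u, hu⟩ := hκG
              rw [hu, totalDegree_mul_of_isDomain hκ.ne_zero (fun h => hG0 (by rw [hu, h, mul_zero]))] at hGd
              omega
            refine le_trans ?_ (Nat.le_mul_of_pos_right _ hκ1)
            by_cases hκ2 : 2 ≤ κ.totalDegree
            · rw [← card_image_of_injOn (hinj.mono (coe_subset.mpr hZ))]
              refine hPC a N ha hN κ hκ hκ2 (hκd.trans hdN10) _ ?_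
              intro y hy
              obtain ⟨x, hx, rfl⟩ := mem_image.mp hy
              refine ⟨fun j => ?_, hZκ x hx⟩
              rw [hπ]
              fin_cases j
              · exact hbox x (hY (hZ hx)) _
              · exact hbox x (hY (hZ hx)) _
            · refine (card_le_one.mpr fun x hx y hy => ?_).trans (Nat.one_le_pow _ _ hN1)
              by_contra hxy
              obtain ⟨g, v, hg0, hv, hgv⟩ := exists_prim (fun s => y s - x s) (fun h => hxy (funext fun s => by have := congrFun h s; simp only [Pi.zero_apply] at this; omega))
              refine (hS x (hY (hZ hx))).2.2.1 ⟨v, hv, fun s => ?_, fun t => ?_⟩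
              · have h2 : |v s| ≤ |y s - x s| := by
                  rw [hgv s, abs_mul]
                  exact le_mul_of_one_le_left (abs_nonneg _) (Int.one_le_abs hg0)
                have h3 := (hS x (hY (hZ hx))).1 s
                have h4 := (hS y (hY (hZ hy))).1 s
                have h5 := abs_sub (y s) (x s)
                push_cast
                linarith
              · have hg0' : (g:ℚ) ≠ 0 := by exact_mod_cast hg0
                obtain ⟨P, hP⟩ : ∃ P : Fin 2 → ℚ, P = fun j => (π x j : ℚ) + t / g * (π y j - π x j) := ⟨_, rfl⟩
                have hκl := lin_form κ (by omega)
                have h2 : eval P κ = 0 := by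
                  have e1 := hZκ x hx
                  have e2 := hZκ y hy
                  rw [hκl] at e1 e2 ⊢
                  simp only [map_add, map_mul, eval_C, eval_X] at e1 e2 ⊢
                  rw [hP]
                  linear_combination (1 - (t:ℚ) / g) * e1 + (t:ℚ) / g * e2
                have h3 : eval P G = 0 := by
                  obtain ⟨u, hu⟩ := hκG
                  rw [hu, map_mul, h2, zero_mul]
                have h4 : ∀ s, eval P (w s) = ((x s + t * v s : ℤ) : ℚ) := by
                  intro s
                  have e1 := hwx x (hZ hx) s
                  have e2 := hwx y (hZ hy) s
                  have e3 : ((y s : ℚ) - x s) = g * v s := by exact_mod_cast hgv s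
                  have hl := lin_form (w s) (hwd s)
                  rw [hl] at e1 e2 ⊢
                  simp only [map_add, map_mul, eval_C, eval_X] at e1 e2 ⊢
                  rw [hP]
                  push_cast
                  have e4 : (t:ℚ) / g * (y s - x s) = t * v s := by rw [e3]; field_simp
                  linear_combination (1 - (t:ℚ) / g) * e1 + (t:ℚ) / g * e2 + e4
                rw [hG, eval_aeval, funext h4, eval_cast (fun s => x s + t * v s)] at h3
                exact_mod_cast h3
        calc Y.card ≤ N ^ (510 * a) * d * 1 * 1 := by rw [mul_one, mul_one]; exact h1.trans (Nat.mul_le_mul_left _ hGd)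
          _ ≤ _ := by gcongr; omega
  calc S.card ≤ (N ^ (510 * a) * N) * N * N ^ (480 * a + 2) := by refine hmain.trans ?_; gcongr
    _ = N ^ (510 * a + 2 + (480 * a + 2)) := by rw [pow_add, pow_add]; ring
    _ ≤ _ := Nat.pow_le_pow_right hN1 (by omega)

theorem elim_pts {d D : ℕ} (f : MP 3 ℤ) (hd : (map toℚ f).totalDegree = d) (hd1 : 1 ≤ d) (hf : Irreducible (map toℚ f))
    (g : MP 3 ℚ) (hg : ¬ map toℚ f ∣ g) (hD : g.totalDegree ≤ D) (hD1 : 1 ≤ D) :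
    ∃ h : MP 2 ℚ, h ≠ 0 ∧ h.totalDegree ≤ 2 * d * D ∧ ∀ x : Fin 3 → ℤ, eval x f = 0 → eval (fun i => (x i : ℚ)) g = 0 →
      eval (fun i => (x i.succ : ℚ)) h = 0 := by
  obtain ⟨h, h0, h1, u, w, h2⟩ := elimination _ g hf hg d D hd hD hd1 hD1
  refine ⟨h, h0, h1, fun x hx hxg => ?_⟩
  have := congrArg (eval (fun i => (x i : ℚ))) h2
  rwa [eval_rename, map_add, map_mul, map_mul, eval_cast, hx, hxg, Int.cast_zero, zero_mul, zero_mul, add_zero] at this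

theorem bez3 {d : ℕ} (f : MP 3 ℤ) (hd : f.totalDegree ≤ d) (hc : coeff (single 0 d) f ≠ 0) (k g : MP 2 ℚ)
    (hk : Irreducible k) (hkg : ¬ k ∣ g) (S : Finset (Fin 3 → ℤ)) (hS : ∀ x ∈ S, eval x f = 0 ∧ eval (fun i => (x i.succ : ℚ)) k = 0 ∧
      eval (fun i => (x i.succ : ℚ)) g = 0) : S.card ≤ d * (k.totalDegree * g.totalDegree) := by
  classical
  refine (fiber_le f hd hc S fun x hx => (hS x hx).1).trans (Nat.mul_le_mul_left _ ?_)
  have hinj : Injective (fun (y : Fin 2 → ℤ) i => (y i : ℚ)) := fun y y' h => funext fun i => Int.cast_injective (congrFun h i)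
  rw [← card_image_of_injective _ hinj, image_image]
  refine bezout_points k g hk hkg _ ?_ ?_ <;>
  · intro z hz
    obtain ⟨x, hx, rfl⟩ := mem_image.mp hz
    first | exact (hS x hx).2.1 | exact (hS x hx).2.2

theorem tree : ∃ C : ℕ, ∀ a N d E p0 : ℕ, 100 ≤ a → C * (E + 1) * d ^ 7 ≤ N → 5 ≤ d → ∀ f : MP 3 ℤ, f.totalDegree = d →
    coeff (single 0 d) f ≠ 0 → Irreducible (map toℚ f) → nrm 1 f ≤ (N:ℝ) ^ E → 1000 * a ≤ E →
    p0.Prime → N ^ 3 < p0 → p0 ≤ N ^ 4 → ∀ S : Finset (Fin 3 → ℤ), (∀ x ∈ S, (∀ i, |x i| ≤ (N:ℤ) ^ (1000 * a)) ∧ eval x f = 0 ∧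
      ¬ LinePt f (N ^ (1000 * a)) x ∧ ¬ (p0:ℤ) ∣ eval x (pderiv 0 f)) → S.card ≤ N ^ (999 * a) + N ^ (999 * a) := by
  classical
  obtain ⟨C1, hC1, hgl⟩ := gl
  obtain ⟨C2, hFS⟩ := FS
  refine ⟨C1 + C2 + 16, fun a N d E p0 ha hN hd5 f hd hc hirr hnrm hE hp hp3 hp4 S hS => ?_⟩
  have hN' : C1 * (E + 1) * d ^ 7 ≤ N := le_trans (by gcongr; omega) hN
  have hd7 : 1 ≤ d ^ 7 := Nat.one_le_pow _ _ (by omega)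
  have hNE : (C1 + C2 + 16) * (E + 1) ≤ N := (Nat.le_mul_of_pos_right _ hd7).trans hN
  have hNC : C1 + C2 + 16 ≤ N := (Nat.le_mul_of_pos_right _ (by omega)).trans hNE
  have hNa : E + 1 ≤ N := (Nat.le_mul_of_pos_left _ (by omega)).trans hNE
  have hNd : 16 * d ^ 7 ≤ N := le_trans (Nat.mul_le_mul_right _ (by nlinarith)) hN
  have hdd : d ≤ d ^ 7 := Nat.le_self_pow (by norm_num) d
  have hd4 : d ^ 4 ≤ d ^ 7 := Nat.pow_le_pow_right (by omega) (by norm_num)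
  have hN1 : 1 ≤ N := by omega
  have hN0 : 0 < N := hN1
  have hp0 : 0 < p0 := hp.pos
  have hNp : N < p0 := (Nat.le_self_pow (by norm_num) N).trans_lt hp3
  obtain ⟨b, hb⟩ : ∃ b, 480 * a = b + 2 := ⟨480 * a - 2, by omega⟩
  obtain ⟨J, hJ⟩ : ∃ J, J = Nat.log p0 (N ^ b) := ⟨_, rfl⟩
  have hJ1 : p0 ^ J ≤ N ^ b := by rw [hJ]; exact Nat.pow_log_le_self _ (by positivity)
  have hJ2 : N ^ b < p0 ^ (J + 1) := by rw [hJ]; exact Nat.lt_pow_succ_log_self hp.one_lt _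
  have hJb : J ≤ b := by
    by_contra hcon
    have : N ^ b < p0 ^ J := by
      calc N ^ b < N ^ J := Nat.pow_lt_pow_right (by omega) (by omega)
        _ ≤ p0 ^ J := Nat.pow_le_pow_left hNp.le _
    omega
  obtain ⟨D, hD⟩ : ∃ D : ℕ → ℕ, D = fun j => N ^ (480 * a) / p0 ^ j + 1 := ⟨_, rfl⟩
  have hpj : ∀ j ≤ J, p0 ^ j * N ^ 2 ≤ N ^ (480 * a) := by
    intro j hj
    calc p0 ^ j * N ^ 2 ≤ p0 ^ J * N ^ 2 := Nat.mul_le_mul_right _ (Nat.pow_le_pow_right hp0 hj)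
      _ ≤ N ^ b * N ^ 2 := Nat.mul_le_mul_right _ hJ1
      _ = _ := by rw [hb, pow_add]
  have hD2 : ∀ j ≤ J, N ^ 2 ≤ D j := by
    intro j hj
    rw [hD]
    refine le_trans ?_ (Nat.le_succ _)
    rw [Nat.le_div_iff_mul_le (pow_pos hp0 _), mul_comm]
    exact hpj j hj
  have hDl : ∀ j, N ^ (480 * a) ≤ p0 ^ j * D j := fun j => by rw [hD]; exact (Nat.lt_mul_div_succ _ (pow_pos hp0 _)).le
  have hDu : ∀ j ≤ J, p0 ^ j * D j ≤ 2 * N ^ (480 * a) := by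
    intro j hj
    rw [hD]
    simp only [mul_add, mul_one]
    have h1 := Nat.mul_div_le (N ^ (480 * a)) (p0 ^ j)
    have h2 : p0 ^ j ≤ N ^ (480 * a) := (Nat.le_mul_of_pos_right _ (by positivity)).trans (hpj j hj)
    omega
  have hDJ : D J ≤ N ^ 6 + 1 := by
    rw [hD]
    refine Nat.succ_le_succ (Nat.div_le_of_le_mul ?_)
    calc N ^ (480 * a) = N ^ b * N ^ 2 := by rw [hb, pow_add]
      _ ≤ (p0 ^ J * N ^ 4) * N ^ 2 := Nat.mul_le_mul_right _ (hJ2.le.trans (by rw [pow_succ]; exact Nat.mul_le_mul_left _ hp4))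
      _ = _ := by ring
  have hinjQ : Injective toℚ := Int.cast_injective
  have hfd : (map toℚ f).totalDegree = d := by
    rw [← hd, totalDegree, totalDegree, support_map_of_injective _ hinjQ]
  obtain ⟨cl, hcl⟩ : ∃ cl : ∀ j : ℕ, (Fin 3 → ℤ) → (Fin 3 → ZMod (p0 ^ j)), cl = fun j x t => ((x t : ℤ) : ZMod (p0 ^ j)) := ⟨_, rfl⟩
  have hcle : ∀ j x y, cl j x = cl j y ↔ ∀ t, ((p0 ^ j : ℕ) : ℤ) ∣ x t - y t := by
    intro j x y
    rw [hcl, funext_iff]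
    refine forall_congr' fun t => ?_
    rw [eq_comm, ZMod.intCast_eq_intCast_iff_dvd_sub]
  have hex : ∀ j c, ∃ h : MP 2 ℚ, j ≤ J → h ≠ 0 ∧ h.totalDegree ≤ 2 * d * D j ∧ ∀ x ∈ S, cl j x = c →
      eval (fun i => (x i.succ : ℚ)) h = 0 := by
    intro j c
    by_cases hj : j ≤ J
    swap
    · exact ⟨0, fun h => absurd h hj⟩
    by_cases hx0 : ∃ x0 ∈ S, cl j x0 = c
    swap
    · refine ⟨1, fun _ => ⟨one_ne_zero, by simp, fun x hx hxc => absurd ⟨x, hx, hxc⟩ hx0⟩⟩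
    obtain ⟨x0, _, rfl⟩ := hx0
    obtain ⟨g, hg0, hgs, hgz⟩ := hgl f a d N E p0 j (D j) {x | x ∈ S ∧ cl j x = cl j x0} x0 (by omega) hd5 hd.le hc hirr hnrm hE hN' hp (hD2 j hj)
      ((hDl j).trans (by omega)) (fun x hx => ⟨(hS x hx.1).1, (hS x hx.1).2.1, (hS x hx.1).2.2.2, (hcle j x x0).mp hx.2⟩)
    have hndvd : ¬ map toℚ f ∣ g := not_dvd_of_supp (d := d) _ g (by rw [coeff_map]; simpa using hc) hg0 fun m hm => (mem_monsd.mp (hgs hm)).2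
    obtain ⟨h, h0, h1, h2⟩ := elim_pts f hfd (by omega) hirr g hndvd (totalDegree_of_supp g (hgs.trans (monsd_subset _ _ _))) (le_trans (Nat.one_le_pow _ _ hN1) (hD2 j hj))
    exact ⟨h, fun _ => ⟨h0, h1, fun x hx hxc => h2 x (hS x hx).2.1 (hgz x ⟨hx, hxc⟩)⟩⟩
  choose h hh using hex
  obtain ⟨Bad, hBad⟩ : ∃ Bad : ℕ → Finset (Fin 3 → ℤ), Bad = fun j => S.filter fun x => ∃ k, Irreducible k ∧ k ∣ h j (cl j x) ∧ ¬ k ∣ h (j + 1) (cl (j + 1) x) ∧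
    eval (fun i => (x i.succ : ℚ)) k = 0 := ⟨_, rfl⟩
  -- points separated at level j+1
  have hBc : ∀ j, j + 1 ≤ J → (Bad j).card ≤ N ^ (960 * a + 6) := by
    intro j hj
    have h1 : (Bad j).card ≤ d * (2 * d * D (j + 1)) * (2 * d * D j) * ((Bad j).image (cl (j + 1))).card := by
      refine card_le_mul_card_image _ _ fun c hcm => ?_
      obtain ⟨x0, hx0, rfl⟩ := mem_image.mp hcm
      obtain ⟨h0, h1, h2⟩ := hh j (cl j x0) (by omega)
      obtain ⟨h0', h1', h2'⟩ := hh (j + 1) (cl (j + 1) x0) hj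
      have hcc : ∀ x, cl (j + 1) x = cl (j + 1) x0 → cl j x = cl j x0 := by
        intro x hx
        rw [hcle] at hx ⊢
        exact fun t => (Int.natCast_dvd_natCast.mpr (pow_dvd_pow p0 (Nat.le_succ j))).trans (hx t)
      refine (factor_sum (d * (2 * d * D (j + 1))) (fun k (x : Fin 3 → ℤ) => ¬ k ∣ h (j + 1) (cl (j + 1) x0) ∧ eval (fun i => (x i.succ : ℚ)) k = 0) ?_ (h j (cl j x0)) h0 _ ?_ ?_).trans
        (Nat.mul_le_mul_left _ h1)
      · rintro k k' x hkk ⟨e1, e2⟩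
        refine ⟨fun e3 => e1 (hkk.dvd.trans e3), ?_⟩
        obtain ⟨u, rfl⟩ := hkk
        rw [map_mul, e2, zero_mul]
      · intro x hx
        rw [mem_filter, hBad, mem_filter] at hx
        obtain ⟨⟨_, k, e1, e2, e3, e4⟩, hxc⟩ := hx
        rw [hxc] at e3
        rw [hcc x hxc] at e2
        exact ⟨k, e1, e2, e3, e4⟩
      · intro k hk _ Y hY hYk
        rcases eq_empty_or_nonempty Y with rfl | ⟨y0, hy0⟩
        · simp
        refine (bez3 f hd.le hc k (h (j + 1) (cl (j + 1) x0)) hk (hYk y0 hy0).1 Y ?_).trans ?_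
        · intro x hx
          have e1 := hY hx
          rw [mem_filter, hBad, mem_filter] at e1
          exact ⟨(hS x e1.1.1).2.1, (hYk x hx).2, h2' x e1.1.1 e1.2⟩
        · calc d * (k.totalDegree * (h (j + 1) (cl (j + 1) x0)).totalDegree) ≤ d * (k.totalDegree * (2 * d * D (j + 1))) := by gcongr
            _ = _ := by ring
    have h2 : ((Bad j).image (cl (j + 1))).card ≤ d * (p0 ^ (j + 1)) ^ 2 := by
      rw [hcl]
      refine class_count f d hd.le (by omega) p0 (j + 1) hp _ fun x hx => ?_
      rw [hBad, mem_filter] at hx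
      refine ⟨?_, (hS x hx.1).2.2.2⟩
      rw [(hS x hx.1).2.1]; exact dvd_zero _
    calc (Bad j).card ≤ d * (2 * d * D (j + 1)) * (2 * d * D j) * (d * (p0 ^ (j + 1)) ^ 2) := h1.trans (Nat.mul_le_mul_left _ h2)
      _ = 4 * d ^ 4 * (p0 ^ (j + 1) * D (j + 1)) * (p0 ^ j * D j) * p0 := by ring
      _ ≤ 4 * d ^ 4 * (2 * N ^ (480 * a)) * (2 * N ^ (480 * a)) * N ^ 4 := by
        exact Nat.mul_le_mul (Nat.mul_le_mul (Nat.mul_le_mul_left _ (hDu _ hj)) (hDu j (by omega))) hp4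
      _ = (16 * d ^ 4) * (N ^ (960 * a + 4)) := by rw [show 960 * a + 4 = 480 * a + 480 * a + 4 by ring, pow_add, pow_add]; ring
      _ ≤ N * N ^ (960 * a + 4) := Nat.mul_le_mul_right _ (by omega)
      _ ≤ _ := by rw [← pow_succ']; exact Nat.pow_le_pow_right hN1 (by omega)
  obtain ⟨Good, hGood⟩ : ∃ Good, Good = S.filter fun x => ∃ k, Irreducible k ∧ k ∣ h 0 (fun _ => 0) ∧ k.totalDegree ≤ N ^ 10 ∧ eval (fun i => (x i.succ : ℚ)) k = 0 := ⟨_, rfl⟩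
  have hcl0 : ∀ x, cl 0 x = fun _ => 0 := by
    intro x
    funext t
    haveI : Subsingleton (ZMod (p0 ^ 0)) := by rw [pow_zero]; exact inferInstanceAs (Subsingleton (Fin 1))
    exact Subsingleton.elim _ _
  obtain ⟨h00, h01, h02⟩ := hh 0 (fun _ => 0) (by omega)
  have hGc : Good.card ≤ N ^ (999 * a) := by
    refine hFS a N d ha (by omega) hd5 (by omega) f hd hc (h 0 fun _ => 0) h00 ?_ Good ?_
    · have := hDu 0 (by omega)
      rw [pow_zero, one_mul] at this
      calc (h 0 fun _ => 0).totalDegree ≤ 2 * d * D 0 := h01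
        _ ≤ 2 * d * (2 * N ^ (480 * a)) := Nat.mul_le_mul_left _ this
        _ = (4 * d) * N ^ (480 * a) := by ring
        _ ≤ N * N ^ (480 * a) := Nat.mul_le_mul_right _ (by omega)
        _ ≤ _ := by rw [← pow_succ']; exact Nat.pow_le_pow_right hN1 (by omega)
    · intro x hx
      rw [hGood, mem_filter] at hx
      exact ⟨(hS x hx.1).1, (hS x hx.1).2.1, (hS x hx.1).2.2.1, hx.2⟩
  have hcover : S ⊆ Good ∪ (range J).biUnion Bad := by
    intro x hx
    obtain ⟨k, hk, hkd, hkx⟩ := exists_irred_root _ (h 0 fun _ => 0) h00 (h02 x hx (hcl0 x))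
    rw [mem_union, mem_biUnion]
    by_cases hall : ∀ j ≤ J, k ∣ h j (cl j x)
    · left
      rw [hGood, mem_filter]
      refine ⟨hx, k, hk, hkd, ?_, hkx⟩
      obtain ⟨u, hu⟩ := hall J le_rfl
      obtain ⟨e0, e1, _⟩ := hh J (cl J x) le_rfl
      rw [hu, totalDegree_mul_of_isDomain hk.ne_zero (fun e => e0 (by rw [hu, e, mul_zero]))] at e1
      calc k.totalDegree ≤ 2 * d * D J := by omega
        _ ≤ 2 * d * (N ^ 6 + 1) := Nat.mul_le_mul_left _ hDJ
        _ ≤ 2 * d * (2 * N ^ 6) := Nat.mul_le_mul_left _ (by have := Nat.one_le_pow 6 N hN1; omega)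
        _ = (4 * d) * N ^ 6 := by ring
        _ ≤ N * N ^ 6 := Nat.mul_le_mul_right _ (by omega)
        _ ≤ _ := by rw [← pow_succ']; exact Nat.pow_le_pow_right hN1 (by omega)
    · right
      by_contra hcon
      push Not at hcon
      refine hall fun j => ?_
      induction j with
      | zero => intro _; rw [hcl0]; exact hkd
      | succ j ih =>
        intro hj
        by_contra hk'
        refine hcon j (mem_range.mpr hj) ?_
        rw [hBad, mem_filter]
        exact ⟨hx, k, hk, ih (by omega), hk', hkx⟩
  refine (card_le_card hcover).trans ((card_union_le _ _).trans (Nat.add_le_add hGc ?_))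
  refine (card_biUnion_le_card_mul _ _ _ fun j hj => hBc j (mem_range.mp hj)).trans ?_
  rw [card_range]
  calc J * N ^ (960 * a + 6) ≤ N * N ^ (960 * a + 6) := Nat.mul_le_mul_right _ (by omega)
    _ ≤ _ := by rw [← pow_succ']; exact Nat.pow_le_pow_right hN1 (by omega)

theorem curve_pts : ∃ C2 : ℕ, ∀ a N d : ℕ, 100 ≤ a → C2 ≤ N → 5 ≤ d → 2 * d * d ≤ N → ∀ f : MP 3 ℤ, f.totalDegree = d →
    coeff (single 0 d) f ≠ 0 → Irreducible (map toℚ f) → ∀ g : MP 3 ℚ, g.totalDegree ≤ d →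
    ¬ map toℚ f ∣ g → ∀ S : Finset (Fin 3 → ℤ), (∀ x ∈ S, (∀ i, |x i| ≤ (N:ℤ) ^ (1000 * a)) ∧ eval x f = 0 ∧
      ¬ LinePt f (N ^ (1000 * a)) x ∧ eval (fun i => (x i : ℚ)) g = 0) → S.card ≤ N ^ (999 * a) := by
  obtain ⟨C2, hFS⟩ := FS
  refine ⟨C2, fun a N d ha hN hd5 hdN f hd hc hirr g hg hfg S hS => ?_⟩
  have hfd : (map toℚ f).totalDegree = d := by
    rw [← hd, totalDegree, totalDegree, support_map_of_injective _ (Int.cast_injective (α := ℚ))]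
  obtain ⟨h, h0, h1, h2⟩ := elim_pts f hfd (by omega) hirr g hfg hg (by omega)
  have hpw : ∀ k, k ≠ 0 → h.totalDegree ≤ N ^ k := fun k hk => (h1.trans hdN).trans (Nat.le_self_pow hk N)
  refine hFS a N d ha hN hd5 (by nlinarith) f hd hc h h0 (hpw _ (by omega)) S fun x hx => ?_
  obtain ⟨e1, e2, e3, e4⟩ := hS x hx
  obtain ⟨k, hk, ⟨u, hu⟩, hkx⟩ := exists_irred_root _ h h0 (h2 x e2 e4)
  refine ⟨e1, e2, e3, k, hk, ⟨u, hu⟩, le_trans ?_ (hpw 10 (by norm_num)), hkx⟩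
  rw [hu, totalDegree_mul_of_isDomain hk.ne_zero (fun e => h0 (by rw [hu, e, mul_zero]))]
  omega

theorem T3core : ∃ C : ℕ, ∀ a N d E : ℕ, 100 ≤ a → C * (E + 1) * d ^ 7 ≤ N → 5 ≤ d → ∀ f : MP 3 ℤ, f.totalDegree = d →
    coeff (single 0 d) f ≠ 0 → Irreducible (map toℚ f) → nrm 1 f ≤ (N:ℝ) ^ E → 1000 * a * (d + 1) ≤ E →
    ∀ S : Finset (Fin 3 → ℤ), (∀ x ∈ S, (∀ i, |x i| ≤ (N:ℤ) ^ (1000 * a)) ∧ eval x f = 0 ∧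
      ¬ LinePt f (N ^ (1000 * a)) x) → S.card ≤ N ^ (1000 * a) := by
  classical
  obtain ⟨C1, htree⟩ := tree
  obtain ⟨C2, hcp⟩ := curve_pts
  obtain ⟨C3, -, hmp⟩ := many_primes
  obtain ⟨N0, -, hlog⟩ := le_log_of (C3 + 4 * (3:ℕ))
  refine ⟨C1 + C2 + N0 + 16, fun a N d E ha hN hd5 f hd hc hirr hnrm hE S hS => ?_⟩
  have hN' : C1 * (E + 1) * d ^ 7 ≤ N := le_trans (by gcongr; omega) hN
  have hd7 : 1 ≤ d ^ 7 := Nat.one_le_pow _ _ (by omega)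
  have hNE : (C1 + C2 + N0 + 16) * (E + 1) ≤ N := (Nat.le_mul_of_pos_right _ hd7).trans hN
  have hNC : C1 + C2 + N0 + 16 ≤ N := (Nat.le_mul_of_pos_right _ (by omega)).trans hNE
  have hNa : 16 * (E + 1) ≤ N := (Nat.mul_le_mul_right _ (by omega)).trans hNE
  have hNd : 16 * d ^ 7 ≤ N := le_trans (Nat.mul_le_mul_right _ (by nlinarith)) hN
  have hd2 : d * d ≤ d ^ 7 := by rw [← sq]; exact Nat.pow_le_pow_right (by omega) (by norm_num)
  have hdd : d ≤ d * d := Nat.le_mul_self d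
  have hN1 : 1 ≤ N := by omega
  have hmap : pderiv 0 (map toℚ f) = map toℚ (pderiv 0 f) := by rw [pderiv_map]
  have hinjQ : Injective toℚ := Int.cast_injective
  have hfd : (map toℚ f).totalDegree = d := by
    rw [← hd, totalDegree, totalDegree, support_map_of_injective _ hinjQ]
  have h0 : (S.filter fun x => eval x (pderiv 0 f) = 0).card ≤ N ^ (999 * a) := by
    refine hcp a N d ha (by omega) hd5 (by rw [mul_assoc]; omega) f hd hc hirr (pderiv 0 (map toℚ f)) ((totalDegree_pderiv_le _ _).trans hfd.le)
      (pderiv_zero_props _ d hfd (by rw [coeff_map]; simpa using hc) (by exact_mod_cast (by omega : d ≠ 0))) _ fun x hx => ?_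
    rw [mem_filter] at hx
    obtain ⟨e1, e2, e3⟩ := hS x hx.1
    exact ⟨e1, e2, e3, by rw [hmap, eval_cast, hx.2, Int.cast_zero]⟩
  obtain ⟨Q, hQ⟩ : ∃ Q, Q = (Ioc (N ^ 3) (N ^ 4)).filter Nat.Prime := ⟨_, rfl⟩
  have hQ1 : N ≤ Q.card := by rw [hQ]; exact hmp N 3 (by norm_num) (hlog N (by omega))
  have hQ2 : Q.card ≤ N ^ 4 := by
    rw [hQ]; exact (card_filter_le _ _).trans (by rw [Nat.card_Ioc]; omega)
  have hcover : S ⊆ (S.filter fun x => eval x (pderiv 0 f) = 0) ∪ Q.biUnion fun p => S.filter fun x => ¬ (p:ℤ) ∣ eval x (pderiv 0 f) := by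
    intro x hx
    rw [mem_union, mem_filter, mem_biUnion]
    by_cases hz : eval x (pderiv 0 f) = 0
    · exact Or.inl ⟨hx, hz⟩
    right
    by_contra hcon
    push Not at hcon
    have hN1' : (1:ℝ) ≤ N := by exact_mod_cast hN1
    have hV1 : (1:ℝ) ≤ (N:ℝ) ^ (1000 * a) := one_le_pow₀ hN1'
    have := card_primes_dvd N (2 * E + 1) (by omega) _ hz ?_ Q ?_
    · omega
    · refine (nrm_eval_le _ d ((totalDegree_pderiv_le 0 f).trans hd.le) x _ hV1 fun i => by exact_mod_cast (hS x hx).1 i).trans ?_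
      calc nrm 1 (pderiv 0 f) * ((N:ℝ) ^ (1000 * a)) ^ d ≤ (N * (N:ℝ) ^ E) * (N:ℝ) ^ E := by
            refine mul_le_mul ((nrm_pderiv_le f d hd.le 0).trans ?_) ?_ (by positivity) (by positivity)
            · exact mul_le_mul (by exact_mod_cast (by omega : d ≤ N)) hnrm (nrm_nonneg zero_le_one _) (by positivity)
            · rw [← pow_mul]; exact pow_le_pow_right₀ hN1' (by nlinarith)
        _ = _ := by ring
    · intro p hp
      have hp' := hp
      rw [hQ, mem_filter, mem_Ioc] at hp'
      refine ⟨hp'.2, (Nat.le_self_pow (by norm_num) N).trans_lt hp'.1.1, ?_⟩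
      by_contra hpd
      exact hcon p hp (mem_filter.mpr ⟨hx, hpd⟩)
  have h1 : (Q.biUnion fun p => S.filter fun x => ¬ (p:ℤ) ∣ eval x (pderiv 0 f)).card ≤ N ^ 4 * (N ^ (999 * a) + N ^ (999 * a)) := by
    refine (card_biUnion_le_card_mul _ _ (N ^ (999 * a) + N ^ (999 * a)) fun p hp => ?_).trans (Nat.mul_le_mul_right _ hQ2)
    rw [hQ, mem_filter, mem_Ioc] at hp
    refine htree a N d E p ha hN' hd5 f hd hc hirr hnrm (by nlinarith) hp.2 hp.1.1 hp.1.2 _ fun x hx => ?_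
    rw [mem_filter] at hx
    obtain ⟨e1, e2, e3⟩ := hS x hx.1
    exact ⟨e1, e2, e3, hx.2⟩
  refine (card_le_card hcover).trans ((card_union_le _ _).trans ((Nat.add_le_add h0 h1).trans ?_))
  have h4 := Nat.one_le_pow 4 N hN1
  calc N ^ (999 * a) + N ^ 4 * (N ^ (999 * a) + N ^ (999 * a)) ≤ (3 * N ^ 4) * N ^ (999 * a) := by nlinarith [Nat.one_le_pow (999 * a) N hN1]
    _ ≤ (N * N ^ 4) * N ^ (999 * a) := by gcongr; omega
    _ = N ^ (5 + 999 * a) := by rw [pow_add]; ring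
    _ ≤ _ := Nat.pow_le_pow_right hN1 (by omega)

theorem T3a : ∃ C : ℕ, 1 ≤ C ∧ ∀ a N d : ℕ, 100 ≤ a → C * a * d ^ 11 ≤ N → 5 ≤ d → ∀ f : MP 3 ℤ, f.totalDegree = d →
    coeff (single 0 d) f ≠ 0 → Irreducible (map toℚ f) →
    ∀ S : Finset (Fin 3 → ℤ), (∀ x ∈ S, (∀ i, |x i| ≤ (N:ℤ) ^ (1000 * a)) ∧ eval x f = 0 ∧
      ¬ LinePt f (N ^ (1000 * a)) x) → S.card ≤ N ^ (1000 * a) := by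
  obtain ⟨C1, hcore⟩ := T3core
  obtain ⟨C2, hcp⟩ := curve_pts
  refine ⟨20000 * C1 + C2 + 16, by omega, fun a N d ha hN hd5 f hd hc hirr S hS => ?_⟩
  have hinjQ : Injective toℚ := Int.cast_injective
  have hfd : (map toℚ f).totalDegree = d := by
    rw [← hd, totalDegree, totalDegree, support_map_of_injective _ hinjQ]
  have hNd : (20000 * C1 + C2 + 16) * d ^ 11 ≤ N := le_trans (Nat.mul_le_mul_right _ (by nlinarith)) hN
  have hd11 : 1 ≤ d ^ 11 := Nat.one_le_pow _ _ (by omega)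
  have hd3 : d ^ 3 ≤ d ^ 11 := Nat.pow_le_pow_right (by omega) (by norm_num)
  have hd2 : d ^ 2 ≤ d ^ 11 := Nat.pow_le_pow_right (by omega) (by norm_num)
  have hNC : 16 * d ^ 11 ≤ N := le_trans (Nat.mul_le_mul_right _ (by omega)) hNd
  have hNC2 : C2 ≤ N := le_trans (by nlinarith) hNd
  have hN1 : 1 ≤ N := by omega
  have hM : (mons 3 d).card ≤ 8 * d ^ 3 := by
    rw [card_mons]
    calc _ ≤ (d + 3) ^ 3 := Nat.choose_le_pow _ _
      _ ≤ (2 * d) ^ 3 := Nat.pow_le_pow_left (by omega) 3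
      _ = _ := by ring
  rcases height_dichotomy _ d hfd hirr.ne_zero {x | x ∈ S} (N ^ (1000 * a)) (Nat.one_le_pow _ _ hN1)
    (fun x hx => by push_cast; exact (hS x hx).1) (fun x hx => by rw [eval_cast, (hS x hx).2.1, Int.cast_zero]) with ⟨g, hg1, hg2, hg3⟩ | ⟨k, t, ht, hk, hn⟩
  · exact (hcp a N d ha hNC2 hd5 (by nlinarith) f hd hc hirr g hg1 hg2 S fun x hx => ⟨(hS x hx).1, (hS x hx).2.1, (hS x hx).2.2, hg3 x hx⟩).trans
      (Nat.pow_le_pow_right hN1 (by omega))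
  generalize (mons 3 d).card = M at hM hn
  have hz : ∀ x, eval x k = 0 ↔ eval x f = 0 := by
    intro x
    have h1 := eval_cast x k (K := ℚ)
    rw [hk, map_mul, eval_C, eval_cast] at h1
    rw [← Int.cast_eq_zero (α := ℚ), ← h1, mul_eq_zero, or_iff_right ht, Int.cast_eq_zero]
  have hu : IsUnit (C t : MP 3 ℚ) := (IsUnit.mk0 t ht).map C
  refine hcore a N d (1000 * a * (d + 1) * (M + 1)) ha ?_ hd5 k ?_ ?_ ?_ ?_ (Nat.le_mul_of_pos_right _ (by omega)) S fun x hx => ⟨(hS x hx).1, (hz x).mpr (hS x hx).2.1, ?_⟩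
  · have hd4 : 1 ≤ a * d ^ 4 := Nat.mul_pos (by omega) (by positivity)
    calc C1 * (1000 * a * (d + 1) * (M + 1) + 1) * d ^ 7 ≤ C1 * (1000 * a * (2 * d) * (9 * d ^ 3) + 1) * d ^ 7 := by
          gcongr <;> nlinarith [Nat.one_le_pow 3 d (by omega)]
      _ ≤ C1 * (20000 * (a * d ^ 4)) * d ^ 7 := by
          gcongr; nlinarith
      _ = (20000 * C1) * a * d ^ 11 := by ring
      _ ≤ (20000 * C1 + C2 + 16) * a * d ^ 11 := by gcongr; omega
      _ ≤ N := hN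
  · rw [← hfd, totalDegree, ← support_map_of_injective k hinjQ, ← totalDegree, hk,
      totalDegree_mul_of_isDomain hu.ne_zero hirr.ne_zero, totalDegree_C, zero_add]
  · intro h
    have := congrArg (coeff (single 0 d)) hk
    rw [coeff_map, coeff_C_mul, coeff_map, h, map_zero, eq_comm, mul_eq_zero, or_iff_right ht] at this
    exact hc (Int.cast_injective this)
  · rw [hk]; exact (irreducible_isUnit_mul hu).mpr hirr
  · have hN1' : (1:ℝ) ≤ N := by exact_mod_cast hN1
    have hMN : (M:ℝ) ≤ N := by exact_mod_cast (by omega : M ≤ N)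
    have hfac : (M.factorial : ℝ) ≤ (N:ℝ) ^ M := by
      exact_mod_cast (Nat.factorial_le_pow M).trans (Nat.pow_le_pow_left (by omega) M)
    calc nrm 1 k ≤ _ := hn
      _ ≤ N * ((N:ℝ) ^ M * ((((N ^ (1000 * a) : ℕ) : ℝ)) ^ d) ^ M) := by gcongr
      _ = (N:ℝ) ^ (1 + M + 1000 * a * d * M) := by push_cast; ring
      _ ≤ _ := pow_le_pow_right₀ hN1' (by nlinarith [Nat.zero_le (a * d), Nat.zero_le (a * M)])
  · rintro ⟨v, hv1, hv2, hv3⟩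
    exact (hS x hx).2.2 ⟨v, hv1, hv2, fun s => (hz _).mp (hv3 s)⟩

theorem shear_red {n d : ℕ} (f : MP (n + 1) ℤ) (hd1 : 1 ≤ d) (hd : f.totalDegree = d)
    (hirr : Irreducible (map (Int.castRingHom (AlgebraicClosure ℚ)) (homogeneousComponent d f))) :
    ∃ (F : MP (n + 1) ℤ) (φ : (Fin (n + 1) → ℤ) → (Fin (n + 1) → ℤ)), F.totalDegree = d ∧ coeff (single 0 d) F ≠ 0 ∧
      Irreducible (map (Int.castRingHom (AlgebraicClosure ℚ)) (homogeneousComponent d F)) ∧ Injective φ ∧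
      (∀ x, eval (φ x) F = eval x f) ∧ ∀ (B : ℕ) x, (∀ i, |x i| ≤ (B:ℤ)) → ∀ i, |φ x i| ≤ ((2 * d * B : ℕ) : ℤ) := by
  have hf : f ≠ 0 := by rintro rfl; rw [totalDegree_zero] at hd; omega
  obtain ⟨s, hs, hc⟩ := exists_shear f hd hf
  obtain ⟨F, hF⟩ : ∃ F, F = aeval (shv (fun i => (s i : ℤ))) f := ⟨_, rfl⟩
  have hFd : F.totalDegree = d := by rw [hF]; exact totalDegree_shv _ f hd.le hc
  rw [← hF] at hc
  have hFirr : Irreducible (map (Int.castRingHom (AlgebraicClosure ℚ)) (homogeneousComponent d F)) := by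
    rw [hF, hc_aeval_linear _ (shv_isHomogeneous _)]
    refine Eq.subst (motive := Irreducible) ?_ ((shv_irreducible (fun i => ((s i : ℕ) : AlgebraicClosure ℚ)) _).mpr hirr)
    refine Eq.trans ?_ (map_bind₁ _ _ _).symm
    refine congrArg (fun v => aeval v _) (funext fun i => ?_)
    refine Fin.cases ?_ (fun j => ?_) i <;> simp [shv]
  obtain ⟨φ, hφ⟩ : ∃ φ : (Fin (n + 1) → ℤ) → (Fin (n + 1) → ℤ), φ = fun x => Fin.cons (x 0) (fun i : Fin n => (x i.succ : ℤ) - ((s i : ℕ) : ℤ) * x 0) := ⟨_, rfl⟩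
  have hinj : Injective φ := by
    intro x y hxy
    rw [hφ] at hxy
    have h0 : x 0 = y 0 := congrFun hxy 0
    refine funext fun i => Fin.cases h0 (fun j => ?_) i
    have h1 : x j.succ - s j * x 0 = y j.succ - s j * y 0 := congrFun hxy j.succ
    rw [h0] at h1
    linarith
  have hev : ∀ x, eval (φ x) F = eval x f := by
    intro x
    rw [hF, eval_shv, hφ]
    refine congrArg (fun y => eval y f) (funext fun i => ?_)
    refine Fin.cases rfl (fun j => ?_) i
    simp
  refine ⟨F, φ, hFd, hc, hFirr, hinj, hev, fun B x hx i => ?_⟩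
  rw [hφ]
  have h0 := hx 0
  have hdB : (B:ℤ) ≤ d * B := by nlinarith
  push_cast
  refine Fin.cases ?_ (fun j => ?_) i
  · simp only [cons_zero]; linarith
  · simp only [cons_succ]
    refine (abs_sub _ _).trans ?_
    rw [abs_mul, Nat.abs_cast]
    have h1 := hx j.succ
    have h2 : (s j : ℤ) * |x 0| ≤ d * B := mul_le_mul (by exact_mod_cast hs j) h0 (abs_nonneg _) (by positivity)
    linarith

theorem T3 : ∃ c K : ℕ, ∀ (d : ℕ) (f : MP 3 ℤ) (B : ℕ), 5 ≤ d → f.totalDegree = d →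
    Irreducible (map (Int.castRingHom (AlgebraicClosure ℚ)) (homogeneousComponent d f)) → 1 ≤ B →
    ∀ S : Finset (Fin 3 → ℤ), (∀ x ∈ S, (∀ i, |x i| ≤ (B:ℤ)) ∧ eval x f = 0) → S.card ≤ c * d ^ K * B := by
  classical
  obtain ⟨C1, hC1, hT⟩ := T3a
  obtain ⟨CL, hL⟩ := lines_bound
  replace hT := hT 100
  obtain ⟨Q, hQ⟩ : ∃ Q, Q = 1000 * 100 := ⟨_, rfl⟩
  rw [← hQ] at hT
  have hQ0 : Q ≠ 0 := by omega
  clear hQ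
  generalize hA : C1 * 100 = A at hT
  have hA1 : 1 ≤ A := by omega
  refine ⟨(CL + 1) * ((2 * A) ^ Q * 2), 47 + (11 * Q + 1), fun d f B hd5 hd hirr hB S hS => ?_⟩
  obtain ⟨F, φ, hFd, hc, hFirr, hinj, hev, hbox⟩ := shear_red f (by omega) hd hirr
  have hFQ : Irreducible (map toℚ F) := by
    refine rat_irred F (irred_of_top _ (d := d) ?_ (by omega) (by rwa [hc_map]))
    rw [← hFd, totalDegree, totalDegree, support_map_of_injective _ (Int.cast_injective (α := AlgebraicClosure ℚ))]
  have hB1 : 1 ≤ 2 * d * B := Nat.mul_pos (by omega) hB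
  obtain ⟨r, hr⟩ : ∃ r, r = Nat.findGreatest (fun r => r ^ Q ≤ 2 * d * B) (2 * d * B) := ⟨_, rfl⟩
  have hr1 : r ^ Q ≤ 2 * d * B := by rw [hr]; exact Nat.findGreatest_spec (P := fun r => r ^ Q ≤ 2 * d * B) hB1 (by simpa using hB1)
  have hr0 : 1 ≤ r := by rw [hr]; exact Nat.le_findGreatest hB1 (by simpa using hB1)
  have hr2 : 2 * d * B ≤ (r + 1) ^ Q := by
    by_contra hcon
    push Not at hcon
    have := Nat.le_findGreatest (P := fun r => r ^ Q ≤ 2 * d * B) (((Nat.le_self_pow hQ0 (r + 1)).trans hcon.le)) hcon.le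
    omega
  obtain ⟨N, hN⟩ : ∃ N, N = (r + 1) * (A * d ^ 11) := ⟨_, rfl⟩
  have hAd : 1 ≤ A * d ^ 11 := Nat.mul_pos hA1 (by positivity)
  have hNQ : 2 * d * B ≤ N ^ Q := hr2.trans (Nat.pow_le_pow_left (by rw [hN]; exact Nat.le_mul_of_pos_right _ hAd) Q)
  have hNu : N ^ Q ≤ ((2 * A) ^ Q * 2) * d ^ (11 * Q + 1) * B := by
    calc N ^ Q ≤ ((2 * r) * (A * d ^ 11)) ^ Q := by rw [hN]; gcongr; omega
      _ = (2 * A) ^ Q * (d ^ 11) ^ Q * r ^ Q := by simp only [mul_pow]; ring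
      _ ≤ (2 * A) ^ Q * (d ^ 11) ^ Q * (2 * d * B) := Nat.mul_le_mul_left _ hr1
      _ = _ := by rw [pow_add, pow_mul d 11 Q]; ring
  have hbox' : ∀ x ∈ S.image φ, (∀ i, |x i| ≤ (N:ℤ) ^ Q) ∧ eval x F = 0 := by
    intro y hy
    obtain ⟨x, hx, rfl⟩ := mem_image.mp hy
    exact ⟨fun i => (hbox B x (hS x hx).1 i).trans (by exact_mod_cast hNQ), (hev x).trans (hS x hx).2⟩
  rw [← card_image_of_injective S hinj, ← card_filter_add_card_filter_not (s := S.image φ) (LinePt F (N ^ Q))]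
  refine (Nat.add_le_add (hL d F (N ^ Q) hd5 hFd hFirr hc _ fun x hx => ?_) (hT N d le_rfl ?_ hd5 F hFd hc hFQ _ fun x hx => ?_)).trans ?_
  · rw [mem_filter] at hx
    exact ⟨by push_cast; exact (hbox' x hx.1).1, hx.2⟩
  · rw [hN]; exact Nat.le_mul_of_pos_left _ (by omega)
  · rw [mem_filter] at hx
    exact ⟨(hbox' x hx.1).1, (hbox' x hx.1).2, hx.2⟩
  · have hd47 := Nat.one_le_pow 47 d (by omega)
    calc CL * d ^ 47 * N ^ Q + N ^ Q = (CL * d ^ 47 + 1) * N ^ Q := by ring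
      _ ≤ ((CL + 1) * d ^ 47) * (((2 * A) ^ Q * 2) * d ^ (11 * Q + 1) * B) := Nat.mul_le_mul (by nlinarith) hNu
      _ = _ := by rw [pow_add d 47]; ring

theorem pderiv_fse {K : Type*} [CommRing K] {m : ℕ} (G : MP (m + 1) K) :
    finSuccEquiv K m (pderiv 0 G) = (finSuccEquiv K m G).derivative := by
  ext i e
  rw [finSuccEquiv_coeff_coeff, coeff_pderiv, coeff_derivative]
  have h : e.cons i + single 0 1 = e.cons (i + 1) := by
    ext j; refine Fin.cases ?_ (fun j => ?_) j <;> simp [(succ_ne_zero _).symm]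
  have h2 : ((i : MP m K) + 1) = C ((i : K) + 1) := by simp
  rw [h, h2, mul_comm _ (C _), coeff_C_mul, finSuccEquiv_coeff_coeff, mul_comm]
  simp

theorem small_pt {K : Type*} [Field K] [IsAlgClosed K] [CharZero K] {m d : ℕ} (G : MP (m + 1) K) (hd1 : 1 ≤ d)
    (hd : G.totalDegree = d) (hc : coeff (single 0 d) G ≠ 0) (hirr : Irreducible G) :
    ∃ (b : Fin m → ℕ) (α : K), (∀ i, b i ≤ 2 * d * d) ∧ eval (Fin.cons α (fun i => (b i : K)) : Fin (m + 1) → K) G = 0 ∧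
      eval (Fin.cons α (fun i => (b i : K)) : Fin (m + 1) → K) (pderiv 0 G) ≠ 0 := by
  classical
  obtain ⟨hnd, hlc⟩ := finSuccEquiv_top G d hd hc
  have hev : ∀ (H : MP (m + 1) K) (b : Fin m → K) (α : K),
      Polynomial.eval α ((finSuccEquiv K m H).map (eval b)) = eval (Fin.cons α b : Fin (m + 1) → K) H :=
    fun H b α => (eval_eq_eval_mv_eval' b α H).symm
  have hdP := pderiv_fse G
  obtain ⟨P, hP⟩ : ∃ P, P = finSuccEquiv K m G := ⟨_, rfl⟩
  have hPirr : Irreducible P := by rw [hP]; exact (MulEquiv.irreducible_iff (finSuccEquiv K m)).mpr hirr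
  have hcoef : ∀ i, (P.coeff i).totalDegree ≤ d := by
    intro i
    by_cases h : P.coeff i = 0
    · rw [h, totalDegree_zero]; exact Nat.zero_le _
    · rw [hP] at h ⊢
      have := totalDegree_coeff_finSuccEquiv_add_le G i h
      omega
  rw [← hP] at hnd hlc hdP
  letI := UniqueFactorizationMonoid.toGCDMonoid (MP m K)
  letI : NormalizedGCDMonoid (MP m K) := Classical.choice inferInstance
  have hinj := IsFractionRing.injective (MP m K) (FractionRing (MP m K))
  have hPK := ((hPirr.isPrimitive (by omega)).irreducible_iff_irreducible_map_fraction_map (K := FractionRing (MP m K))).mp hPirr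
  have hres := Polynomial.resultant_ne_zero _ _ hPK.separable
  rw [Polynomial.derivative_map, Polynomial.natDegree_map_eq_of_injective hinj, Polynomial.natDegree_map_eq_of_injective hinj,
    Polynomial.resultant_map_map] at hres
  have hres := ne_of_apply_ne _ (hres.trans_eq (map_zero _).symm)
  have hle := Polynomial.natDegree_derivative_le P
  obtain ⟨p, q, -, -, hpq⟩ := Polynomial.exists_mul_add_mul_eq_C_resultant P P.derivative le_rfl le_rfl (Or.inl (by omega))
  obtain ⟨b, hb, hb0⟩ := exists_nonroot _ hres (2 * d * d) <| by
    refine (totalDegree_det_le _ d fun i j => ?_).trans (Nat.mul_le_mul_right _ (by rw [Fintype.card_fin]; omega))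
    rw [Polynomial.sylvester, Matrix.of_apply]
    refine Fin.addCases (fun j => ?_) (fun j => ?_) j
    · rw [Fin.addCases_left]
      split_ifs
      · rw [coeff_derivative]
        refine (totalDegree_mul _ _).trans ?_
        have h2 : ∀ i : ℕ, ((i : MP m K) + 1) = C ((i : K) + 1) := by simp
        rw [h2, totalDegree_C]
        exact hcoef _
      · simp
    · rw [Fin.addCases_right]
      split_ifs
      · exact hcoef _
      · simp
  obtain ⟨α, hα⟩ := IsAlgClosed.exists_root (P.map (eval fun i => (b i : K))) (by
    have h : (P.map (eval fun i => (b i : K))).coeff d ≠ 0 := by rw [Polynomial.coeff_map, hlc, eval_C]; exact hc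
    intro h0
    have := Polynomial.le_natDegree_of_ne_zero h
    rw [Polynomial.natDegree_eq_of_degree_eq_some h0] at this
    exact absurd (Nat.le_zero.mp this) (by omega))
  refine ⟨b, α, hb, by rw [← hev, ← hP]; exact hα, fun h => hb0 ?_⟩
  rw [← hev, hdP] at h
  have := congrArg (fun Q => Polynomial.eval α (Polynomial.map (eval fun i => (b i : K)) Q)) hpq
  simp only [Polynomial.map_add, Polynomial.map_mul, Polynomial.eval_add, Polynomial.eval_mul, h, hα.eq_zero, zero_mul, add_zero, Polynomial.map_C, Polynomial.eval_C] at this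
  exact this.symm

theorem irred_pullback {K : Type*} [Field K] {n m d : ℕ} (H : MP n K) (u : Fin n → MP m K)
    (hu : ∀ i, (u i).totalDegree ≤ 1) (hH : H.totalDegree ≤ d) (hd : (aeval u H).totalDegree = d) (hirr : Irreducible (aeval u H)) : Irreducible H := by
  refine ⟨fun h => hirr.not_isUnit (h.map _), fun a b hab => ?_⟩
  have hH0 : H ≠ 0 := by rintro rfl; exact hirr.ne_zero (map_zero _)
  rw [hab] at hH0
  have key : ∀ p q : MP n K, p ≠ 0 → (p * q).totalDegree = p.totalDegree + q.totalDegree → p * q = H → IsUnit (aeval u p) → IsUnit p := by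
    intro p q hp hdeg hpq hun
    refine isUnit_of_totalDegree_zero p hp ?_
    have h1 := totalDegree_mul (aeval u p) (aeval u q)
    rw [← map_mul, hpq, hd, totalDegree_zero_of_isUnit _ hun] at h1
    have h2 := totalDegree_affine_le q u hu
    rw [hpq] at hdeg
    omega
  have hdeg := totalDegree_mul_of_isDomain (left_ne_zero_of_mul hH0) (right_ne_zero_of_mul hH0)
  rcases hirr.isUnit_or_isUnit (by rw [hab, map_mul]) with h | h
  · exact Or.inl (key a b (left_ne_zero_of_mul hH0) hdeg hab.symm h)
  · exact Or.inr (key b a (right_ne_zero_of_mul hH0) (by rw [mul_comm, hdeg, add_comm]) (by rw [mul_comm, hab]) h)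

theorem key_slice {K : Type} [Field K] [IsAlgClosed K] [CharZero K] {m d : ℕ} (F : MP (m + 4) K) (hF : F.IsHomogeneous d) (hd1 : 1 ≤ d)
    (hc : coeff (single 0 d) F ≠ 0) (hirr : Irreducible F) :
    ∃ (l : ℤ) (t : ℕ), |l| ≤ 4 * d ^ 6 ∧ t ≤ d ^ 4 ∧
      Irreducible (aeval (snoc X (C (l : K) * X 1 + C (t : K) * X 2) : Fin (m + 4) → MP (m + 3) K) F) := by
  classical
  obtain ⟨e, he⟩ : ∃ e : Fin (m + 4) ≃ Fin (m + 4), e = Equiv.swap 0 1 := ⟨_, rfl⟩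
  obtain ⟨G, hG⟩ : ∃ G, G = dhz (m + 3) (rename e F) := ⟨_, rfl⟩
  have hF' : (rename e F).IsHomogeneous d := hF.rename_isHomogeneous
  have hcG : coeff (single 0 d) G = coeff (single 0 d) F := by
    rw [hG, coeff_dhz _ hF' _ (by simp), ← coeff_rename_mapDomain e e.injective F (single 0 d), Finsupp.mapDomain_single]
    refine congrArg (fun z => coeff z _) ?_
    rw [he, Equiv.swap_apply_left]
    ext i
    refine Fin.cases ?_ (fun i => ?_) i
    · simp
    · rw [Finsupp.cons_succ, ← Fin.succ_zero_eq_one, single_apply, single_apply]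
      simp only [Fin.succ_inj]
  rw [← hcG] at hc
  have hv1 : ∀ i, ((Fin.cons 1 X : Fin (m + 4) → MP (m + 3) K) i).totalDegree ≤ 1 := by
    intro i
    refine Fin.cases ?_ (fun i => ?_) i
    · rw [cons_zero, totalDegree_one]; exact Nat.zero_le _
    · rw [cons_succ, totalDegree_X]
  have hGd : G.totalDegree = d := by
    refine le_antisymm ?_ ?_
    · rw [hG]; exact (totalDegree_affine_le _ _ hv1).trans hF'.totalDegree_le
    · have := le_totalDegree (mem_support_iff.mpr hc)
      rwa [sum_single_index rfl] at this
  have hGirr : Irreducible G := by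
    rw [hG] at hGd ⊢
    exact dhz_irreducible _ hF' ((MulEquiv.irreducible_iff (renameEquiv K e)).mpr hirr) hGd hd1
  obtain ⟨b, α, hb, hP, hu0⟩ := small_pt G hd1 hGd hc hGirr
  obtain ⟨u, hu⟩ : ∃ u, u = eval (Fin.cons α (fun i => (b i : K)) : Fin (m + 2 + 1) → K) (pderiv 0 G) := ⟨_, rfl⟩
  rw [← hu] at hu0
  obtain ⟨F2, hF2, h2d, h20, h21, h2c, h2irr⟩ := recenter (RingHom.id K) Function.injective_id G d hGd.le _ hP u hu.symm hu0 hc (by rwa [map_id])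
  obtain ⟨A, hA⟩ : ∃ A, A = (fun i => C ((Fin.cons α (fun i => (b i : K)) : Fin (m + 2 + 1) → K) i) + C ((Fin.cons u (fun _ => u ^ 2) : Fin (m + 2 + 1) → K) i) * X i : Fin (m + 2 + 1) → MP (m + 2 + 1) K) := ⟨_, rfl⟩
  rw [← hA] at hF2
  obtain ⟨μ, hμ0, hμd, hμ⟩ := bertini_field (RingHom.id K) F2 d hd1 h2d h20 h21 h2c h2irr
  obtain ⟨s0, -, hs0⟩ := exists_nonroot (μ * X 0) (mul_ne_zero hμ0 (X_ne_zero 0)) _ le_rfl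
  rw [map_mul, eval_X] at hs0
  have hμs := left_ne_zero_of_mul hs0
  have hs00 := right_ne_zero_of_mul hs0
  obtain ⟨L, hL⟩ : ∃ L : Fin (m + 2), L = Fin.last (m + 1) := ⟨_, rfl⟩
  have hL0 : (0 : Fin (m + 2)) ≠ L := by rw [hL]; exact (Fin.last_pos).ne
  obtain ⟨w, hw⟩ : ∃ w : Fin (m + 2) → MP 1 K, w = update (fun i => C (s0 i : K)) L (C (s0 0 : K) * X 0) := ⟨_, rfl⟩
  have hwe : ∀ x : K, (fun i => eval (fun _ => x) (w i)) = update (fun i => (s0 i : K)) L (s0 0 * x) := by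
    intro x
    funext i
    rw [hw]
    by_cases h : i = L
    · rw [h, update_self, update_self, map_mul, eval_C, eval_X]
    · rw [update_of_ne h, update_of_ne h, eval_C]
  obtain ⟨t, ht, ht0⟩ := exists_nonroot (aeval w μ) (by
    intro h
    have h1 := congrArg (eval (fun _ => (s0 L : K) / s0 0)) h
    rw [eval_aeval, hwe, mul_div_cancel₀ _ hs00, map_zero, Function.update_eq_self] at h1
    exact hμs h1) (d ^ 4) ((totalDegree_affine_le _ _ fun i => by
      rw [hw]
      by_cases h : i = L
      · rw [h, update_self]; refine (totalDegree_mul _ _).trans ?_; rw [totalDegree_C, totalDegree_X]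
      · rw [update_of_ne h, totalDegree_C]; exact Nat.zero_le _).trans hμd)
  have htc : (fun i => (t i : K)) = fun _ => (t 0 : K) := by funext i; rw [Subsingleton.elim i 0]
  rw [htc, eval_aeval, hwe] at ht0
  obtain ⟨s, hs⟩ : ∃ s, s = update (fun i => (s0 i : K)) L (s0 0 * t 0) := ⟨_, rfl⟩
  rw [← hs] at ht0
  have hsL : s L = s 0 * t 0 := by rw [hs, update_self, update_of_ne hL0]
  obtain ⟨hi, hid, -⟩ := hμ K (RingHom.id K) s h2c ht0
  obtain ⟨w0, hw0⟩ : ∃ w0, w0 = (Fin.cons (X 0) (fun i => C (s i) * X 1) : Fin (m + 2 + 1) → MP 2 K) := ⟨_, rfl⟩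
  have hpsl : psl (RingHom.id K) s F2 = aeval w0 F2 := by rw [hw0]; rfl
  obtain ⟨π, hπ⟩ : ∃ π, π = fun i => aeval w0 (aeval A ((Fin.cons 1 X : Fin (m + 4) → MP (m + 3) K) (e i))) := ⟨_, rfl⟩
  have hπF : aeval π F = C (u ^ 2) * psl (RingHom.id K) s F2 := by
    have h1 := congrArg (aeval w0) hF2
    rw [map_mul, aeval_C, algebraMap_eq, ← hpsl] at h1
    refine Eq.trans ?_ h1.symm
    have h2 : G = aeval (fun i => (Fin.cons 1 X : Fin (m + 4) → MP (m + 3) K) (e i)) F := by rw [hG, dhz, aeval_rename]; rfl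
    rw [h2, aeval_aeval' F, aeval_aeval' F, hπ]
  have hun : IsUnit (C (u ^ 2) : MP 2 K) := (isUnit_iff_ne_zero.mpr (pow_ne_zero _ hu0)).map C
  have hu2 : (C (u ^ 2) : MP 2 K) ≠ 0 := hun.ne_zero
  have hw01 : ∀ i, (w0 i).totalDegree ≤ 1 := by
    intro i
    rw [hw0]
    refine Fin.cases ?_ (fun i => ?_) i
    · rw [cons_zero, totalDegree_X]
    · rw [cons_succ]; refine (totalDegree_mul _ _).trans ?_; rw [totalDegree_C, totalDegree_X]
  have hA1 : ∀ i, (A i).totalDegree ≤ 1 := by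
    intro i
    rw [hA]
    refine (totalDegree_add _ _).trans (max_le (by rw [totalDegree_C]; exact Nat.zero_le _) ((totalDegree_mul _ _).trans ?_))
    rw [totalDegree_C, totalDegree_X]
  have hπ1 : ∀ i, (π i).totalDegree ≤ 1 := fun i => by
    rw [hπ]
    exact (totalDegree_affine_le _ _ hw01).trans ((totalDegree_affine_le _ _ hA1).trans (hv1 _))
  have hπs : ∀ i : Fin (m + 2), π i.succ.succ = C (b i : K) + C (u ^ 2) * (C (s i) * X 1) := by
    intro i
    have : e i.succ.succ = i.succ.succ := by
      rw [he]; exact Equiv.swap_apply_of_ne_of_ne (succ_ne_zero _) (by rw [← Fin.succ_zero_eq_one]; exact fun h => succ_ne_zero _ (Fin.succ_injective _ h))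
    rw [hπ]
    simp only [this, cons_succ, aeval_X]
    rw [hA]
    simp only [cons_succ, map_add, map_mul, aeval_X, ← algebraMap_eq, AlgHom.commutes]
    rw [hw0, cons_succ, algebraMap_eq]
  have hπ10 : π 1 = 1 := by
    rw [hπ]; simp only [he, Equiv.swap_apply_right, cons_zero, map_one]
  obtain ⟨l, hl⟩ : ∃ l : ℤ, l = b L - t 0 * b 0 := ⟨_, rfl⟩
  refine ⟨l, t 0, ?_, ht 0, ?_⟩
  · have h1 := hb L
    have h2 := Nat.mul_le_mul (ht 0) (hb 0)
    have h3 : 2 * d * d ≤ 2 * d ^ 6 := by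
      calc 2 * d * d = 2 * d ^ 2 := by ring
        _ ≤ _ := Nat.mul_le_mul_left _ (Nat.pow_le_pow_right hd1 (by omega))
    have h4 : d ^ 4 * (2 * d * d) = 2 * d ^ 6 := by ring
    zify at h1 h2 h3 h4
    rw [hl, abs_le]
    have := Int.natCast_nonneg (b L)
    have : (0:ℤ) ≤ t 0 * b 0 := by positivity
    constructor <;> linarith
  have hcomp : aeval (fun j : Fin (m + 3) => π j.castSucc) (aeval (snoc X (C (l : K) * X 1 + C (t 0 : K) * X 2) : Fin (m + 4) → MP (m + 3) K) F) = aeval π F := by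
    rw [aeval_aeval']
    refine congrArg (fun v => aeval v F) (funext fun i => ?_)
    refine lastCases ?_ (fun i => ?_) i
    · rw [snoc_last, map_add, map_mul, map_mul, aeval_X, aeval_X, aeval_C, aeval_C, ← Fin.succ_last, ← Fin.succ_last, ← hL, hπs, hsL,
        show ((1 : Fin (m + 3)).castSucc) = 1 from rfl, show ((2 : Fin (m + 3)).castSucc) = (0 : Fin (m + 2)).succ.succ from rfl, hπ10, hπs, hl, algebraMap_eq]
      push_cast
      simp only [map_sub, map_mul, map_natCast]
      ring
    · rw [snoc_castSucc, aeval_X]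
  have hm := (irreducible_isUnit_mul hun).mpr hi
  rw [← hπF, ← hcomp] at hm
  refine irred_pullback _ _ (fun i => hπ1 _) ((totalDegree_affine_le _ _ fun i => ?_).trans hF.totalDegree_le) ?_ hm
  · refine lastCases ?_ (fun i => ?_) i
    · rw [snoc_last]
      refine (totalDegree_add _ _).trans (max_le ((totalDegree_mul _ _).trans ?_) ((totalDegree_mul _ _).trans ?_)) <;> rw [totalDegree_C, totalDegree_X]
    · rw [snoc_castSucc, totalDegree_X]
  · rw [hcomp, hπF, totalDegree_mul_of_isDomain hu2 hi.ne_zero, totalDegree_C, hid, zero_add]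

theorem hc_slice {n d : ℕ} (f : MP (n + 4) ℤ) (hd : f.totalDegree ≤ d) (l t c : ℤ) :
    homogeneousComponent d (aeval (snoc X (C l * X 1 + C t * X 2 + C c) : Fin (n + 4) → MP (n + 3) ℤ) f) =
      aeval (snoc X (C l * X 1 + C t * X 2) : Fin (n + 4) → MP (n + 3) ℤ) (homogeneousComponent d f) := by
  refine MvPolynomial.funext fun σ => ?_
  rw [← coeff_ray, aeval_aeval', eval_aeval, ← coeff_line f hd (snoc (fun _ => 0) c : Fin (n + 4) → ℤ)]
  refine congrArg (fun v => Polynomial.coeff (aeval v f) d) (funext fun i => ?_)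
  refine lastCases ?_ (fun i => ?_) i
  · simp only [snoc_last, map_add, map_mul, aeval_X, aeval_C, eval_C, eval_X, Polynomial.algebraMap_eq]
    ring
  · simp only [snoc_castSucc, aeval_X, eval_X, map_zero, zero_add, mul_comm]

theorem Tn (m : ℕ) : ∃ c K : ℕ, ∀ (d : ℕ) (f : MP (m + 3) ℤ) (B : ℕ), 5 ≤ d → f.totalDegree = d →
    Irreducible (map (Int.castRingHom (AlgebraicClosure ℚ)) (homogeneousComponent d f)) → 1 ≤ B →
    ∀ S : Finset (Fin (m + 3) → ℤ), (∀ x ∈ S, (∀ i, |x i| ≤ (B:ℤ)) ∧ eval x f = 0) → S.card ≤ c * d ^ K * B ^ (m + 1) := by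
  classical
  induction m with
  | zero =>
    obtain ⟨c, K, h⟩ := T3
    exact ⟨c, K, fun d f B h1 h2 h3 h4 S h5 => (h d f B h1 h2 h3 h4 S h5).trans (by simp)⟩
  | succ m ih =>
    obtain ⟨c, K, ih⟩ := ih
    refine ⟨c * 2 ^ (m + 1) * 25, K + (m + 1) + 7, fun d f B hd5 hd hirr hB S hS => ?_⟩
    obtain ⟨F, φ, hFd, hc, hFirr, hinj, hev, hbox⟩ := shear_red (n := m + 3) f (by omega) hd hirr
    obtain ⟨l, t, hl, ht, hk⟩ := key_slice (m := m) (d := d) _ ((homogeneousComponent_isHomogeneous d F).map _) (by omega)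
      (by rw [coeff_map, coeff_homogeneousComponent, if_pos (by simp)]; exact fun h => hc (Int.cast_injective (h.trans Int.cast_zero.symm))) hFirr
    have hg : ∀ c : ℤ, ∃ g : MP (m + 3) ℤ, g.totalDegree = d ∧
        Irreducible (map (Int.castRingHom (AlgebraicClosure ℚ)) (homogeneousComponent d g)) ∧
        ∀ x : Fin (m + 4) → ℤ, x (Fin.last _) - l * x 1 - t * x 2 = c → eval (Fin.init x : Fin (m + 3) → ℤ) g = eval x F := by
      intro c
      obtain ⟨g, hg⟩ : ∃ g, g = aeval (snoc X (C l * X 1 + C (t : ℤ) * X 2 + C c) : Fin (m + 4) → MP (m + 3) ℤ) F := ⟨_, rfl⟩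
      have hgi : Irreducible (map (Int.castRingHom (AlgebraicClosure ℚ)) (homogeneousComponent d g)) := by
        rw [hg, hc_slice F hFd.le]
        refine Eq.subst (motive := Irreducible) ?_ hk
        refine Eq.trans ?_ (map_bind₁ _ _ _).symm
        refine congrArg (fun v => aeval v _) (funext fun i => ?_)
        refine lastCases ?_ (fun j => ?_) i <;> simp
      refine ⟨g, le_antisymm ?_ ?_, hgi, fun x hx => ?_⟩
      · rw [hg, ← hFd]
        refine totalDegree_affine_le _ _ fun i => lastCases ?_ (fun i => ?_) i
        · rw [snoc_last]
          refine (totalDegree_add _ _).trans (max_le ((totalDegree_add _ _).trans (max_le ((totalDegree_mul _ _).trans ?_) ((totalDegree_mul _ _).trans ?_))) ?_)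
          · rw [totalDegree_C, totalDegree_X]
          · rw [totalDegree_C, totalDegree_X]
          · rw [totalDegree_C]; exact Nat.zero_le _
        · rw [snoc_castSucc, totalDegree_X]
      · by_contra h
        rw [homogeneousComponent_eq_zero _ _ (not_le.mp h), map_zero] at hgi
        exact hgi.ne_zero rfl
      · rw [hg, eval_aeval]
        refine congrArg (fun y => eval y F) (funext fun i => ?_)
        refine lastCases ?_ (fun i => ?_) i
        · simp only [snoc_last, map_add, map_mul, eval_C, eval_X, ← hx]
          change l * x 1 + t * x 2 + _ = _
          ring
        · rw [snoc_castSucc, eval_X]; rfl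
    obtain ⟨B', hB'⟩ : ∃ B', B' = 2 * d * B := ⟨_, rfl⟩
    rw [← card_image_of_injective S hinj]
    have hS' : ∀ x ∈ S.image φ, (∀ i, |x i| ≤ (B' : ℤ)) ∧ eval x F = 0 := by
      intro y hy
      obtain ⟨x, hx, rfl⟩ := mem_image.mp hy
      exact ⟨by rw [hB']; exact hbox B x (hS x hx).1, (hev x).trans (hS x hx).2⟩
    obtain ⟨M, hM⟩ : ∃ M : ℕ, M = 6 * d ^ 6 * B' := ⟨_, rfl⟩
    have hcard := card_le_mul_card_image_of_maps_to (s := S.image φ) (t := Icc (-(M:ℤ)) M) (f := fun x => x (Fin.last _) - l * x 1 - t * x 2)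
      (fun x hx => by
        obtain ⟨hx, -⟩ := hS' x hx
        have h1 : |l * x 1| ≤ 4 * d ^ 6 * B' := by rw [abs_mul]; exact mul_le_mul hl (hx 1) (abs_nonneg _) (by positivity)
        have h2 : |(t : ℤ) * x 2| ≤ d ^ 4 * B' := by
          rw [abs_mul, Nat.abs_cast]; exact mul_le_mul (by exact_mod_cast ht) (hx 2) (abs_nonneg _) (by positivity)
        have h3 : (d : ℤ) ^ 4 * B' ≤ d ^ 6 * B' := by exact_mod_cast Nat.mul_le_mul_right _ (Nat.pow_le_pow_right (by omega) (by omega))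
        have h4 : (B' : ℤ) ≤ d ^ 6 * B' := by exact_mod_cast Nat.le_mul_of_pos_left _ (by positivity)
        have h5 := hx (Fin.last _)
        have hM' : (M : ℤ) = 6 * d ^ 6 * B' := by rw [hM]; push_cast; ring
        rw [abs_le] at h1 h2 h5
        rw [mem_Icc]
        constructor <;> linarith) (c * d ^ K * B' ^ (m + 1)) (fun c _ => by
        obtain ⟨g, hgd, hgi, hge⟩ := hg c
        have hinj2 : Set.InjOn (Fin.init : (Fin (m + 4) → ℤ) → (Fin (m + 3) → ℤ)) ((S.image φ).filter fun x => x (Fin.last _) - l * x 1 - t * x 2 = c) := by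
          intro x hx y hy hxy
          have hx2 := (mem_filter.mp hx).2
          have hy2 := (mem_filter.mp hy).2
          have h1 : x 1 = y 1 := congrFun hxy (1 : Fin (m + 3))
          have h2 : x 2 = y 2 := congrFun hxy (2 : Fin (m + 3))
          funext i
          refine lastCases ?_ (fun i => congrFun hxy i) i
          rw [h1, h2] at hx2
          linarith
        rw [← card_image_of_injOn hinj2]
        refine ih d g B' hd5 hgd hgi (by rw [hB']; exact Nat.mul_pos (by omega) hB) _ fun y hy => ?_
        obtain ⟨x, hx, rfl⟩ := mem_image.mp hy
        obtain ⟨hx1, hx2⟩ := mem_filter.mp hx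
        exact ⟨fun i => (hS' x hx1).1 _, (hge x hx2).trans (hS' x hx1).2⟩)
    refine hcard.trans ?_
    have hN : (Icc (-(M:ℤ)) M).card ≤ 25 * d ^ 7 * B := by
      rw [Int.card_Icc]
      have h1 : M = 12 * d ^ 7 * B := by rw [hM, hB']; ring
      have h2 : 1 ≤ d ^ 7 * B := Nat.mul_pos (by positivity) hB
      have h3 : 25 * d ^ 7 * B = 2 * M + d ^ 7 * B := by rw [h1]; ring
      omega
    refine (Nat.mul_le_mul_left _ hN).trans (le_of_eq ?_)
    rw [hB', mul_pow, mul_pow]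
    ring

end

theorem affine_hypersurfaces_bound (n : ℕ) (hn : 2 < n) :
    ∃ c e : ℝ, 0 < c ∧ 0 < e ∧
      ∀ (d : ℕ) (f : MvPolynomial (Fin n) ℤ) (B : ℝ),
        5 ≤ d → f.totalDegree = d →
        Irreducible (MvPolynomial.map (Int.castRingHom (AlgebraicClosure ℚ))
          (MvPolynomial.homogeneousComponent d f)) →
        1 ≤ B →
        (Naff f B : ℝ) ≤ c * (d : ℝ) ^ e * B ^ (n - 2) := by
  obtain ⟨m, rfl⟩ : ∃ m, n = m + 3 := ⟨n - 3, by omega⟩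
  obtain ⟨c, K, h⟩ := Tn m
  refine ⟨(c + 1 : ℕ), (K + 1 : ℕ), by positivity, by positivity, fun d f B hd5 hd hirr hB => ?_⟩
  have hfl := Nat.floor_le (zero_le_one.trans hB)
  have hfin : {x : Fin (m + 3) → ℤ | (∀ i, |(x i : ℝ)| ≤ B) ∧ MvPolynomial.eval x f = 0}.Finite := by
    refine (Set.finite_Icc (fun _ => -(⌊B⌋₊ : ℤ)) (fun _ => (⌊B⌋₊ : ℤ))).subset fun x hx => ?_
    have hi : ∀ i, |x i| ≤ (⌊B⌋₊ : ℤ) := fun i => by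
      rw [← Int.natCast_natAbs, Nat.cast_le]
      exact Nat.le_floor (by rw [Nat.cast_natAbs, Int.cast_abs]; exact hx.1 i)
    exact ⟨fun i => (abs_le.mp (hi i)).1, fun i => (abs_le.mp (hi i)).2⟩
  have h1 := h d f ⌊B⌋₊ hd5 hd hirr (Nat.le_floor (by exact_mod_cast hB)) hfin.toFinset fun x hx => by
    rw [Set.Finite.mem_toFinset] at hx
    refine ⟨fun i => ?_, hx.2⟩
    rw [← Int.natCast_natAbs, Nat.cast_le]
    exact Nat.le_floor (by rw [Nat.cast_natAbs, Int.cast_abs]; exact hx.1 i)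
  rw [← Set.ncard_eq_toFinset_card _ hfin] at h1
  have h1' : Naff f B ≤ c * d ^ K * ⌊B⌋₊ ^ (m + 1) := h1
  have h2 : (Naff f B : ℝ) ≤ c * (d : ℝ) ^ K * (⌊B⌋₊ : ℝ) ^ (m + 1) := by exact_mod_cast h1'
  have hd1 : (1 : ℝ) ≤ d := by exact_mod_cast (by omega : 1 ≤ d)
  refine h2.trans ?_
  rw [Real.rpow_natCast, show m + 3 - 2 = m + 1 by omega]
  have h3 : (d : ℝ) ^ K ≤ d ^ (K + 1) := pow_le_pow_right₀ hd1 (Nat.le_succ K)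
  push_cast
  gcongr
  linarith
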